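/- Fix d ∈ ℕ+. There exist D ∈ ℕ and real constants C₁, κ′ > 0 (depending only on d) such that for every n ∈ ℕ+, every b ∈ ℤ with gcd(n, b) = 1, and every smooth compactly supported function f : X → ℂ, one has | φ(n)⁻¹ · Σ_{k ∈ (ℤ/nℤ)ˣ} f( SL₂(ℤ) u_{b k^d / n} a_{√n}⁻¹ ) − ∫_X f dμ_X | ≤ C₁ n^{−κ′} S_D(f); in particular the bound is uniform over all b coprime to n. The summand uses any integer representative of k (it is independent of the choice), and the average over k ∈ (ℤ/nℤ)ˣ equals the average over the point set 𝒫_X^{×d}(n;b) = {SL₂(ℤ) u_{b k^d/n} a_{√n}⁻¹ : gcd(k,n) = 1}, because all fibres of k ↦ k^d on (ℤ/nℤ)ˣ have the same cardinality. -/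

import Mathlib

/-!
Effective equidistribution of the points `SL₂(ℤ) u_{b k^d / n} a_{√n}⁻¹`, `k ∈ (ℤ/nℤ)ˣ`,
in the modular surface `X = SL₂(ℤ)\SL₂(ℝ)` (Corollary 1.2 of
"Primitive rational points on expanding horocycles ...").
-/

noncomputable section
open MeasureTheory Matrix

abbrev SL2R := Matrix.SpecialLinearGroup (Fin 2) ℝ

instance : TopologicalSpace SL2R :=
  inferInstanceAs (TopologicalSpace {A : Matrix (Fin 2) (Fin 2) ℝ // A.det = 1})

instance : MeasurableSpace (Matrix (Fin 2) (Fin 2) ℝ) :=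
  inferInstanceAs (MeasurableSpace ((Fin 2) → (Fin 2) → ℝ))

instance : MeasurableSpace SL2R :=
  inferInstanceAs (MeasurableSpace {A : Matrix (Fin 2) (Fin 2) ℝ // A.det = 1})

/-- The upper-triangular unipotent `u t = [[1, t], [0, 1]]`. -/
def uElt (t : ℝ) : SL2R := ⟨!![1, t; 0, 1], by simp [Matrix.det_fin_two_of]⟩

/-- The lower-triangular unipotent `v t = [[1, 0], [t, 1]]`. -/
def vElt (t : ℝ) : SL2R := ⟨!![1, 0; t, 1], by simp [Matrix.det_fin_two_of]⟩

/-- The diagonal element `a y = [[y, 0], [0, y⁻¹]]` (junk value `1` for `y = 0`). -/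
def aElt (y : ℝ) : SL2R :=
  if h : y = 0 then 1 else ⟨!![y, 0; 0, y⁻¹], by simp [Matrix.det_fin_two_of, mul_inv_cancel₀ h]⟩

/-- The one-parameter subgroup `exp (s H₀) = [[e^{-s}, 0], [0, e^s]]` for `H₀ = [[-1,0],[0,1]]`. -/
def hElt (s : ℝ) : SL2R :=
  ⟨!![Real.exp (-s), 0; 0, Real.exp s], by simp [Matrix.det_fin_two_of, ← Real.exp_add]⟩

/-- The one-parameter subgroups generated by the basis `H₀, E₀, F₀` of `𝔰𝔩₂(ℝ)`. -/
def oneParam : Fin 3 → ℝ → SL2R := ![hElt, uElt, vElt]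

/-- The space of right cosets `Γ g` of a subgroup `Γ ≤ SL₂(ℝ)`. -/
abbrev XQuot (Γ : Subgroup SL2R) := Quotient (QuotientGroup.rightRel Γ)

/-- The projection `SL₂(ℝ) → Γ\SL₂(ℝ)`. -/
def XProj (Γ : Subgroup SL2R) (g : SL2R) : XQuot Γ := Quotient.mk _ g

/-- Right translation by `g` on the space of right cosets. -/
def rightT (Γ : Subgroup SL2R) (g : SL2R) : XQuot Γ → XQuot Γ :=
  Quotient.map (· * g) (by
    intro a b hab
    have h := QuotientGroup.rightRel_apply.mp hab
    exact QuotientGroup.rightRel_apply.mpr (by simpa [mul_assoc] using h))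

/-- Maximum of the absolute values of the entries of a real `2×2` matrix. -/
def matSup (A : Matrix (Fin 2) (Fin 2) ℝ) : ℝ :=
  max (max |A 0 0| |A 0 1|) (max |A 1 0| |A 1 1|)

/-- The height function `ht (Γ g) = sup {‖g⁻¹ w g‖⁻¹ : w ∈ M₂(ℤ), tr w = 0, w ≠ 0}`. -/
def htX (Γ : Subgroup SL2R) (x : XQuot Γ) : ℝ :=
  sSup {r : ℝ | ∃ w : Matrix (Fin 2) (Fin 2) ℤ, w ≠ 0 ∧ w.trace = 0 ∧
    r = (matSup (((x.out⁻¹ : SL2R) : Matrix (Fin 2) (Fin 2) ℝ) *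
      (w.map (Int.cast : ℤ → ℝ)) * ((x.out : SL2R) : Matrix (Fin 2) (Fin 2) ℝ)))⁻¹}

/-- The Lie derivative of `f` in the direction of the `i`-th basis element:
`(D_Z f) g = (d/ds)|₀ f (g · exp (s Z))`. -/
def lieDeriv (i : Fin 3) (f : SL2R → ℂ) : SL2R → ℂ :=
  fun g => deriv (fun s : ℝ => f (g * oneParam i s)) 0

/-- Iterated Lie derivatives along a word in the basis directions. -/
def wordDeriv : List (Fin 3) → (SL2R → ℂ) → SL2R → ℂ
  | [], f => f
  | i :: w, f => lieDeriv i (wordDeriv w f)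

/-- A (left-`Γ`-invariant) function on `SL₂(ℝ)` is smooth if all its iterated Lie
derivatives exist and are continuous. -/
def IsSmoothSL (f : SL2R → ℂ) : Prop :=
  ∀ w : List (Fin 3),
    Continuous (wordDeriv w f) ∧
    ∀ i : Fin 3, ∀ g : SL2R,
      DifferentiableAt ℝ (fun s : ℝ => wordDeriv w f (g * oneParam i s)) 0

/-- The lift to `SL₂(ℝ)` of a function on `Γ\SL₂(ℝ)`. -/
def liftX (Γ : Subgroup SL2R) (f : XQuot Γ → ℂ) : SL2R → ℂ := fun g => f (XProj Γ g)

/-- The degree-`D` `L²`-Sobolev norm of a function on `Γ\SL₂(ℝ)` with respect to the basis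
`H₀, E₀, F₀`, summing over all monomials of degree at most `D`. -/
def sobX (Γ : Subgroup SL2R) (μ : Measure (XQuot Γ)) (D : ℕ) (f : XQuot Γ → ℂ) : ℝ :=
  Real.sqrt (∑ l ∈ Finset.range (D + 1), ∑ w : Fin l → Fin 3,
    ∫ x : XQuot Γ, (1 + htX Γ x) ^ (2 * D) *
      ‖wordDeriv (List.ofFn w) (liftX Γ f) x.out‖ ^ 2 ∂μ)

/-- `SL₂(ℤ)`, embedded entrywise as a subgroup of `SL₂(ℝ)`. -/
def Γℤ : Subgroup SL2R := (Matrix.SpecialLinearGroup.map (Int.castRingHom ℝ)).range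

namespace HorocyclePoints

section
open Finset

/-! ### Kloosterman sums -/

lemma card_divisors_le_rpow {ε : ℝ} (hε : 0 < ε) :
    ∃ C : ℝ, 1 ≤ C ∧ ∀ n : ℕ, (n.divisors.card : ℝ) ≤ C * (n : ℝ) ^ ε := by
  set c : ℝ := 1 + 1 / (ε * Real.log 2) with hc
  have hl2 : 0 < Real.log 2 := Real.log_pos (by norm_num)
  have hc1 : 1 ≤ c := by rw [hc]; have : 0 < 1 / (ε * Real.log 2) := by positivity
                         linarith
  have hexp : ∀ x : ℝ, 1 + x ≤ Real.exp x := fun x => by linarith [Real.add_one_le_exp x]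
  obtain ⟨N, hN⟩ := exists_nat_gt ((2 : ℝ) ^ (1 / ε))
  refine ⟨c ^ N, one_le_pow₀ hc1, fun n => ?_⟩
  rcases Nat.eq_zero_or_pos n with rfl | hn
  · simp; positivity
  have hpf : ∀ p ∈ n.primeFactors, ((n.factorization p + 1 : ℕ) : ℝ) ≤
      (if p < N then c else 1) * ((p : ℝ) ^ (n.factorization p)) ^ ε := by
    intro p hp
    have hp2 : (2 : ℝ) ≤ p := by exact_mod_cast (Nat.prime_of_mem_primeFactors hp).two_le
    set k := n.factorization p
    have h1 : ((p : ℝ) ^ k) ^ ε = Real.exp (k * (ε * Real.log p)) := by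
      rw [← Real.rpow_natCast, ← Real.rpow_mul (by positivity), Real.rpow_def_of_pos (by positivity)]
      ring_nf
    have hlp : Real.log 2 ≤ Real.log p := Real.log_le_log (by norm_num) hp2
    have hk : (0 : ℝ) ≤ k := Nat.cast_nonneg k
    push_cast
    split_ifs with h
    · rw [h1]
      have h2 : 1 + k * (ε * Real.log 2) ≤ Real.exp (k * (ε * Real.log p)) :=
        (hexp _).trans (Real.exp_le_exp.2 (by gcongr))
      have h3 : (k : ℝ) + 1 ≤ c * (1 + k * (ε * Real.log 2)) := by
        have : c * (1 + k * (ε * Real.log 2)) = 1 + 1 / (ε * Real.log 2) + k * (ε * Real.log 2) + k := by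
          rw [hc]; field_simp; ring
        rw [this]
        have : 0 < 1 / (ε * Real.log 2) := by positivity
        nlinarith [mul_nonneg hk (mul_pos hε hl2).le]
      exact h3.trans (by gcongr)
    · push Not at h
      have hpN : (2 : ℝ) ^ (1 / ε) ≤ p := hN.le.trans (by exact_mod_cast h)
      have h2 : (2 : ℝ) ≤ (p : ℝ) ^ ε := by
        calc (2 : ℝ) = ((2 : ℝ) ^ (1 / ε)) ^ ε := by
              rw [← Real.rpow_mul (by norm_num)]; field_simp; simp
          _ ≤ _ := by gcongr
      have h3 : ((p : ℝ) ^ k) ^ ε = ((p : ℝ) ^ ε) ^ k := by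
        rw [← Real.rpow_natCast, ← Real.rpow_mul (by positivity), mul_comm,
          Real.rpow_mul (by positivity), Real.rpow_natCast]
      rw [h3, one_mul]
      calc (k : ℝ) + 1 ≤ 2 ^ k := by exact_mod_cast Nat.lt_two_pow_self
        _ ≤ _ := by gcongr
  rw [Nat.card_divisors hn.ne']
  push_cast
  have hn' : (n : ℝ) ^ ε = ∏ p ∈ n.primeFactors, ((p : ℝ) ^ (n.factorization p)) ^ ε := by
    conv_lhs => rw [← Nat.prod_factorization_pow_eq_self hn.ne']
    rw [Finsupp.prod, Nat.support_factorization]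
    push_cast
    exact (Real.finsetProd_rpow _ _ (fun i _ => by positivity) _).symm
  rw [hn']
  calc _ ≤ ∏ p ∈ n.primeFactors, ((if p < N then c else 1) * ((p : ℝ) ^ (n.factorization p)) ^ ε) :=
        Finset.prod_le_prod (fun _ _ => by positivity) (fun p hp => by exact_mod_cast hpf p hp)
    _ = (∏ p ∈ n.primeFactors, (if p < N then c else 1)) * _ := Finset.prod_mul_distrib
    _ ≤ _ := by
        gcongr
        rw [Finset.prod_ite]
        simp only [prod_const_one, mul_one, prod_const]
        apply pow_le_pow_right₀ hc1
        calc _ ≤ (Finset.range N).card := Finset.card_le_card (fun p hp => by simp at hp ⊢; exact hp.2)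
          _ = N := by simp

lemma le_card_divisors_mul_totient (a : ℕ) : a ≤ a.divisors.card * a.totient := by
  rcases Nat.eq_zero_or_pos a with rfl | ha
  · simp
  conv_lhs => rw [← Nat.sum_totient a]
  rw [← smul_eq_mul]
  apply Finset.sum_le_card_nsmul
  intro d hd
  exact Nat.le_of_dvd (Nat.totient_pos.2 ha) (Nat.totient_dvd_of_dvd (Nat.dvd_of_mem_divisors hd))

lemma card_mul_eq_le_gcd {a : ℕ} [NeZero a] (w c : ZMod a) :
    (univ.filter fun t : ZMod a => w * t = c).card ≤ Nat.gcd w.val a := by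
  have hapos : 0 < a := Nat.pos_of_ne_zero (NeZero.ne a)
  set g := Nat.gcd w.val a with hg
  have hgpos : 0 < g := Nat.gcd_pos_of_pos_right _ hapos
  obtain ⟨a', ha'⟩ : g ∣ a := Nat.gcd_dvd_right _ _
  have ha'pos : 0 < a' := Nat.pos_of_mul_pos_left (ha' ▸ hapos) |> fun h => by
    rcases Nat.eq_zero_or_pos a' with h0 | h0
    · simp [h0] at ha'; omega
    · exact h0
  rcases (univ.filter fun t : ZMod a => w * t = c).eq_empty_or_nonempty with h | ⟨t0, ht0⟩
  · simp [h]
  simp only [mem_filter, mem_univ, true_and] at ht0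
  have key : ∀ t : ZMod a, w * t = c → a' ∣ (t - t0).val := by
    intro t ht
    have h0 : w * (t - t0) = 0 := by rw [mul_sub, ht, ht0, sub_self]
    have h1 : a ∣ w.val * (t - t0).val := by
      rw [← ZMod.natCast_eq_zero_iff]; push_cast; simpa using h0
    have h2 : a / g ∣ (w.val / g) * (t - t0).val := by
      have := Nat.div_dvd_div (Nat.gcd_dvd_right w.val a) h1
      rwa [Nat.mul_div_right_comm (Nat.gcd_dvd_left _ _)] at this
    have h3 : a / g = a' := by rw [ha']; exact Nat.mul_div_cancel_left _ hgpos
    have h4 := Nat.coprime_div_gcd_div_gcd hgpos (m := w.val) (n := a)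
    rw [← hg, h3] at h4
    rw [h3] at h2
    exact (h4.symm).dvd_of_dvd_mul_left h2
  calc _ ≤ (range g).card := by
        apply Finset.card_le_card_of_injOn (fun t => (t - t0).val / a')
        · intro t _
          simp only [coe_range, Set.mem_Iio]
          rw [Nat.div_lt_iff_lt_mul ha'pos, ← ha']
          exact ZMod.val_lt _
        · intro t ht s hs h
          simp only [coe_filter, mem_univ, true_and, Set.mem_ofPred_eq] at ht hs
          have := (Nat.div_left_inj (key t ht) (key s hs)).1 h
          have := ZMod.val_injective a this
          simpa using this
    _ = g := by simp

lemma sum_gcd_le (a : ℕ) [NeZero a] :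
    ∑ x : ZMod a, Nat.gcd x.val a ≤ a * a.divisors.card := by
  have hapos : 0 < a := Nat.pos_of_ne_zero (NeZero.ne a)
  have h1 : ∀ x : ZMod a, Nat.gcd x.val a ≤ ∑ g ∈ a.divisors, if g ∣ x.val then g else 0 := by
    intro x
    have hm : Nat.gcd x.val a ∈ a.divisors := Nat.mem_divisors.2 ⟨Nat.gcd_dvd_right _ _, hapos.ne'⟩
    calc _ = if Nat.gcd x.val a ∣ x.val then Nat.gcd x.val a else 0 := by
          rw [if_pos (Nat.gcd_dvd_left _ _)]
      _ ≤ _ := Finset.single_le_sum (f := fun g => if g ∣ x.val then g else 0)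
          (fun _ _ => Nat.zero_le _) hm
  calc _ ≤ ∑ x : ZMod a, ∑ g ∈ a.divisors, (if g ∣ x.val then g else 0) := sum_le_sum fun x _ => h1 x
    _ = ∑ g ∈ a.divisors, ∑ x : ZMod a, (if g ∣ x.val then g else 0) := sum_comm
    _ ≤ ∑ g ∈ a.divisors, a := by
        apply sum_le_sum
        intro g hg
        obtain ⟨a', ha'⟩ := Nat.dvd_of_mem_divisors hg
        have hgpos : 0 < g := Nat.pos_of_mem_divisors hg
        rw [← sum_filter, sum_const, smul_eq_mul]
        have : (univ.filter fun x : ZMod a => g ∣ x.val).card ≤ (range a').card := by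
          apply Finset.card_le_card_of_injOn (fun t => t.val / g)
          · intro t _
            simp only [coe_range, Set.mem_Iio]
            rw [Nat.div_lt_iff_lt_mul hgpos, mul_comm, ← ha']
            exact ZMod.val_lt _
          · intro t ht s hs h
            simp only [coe_filter, mem_univ, true_and, Set.mem_ofPred_eq] at ht hs
            exact ZMod.val_injective a ((Nat.div_left_inj ht hs).1 h)
        rw [card_range] at this
        calc _ ≤ a' * g := by gcongr
          _ = a := by rw [ha', mul_comm]
    _ = _ := by rw [sum_const, smul_eq_mul, mul_comm]

/-- The Kloosterman sum modulo `a`. -/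
noncomputable def kloo (a : ℕ) [NeZero a] (m l : ZMod a) : ℂ :=
  ∑ u : (ZMod a)ˣ, ZMod.stdAddChar (m * ((u⁻¹ : (ZMod a)ˣ) : ZMod a) + l * (u : ZMod a))

lemma kloo_mul {a : ℕ} [NeZero a] (m l : ZMod a) (w : (ZMod a)ˣ) :
    kloo a (m * w) (l * ((w⁻¹ : (ZMod a)ˣ) : ZMod a)) = kloo a m l := by
  unfold kloo
  rw [← Equiv.sum_comp (Equiv.mulRight w)]
  refine sum_congr rfl fun u _ => ?_
  congr 1
  simp only [Equiv.coe_mulRight, mul_inv, Units.val_mul]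
  have : (w : ZMod a) * ((w⁻¹ : (ZMod a)ˣ) : ZMod a) = 1 := by simp
  linear_combination (m * ((u⁻¹ : (ZMod a)ˣ) : ZMod a) + l * u) * this

lemma kloo_symm {a : ℕ} [NeZero a] (m l : ZMod a) : kloo a m l = kloo a l m := by
  unfold kloo
  rw [← Equiv.sum_comp (Equiv.inv _)]
  refine sum_congr rfl fun u _ => ?_
  congr 1
  simp [add_comm]

lemma sum_stdAddChar {a : ℕ} [NeZero a] (x : ZMod a) :
    ∑ m : ZMod a, ZMod.stdAddChar (m * x) = if x = 0 then (a : ℂ) else 0 := by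
  have := AddChar.sum_mulShift x (ZMod.isPrimitive_stdAddChar a)
  simpa using this

lemma sum_norm_sq_char {a : ℕ} [NeZero a] {ι : Type*} [Fintype ι] (α β : ι → ZMod a) :
    ∑ m : ZMod a, ∑ l : ZMod a, ‖∑ i, ZMod.stdAddChar (m * α i + l * β i)‖ ^ 2 =
      (a : ℝ) ^ 2 * ((univ.filter fun p : ι × ι => α p.1 = α p.2 ∧ β p.1 = β p.2).card : ℝ) := by
  have hconj : ∀ x : ZMod a, (starRingEnd ℂ) (ZMod.stdAddChar x) = ZMod.stdAddChar (-x) := by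
    intro x; exact AddChar.starComp_apply (by
      rw [ZMod.ringChar_zmod_n]; exact Nat.pos_of_ne_zero (NeZero.ne a)) x
  have h : ((∑ m : ZMod a, ∑ l : ZMod a, ‖∑ i, ZMod.stdAddChar (m * α i + l * β i)‖ ^ 2 : ℝ) : ℂ) =
      (a : ℂ) ^ 2 * ((univ.filter fun p : ι × ι => α p.1 = α p.2 ∧ β p.1 = β p.2).card : ℂ) := by
    push_cast
    calc _ = ∑ m : ZMod a, ∑ l : ZMod a, ∑ i, ∑ j,
          ZMod.stdAddChar (m * (α i - α j)) * ZMod.stdAddChar (l * (β i - β j)) := by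
          refine sum_congr rfl fun m _ => sum_congr rfl fun l _ => ?_
          rw [← Complex.mul_conj', map_sum, sum_mul_sum]
          refine sum_congr rfl fun i _ => sum_congr rfl fun j _ => ?_
          rw [hconj, ← AddChar.map_add_eq_mul, ← AddChar.map_add_eq_mul]
          congr 1; ring
      _ = ∑ i, ∑ j, (∑ m : ZMod a, (ZMod.stdAddChar (m * (α i - α j)) : ℂ)) *
            ∑ l : ZMod a, (ZMod.stdAddChar (l * (β i - β j)) : ℂ) := by
          simp_rw [sum_mul_sum]
          rw [sum_congr rfl fun m _ => sum_comm, sum_comm]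
          refine sum_congr rfl fun i _ => ?_
          rw [sum_congr rfl fun m _ => sum_comm, sum_comm]
      _ = ∑ i, ∑ j, if α i = α j ∧ β i = β j then (a : ℂ) ^ 2 else 0 := by
          refine sum_congr rfl fun i _ => sum_congr rfl fun j _ => ?_
          rw [sum_stdAddChar, sum_stdAddChar]
          simp only [sub_eq_zero]
          by_cases h1 : α i = α j <;> by_cases h2 : β i = β j <;> simp [h1, h2, sq]
      _ = _ := by
          rw [← Fintype.sum_prod_type' (f := fun i j => if α i = α j ∧ β i = β j then (a : ℂ) ^ 2 else 0),
            ← sum_filter, sum_const, nsmul_eq_mul, mul_comm]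
  exact_mod_cast h

lemma card_quadruples_le (a : ℕ) [NeZero a] :
    (univ.filter fun p : ((ZMod a)ˣ × (ZMod a)ˣ) × ((ZMod a)ˣ × (ZMod a)ˣ) =>
      ((p.1.1⁻¹ : (ZMod a)ˣ) : ZMod a) + ((p.1.2⁻¹ : (ZMod a)ˣ) : ZMod a) =
        ((p.2.1⁻¹ : (ZMod a)ˣ) : ZMod a) + ((p.2.2⁻¹ : (ZMod a)ˣ) : ZMod a) ∧
      (p.1.1 : ZMod a) + p.1.2 = p.2.1 + p.2.2).card ≤ 2 * (a * a.divisors.card) ^ 2 := by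
  set T := (univ : Finset (ZMod a × ZMod a)).sigma
    (fun q => univ.filter fun t : ZMod a => (2 * (q.1 * q.2)) * t = (q.1 + q.2) * (q.1 * q.2)) with hT
  calc _ ≤ T.card := by
        apply Finset.card_le_card_of_injOn
          (fun p => ⟨((p.2.1 : ZMod a) - p.1.1, (p.2.1 : ZMod a) - p.1.2), (p.2.1 : ZMod a)⟩)
        · rintro ⟨⟨u1, u2⟩, ⟨u3, u4⟩⟩ h
          simp only [coe_filter, mem_univ, true_and, Set.mem_ofPred_eq] at h
          simp only [hT, coe_sigma, Set.mem_sigma_iff, coe_univ, Set.mem_univ, true_and, coe_filter,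
            mem_univ, Set.mem_ofPred_eq]
          obtain ⟨h1, h2⟩ := h
          have e1 : (u1 : ZMod a) * ((u1⁻¹ : (ZMod a)ˣ) : ZMod a) = 1 := by simp
          have e2 : (u2 : ZMod a) * ((u2⁻¹ : (ZMod a)ˣ) : ZMod a) = 1 := by simp
          have e3 : (u3 : ZMod a) * ((u3⁻¹ : (ZMod a)ˣ) : ZMod a) = 1 := by simp
          have e4 : (u4 : ZMod a) * ((u4⁻¹ : (ZMod a)ˣ) : ZMod a) = 1 := by simp
          generalize ((u1⁻¹ : (ZMod a)ˣ) : ZMod a) = v1 at *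
          generalize ((u2⁻¹ : (ZMod a)ˣ) : ZMod a) = v2 at *
          generalize ((u3⁻¹ : (ZMod a)ˣ) : ZMod a) = v3 at *
          generalize ((u4⁻¹ : (ZMod a)ˣ) : ZMod a) = v4 at *
          generalize (u1 : ZMod a) = x1 at *
          generalize (u2 : ZMod a) = x2 at *
          generalize (u3 : ZMod a) = x3 at *
          generalize (u4 : ZMod a) = x4 at *
          obtain rfl : x4 = x1 + x2 - x3 := by linear_combination -h2
          have h5 : (x1 + x2) * (x3 * (x1 + x2 - x3)) = (x1 + x2) * (x1 * x2) := by
            have hA : (v1 + v2) * (x1 * x2) = x1 + x2 := by linear_combination x2 * e1 + x1 * e2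
            have hB : (v3 + v4) * (x3 * (x1 + x2 - x3)) = x1 + x2 := by
              linear_combination (x1 + x2 - x3) * e3 + x3 * e4
            linear_combination (x1 * x2) * hB - (x3 * (x1 + x2 - x3)) * hA +
              (x1 * x2) * (x3 * (x1 + x2 - x3)) * h1
          linear_combination -h5
        · rintro ⟨⟨u1, u2⟩, ⟨u3, u4⟩⟩ h ⟨⟨w1, w2⟩, ⟨w3, w4⟩⟩ h' heq
          simp only [coe_filter, mem_univ, true_and, Set.mem_ofPred_eq] at h h'
          simp only [Sigma.mk.injEq, Prod.mk.injEq, heq_eq_eq] at heq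
          obtain ⟨⟨a1, a2⟩, a3⟩ := heq
          have b1 : (u1 : ZMod a) = w1 := by linear_combination a3 - a1
          have b2 : (u2 : ZMod a) = w2 := by linear_combination a3 - a2
          have b4 : (u4 : ZMod a) = w4 := by linear_combination h'.2 - h.2 + b1 + b2 - a3
          rw [Units.ext b1, Units.ext b2, Units.ext a3, Units.ext b4]
    _ = ∑ q : ZMod a × ZMod a, (univ.filter fun t : ZMod a =>
          (2 * (q.1 * q.2)) * t = (q.1 + q.2) * (q.1 * q.2)).card := by rw [hT, card_sigma]
    _ ≤ ∑ q : ZMod a × ZMod a, 2 * (Nat.gcd q.1.val a * Nat.gcd q.2.val a) := by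
        refine sum_le_sum fun q _ => (card_mul_eq_le_gcd _ _).trans ?_
        have h1 : Nat.gcd (2 * (q.1 * q.2) : ZMod a).val a = Nat.gcd (2 * (q.1.val * q.2.val)) a := by
          have : (2 * (q.1 * q.2) : ZMod a) = ((2 * (q.1.val * q.2.val) : ℕ) : ZMod a) := by
            push_cast; simp
          rw [this, ZMod.val_natCast, ← Nat.gcd_rec, Nat.gcd_comm]
        rw [h1]
        have h0 : 0 < a := Nat.pos_of_ne_zero (NeZero.ne a)
        calc _ ≤ Nat.gcd 2 a * Nat.gcd (q.1.val * q.2.val) a :=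
              Nat.le_of_dvd (by positivity) (Nat.gcd_mul_left_dvd_mul_gcd _ _ _)
          _ ≤ 2 * (Nat.gcd q.1.val a * Nat.gcd q.2.val a) := by
              gcongr
              · exact Nat.gcd_le_left _ (by norm_num)
              · exact Nat.le_of_dvd (by positivity) (Nat.gcd_mul_left_dvd_mul_gcd _ _ _)
    _ = 2 * (∑ x : ZMod a, Nat.gcd x.val a) ^ 2 := by
        rw [← mul_sum, Fintype.sum_prod_type, sq, sum_mul_sum]
    _ ≤ _ := by gcongr; exact sum_gcd_le a

lemma sum_kloo_pow_four (a : ℕ) [NeZero a] :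
    ∑ m : ZMod a, ∑ l : ZMod a, ‖kloo a m l‖ ^ 4 ≤
      2 * (a : ℝ) ^ 4 * (a.divisors.card : ℝ) ^ 2 := by
  have h : ∀ m l : ZMod a, ‖kloo a m l‖ ^ 4 = ‖∑ p : (ZMod a)ˣ × (ZMod a)ˣ, ZMod.stdAddChar
      (m * (((p.1⁻¹ : (ZMod a)ˣ) : ZMod a) + ((p.2⁻¹ : (ZMod a)ˣ) : ZMod a)) +
        l * ((p.1 : ZMod a) + (p.2 : ZMod a)))‖ ^ 2 := by
    intro m l
    rw [show ‖kloo a m l‖ ^ 4 = ‖kloo a m l * kloo a m l‖ ^ 2 by rw [norm_mul]; ring]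
    congr 2
    unfold kloo
    rw [sum_mul_sum, Fintype.sum_prod_type]
    refine sum_congr rfl fun i _ => sum_congr rfl fun j _ => ?_
    rw [← AddChar.map_add_eq_mul]
    congr 1; ring
  simp_rw [h]
  rw [sum_norm_sq_char]
  have := card_quadruples_le a
  calc _ ≤ (a : ℝ) ^ 2 * ((2 * (a * a.divisors.card) ^ 2 : ℕ) : ℝ) := by gcongr
    _ = _ := by push_cast; ring

lemma norm_kloo_pow_four_le (a : ℕ) [NeZero a] (m l : ZMod a) :
    ‖kloo a m l‖ ^ 4 ≤ 2 * (a : ℝ) ^ 3 * (a.divisors.card : ℝ) ^ 3 * (Nat.gcd m.val a : ℝ) := by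
  have hapos : (0 : ℝ) < a := by exact_mod_cast Nat.pos_of_ne_zero (NeZero.ne a)
  set τ : ℝ := (a.divisors.card : ℝ)
  set g : ℝ := (Nat.gcd m.val a : ℝ)
  have h1 : (a.totient : ℝ) * ‖kloo a m l‖ ^ 4 ≤ g * (2 * (a : ℝ) ^ 4 * τ ^ 2) := by
    calc (a.totient : ℝ) * ‖kloo a m l‖ ^ 4
        = ∑ w : (ZMod a)ˣ, ‖kloo a (m * w) (l * ((w⁻¹ : (ZMod a)ˣ) : ZMod a))‖ ^ 4 := by
          simp_rw [kloo_mul]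
          simp [ZMod.card_units_eq_totient]
      _ ≤ ∑ w : (ZMod a)ˣ, ∑ l' : ZMod a, ‖kloo a (m * w) l'‖ ^ 4 :=
          sum_le_sum fun w _ => single_le_sum (f := fun l' => ‖kloo a (m * w) l'‖ ^ 4)
            (fun _ _ => by positivity) (mem_univ _)
      _ ≤ ∑ w : ZMod a, ∑ l' : ZMod a, ‖kloo a (m * w) l'‖ ^ 4 := by
          rw [← sum_image (s := (univ : Finset (ZMod a)ˣ)) (g := fun w : (ZMod a)ˣ => (w : ZMod a))
            (f := fun w => ∑ l' : ZMod a, ‖kloo a (m * w) l'‖ ^ 4)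
            (fun x _ y _ h => Units.ext h)]
          exact sum_le_sum_of_subset_of_nonneg (subset_univ _) (fun _ _ _ => by positivity)
      _ = ∑ m' : ZMod a, ((univ.filter fun w : ZMod a => m * w = m').card : ℝ) *
            ∑ l' : ZMod a, ‖kloo a m' l'‖ ^ 4 := by
          rw [← sum_fiberwise (s := univ) (g := fun w => m * w)]
          refine sum_congr rfl fun m' _ => ?_
          rw [sum_congr rfl (g := fun _ => ∑ l' : ZMod a, ‖kloo a m' l'‖ ^ 4), sum_const, nsmul_eq_mul]
          intro w hw
          simp only [mem_filter, mem_univ, true_and] at hw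
          rw [hw]
      _ ≤ ∑ m' : ZMod a, g * ∑ l' : ZMod a, ‖kloo a m' l'‖ ^ 4 := by
          refine sum_le_sum fun m' _ => ?_
          gcongr
          simp only [g]; exact_mod_cast card_mul_eq_le_gcd m m'
      _ ≤ _ := by
          rw [← mul_sum]
          gcongr
          exact sum_kloo_pow_four a
  have h2 : (a : ℝ) ≤ τ * a.totient := by
    simp only [τ]; exact_mod_cast le_card_divisors_mul_totient a
  have h3 : (a : ℝ) * ‖kloo a m l‖ ^ 4 ≤ a * (2 * (a : ℝ) ^ 3 * τ ^ 3 * g) := by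
    calc _ ≤ τ * a.totient * ‖kloo a m l‖ ^ 4 := by gcongr
      _ = τ * (a.totient * ‖kloo a m l‖ ^ 4) := by ring
      _ ≤ τ * (g * (2 * (a : ℝ) ^ 4 * τ ^ 2)) := by gcongr
      _ = _ := by ring
  exact le_of_mul_le_mul_left h3 hapos

lemma norm_kloo_le : ∃ C : ℝ, 1 ≤ C ∧ ∀ (a : ℕ) [NeZero a] (m l : ZMod a),
    ‖kloo a m l‖ ≤ C * (a : ℝ) ^ (7 / 8 : ℝ) * (Nat.gcd m.val a : ℝ) := by
  obtain ⟨C, hC1, hC⟩ := card_divisors_le_rpow (ε := 1 / 6) (by norm_num)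
  refine ⟨2 * C, by linarith, fun a _ m l => ?_⟩
  have hapos : (0 : ℝ) < a := by exact_mod_cast Nat.pos_of_ne_zero (NeZero.ne a)
  have hg : (1 : ℝ) ≤ (Nat.gcd m.val a : ℝ) := by
    exact_mod_cast Nat.gcd_pos_of_pos_right _ (Nat.pos_of_ne_zero (NeZero.ne a))
  set g : ℝ := (Nat.gcd m.val a : ℝ)
  have h := norm_kloo_pow_four_le a m l
  have hpow : ((a : ℝ) ^ (7 / 8 : ℝ)) ^ 4 = (a : ℝ) ^ 3 * ((a : ℝ) ^ (1 / 6 : ℝ)) ^ 3 := by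
    rw [← Real.rpow_natCast, ← Real.rpow_mul hapos.le, ← Real.rpow_natCast, ← Real.rpow_natCast,
      ← Real.rpow_mul hapos.le, ← Real.rpow_add hapos]
    norm_num
  refine le_of_pow_le_pow_left₀ (n := 4) (by norm_num) (by positivity) (h.trans ?_)
  have e : (2 * C * (a : ℝ) ^ (7 / 8 : ℝ) * g) ^ 4 =
      16 * C ^ 4 * ((a : ℝ) ^ 3 * ((a : ℝ) ^ (1 / 6 : ℝ)) ^ 3) * g ^ 4 := by
    rw [← hpow]; ring
  rw [e]
  calc _ ≤ 2 * (a : ℝ) ^ 3 * (C * (a : ℝ) ^ (1 / 6 : ℝ)) ^ 3 * g := by gcongr; exact hC a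
    _ = 2 * C ^ 3 * ((a : ℝ) ^ 3 * ((a : ℝ) ^ (1 / 6 : ℝ)) ^ 3) * g ^ 1 := by ring
    _ ≤ _ := by gcongr <;> norm_num

lemma div_le_norm_stdAddChar_sub_one {a : ℕ} [NeZero a] (h : ZMod a) (hh : h ≠ 0) :
    2 ≤ ((a : ℝ) / h.val + a / (a - h.val)) * ‖ZMod.stdAddChar h - 1‖ := by
  have hv : 0 < h.val := ZMod.val_pos.2 hh
  have hlt : h.val < a := ZMod.val_lt h
  have hvR : (0 : ℝ) < h.val := by exact_mod_cast hv
  have hltR : (h.val : ℝ) < a := by exact_mod_cast hlt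
  have haR : (0 : ℝ) < a := hvR.trans hltR
  set x : ℝ := (h.val : ℝ) with hx
  have h1 : ‖ZMod.stdAddChar h - 1‖ = 2 * Real.sin (Real.pi * x / a) := by
    have : (ZMod.stdAddChar h : ℂ) = Complex.exp (Complex.I * ((2 * Real.pi * x / a : ℝ) : ℂ)) := by
      rw [ZMod.stdAddChar_apply, ZMod.toCircle_apply]
      congr 1; push_cast; rw [hx]; push_cast; ring
    rw [this, Complex.norm_exp_I_mul_ofReal_sub_one, show 2 * Real.pi * x / a / 2 = Real.pi * x / a by ring,
      Real.norm_of_nonneg]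
    have := Real.sin_nonneg_of_nonneg_of_le_pi (x := Real.pi * x / a) (by positivity)
      (by rw [div_le_iff₀ haR]; nlinarith [Real.pi_pos])
    positivity
  rw [h1]
  have hax : 0 < (a : ℝ) - x := by linarith
  rcases le_total (2 * x) a with hc | hc
  · have h2 := Real.mul_le_sin (x := Real.pi * x / a) (by positivity)
      (by rw [div_le_iff₀ haR]; nlinarith [Real.pi_pos])
    have h3 : 2 / Real.pi * (Real.pi * x / a) = 2 * x / a := by field_simp
    rw [h3] at h2
    calc (2 : ℝ) ≤ (a / x) * (2 * (2 * x / a)) := by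
          rw [show (a / x) * (2 * (2 * x / a)) = 4 by field_simp; norm_num]; norm_num
      _ ≤ _ := by gcongr; linarith [show 0 ≤ (a : ℝ) / (a - x) by positivity]
  · have h2 := Real.mul_le_sin (x := Real.pi * (a - x) / a) (by positivity)
      (by rw [div_le_iff₀ haR]; nlinarith [Real.pi_pos])
    have h3 : 2 / Real.pi * (Real.pi * (a - x) / a) = 2 * (a - x) / a := by field_simp
    have h4 : Real.sin (Real.pi * (a - x) / a) = Real.sin (Real.pi * x / a) := by
      rw [← Real.sin_pi_sub]; congr 1; field_simp; ring
    rw [h3, h4] at h2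
    calc (2 : ℝ) ≤ (a / (a - x)) * (2 * (2 * (a - x) / a)) := by
          rw [show (a / (a - x)) * (2 * (2 * (a - x) / a)) = 4 by field_simp; norm_num]; norm_num
      _ ≤ _ := by gcongr; linarith [show 0 ≤ (a : ℝ) / x by positivity]

/-- The exponential sum over the integers of `(x₁, x₂]`. -/
noncomputable def intervalSum (a : ℕ) [NeZero a] (x₁ x₂ : ℤ) (h : ZMod a) : ℂ :=
  ∑ b ∈ Ioc x₁ x₂, ZMod.stdAddChar (h * (b : ZMod a))

/-- A majorant for `intervalSum` on intervals of length at most `2 * a`. -/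
noncomputable def fourierWeight (a : ℕ) (h : ZMod a) : ℝ :=
  if h = 0 then 2 * a else (a : ℝ) / h.val + a / (a - h.val)

lemma fourierWeight_nonneg {a : ℕ} [NeZero a] (h : ZMod a) : 0 ≤ fourierWeight a h := by
  unfold fourierWeight
  have : (h.val : ℝ) ≤ a := by exact_mod_cast (ZMod.val_lt h).le
  split_ifs
  · positivity
  · have : 0 ≤ (a : ℝ) - h.val := by linarith
    positivity

lemma norm_intervalSum_le {a : ℕ} [NeZero a] (x₁ x₂ : ℤ) (hI : (Ioc x₁ x₂).card ≤ 2 * a)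
    (h : ZMod a) : ‖intervalSum a x₁ x₂ h‖ ≤ fourierWeight a h := by
  have hnorm : ∀ x : ZMod a, ‖(ZMod.stdAddChar x : ℂ)‖ = 1 := fun x => by
    rw [ZMod.stdAddChar_apply]; exact Circle.norm_coe _
  unfold fourierWeight
  split_ifs with hh
  · calc _ ≤ ∑ b ∈ Ioc x₁ x₂, ‖(ZMod.stdAddChar (h * (b : ZMod a)) : ℂ)‖ := norm_sum_le _ _
      _ = ((Ioc x₁ x₂).card : ℝ) := by simp [hnorm]
      _ ≤ _ := by exact_mod_cast hI
  · have hpos : 0 < ‖(ZMod.stdAddChar h : ℂ) - 1‖ := by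
      rw [norm_pos_iff, sub_ne_zero]
      intro h0
      apply hh
      apply ZMod.injective_stdAddChar
      simpa using h0
    have key := div_le_norm_stdAddChar_sub_one h hh
    have hgeo : ‖intervalSum a x₁ x₂ h * (ZMod.stdAddChar h - 1)‖ ≤ 2 := by
      rcases le_or_gt x₁ x₂ with hx | hx
      · have : intervalSum a x₁ x₂ h * (ZMod.stdAddChar h - 1) =
            ZMod.stdAddChar (h * ((x₂ + 1 : ℤ) : ZMod a)) - ZMod.stdAddChar (h * ((x₁ + 1 : ℤ) : ZMod a)) := by
          induction x₂, hx using Int.leInduction with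
          | base => simp [intervalSum]
          | succ y hy ih =>
            unfold intervalSum
            rw [show Ioc x₁ (y + 1) = insert (y + 1) (Ioc x₁ y) by ext t; simp; omega,
              sum_insert (by simp), add_mul]
            change _ + intervalSum a x₁ y h * _ = _
            rw [ih ((card_le_card (Ioc_subset_Ioc_right (by omega))).trans hI)]
            have : (ZMod.stdAddChar (h * ((y + 1 + 1 : ℤ) : ZMod a)) : ℂ) =
              ZMod.stdAddChar (h * ((y + 1 : ℤ) : ZMod a)) * ZMod.stdAddChar h := by
              rw [← AddChar.map_add_eq_mul]; congr 1; push_cast; ring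
            rw [this]; ring
        rw [this]
        calc _ ≤ _ := norm_sub_le _ _
          _ = 2 := by rw [hnorm, hnorm]; norm_num
      · simp [intervalSum, Ioc_eq_empty_of_le hx.le]
    rw [norm_mul] at hgeo
    exact le_of_mul_le_mul_right (hgeo.trans key) hpos

lemma sum_Ioo_inv_le (a : ℕ) : ∑ k ∈ Ioo 0 a, (1 : ℝ) / k ≤ 1 + Real.log a := by
  rcases Nat.eq_zero_or_pos a with rfl | ha
  · simp
  calc ∑ k ∈ Ioo 0 a, (1 : ℝ) / k ≤ ∑ k ∈ Icc 1 a, (1 : ℝ) / k := by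
        apply sum_le_sum_of_subset_of_nonneg
        · intro x; simp; omega
        · intros; positivity
    _ ≤ _ := by
      have := harmonic_le_one_add_log a
      rw [harmonic_eq_sum_Icc] at this
      push_cast at this
      simpa using this

lemma sum_fourierWeight_le {a : ℕ} [NeZero a] :
    ∑ h ∈ univ.erase (0 : ZMod a), fourierWeight a h * (Nat.gcd h.val a : ℝ) ≤
      a * (2 * (a.divisors.card : ℝ) * (1 + Real.log a)) := by
  have hapos : 0 < a := Nat.pos_of_ne_zero (NeZero.ne a)
  have hlog : 0 ≤ Real.log a := Real.log_natCast_nonneg a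
  have h1 : ∑ h ∈ univ.erase (0 : ZMod a), fourierWeight a h * (Nat.gcd h.val a : ℝ) =
      ∑ k ∈ Ioo 0 a, ((a : ℝ) / k + a / (a - k)) * (Nat.gcd k a : ℝ) := by
    apply sum_bij (fun h _ => h.val)
    · intro h hh
      simp only [mem_erase, mem_univ, and_true] at hh
      exact mem_Ioo.2 ⟨ZMod.val_pos.2 hh, ZMod.val_lt h⟩
    · intro h _ h' _ e; exact ZMod.val_injective a e
    · intro k hk
      obtain ⟨hk1, hk2⟩ := mem_Ioo.1 hk
      refine ⟨(k : ZMod a), ?_, ZMod.val_cast_of_lt hk2⟩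
      simp only [mem_erase, mem_univ, and_true]
      intro h0
      have := congrArg ZMod.val h0
      rw [ZMod.val_cast_of_lt hk2, ZMod.val_zero] at this
      omega
    · intro h hh
      simp only [mem_erase, mem_univ, and_true] at hh
      simp [fourierWeight, hh]
  have h2 : ∑ k ∈ Ioo 0 a, ((a : ℝ) / (a - k)) * (Nat.gcd k a : ℝ) =
      ∑ k ∈ Ioo 0 a, ((a : ℝ) / k) * (Nat.gcd k a : ℝ) := by
    apply sum_bij (fun k _ => a - k)
    · intro k hk; simp only [mem_Ioo] at hk ⊢; omega
    · intro k hk k' hk' e; simp only [mem_Ioo] at hk hk'; omega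
    · intro k hk; simp only [mem_Ioo] at hk
      exact ⟨a - k, by simp only [mem_Ioo]; omega, by omega⟩
    · intro k hk; simp only [mem_Ioo] at hk
      rw [Nat.cast_sub hk.2.le]
      congr 2
      exact (Nat.gcd_self_sub_left hk.2.le).symm
  have h3 : ∑ k ∈ Ioo 0 a, (1 / (k : ℝ)) * (Nat.gcd k a : ℝ) ≤
      (a.divisors.card : ℝ) * (1 + Real.log a) := by
    have h4 : ∀ k ∈ Ioo 0 a, (1 / (k : ℝ)) * (Nat.gcd k a : ℝ) ≤
        ∑ g ∈ a.divisors, if g ∣ k then (1 / (k : ℝ)) * g else 0 := by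
      intro k _
      have hm : Nat.gcd k a ∈ a.divisors := Nat.mem_divisors.2 ⟨Nat.gcd_dvd_right _ _, hapos.ne'⟩
      calc _ = if Nat.gcd k a ∣ k then (1 / (k : ℝ)) * (Nat.gcd k a : ℝ) else 0 := by
            rw [if_pos (Nat.gcd_dvd_left _ _)]
        _ ≤ _ := Finset.single_le_sum (f := fun g : ℕ => if g ∣ k then (1 / (k : ℝ)) * (g : ℝ) else 0)
            (fun _ _ => by positivity) hm
    calc _ ≤ ∑ k ∈ Ioo 0 a, ∑ g ∈ a.divisors, (if g ∣ k then (1 / (k : ℝ)) * g else 0) := sum_le_sum h4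
      _ = ∑ g ∈ a.divisors, ∑ k ∈ Ioo 0 a, (if g ∣ k then (1 / (k : ℝ)) * g else 0) := sum_comm
      _ ≤ ∑ g ∈ a.divisors, (1 + Real.log a) := by
          apply sum_le_sum
          intro g hg
          have hgpos : 0 < g := Nat.pos_of_mem_divisors hg
          rw [← sum_filter]
          calc _ = ∑ k ∈ (Ioo 0 a).filter (g ∣ ·), (1 : ℝ) / ((k / g : ℕ) : ℝ) := by
                apply sum_congr rfl
                intro k hk
                obtain ⟨hk1, m, rfl⟩ := mem_filter.1 hk
                have hm : 0 < m := Nat.pos_of_mul_pos_left (mem_Ioo.1 hk1).1 |> fun _ => by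
                  rcases Nat.eq_zero_or_pos m with h | h
                  · subst h; simp at hk1
                  · exact h
                rw [Nat.mul_div_cancel_left _ hgpos]
                push_cast
                field_simp
            _ = ∑ m ∈ ((Ioo 0 a).filter (g ∣ ·)).image (· / g), (1 : ℝ) / (m : ℝ) := by
                rw [sum_image]
                intro x hx y hy e
                simp only [coe_filter, Set.mem_ofPred_eq] at hx hy
                exact (Nat.div_left_inj hx.2 hy.2).1 e
            _ ≤ ∑ m ∈ Ioo 0 a, (1 : ℝ) / (m : ℝ) := by
                apply sum_le_sum_of_subset_of_nonneg
                · intro m hm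
                  obtain ⟨k, hk, rfl⟩ := mem_image.1 hm
                  obtain ⟨hk1, hk2⟩ := mem_filter.1 hk
                  have := mem_Ioo.1 hk1
                  exact mem_Ioo.2 ⟨Nat.div_pos (Nat.le_of_dvd this.1 hk2) hgpos,
                    (Nat.div_le_self _ _).trans_lt this.2⟩
                · intros; positivity
            _ ≤ _ := sum_Ioo_inv_le a
      _ = _ := by rw [sum_const, nsmul_eq_mul]
  rw [h1]
  simp_rw [add_mul]
  rw [sum_add_distrib, h2]
  have h5 : ∑ k ∈ Ioo 0 a, ((a : ℝ) / k) * (Nat.gcd k a : ℝ) =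
      a * ∑ k ∈ Ioo 0 a, (1 / (k : ℝ)) * (Nat.gcd k a : ℝ) := by
    rw [mul_sum]; refine sum_congr rfl fun k _ => by ring
  rw [h5]
  have : (0 : ℝ) ≤ a := Nat.cast_nonneg a
  nlinarith [mul_le_mul_of_nonneg_left h3 this]

/-- The pairs `(b, c)` of integers in a box with `c` invertible modulo `a` and `b * c ≡ ν`. -/
noncomputable def hypPoints (a : ℕ) (ν : ZMod a) (x₁ x₂ y₁ y₂ : ℤ) : Finset (ℤ × ℤ) := by
  classical
  exact (Ioc x₁ x₂ ×ˢ Ioc y₁ y₂).filter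
    fun p => IsUnit ((p.2 : ℤ) : ZMod a) ∧ ((p.1 : ℤ) : ZMod a) * ((p.2 : ℤ) : ZMod a) = ν

lemma card_hypPoints_eq (a : ℕ) [NeZero a] (ν : ZMod a) (x₁ x₂ y₁ y₂ : ℤ) :
    (a : ℂ) ^ 2 * ((hypPoints a ν x₁ x₂ y₁ y₂).card : ℂ) =
      ∑ h : ZMod a, ∑ l : ZMod a,
        kloo a (-(h * ν)) (-l) * intervalSum a x₁ x₂ h * intervalSum a y₁ y₂ l := by
  classical
  symm
  have hdelta : ∀ x : ZMod a, ∑ h : ZMod a, (ZMod.stdAddChar (h * x) : ℂ) =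
      if x = 0 then (a : ℂ) else 0 := sum_stdAddChar
  calc _ = ∑ h : ZMod a, ∑ l : ZMod a, ∑ u : (ZMod a)ˣ, ∑ b ∈ Ioc x₁ x₂, ∑ c ∈ Ioc y₁ y₂,
        (ZMod.stdAddChar (h * ((b : ZMod a) - ν * ((u⁻¹ : (ZMod a)ˣ) : ZMod a))) : ℂ) *
          ZMod.stdAddChar (l * ((c : ZMod a) - (u : ZMod a))) := by
        refine sum_congr rfl fun h _ => sum_congr rfl fun l _ => ?_
        unfold kloo intervalSum
        rw [sum_mul, sum_mul]
        refine sum_congr rfl fun u _ => ?_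
        rw [mul_assoc, sum_mul_sum, mul_sum]
        refine sum_congr rfl fun b _ => ?_
        rw [mul_sum]
        refine sum_congr rfl fun c _ => ?_
        rw [← AddChar.map_add_eq_mul, ← AddChar.map_add_eq_mul, ← AddChar.map_add_eq_mul]
        congr 1; ring
    _ = ∑ u : (ZMod a)ˣ, ∑ b ∈ Ioc x₁ x₂, ∑ c ∈ Ioc y₁ y₂, ∑ h : ZMod a, ∑ l : ZMod a,
        (ZMod.stdAddChar (h * ((b : ZMod a) - ν * ((u⁻¹ : (ZMod a)ˣ) : ZMod a))) : ℂ) *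
          ZMod.stdAddChar (l * ((c : ZMod a) - (u : ZMod a))) := by
        rw [sum_congr rfl fun h _ => sum_comm, sum_comm]
        refine sum_congr rfl fun u _ => ?_
        rw [sum_congr rfl fun h _ => sum_comm, sum_comm]
        refine sum_congr rfl fun b _ => ?_
        rw [sum_congr rfl fun h _ => sum_comm, sum_comm]
    _ = ∑ u : (ZMod a)ˣ, ∑ b ∈ Ioc x₁ x₂, ∑ c ∈ Ioc y₁ y₂,
          if (c : ZMod a) = (u : ZMod a) then (if (b : ZMod a) * c = ν then (a : ℂ) ^ 2 else 0) else 0 := by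
        refine sum_congr rfl fun u _ => sum_congr rfl fun b _ => sum_congr rfl fun c _ => ?_
        rw [← sum_mul_sum, hdelta, hdelta]
        have e1 : (b : ZMod a) - ν * ((u⁻¹ : (ZMod a)ˣ) : ZMod a) = 0 ↔ (b : ZMod a) * u = ν := by
          rw [sub_eq_zero]
          constructor
          · intro h; rw [h, mul_assoc]; simp
          · intro h; rw [← h, mul_assoc]; simp
        rw [if_congr e1 rfl rfl, if_congr sub_eq_zero rfl rfl]
        by_cases h1 : (c : ZMod a) = (u : ZMod a)
        · rw [if_pos h1, if_pos h1, h1]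
          split_ifs <;> ring
        · rw [if_neg h1, if_neg h1, mul_zero]
    _ = ∑ b ∈ Ioc x₁ x₂, ∑ c ∈ Ioc y₁ y₂,
          if IsUnit (c : ZMod a) ∧ (b : ZMod a) * c = ν then (a : ℂ) ^ 2 else 0 := by
        rw [sum_comm]
        refine sum_congr rfl fun b _ => ?_
        rw [sum_comm]
        refine sum_congr rfl fun c _ => ?_
        by_cases hc : IsUnit (c : ZMod a)
        · obtain ⟨u, hu⟩ := hc
          rw [sum_eq_single u]
          · rw [if_pos hu.symm]
            have : IsUnit (c : ZMod a) := ⟨u, hu⟩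
            simp [this]
          · intro v _ hv
            rw [if_neg]
            intro h; exact hv (Units.ext (h.symm.trans hu.symm))
          · simp
        · rw [if_neg (fun h : IsUnit (c : ZMod a) ∧ (b : ZMod a) * c = ν => hc h.1)]
          apply sum_eq_zero
          intro u _
          rw [if_neg]
          intro h; exact hc (h ▸ u.isUnit)
    _ = _ := by
        rw [← sum_product', ← sum_filter, sum_const, nsmul_eq_mul, mul_comm]
        unfold hypPoints
        congr!

lemma gcd_val_neg_mul_le {a : ℕ} [NeZero a] (h ν : ZMod a) :
    Nat.gcd (-(h * ν)).val a ≤ Nat.gcd h.val a * Nat.gcd ν.val a := by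
  have h0 : 0 < a := Nat.pos_of_ne_zero (NeZero.ne a)
  have h1 : Nat.gcd (-(h * ν)).val a = Nat.gcd (h.val * ν.val) a := by
    have key : ∀ z : ℤ, Nat.gcd ((z : ZMod a)).val a = Int.gcd z a := by
      intro z
      have : ((z : ZMod a).val : ℤ) = z % a := ZMod.val_intCast z
      rw [← Int.gcd_natCast_natCast, this, Int.gcd_emod]
    have e : -(h * ν) = ((-(h.val * ν.val : ℕ) : ℤ) : ZMod a) := by push_cast; simp
    rw [e, key, Int.neg_gcd, Int.gcd_natCast_natCast]
  rw [h1]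
  exact Nat.le_of_dvd (Nat.mul_pos (Nat.gcd_pos_of_pos_right _ h0) (Nat.gcd_pos_of_pos_right _ h0))
    (Nat.gcd_mul_left_dvd_mul_gcd _ _ _)

lemma card_hypPoints_approx : ∃ C : ℝ, 1 ≤ C ∧ ∀ (a : ℕ) [NeZero a] (ν : ZMod a)
    (x₁ x₂ y₁ y₂ : ℤ), (Ioc x₁ x₂).card ≤ 2 * a → (Ioc y₁ y₂).card ≤ 2 * a →
    |((hypPoints a ν x₁ x₂ y₁ y₂).card : ℝ) -
      (a.totient : ℝ) / (a : ℝ) ^ 2 * ((Ioc x₁ x₂).card : ℝ) * ((Ioc y₁ y₂).card : ℝ)| ≤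
      C * (a : ℝ) ^ (15 / 16 : ℝ) * (Nat.gcd ν.val a : ℝ) := by
  obtain ⟨C, hC1, hC⟩ := norm_kloo_le
  obtain ⟨C', hC1', hC'⟩ := card_divisors_le_rpow (ε := 1 / 64) (by norm_num)
  refine ⟨2 * C * (4 * C' * 65) ^ 2, by nlinarith [mul_pos (by linarith : 0 < C) (by linarith : 0 < C')], ?_⟩
  intro a _ ν x₁ x₂ y₁ y₂ hI hJ
  have hapos : 0 < a := Nat.pos_of_ne_zero (NeZero.ne a)
  have haR : (0 : ℝ) < a := by exact_mod_cast hapos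
  have ha1 : (1 : ℝ) ≤ a := by exact_mod_cast hapos
  set G : ℝ := (Nat.gcd ν.val a : ℝ) with hG
  have hg1 : ∀ x : ZMod a, (1 : ℝ) ≤ (Nat.gcd x.val a : ℝ) := fun x => by
    exact_mod_cast Nat.gcd_pos_of_pos_right _ hapos
  have hG1 : 1 ≤ G := hg1 ν
  set F : ZMod a → ZMod a → ℂ := fun h l =>
    kloo a (-(h * ν)) (-l) * intervalSum a x₁ x₂ h * intervalSum a y₁ y₂ l with hF
  have h00 : F 0 0 = (a.totient : ℂ) * ((Ioc x₁ x₂).card : ℂ) * ((Ioc y₁ y₂).card : ℂ) := by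
    simp [hF, kloo, intervalSum, ZMod.card_units_eq_totient]
  set K : ℝ := C * (a : ℝ) ^ (7 / 8 : ℝ) * G with hK
  have hKpos : 0 < K := by positivity
  set W := fun h : ZMod a => fourierWeight a h
  set γ := fun h : ZMod a => (Nat.gcd h.val a : ℝ)
  have hW : ∀ h, 0 ≤ W h := fun h => fourierWeight_nonneg h
  have hγ0 : γ 0 = a := by simp [γ]
  have hγ : ∀ h, 0 ≤ γ h := fun h => by simp only [γ]; positivity
  have hb1 : ∀ h l, ‖F h l‖ ≤ K * γ h * W h * W l := by
    intro h l
    have h1 : ((Nat.gcd (-(h * ν)).val a : ℕ) : ℝ) ≤ γ h * G := by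
      simp only [γ, hG]; exact_mod_cast gcd_val_neg_mul_le h ν
    have h2 : ‖kloo a (-(h * ν)) (-l)‖ ≤ K * γ h := by
      calc _ ≤ _ := hC a _ _
        _ ≤ C * (a : ℝ) ^ (7 / 8 : ℝ) * (γ h * G) := by gcongr
        _ = _ := by rw [hK]; ring
    simp only [hF, norm_mul]
    exact mul_le_mul (mul_le_mul h2 (norm_intervalSum_le _ _ hI h) (norm_nonneg _)
      (mul_nonneg hKpos.le (hγ h))) (norm_intervalSum_le _ _ hJ l) (norm_nonneg _)
      (mul_nonneg (mul_nonneg hKpos.le (hγ h)) (hW h))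
  have hb2 : ∀ h l, ‖F h l‖ ≤ K * γ l * W h * W l := by
    intro h l
    have h1 : ((Nat.gcd (-l).val a : ℕ) : ℝ) ≤ γ l * G := by
      have h1 : Nat.gcd (-l).val a ≤ Nat.gcd l.val a := by
        have h0 := gcd_val_neg_mul_le l 1
        have h3 : Nat.gcd (1 : ZMod a).val a = 1 := by
          rw [ZMod.val_one_eq_one_mod, ← Nat.gcd_rec]; simp
        rwa [h3, mul_one, mul_one] at h0
      calc _ ≤ γ l := by simp only [γ]; exact_mod_cast h1
        _ ≤ γ l * G := le_mul_of_one_le_right (hγ l) hG1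
    have h2 : ‖kloo a (-(h * ν)) (-l)‖ ≤ K * γ l := by
      rw [kloo_symm]
      calc _ ≤ _ := hC a _ _
        _ ≤ C * (a : ℝ) ^ (7 / 8 : ℝ) * (γ l * G) := by gcongr
        _ = _ := by rw [hK]; ring
    simp only [hF, norm_mul]
    exact mul_le_mul (mul_le_mul h2 (norm_intervalSum_le _ _ hI h) (norm_nonneg _)
      (mul_nonneg hKpos.le (hγ l))) (norm_intervalSum_le _ _ hJ l) (norm_nonneg _)
      (mul_nonneg (mul_nonneg hKpos.le (hγ l)) (hW h))
  set V : ℝ := 2 * (a.divisors.card : ℝ) * (1 + Real.log a) with hV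
  have hlog : 0 ≤ Real.log a := Real.log_natCast_nonneg a
  have hd1 : (1 : ℝ) ≤ a.divisors.card := by
    exact_mod_cast Finset.card_pos.2 ⟨1, Nat.one_mem_divisors.2 hapos.ne'⟩
  have hV2 : 2 ≤ V := by rw [hV]; nlinarith
  have hS1 : ∑ h ∈ univ.erase (0 : ZMod a), γ h * W h ≤ a * V := by
    have := sum_fourierWeight_le (a := a)
    simp_rw [mul_comm] at this ⊢
    linarith
  have hS2 : ∑ h ∈ univ.erase (0 : ZMod a), W h ≤ a * V := by
    refine le_trans (sum_le_sum fun h _ => ?_) hS1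
    exact le_mul_of_one_le_left (hW h) (hg1 h)
  have hW0 : W 0 = 2 * a := by simp [W, fourierWeight]
  have hS3 : ∑ h, W h ≤ 2 * a * V := by
    rw [← add_sum_erase _ _ (mem_univ (0 : ZMod a)), hW0]
    nlinarith
  have hsplit : ∑ h, ∑ l, F h l - F 0 0 =
      ∑ h ∈ univ.erase (0 : ZMod a), ∑ l, F h l + ∑ l ∈ univ.erase (0 : ZMod a), F 0 l := by
    rw [← add_sum_erase _ _ (mem_univ (0 : ZMod a)), ← add_sum_erase _ (F 0) (mem_univ (0 : ZMod a))]
    ring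
  have hnorm : ‖∑ h, ∑ l, F h l - F 0 0‖ ≤ K * (4 * a ^ 2 * V ^ 2) := by
    rw [hsplit]
    calc _ ≤ ∑ h ∈ univ.erase (0 : ZMod a), ∑ l, K * γ h * W h * W l +
          ∑ l ∈ univ.erase (0 : ZMod a), K * γ l * W 0 * W l := by
          refine (norm_add_le _ _).trans (add_le_add ?_ ?_)
          · exact (norm_sum_le _ _).trans (sum_le_sum fun h _ => (norm_sum_le _ _).trans
              (sum_le_sum fun l _ => hb1 h l))
          · exact (norm_sum_le _ _).trans (sum_le_sum fun l _ => hb2 0 l)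
      _ = K * ((∑ h ∈ univ.erase (0 : ZMod a), γ h * W h) * (∑ l, W l)) +
          K * (W 0 * ∑ l ∈ univ.erase (0 : ZMod a), γ l * W l) := by
          rw [sum_mul_sum, mul_sum, mul_sum, mul_sum]
          congr 1
          · refine sum_congr rfl fun h _ => ?_
            rw [mul_sum]
            exact sum_congr rfl fun l _ => by ring
          · exact sum_congr rfl fun l _ => by ring
      _ ≤ K * ((a * V) * (2 * a * V)) + K * ((2 * a) * (a * V)) := by
          have : 0 ≤ ∑ l, W l := sum_nonneg fun l _ => hW l
          rw [hW0]
          gcongr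
      _ ≤ _ := by
          have : (a : ℝ) ^ 2 * V ≤ a ^ 2 * V ^ 2 := by gcongr; nlinarith
          nlinarith [mul_le_mul_of_nonneg_left this hKpos.le]
  have hcard := card_hypPoints_eq a ν x₁ x₂ y₁ y₂
  set N := ((hypPoints a ν x₁ x₂ y₁ y₂).card)
  set cI := (Ioc x₁ x₂).card
  set cJ := (Ioc y₁ y₂).card
  have hmain : (a : ℝ) ^ 2 * |(N : ℝ) - (a.totient : ℝ) / (a : ℝ) ^ 2 * cI * cJ| ≤
      K * (4 * a ^ 2 * V ^ 2) := by
    have e : (((a : ℝ) ^ 2 * ((N : ℝ) - (a.totient : ℝ) / (a : ℝ) ^ 2 * cI * cJ) : ℝ) : ℂ) =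
        ∑ h, ∑ l, F h l - F 0 0 := by
      rw [← hcard, h00]
      push_cast
      have : (a : ℂ) ≠ 0 := by exact_mod_cast hapos.ne'
      field_simp
    rw [← e, Complex.norm_real, norm_mul, norm_pow, Real.norm_natCast, Real.norm_eq_abs] at hnorm
    exact hnorm
  have hmain' : |(N : ℝ) - (a.totient : ℝ) / (a : ℝ) ^ 2 * cI * cJ| ≤ K * (4 * V ^ 2) := by
    refine le_of_mul_le_mul_left (hmain.trans (le_of_eq ?_)) (show (0 : ℝ) < a ^ 2 by positivity)
    ring
  refine hmain'.trans ?_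
  have hVle : V ≤ 2 * C' * 65 * (a : ℝ) ^ (1 / 32 : ℝ) := by
    have h1 : 1 + Real.log a ≤ 65 * (a : ℝ) ^ (1 / 64 : ℝ) := by
      have := Real.log_le_rpow_div haR.le (show (0 : ℝ) < 1 / 64 by norm_num)
      have h1' : (1 : ℝ) ≤ (a : ℝ) ^ (1 / 64 : ℝ) := Real.one_le_rpow ha1 (by norm_num)
      linarith
    have h2 : (a : ℝ) ^ (1 / 32 : ℝ) = (a : ℝ) ^ (1 / 64 : ℝ) * (a : ℝ) ^ (1 / 64 : ℝ) := by
      rw [← Real.rpow_add haR]; norm_num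
    rw [hV, h2]
    calc _ ≤ 2 * (C' * (a : ℝ) ^ (1 / 64 : ℝ)) * (65 * (a : ℝ) ^ (1 / 64 : ℝ)) := by
          gcongr; exact hC' a
      _ = _ := by ring
  have hpow : (a : ℝ) ^ (15 / 16 : ℝ) = (a : ℝ) ^ (7 / 8 : ℝ) * ((a : ℝ) ^ (1 / 32 : ℝ)) ^ 2 := by
    rw [← Real.rpow_natCast, ← Real.rpow_mul haR.le, ← Real.rpow_add haR]; norm_num
  calc K * (4 * V ^ 2) ≤ K * (4 * (2 * C' * 65 * (a : ℝ) ^ (1 / 32 : ℝ)) ^ 2) := by gcongr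
    _ = C * (4 * C' * 65) ^ 2 * ((a : ℝ) ^ (7 / 8 : ℝ) * ((a : ℝ) ^ (1 / 32 : ℝ)) ^ 2) * G := by
        rw [hK]; ring
    _ ≤ _ := by
        rw [← hpow]
        gcongr
        linarith

lemma sum_Ioc_inv_bounds {m M : ℕ} (hm : 0 < m) (hM : m ≤ M) :
    Real.log (M / m) - (1 / m - 1 / M) ≤ ∑ k ∈ Ioc m M, (1 : ℝ) / k ∧
      ∑ k ∈ Ioc m M, (1 : ℝ) / k ≤ Real.log (M / m) := by
  have hmR : (0 : ℝ) < m := by exact_mod_cast hm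
  induction M, hM using Nat.le_induction with
  | base => simp [hmR.ne']
  | succ N hN ih =>
    have hNR : (0 : ℝ) < N := by exact_mod_cast (hm.trans_le hN)
    rw [← insert_Ioc_right_eq_Ioc_add_one (by omega), sum_insert (by simp)]
    have h1 : Real.log (((N + 1 : ℕ) : ℝ) / m) = Real.log (N / m) + Real.log ((N + 1) / N) := by
      rw [← Real.log_mul (by positivity) (by positivity)]; congr 1; push_cast; field_simp
    have h2 : Real.log (((N : ℝ) + 1) / N) ≤ 1 / N := by
      have := Real.log_le_sub_one_of_pos (show 0 < ((N : ℝ) + 1) / N by positivity)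
      rw [show ((N : ℝ) + 1) / N - 1 = 1 / N by field_simp; ring] at this
      exact this
    have h3 : 1 / ((N : ℝ) + 1) ≤ Real.log (((N : ℝ) + 1) / N) := by
      have := Real.one_sub_inv_le_log_of_pos (show 0 < ((N : ℝ) + 1) / N by positivity)
      rw [show 1 - (((N : ℝ) + 1) / N)⁻¹ = 1 / (N + 1) by field_simp; ring] at this
      exact this
    rw [h1]
    push_cast
    constructor <;> linarith [ih.1, ih.2]

lemma sum_Ioc_inv_approx {x y : ℝ} (hx : 0 < x) (hxy : x ≤ y) :
    |∑ k ∈ Ioc ⌊x⌋₊ ⌊y⌋₊, (1 : ℝ) / k - Real.log (y / x)| ≤ 4 / x := by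
  have hy : 0 < y := hx.trans_le hxy
  rcases Nat.eq_zero_or_pos ⌊x⌋₊ with h0 | h0
  · have hx1 : x < 1 := Nat.floor_eq_zero.1 h0
    have hlx : -Real.log x ≤ 1 / x := by
      have := Real.log_le_sub_one_of_pos (show 0 < 1 / x by positivity)
      rw [Real.log_div one_ne_zero hx.ne', Real.log_one] at this
      linarith
    have hlx0 : Real.log x ≤ 0 := Real.log_nonpos hx.le hx1.le
    have h1x : 1 ≤ 1 / x := by rw [le_div_iff₀ hx]; linarith
    rw [Real.log_div hy.ne' hx.ne', h0]
    have e4 : 4 / x = 4 * (1 / x) := by ring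
    rcases Nat.eq_zero_or_pos ⌊y⌋₊ with h1 | h1
    · have hy1 : y < 1 := Nat.floor_eq_zero.1 h1
      rw [h1]
      have : Real.log y ≤ 0 := Real.log_nonpos hy.le hy1.le
      have h2 : Real.log x ≤ Real.log y := Real.log_le_log hx hxy
      simp only [Ioc_self, sum_empty]
      rw [abs_le]; constructor <;> linarith
    · have hM : (⌊y⌋₊ : ℝ) ≤ y := Nat.floor_le hy.le
      have hM2 : y < ⌊y⌋₊ + 1 := Nat.lt_floor_add_one y
      have hM1 : (1 : ℝ) ≤ ⌊y⌋₊ := by exact_mod_cast h1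
      obtain ⟨b1, b2⟩ := sum_Ioc_inv_bounds (m := 1) (M := ⌊y⌋₊) one_pos h1
      have : Ioc 0 ⌊y⌋₊ = insert 1 (Ioc 1 ⌊y⌋₊) := by ext t; simp; omega
      rw [this, sum_insert (by simp)]
      have h2 : Real.log ⌊y⌋₊ ≤ Real.log y := Real.log_le_log (by linarith) hM
      have h3 : Real.log y ≤ Real.log ⌊y⌋₊ + 1 := by
        have := Real.log_le_sub_one_of_pos (show 0 < y / ⌊y⌋₊ by positivity)
        rw [Real.log_div hy.ne' (by positivity)] at this
        have : y / ⌊y⌋₊ ≤ 2 := by rw [div_le_iff₀ (by linarith)]; linarith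
        linarith
      have h4 : 0 ≤ 1 / (⌊y⌋₊ : ℝ) := by positivity
      simp only [Nat.cast_one, div_one] at b1 b2 ⊢
      rw [abs_le]; constructor <;> linarith
  · set m := ⌊x⌋₊
    set M := ⌊y⌋₊
    have hmM : m ≤ M := Nat.floor_le_floor hxy
    obtain ⟨b1, b2⟩ := sum_Ioc_inv_bounds h0 hmM
    have hm1 : (1 : ℝ) ≤ m := by exact_mod_cast h0
    have hM1 : (1 : ℝ) ≤ M := hm1.trans (by exact_mod_cast hmM)
    have hmx : (m : ℝ) ≤ x := Nat.floor_le hx.le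
    have hmx2 : x < m + 1 := Nat.lt_floor_add_one x
    have hMy : (M : ℝ) ≤ y := Nat.floor_le hy.le
    have hMy2 : y < M + 1 := Nat.lt_floor_add_one y
    have h1m : 1 / (m : ℝ) ≤ 2 / x := by
      rw [div_le_div_iff₀ (by linarith) hx]; linarith
    have h1M : 1 / (M : ℝ) ≤ 1 / m := by
      apply one_div_le_one_div_of_le (by linarith); exact_mod_cast hmM
    have hl : Real.log (y / x) = Real.log (M / m) + Real.log (y / M) - Real.log (x / m) := by
      rw [Real.log_div hy.ne' hx.ne', Real.log_div (by positivity) (by positivity),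
        Real.log_div hy.ne' (by positivity), Real.log_div hx.ne' (by positivity)]; ring
    have g1 : 0 ≤ Real.log (y / M) := Real.log_nonneg (by rw [le_div_iff₀ (by linarith)]; linarith)
    have g2 : 0 ≤ Real.log (x / m) := Real.log_nonneg (by rw [le_div_iff₀ (by linarith)]; linarith)
    have key : ∀ (t k : ℝ), 0 < t → 1 ≤ k → t < k + 1 → Real.log (t / k) ≤ 1 / k := by
      intro t k ht hk htk
      have := Real.log_le_sub_one_of_pos (show 0 < t / k by positivity)
      have h2 : t / k - 1 ≤ 1 / k := by
        rw [div_sub_one (by positivity)]; gcongr; linarith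
      linarith
    have g3 := key y M hy hM1 hMy2
    have g4 := key x m hx hm1 hmx2
    have g5 : 0 ≤ 1 / (M : ℝ) := by positivity
    have e4 : 4 / x = 2 * (2 / x) := by ring
    rw [hl, abs_le]
    constructor <;> linarith

lemma sum_multiples_inv_eq (A₁ A₂ : ℝ) {L : ℕ} (hL : 0 < L) :
    ∑ a ∈ (Ioc ⌊A₁⌋₊ ⌊A₂⌋₊).filter (L ∣ ·), (1 : ℝ) / a =
      1 / L * ∑ k ∈ Ioc ⌊A₁ / L⌋₊ ⌊A₂ / L⌋₊, (1 : ℝ) / k := by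
  rw [Nat.floor_div_natCast, Nat.floor_div_natCast, mul_sum]
  symm
  apply sum_bij (fun k _ => L * k)
  · intro k hk
    simp only [mem_Ioc, mem_filter] at hk ⊢
    refine ⟨⟨?_, ?_⟩, dvd_mul_right _ _⟩
    · rw [mul_comm]; exact (Nat.div_lt_iff_lt_mul hL).1 hk.1
    · rw [mul_comm]; exact (Nat.le_div_iff_mul_le hL).1 hk.2
  · intro k _ k' _ h; exact Nat.eq_of_mul_eq_mul_left hL h
  · intro a ha
    simp only [mem_Ioc, mem_filter] at ha
    obtain ⟨⟨h1, h2⟩, k, rfl⟩ := ha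
    refine ⟨k, mem_Ioc.2 ⟨?_, ?_⟩, rfl⟩
    · rw [Nat.div_lt_iff_lt_mul hL, mul_comm]; exact h1
    · rw [Nat.le_div_iff_mul_le hL, mul_comm]; exact h2
  · intro k _; push_cast; field_simp

lemma sum_multiples_inv_approx {A₁ A₂ : ℝ} (h1 : 0 < A₁) (h12 : A₁ ≤ A₂) {L : ℕ} (hL : 0 < L) :
    |∑ a ∈ (Ioc ⌊A₁⌋₊ ⌊A₂⌋₊).filter (L ∣ ·), (1 : ℝ) / a - Real.log (A₂ / A₁) / L| ≤
      4 * (Real.sqrt A₂ / A₁) / Real.sqrt L := by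
  have hLR : (0 : ℝ) < L := by exact_mod_cast hL
  have h2 : 0 < A₂ := h1.trans_le h12
  have hratio : 1 ≤ A₂ / A₁ := by rwa [one_le_div h1]
  set D := ∑ a ∈ (Ioc ⌊A₁⌋₊ ⌊A₂⌋₊).filter (L ∣ ·), (1 : ℝ) / a - Real.log (A₂ / A₁) / L with hD
  have b1 : |D| ≤ 4 / A₁ := by
    rw [hD, sum_multiples_inv_eq _ _ hL]
    have := sum_Ioc_inv_approx (x := A₁ / L) (y := A₂ / L) (by positivity) (by gcongr)
    rw [div_div_div_cancel_right₀ hLR.ne'] at this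
    rw [show ∀ s t : ℝ, 1 / (L : ℝ) * s - t / L = (s - t) / L from fun s t => by ring, abs_div,
      abs_of_pos hLR, div_le_iff₀ hLR]
    calc _ ≤ _ := this
      _ = _ := by field_simp
  have b2 : |D| ≤ 4 * (A₂ / A₁) / L := by
    have hl0 : 0 ≤ Real.log (A₂ / A₁) := Real.log_nonneg hratio
    have hl1 : Real.log (A₂ / A₁) ≤ A₂ / A₁ := by
      have := Real.log_le_sub_one_of_pos (show 0 < A₂ / A₁ by positivity); linarith
    have s0 : 0 ≤ ∑ a ∈ (Ioc ⌊A₁⌋₊ ⌊A₂⌋₊).filter (L ∣ ·), (1 : ℝ) / a :=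
      sum_nonneg fun _ _ => by positivity
    have s1 : ∑ a ∈ (Ioc ⌊A₁⌋₊ ⌊A₂⌋₊).filter (L ∣ ·), (1 : ℝ) / a ≤ (A₂ / A₁) / L := by
      calc _ ≤ ∑ a ∈ (Ioc ⌊A₁⌋₊ ⌊A₂⌋₊).filter (L ∣ ·), (1 : ℝ) / A₁ := by
            apply sum_le_sum
            intro a ha
            simp only [mem_filter, mem_Ioc] at ha
            have : A₁ < a := (Nat.floor_lt h1.le).1 ha.1.1
            gcongr
        _ = (((Ioc ⌊A₁⌋₊ ⌊A₂⌋₊).filter (L ∣ ·)).card : ℝ) * (1 / A₁) := by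
            rw [sum_const, nsmul_eq_mul]
        _ ≤ (A₂ / L) * (1 / A₁) := by
            gcongr
            have : ((Ioc ⌊A₁⌋₊ ⌊A₂⌋₊).filter (L ∣ ·)).card ≤ ⌊A₂⌋₊ / L := by
              rw [← Nat.Ioc_filter_dvd_card_eq_div]
              exact card_le_card (filter_subset_filter _ (Ioc_subset_Ioc_left (Nat.zero_le _)))
            calc _ ≤ ((⌊A₂⌋₊ / L : ℕ) : ℝ) := by exact_mod_cast this
              _ ≤ (⌊A₂⌋₊ : ℝ) / L := Nat.cast_div_le
              _ ≤ _ := by gcongr; exact Nat.floor_le h2.le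
        _ = _ := by field_simp
    have : Real.log (A₂ / A₁) / L ≤ (A₂ / A₁) / L := by gcongr
    have h3 : 0 ≤ Real.log (A₂ / A₁) / L := by positivity
    rw [hD, abs_le, show 4 * (A₂ / A₁) / L = 4 * ((A₂ / A₁) / L) by ring]
    constructor <;> linarith
  have h3 : |D| ^ 2 ≤ (4 * (Real.sqrt A₂ / A₁) / Real.sqrt L) ^ 2 := by
    calc |D| ^ 2 = |D| * |D| := sq _
      _ ≤ (4 / A₁) * (4 * (A₂ / A₁) / L) := by gcongr
      _ = _ := by
        rw [div_pow, mul_pow, div_pow, Real.sq_sqrt h2.le, Real.sq_sqrt hLR.le]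
        field_simp
  exact le_of_pow_le_pow_left₀ two_ne_zero (by positivity) h3

/-- The logarithmic density of `φ(a) / a` over `a` coprime to `q`. -/
noncomputable def totientDensity (q : ℕ) : ℝ :=
  ∑ e ∈ q.divisors, (ArithmeticFunction.moebius e : ℝ) *
    ∑' f : ℕ, (ArithmeticFunction.moebius f : ℝ) / f * (1 / (Nat.lcm e f : ℝ))

lemma abs_moebius_cast_le_one (f : ℕ) : |(ArithmeticFunction.moebius f : ℝ)| ≤ 1 := by
  have := ArithmeticFunction.abs_moebius_le_one (n := f)
  exact_mod_cast this

lemma sum_moebius_divisors_coprime {q a : ℕ} (hq : 0 < q) :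
    ∑ e ∈ q.divisors, (if e ∣ a then (ArithmeticFunction.moebius e : ℝ) else 0) =
      if Nat.Coprime a q then 1 else 0 := by
  have h1 : (q.divisors.filter (· ∣ a)) = (Nat.gcd a q).divisors := by
    ext e
    simp only [mem_filter, Nat.mem_divisors, Nat.dvd_gcd_iff, ne_eq]
    constructor
    · rintro ⟨⟨h1, h2⟩, h3⟩
      exact ⟨⟨h3, h1⟩, fun h => hq.ne' (Nat.gcd_eq_zero_iff.1 h).2⟩
    · rintro ⟨⟨h1, h2⟩, _⟩; exact ⟨⟨h2, hq.ne'⟩, h1⟩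
  rw [← sum_filter, h1]
  have := ArithmeticFunction.moebius_mul_coe_zeta
  have h2 := congrArg (fun g => g (Nat.gcd a q)) this
  simp only [ArithmeticFunction.coe_mul_zeta_apply, ArithmeticFunction.one_apply] at h2
  rw [show (if Nat.Coprime a q then (1 : ℝ) else 0) =
    ((if Nat.gcd a q = 1 then 1 else 0 : ℤ) : ℝ) by simp [Nat.Coprime], ← h2]
  push_cast
  rfl

lemma totient_div_eq_sum {a : ℕ} (ha : 0 < a) :
    (a.totient : ℝ) / a = ∑ f ∈ a.divisors, (ArithmeticFunction.moebius f : ℝ) / f := by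
  have h := (ArithmeticFunction.sum_eq_iff_sum_mul_moebius_eq (R := ℝ)
    (f := fun n => (n.totient : ℝ)) (g := fun n => (n : ℝ))).1
    (fun n _ => by exact_mod_cast Nat.sum_totient n) a ha
  rw [← h, sum_div, Nat.sum_divisorsAntidiagonal (f := fun x y => (ArithmeticFunction.moebius x : ℝ) * (y : ℝ) / a)]
  refine sum_congr rfl fun f hf => ?_
  have hf0 : (f : ℝ) ≠ 0 := by exact_mod_cast (Nat.pos_of_mem_divisors hf).ne'
  have ha0 : (a : ℝ) ≠ 0 := by exact_mod_cast ha.ne'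
  rw [Nat.cast_div (Nat.dvd_of_mem_divisors hf) hf0]
  field_simp

lemma inv_sqrt_mul_inv_eq (f : ℕ) : 1 / ((f : ℝ) * Real.sqrt f) = 1 / (f : ℝ) ^ (3 / 2 : ℝ) := by
  rcases Nat.eq_zero_or_pos f with rfl | hf
  · simp
  · have : (0 : ℝ) < f := by exact_mod_cast hf
    rw [Real.sqrt_eq_rpow]
    nth_rewrite 1 [← Real.rpow_one (f : ℝ)]
    rw [← Real.rpow_add this]; norm_num

lemma summable_inv_mul_sqrt : Summable fun f : ℕ => 1 / ((f : ℝ) * Real.sqrt f) := by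
  simp_rw [inv_sqrt_mul_inv_eq]
  exact Real.summable_one_div_nat_rpow.2 (by norm_num)

lemma totientDensity_approx : ∃ C : ℝ, 1 ≤ C ∧ ∀ (q : ℕ), 0 < q → ∀ A₁ A₂ : ℝ, 0 < A₁ → A₁ ≤ A₂ →
    |∑ a ∈ (Ioc ⌊A₁⌋₊ ⌊A₂⌋₊).filter (Nat.Coprime · q), (a.totient : ℝ) / (a : ℝ) ^ 2 -
      totientDensity q * Real.log (A₂ / A₁)| ≤ C * q * (Real.sqrt A₂ / A₁) := by
  set C0 := ∑' f : ℕ, 1 / ((f : ℝ) * Real.sqrt f) with hC0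
  have hC0n : 0 ≤ C0 := tsum_nonneg fun f => by positivity
  refine ⟨4 * C0 + 1, by linarith, ?_⟩
  intro q hq A₁ A₂ h1 h12
  have h2 : 0 < A₂ := h1.trans_le h12
  set S := Ioc ⌊A₁⌋₊ ⌊A₂⌋₊ with hS
  set μ := fun e : ℕ => (ArithmeticFunction.moebius e : ℝ) with hμ
  have hμ1 : ∀ e, |μ e| ≤ 1 := abs_moebius_cast_le_one
  have hlcm : ∀ e ∈ q.divisors, ∀ f : ℕ, (f : ℝ) ≤ Nat.lcm e f := by
    intro e he f
    rcases Nat.eq_zero_or_pos f with rfl | hf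
    · simp
    · exact_mod_cast Nat.le_of_dvd (Nat.lcm_pos (Nat.pos_of_mem_divisors he) hf) (Nat.dvd_lcm_right e f)
  set inner := fun e f : ℕ => ∑ a ∈ S.filter (Nat.lcm e f ∣ ·), (1 : ℝ) / a with hinner
  have hsum1 : ∀ e ∈ q.divisors, Summable fun f : ℕ => μ f / f * (1 / (Nat.lcm e f : ℝ)) := by
    intro e he
    refine Summable.of_norm_bounded summable_inv_mul_sqrt fun f => ?_
    rcases Nat.eq_zero_or_pos f with rfl | hf
    · simp
    have hfR : (1 : ℝ) ≤ f := by exact_mod_cast hf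
    have hs : Real.sqrt f ≤ f := Real.sqrt_le_iff.2 ⟨by linarith, by nlinarith⟩
    have hs0 : 0 < Real.sqrt f := Real.sqrt_pos.2 (by linarith)
    rw [Real.norm_eq_abs, abs_mul, abs_div, abs_of_pos (by linarith : (0 : ℝ) < f),
      abs_of_nonneg (by positivity : (0 : ℝ) ≤ 1 / (Nat.lcm e f : ℝ))]
    calc |μ f| / f * (1 / (Nat.lcm e f : ℝ)) ≤ 1 / f * (1 / Real.sqrt f) := by
          gcongr
          · exact hμ1 f
          · exact hs.trans (hlcm e he f)
      _ = _ := by field_simp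
  have hsupp : ∀ e f : ℕ, f ∉ range (⌊A₂⌋₊ + 1) → inner e f = 0 := by
    intro e f hf
    apply sum_eq_zero
    intro a ha
    exfalso
    simp only [hS, mem_filter, mem_Ioc, mem_range] at ha hf
    have := Nat.le_of_dvd (by omega) ((Nat.dvd_lcm_right e f).trans ha.2)
    omega
  have hexp : ∑ a ∈ S.filter (Nat.Coprime · q), (a.totient : ℝ) / (a : ℝ) ^ 2 =
      ∑ e ∈ q.divisors, μ e * ∑ f ∈ range (⌊A₂⌋₊ + 1), μ f / f * inner e f := by
    calc _ = ∑ a ∈ S, (∑ e ∈ q.divisors, (if e ∣ a then μ e else 0)) *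
          ((∑ f ∈ range (⌊A₂⌋₊ + 1), if f ∣ a then μ f / f else 0) * (1 / a)) := by
          rw [sum_filter]
          refine sum_congr rfl fun a ha => ?_
          simp only [hS, mem_Ioc] at ha
          have hapos : 0 < a := by omega
          rw [sum_moebius_divisors_coprime hq, ← sum_filter]
          have : (range (⌊A₂⌋₊ + 1)).filter (· ∣ a) = a.divisors := by
            ext f
            simp only [mem_filter, mem_range, Nat.mem_divisors]
            constructor
            · rintro ⟨_, h⟩; exact ⟨h, hapos.ne'⟩
            · rintro ⟨h, _⟩; exact ⟨by have := Nat.le_of_dvd hapos h; omega, h⟩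
          rw [this, ← totient_div_eq_sum hapos]
          split_ifs
          · field_simp
          · ring
      _ = ∑ a ∈ S, ∑ e ∈ q.divisors, ∑ f ∈ range (⌊A₂⌋₊ + 1),
            μ e * (μ f / f * (if Nat.lcm e f ∣ a then (1 : ℝ) / a else 0)) := by
          refine sum_congr rfl fun a _ => ?_
          rw [sum_mul]
          refine sum_congr rfl fun e _ => ?_
          rw [sum_mul, mul_sum]
          refine sum_congr rfl fun f _ => ?_
          by_cases h1 : e ∣ a <;> by_cases h2 : f ∣ a <;> simp [Nat.lcm_dvd_iff, h1, h2]
      _ = _ := by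
          rw [sum_comm]
          refine sum_congr rfl fun e _ => ?_
          rw [sum_comm, mul_sum]
          refine sum_congr rfl fun f _ => ?_
          rw [← mul_sum, ← mul_sum, ← sum_filter]
  have hterm : ∀ e ∈ q.divisors,
      |∑ f ∈ range (⌊A₂⌋₊ + 1), μ f / f * inner e f -
        (∑' f : ℕ, μ f / f * (1 / (Nat.lcm e f : ℝ))) * Real.log (A₂ / A₁)| ≤
      4 * C0 * (Real.sqrt A₂ / A₁) := by
    intro e he
    have e1 : ∑ f ∈ range (⌊A₂⌋₊ + 1), μ f / f * inner e f = ∑' f : ℕ, μ f / f * inner e f := by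
      rw [tsum_eq_sum]
      intro f hf; rw [hsupp e f hf, mul_zero]
    have hs2 : Summable fun f : ℕ => μ f / f * inner e f :=
      summable_of_ne_finset_zero (s := range (⌊A₂⌋₊ + 1)) fun f hf => by rw [hsupp e f hf, mul_zero]
    rw [e1, ← tsum_mul_right, ← hs2.tsum_sub ((hsum1 e he).mul_right _), ← Real.norm_eq_abs]
    have hb : ∀ f : ℕ, ‖μ f / f * inner e f - μ f / f * (1 / (Nat.lcm e f : ℝ)) * Real.log (A₂ / A₁)‖ ≤
        4 * (Real.sqrt A₂ / A₁) * (1 / ((f : ℝ) * Real.sqrt f)) := by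
      intro f
      rcases Nat.eq_zero_or_pos f with rfl | hf
      · simp
      have hfR : (0 : ℝ) < f := by exact_mod_cast hf
      have hs0 : 0 < Real.sqrt f := Real.sqrt_pos.2 hfR
      have hL : 0 < Nat.lcm e f := Nat.lcm_pos (Nat.pos_of_mem_divisors he) hf
      have := sum_multiples_inv_approx h1 h12 hL
      rw [show μ f / f * inner e f - μ f / f * (1 / (Nat.lcm e f : ℝ)) * Real.log (A₂ / A₁) =
        μ f / f * (inner e f - Real.log (A₂ / A₁) / (Nat.lcm e f : ℝ)) by ring,
        Real.norm_eq_abs, abs_mul, abs_div, abs_of_pos hfR]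
      calc _ ≤ 1 / f * (4 * (Real.sqrt A₂ / A₁) / Real.sqrt (Nat.lcm e f)) := by
            gcongr
            exact hμ1 f
        _ ≤ 1 / f * (4 * (Real.sqrt A₂ / A₁) / Real.sqrt f) := by
            gcongr
            exact_mod_cast hlcm e he f
        _ = _ := by field_simp
    refine (tsum_of_norm_bounded (summable_inv_mul_sqrt.hasSum.mul_left _) hb).trans (le_of_eq ?_)
    rw [← hC0]; ring
  rw [hexp, totientDensity, sum_mul, ← sum_sub_distrib]
  calc _ ≤ ∑ e ∈ q.divisors, 4 * C0 * (Real.sqrt A₂ / A₁) := by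
        refine (abs_sum_le_sum_abs _ _).trans (sum_le_sum fun e he => ?_)
        rw [mul_assoc, ← mul_sub, abs_mul]
        calc _ ≤ 1 * (4 * C0 * (Real.sqrt A₂ / A₁)) :=
              mul_le_mul (hμ1 e) (hterm e he) (abs_nonneg _) zero_le_one
          _ = _ := one_mul _
    _ = (q.divisors.card : ℝ) * (4 * C0 * (Real.sqrt A₂ / A₁)) := by rw [sum_const, nsmul_eq_mul]
    _ ≤ q * ((4 * C0 + 1) * (Real.sqrt A₂ / A₁)) := by
        gcongr
        · exact_mod_cast Nat.card_divisors_le_self q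
        · linarith
    _ = _ := by ring

lemma totientDensity_le : ∃ C : ℝ, 1 ≤ C ∧ ∀ q : ℕ, 0 < q → |totientDensity q| ≤ C * q := by
  obtain ⟨C, hC1, hC⟩ := totientDensity_approx
  refine ⟨(2 + C * 2) / Real.log 2 + 1, ?_, fun q hq => ?_⟩
  · have := Real.log_pos (show (1 : ℝ) < 2 by norm_num)
    have : 0 ≤ (2 + C * 2) / Real.log 2 := by positivity
    linarith
  have hl := Real.log_pos (show (1 : ℝ) < 2 by norm_num)
  have hqR : (1 : ℝ) ≤ q := by exact_mod_cast hq
  have h := hC q hq 1 2 one_pos (by norm_num)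
  have hs : Real.sqrt 2 ≤ 2 := Real.sqrt_le_iff.2 ⟨by norm_num, by norm_num⟩
  have hsum : |∑ a ∈ (Ioc ⌊(1 : ℝ)⌋₊ ⌊(2 : ℝ)⌋₊).filter (Nat.Coprime · q),
      (a.totient : ℝ) / (a : ℝ) ^ 2| ≤ 1 := by
    have : Ioc ⌊(1 : ℝ)⌋₊ ⌊(2 : ℝ)⌋₊ = {2} := by norm_num
    rw [this, sum_filter, sum_singleton]
    split_ifs <;> norm_num
  have h3 : |totientDensity q| * Real.log 2 ≤ 1 + C * q * 2 := by
    rw [show |totientDensity q| * Real.log 2 = |totientDensity q * Real.log (2 / 1)| by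
      rw [abs_mul, div_one, abs_of_pos hl]]
    have h4 : C * q * (Real.sqrt 2 / 1) ≤ C * q * 2 := by rw [div_one]; gcongr
    have := abs_le.1 (h.trans h4)
    have := abs_le.1 hsum
    rw [abs_le]; constructor <;> linarith
  have : |totientDensity q| ≤ (1 + C * q * 2) / Real.log 2 := by rwa [le_div_iff₀ hl]
  refine this.trans ?_
  rw [add_mul, div_mul_eq_mul_div, one_mul]
  have : (1 + C * q * 2) / Real.log 2 ≤ (2 + C * 2) * q / Real.log 2 := by
    gcongr; nlinarith
  linarith

/-- Triples `(a, b, c)` in a box of side comparable to `√n`, describing the integer matrices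
`[[a, b], [q c, *]]` of determinant `n` with coprime first column. -/
def latticeBox (n q : ℕ) (α₁ α₂ β₁ β₂ γ₁ γ₂ : ℝ) : Set (ℤ × ℤ × ℤ) :=
  {p | (α₁ * Real.sqrt n < p.1 ∧ (p.1 : ℝ) ≤ α₂ * Real.sqrt n) ∧
    (β₁ * Real.sqrt n < p.2.1 ∧ (p.2.1 : ℝ) ≤ β₂ * Real.sqrt n) ∧
    (γ₁ * Real.sqrt n < q * p.2.2 ∧ (q * p.2.2 : ℝ) ≤ γ₂ * Real.sqrt n) ∧
    IsCoprime p.1 (q * p.2.2) ∧ p.1 ∣ n + p.2.1 * (q * p.2.2)}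

lemma isUnit_intCast_zmod {a : ℕ} {x : ℤ} : IsUnit (x : ZMod a) ↔ IsCoprime (a : ℤ) x := by
  rw [isUnit_iff_exists_inv]
  constructor
  · rintro ⟨y, hy⟩
    obtain ⟨z, rfl⟩ := ZMod.intCast_surjective y
    have : ((x * z - 1 : ℤ) : ZMod a) = 0 := by push_cast; rw [hy, sub_self]
    rw [CharP.intCast_eq_zero_iff (ZMod a) a] at this
    obtain ⟨w, hw⟩ := this
    exact ⟨-w, z, by linarith⟩
  · rintro ⟨u, v, h⟩
    refine ⟨(v : ZMod a), ?_⟩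
    have := congrArg (Int.cast : ℤ → ZMod a) h
    push_cast at this
    simpa [mul_comm] using this

lemma mem_hypPoints_iff {a : ℕ} {ν : ZMod a} {x₁ x₂ y₁ y₂ : ℤ} {p : ℤ × ℤ} :
    p ∈ hypPoints a ν x₁ x₂ y₁ y₂ ↔ (p.1 ∈ Ioc x₁ x₂ ∧ p.2 ∈ Ioc y₁ y₂) ∧
      IsUnit ((p.2 : ℤ) : ZMod a) ∧ ((p.1 : ℤ) : ZMod a) * ((p.2 : ℤ) : ZMod a) = ν := by
  simp [hypPoints]

lemma ncard_latticeBox (n q : ℕ) (hq : 0 < q) (α₁ α₂ β₁ β₂ γ₁ γ₂ : ℝ) (hα : 0 < α₁) :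
    (latticeBox n q α₁ α₂ β₁ β₂ γ₁ γ₂).ncard =
      ∑ a ∈ (Ioc ⌊α₁ * Real.sqrt n⌋₊ ⌊α₂ * Real.sqrt n⌋₊).filter (Nat.Coprime · q),
        (hypPoints a (-(n : ZMod a) * (q : ZMod a)⁻¹) ⌊β₁ * Real.sqrt n⌋ ⌊β₂ * Real.sqrt n⌋
          ⌊γ₁ * Real.sqrt n / q⌋ ⌊γ₂ * Real.sqrt n / q⌋).card := by
  have hX : 0 ≤ Real.sqrt n := Real.sqrt_nonneg _
  have hqR : (0 : ℝ) < q := by exact_mod_cast hq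
  rw [← card_sigma, ← Set.ncard_coe_finset, ← Set.ncard_image_of_injective
    (f := fun s : (Σ _ : ℕ, ℤ × ℤ) => ((s.1 : ℤ), s.2.1, s.2.2))]
  swap
  · rintro ⟨a, b, c⟩ ⟨a', b', c'⟩ h
    simp only [Prod.mk.injEq, Nat.cast_inj] at h
    obtain ⟨rfl, rfl, rfl⟩ := h; rfl
  congr 1
  have key : ∀ (a : ℕ) (b c : ℤ), ((a : ℤ), b, c) ∈ latticeBox n q α₁ α₂ β₁ β₂ γ₁ γ₂ ↔
      (a ∈ (Ioc ⌊α₁ * Real.sqrt n⌋₊ ⌊α₂ * Real.sqrt n⌋₊).filter (Nat.Coprime · q) ∧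
        (b, c) ∈ hypPoints a (-(n : ZMod a) * (q : ZMod a)⁻¹) ⌊β₁ * Real.sqrt n⌋
          ⌊β₂ * Real.sqrt n⌋ ⌊γ₁ * Real.sqrt n / q⌋ ⌊γ₂ * Real.sqrt n / q⌋) := by
    intro a b c
    have e1 : (α₁ * Real.sqrt n < ((a : ℤ) : ℝ) ∧ ((a : ℤ) : ℝ) ≤ α₂ * Real.sqrt n) ↔
        a ∈ Ioc ⌊α₁ * Real.sqrt n⌋₊ ⌊α₂ * Real.sqrt n⌋₊ := by
      rw [mem_Ioc, Nat.floor_lt (by positivity), Int.cast_natCast]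
      constructor
      · rintro ⟨h1, h2⟩
        exact ⟨h1, Nat.le_floor h2⟩
      · rintro ⟨h1, h2⟩
        refine ⟨h1, (Nat.le_floor_iff' ?_).1 h2⟩
        rintro rfl
        have : 0 ≤ α₁ * Real.sqrt n := by positivity
        simp at h1; linarith
    have e2 : (β₁ * Real.sqrt n < (b : ℝ) ∧ (b : ℝ) ≤ β₂ * Real.sqrt n) ↔
        b ∈ Ioc ⌊β₁ * Real.sqrt n⌋ ⌊β₂ * Real.sqrt n⌋ := by
      rw [mem_Ioc, Int.floor_lt, Int.le_floor]
    have e3 : (γ₁ * Real.sqrt n < q * (c : ℝ) ∧ q * (c : ℝ) ≤ γ₂ * Real.sqrt n) ↔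
        c ∈ Ioc ⌊γ₁ * Real.sqrt n / q⌋ ⌊γ₂ * Real.sqrt n / q⌋ := by
      rw [mem_Ioc, Int.floor_lt, Int.le_floor, div_lt_iff₀ hqR, le_div_iff₀ hqR, mul_comm (c : ℝ)]
    have e4 : (IsCoprime (a : ℤ) (q * c) ∧ (a : ℤ) ∣ n + b * (q * c)) ↔
        (Nat.Coprime a q ∧ IsUnit ((c : ℤ) : ZMod a) ∧
          (b : ZMod a) * (c : ZMod a) = -(n : ZMod a) * (q : ZMod a)⁻¹) := by
      rw [IsCoprime.mul_right_iff, isUnit_intCast_zmod, Nat.isCoprime_iff_coprime, and_assoc]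
      refine and_congr_right fun hc => and_congr_right fun _ => ?_
      have hu : (q : ZMod a) * (q : ZMod a)⁻¹ = 1 := ZMod.coe_mul_inv_eq_one q hc.symm
      rw [← CharP.intCast_eq_zero_iff (ZMod a) a]
      push_cast
      constructor
      · intro h
        linear_combination (q : ZMod a)⁻¹ * h - (b : ZMod a) * c * hu
      · intro h
        linear_combination (q : ZMod a) * h - (n : ZMod a) * hu
    simp only [latticeBox, Set.mem_ofPred_eq]
    rw [e1, e2, e3, e4, mem_filter, mem_hypPoints_iff]
    tauto
  ext ⟨a, b, c⟩
  simp only [Set.mem_image, Finset.mem_coe, mem_sigma, Sigma.exists, Prod.mk.injEq, Prod.exists]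
  constructor
  · intro h
    have ha : 0 ≤ a := by
      have := h.1.1
      have h0 : 0 ≤ α₁ * Real.sqrt n := by positivity
      have : (0 : ℝ) < a := h0.trans_lt this
      exact_mod_cast this.le
    lift a to ℕ using ha
    exact ⟨a, b, c, (key a b c).1 h, rfl, rfl, rfl⟩
  · rintro ⟨a, b, c, h, rfl, rfl, rfl⟩
    exact (key a b c).2 h

lemma sum_gcd_Icc_le (n T : ℕ) (hn : 0 < n) :
    ∑ a ∈ Ioc 0 T, Nat.gcd n a ≤ T * n.divisors.card := by
  have h1 : ∀ a ∈ Ioc 0 T, Nat.gcd n a ≤ ∑ g ∈ n.divisors, if g ∣ a then g else 0 := by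
    intro a _
    have hm : Nat.gcd n a ∈ n.divisors := Nat.mem_divisors.2 ⟨Nat.gcd_dvd_left _ _, hn.ne'⟩
    calc _ = if Nat.gcd n a ∣ a then Nat.gcd n a else 0 := by rw [if_pos (Nat.gcd_dvd_right _ _)]
      _ ≤ _ := single_le_sum (f := fun g => if g ∣ a then g else 0) (fun _ _ => Nat.zero_le _) hm
  calc _ ≤ ∑ a ∈ Ioc 0 T, ∑ g ∈ n.divisors, if g ∣ a then g else 0 := sum_le_sum h1
    _ = ∑ g ∈ n.divisors, ∑ a ∈ Ioc 0 T, if g ∣ a then g else 0 := sum_comm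
    _ ≤ ∑ g ∈ n.divisors, T := by
        refine sum_le_sum fun g _ => ?_
        rw [← sum_filter, sum_const, smul_eq_mul, Nat.Ioc_filter_dvd_card_eq_div]
        exact Nat.div_mul_le_self _ _
    _ = _ := by rw [sum_const, smul_eq_mul, mul_comm]

lemma card_Ioc_floor_approx {x y : ℝ} (h : x ≤ y) :
    |((Ioc ⌊x⌋ ⌊y⌋).card : ℝ) - (y - x)| ≤ 1 := by
  have h1 : ((Ioc ⌊x⌋ ⌊y⌋).card : ℝ) = (⌊y⌋ : ℝ) - ⌊x⌋ := by
    rw [Int.card_Ioc]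
    have : 0 ≤ ⌊y⌋ - ⌊x⌋ := sub_nonneg.2 (Int.floor_mono h)
    have h2 : ((⌊y⌋ - ⌊x⌋).toNat : ℤ) = ⌊y⌋ - ⌊x⌋ := Int.toNat_of_nonneg this
    exact_mod_cast h2
  rw [h1, abs_le]
  have := Int.floor_le x
  have := Int.floor_le y
  have := Int.lt_floor_add_one x
  have := Int.lt_floor_add_one y
  constructor <;> linarith

lemma gcd_val_neg_mul_inv {a n q : ℕ} [NeZero a] (h : Nat.Coprime a q) :
    Nat.gcd (-(n : ZMod a) * (q : ZMod a)⁻¹).val a = Nat.gcd n a := by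
  have hu : (q : ZMod a) * (q : ZMod a)⁻¹ = 1 := ZMod.coe_mul_inv_eq_one q h.symm
  set v := (-(n : ZMod a) * (q : ZMod a)⁻¹) with hv
  have hd : ∀ e : ℕ, e ∣ a → (e ∣ v.val ↔ e ∣ n) := by
    intro e he
    have h1 : ((v.val : ℕ) : ZMod a) * q = -(n : ZMod a) := by
      rw [ZMod.natCast_zmod_val, hv]; linear_combination -(n : ZMod a) * hu
    have h2 : ((v.val : ℕ) : ZMod e) * q = -(n : ZMod e) := by
      have := congrArg (ZMod.castHom he (ZMod e)) h1
      simpa only [map_mul, map_natCast, map_neg] using this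
    have hqe : IsUnit (q : ZMod e) := (ZMod.isUnit_iff_coprime q e).2 (h.symm.coprime_dvd_right he)
    rw [← ZMod.natCast_eq_zero_iff, ← ZMod.natCast_eq_zero_iff]
    constructor
    · intro h3; rw [h3, zero_mul] at h2
      exact neg_eq_zero.1 h2.symm
    · intro h3; rw [h3, neg_zero] at h2
      exact (hqe.mul_left_eq_zero).1 h2
  apply Nat.dvd_antisymm
  · exact Nat.dvd_gcd ((hd _ (Nat.gcd_dvd_right _ _)).1 (Nat.gcd_dvd_left _ _)) (Nat.gcd_dvd_right _ _)
  · exact Nat.dvd_gcd ((hd _ (Nat.gcd_dvd_right _ _)).2 (Nat.gcd_dvd_left _ _)) (Nat.gcd_dvd_right _ _)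

lemma sum_totient_div_sq_le {A₁ A₂ : ℝ} (h1 : 0 < A₁) (h12 : A₁ ≤ A₂) (q : ℕ) :
    ∑ a ∈ (Ioc ⌊A₁⌋₊ ⌊A₂⌋₊).filter (Nat.Coprime · q), (a.totient : ℝ) / (a : ℝ) ^ 2 ≤ A₂ / A₁ := by
  calc _ ≤ ∑ a ∈ (Ioc ⌊A₁⌋₊ ⌊A₂⌋₊).filter (Nat.Coprime · q), 1 / A₁ := by
        refine sum_le_sum fun a ha => ?_
        have ha1 : A₁ < a := (Nat.floor_lt h1.le).1 (mem_Ioc.1 (mem_filter.1 ha).1).1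
        have ha0 : (0 : ℝ) < a := h1.trans ha1
        calc (a.totient : ℝ) / (a : ℝ) ^ 2 ≤ a / (a : ℝ) ^ 2 := by
              gcongr; exact_mod_cast Nat.totient_le a
          _ = 1 / (a : ℝ) := by field_simp
          _ ≤ _ := by gcongr
    _ = (((Ioc ⌊A₁⌋₊ ⌊A₂⌋₊).filter (Nat.Coprime · q)).card : ℝ) * (1 / A₁) := by
        rw [sum_const, nsmul_eq_mul]
    _ ≤ A₂ * (1 / A₁) := by
        gcongr
        calc (((Ioc ⌊A₁⌋₊ ⌊A₂⌋₊).filter (Nat.Coprime · q)).card : ℝ) ≤ (⌊A₂⌋₊ : ℝ) := by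
              have : ((Ioc ⌊A₁⌋₊ ⌊A₂⌋₊).filter (Nat.Coprime · q)).card ≤ ⌊A₂⌋₊ :=
                (card_filter_le _ _).trans (by simp)
              exact_mod_cast this
          _ ≤ _ := Nat.floor_le (h1.le.trans h12)
    _ = _ := by ring

set_option maxHeartbeats 1000000 in
lemma ncard_latticeBox_approx : ∃ C : ℝ, 1 ≤ C ∧ ∀ (n q : ℕ), 0 < n → 0 < q →
    ∀ (α₁ α₂ β₁ β₂ γ₁ γ₂ : ℝ), 0 < α₁ → α₁ ≤ α₂ → β₁ ≤ β₂ → β₂ - β₁ ≤ α₁ →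
    γ₁ ≤ γ₂ → γ₂ - γ₁ ≤ α₁ →
    |((latticeBox n q α₁ α₂ β₁ β₂ γ₁ γ₂).ncard : ℝ) / n -
      totientDensity q / q * ((β₂ - β₁) * (γ₂ - γ₁) * Real.log (α₂ / α₁))| ≤
      C * (1 + α₂ + 1 / α₁) ^ 2 * (n : ℝ) ^ (-(1 / 64) : ℝ) := by
  obtain ⟨C1, hC1, H1⟩ := card_hypPoints_approx
  obtain ⟨C2, hC2, H2⟩ := totientDensity_approx
  obtain ⟨C3, hC3, H3⟩ := card_divisors_le_rpow (ε := 1 / 64) (by norm_num)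
  refine ⟨C1 * C3 + 4 + C2, by nlinarith, ?_⟩
  intro n q hn hq α₁ α₂ β₁ β₂ γ₁ γ₂ hα hα12 hβ hβα hγ hγα
  have hnR : (1 : ℝ) ≤ n := by exact_mod_cast hn
  have hn0 : (0 : ℝ) < n := by linarith
  have hqR : (1 : ℝ) ≤ q := by exact_mod_cast hq
  have hα2 : 0 < α₂ := hα.trans_le hα12
  set X := Real.sqrt n with hX
  have hX1 : 1 ≤ X := Real.one_le_sqrt.2 hnR
  have hX0 : 0 < X := by linarith
  have hXX : X * X = n := Real.mul_self_sqrt hn0.le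
  rw [ncard_latticeBox n q hq _ _ _ _ _ _ hα]
  set S := (Ioc ⌊α₁ * X⌋₊ ⌊α₂ * X⌋₊).filter (Nat.Coprime · q) with hS
  set I : ℝ := ((Ioc ⌊β₁ * X⌋ ⌊β₂ * X⌋).card : ℝ) with hI
  set J : ℝ := ((Ioc ⌊γ₁ * X / q⌋ ⌊γ₂ * X / q⌋).card : ℝ) with hJ
  set U : ℝ := ∑ a ∈ S, (a.totient : ℝ) / (a : ℝ) ^ 2 with hU
  set V : ℝ := 1 + α₂ + 1 / α₁ with hV
  have hV1 : 1 ≤ V := by have : 0 < 1 / α₁ := by positivity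
                         linarith
  have hVα : α₂ ≤ V := by have : 0 < 1 / α₁ := by positivity
                          linarith
  have hIa : |I - (β₂ - β₁) * X| ≤ 1 := by
    have := card_Ioc_floor_approx (x := β₁ * X) (y := β₂ * X) (by gcongr)
    rwa [← sub_mul] at this
  have hJa : |J - (γ₂ - γ₁) * X / q| ≤ 1 := by
    have := card_Ioc_floor_approx (x := γ₁ * X / q) (y := γ₂ * X / q) (by gcongr)
    rwa [← sub_div, ← sub_mul] at this
  have hmem : ∀ a ∈ S, 0 < a ∧ α₁ * X < a ∧ (a : ℝ) ≤ α₂ * X ∧ Nat.Coprime a q := by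
    intro a ha
    rw [hS, mem_filter, mem_Ioc] at ha
    refine ⟨by omega, (Nat.floor_lt (by positivity)).1 ha.1.1, ?_, ha.2⟩
    exact (Nat.le_floor_iff (by positivity)).1 ha.1.2
  -- the hyperbola counts
  have hcount : |((∑ a ∈ S, (hypPoints a (-(n : ZMod a) * (q : ZMod a)⁻¹) ⌊β₁ * X⌋ ⌊β₂ * X⌋
          ⌊γ₁ * X / q⌋ ⌊γ₂ * X / q⌋).card : ℕ) : ℝ) - U * I * J| ≤
      C1 * (α₂ * X) ^ (15 / 16 : ℝ) * ((α₂ * X) * (C3 * (n : ℝ) ^ (1 / 64 : ℝ))) := by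
    rw [hU, sum_mul, sum_mul, Nat.cast_sum, ← sum_sub_distrib]
    calc _ ≤ ∑ a ∈ S, C1 * (α₂ * X) ^ (15 / 16 : ℝ) * (Nat.gcd n a : ℝ) := by
          refine (abs_sum_le_sum_abs _ _).trans (sum_le_sum fun a ha => ?_)
          obtain ⟨ha0, ha1, ha2, ha3⟩ := hmem a ha
          have : NeZero a := ⟨ha0.ne'⟩
          have haR : (1 : ℝ) ≤ a := by exact_mod_cast ha0
          have hb : ∀ u v : ℝ, |v - u| ≤ 1 → u ≤ α₁ * X → v ≤ 2 * a := by
            intro u v h1 h2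
            have := (abs_le.1 h1).2
            linarith
          have b1 : (Ioc ⌊β₁ * X⌋ ⌊β₂ * X⌋).card ≤ 2 * a := by
            have := hb _ _ hIa (by gcongr)
            rw [hI] at this
            exact_mod_cast this
          have b2 : (Ioc ⌊γ₁ * X / q⌋ ⌊γ₂ * X / q⌋).card ≤ 2 * a := by
            have := hb _ _ hJa (by
              calc (γ₂ - γ₁) * X / q ≤ (γ₂ - γ₁) * X := by
                    apply div_le_self _ hqR
                    have : 0 ≤ γ₂ - γ₁ := by linarith
                    positivity
                _ ≤ _ := by gcongr)
            rw [hJ] at this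
            exact_mod_cast this
          refine (H1 a _ _ _ _ _ b1 b2).trans ?_
          rw [gcd_val_neg_mul_inv ha3]
          gcongr
      _ = C1 * (α₂ * X) ^ (15 / 16 : ℝ) * (∑ a ∈ S, Nat.gcd n a : ℕ) := by
          rw [← mul_sum, Nat.cast_sum]
      _ ≤ _ := by
          gcongr
          calc ((∑ a ∈ S, Nat.gcd n a : ℕ) : ℝ) ≤ ((⌊α₂ * X⌋₊ * n.divisors.card : ℕ) : ℝ) := by
                have : ∑ a ∈ S, Nat.gcd n a ≤ ⌊α₂ * X⌋₊ * n.divisors.card :=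
                  (sum_le_sum_of_subset ((filter_subset _ _).trans
                    (Ioc_subset_Ioc_left (Nat.zero_le _)))).trans (sum_gcd_Icc_le n _ hn)
                exact_mod_cast this
            _ ≤ _ := by
                push_cast
                gcongr
                · exact Nat.floor_le (by positivity)
                · exact H3 n
  have hU0 : 0 ≤ U := sum_nonneg fun a _ => by positivity
  have hUle : U ≤ α₂ / α₁ := by
    have := sum_totient_div_sq_le (q := q) (show 0 < α₁ * X by positivity)
      (show α₁ * X ≤ α₂ * X by gcongr)
    rwa [mul_div_mul_right _ _ hX0.ne'] at this
  have hUa : |U - totientDensity q * Real.log (α₂ / α₁)| ≤ C2 * q * (Real.sqrt (α₂ * X) / (α₁ * X)) := by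
    have := H2 q hq (α₁ * X) (α₂ * X) (by positivity) (by gcongr)
    rwa [mul_div_mul_right _ _ hX0.ne'] at this
  set β := (β₂ - β₁) with hβd
  set γ := (γ₂ - γ₁) with hγd
  have hβ0 : 0 ≤ β := sub_nonneg.2 hβ
  have hγ0 : 0 ≤ γ := sub_nonneg.2 hγ
  have hIJ : |I * J - β * X * (γ * X / q)| ≤ 2 * α₁ * X + 1 := by
    have hb1 : β * X ≤ α₁ * X := by gcongr
    have hb2 : γ * X / q ≤ α₁ * X := (div_le_self (by positivity) hqR).trans (by gcongr)
    have hb0 : 0 ≤ β * X := by positivity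
    have hb3 : 0 ≤ γ * X / q := by positivity
    have e : I * J - β * X * (γ * X / q) = (I - β * X) * (J - γ * X / q) +
      (I - β * X) * (γ * X / q) + β * X * (J - γ * X / q) := by ring
    rw [e]
    refine (abs_add_three _ _ _).trans ?_
    rw [abs_mul, abs_mul, abs_mul, abs_of_nonneg hb0, abs_of_nonneg hb3]
    have k1 := mul_le_mul hIa hJa (abs_nonneg _) zero_le_one
    have k2 := mul_le_mul hIa hb2 hb3 zero_le_one
    have k3 := mul_le_mul hb1 hJa (abs_nonneg _) (by positivity)
    linarith
  have hnn : ∀ e : ℝ, e ≤ 63 / 64 → (n : ℝ) ^ e / n ≤ (n : ℝ) ^ (-(1 / 64) : ℝ) := by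
    intro e he
    rw [← Real.rpow_sub_one hn0.ne']
    exact Real.rpow_le_rpow_of_exponent_le hnR (by linarith)
  have hXr : X = (n : ℝ) ^ (1 / 2 : ℝ) := by rw [hX, Real.sqrt_eq_rpow]
  have p1 : C1 * (α₂ * X) ^ (15 / 16 : ℝ) * ((α₂ * X) * (C3 * (n : ℝ) ^ (1 / 64 : ℝ))) / n ≤
      C1 * C3 * V ^ 2 * (n : ℝ) ^ (-(1 / 64) : ℝ) := by
    have e1 : (α₂ * X) ^ (15 / 16 : ℝ) ≤ V * (n : ℝ) ^ (15 / 32 : ℝ) := by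
      rw [Real.mul_rpow hα2.le hX0.le, hXr, ← Real.rpow_mul hn0.le]
      have : α₂ ^ (15 / 16 : ℝ) ≤ V := by
        calc α₂ ^ (15 / 16 : ℝ) ≤ V ^ (15 / 16 : ℝ) := by gcongr
          _ ≤ V ^ (1 : ℝ) := Real.rpow_le_rpow_of_exponent_le hV1 (by norm_num)
          _ = V := Real.rpow_one V
      norm_num
      gcongr
    calc _ ≤ C1 * (V * (n : ℝ) ^ (15 / 32 : ℝ)) * ((V * (n : ℝ) ^ (1 / 2 : ℝ)) * (C3 * (n : ℝ) ^ (1 / 64 : ℝ))) / n := by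
          rw [← hXr]; gcongr
      _ = C1 * C3 * V ^ 2 * ((n : ℝ) ^ ((15 / 32 : ℝ) + 1 / 2 + 1 / 64) / n) := by
          rw [Real.rpow_add hn0, Real.rpow_add hn0]; ring
      _ ≤ _ := by
          gcongr
          exact hnn _ (by norm_num)
  have hV2 : V ≤ V ^ 2 := by nlinarith
  have hinv : 1 / α₁ ≤ V := by linarith
  have p2 : U * (2 * α₁ * X + 1) / n ≤ 4 * V ^ 2 * (n : ℝ) ^ (-(1 / 64) : ℝ) := by
    calc _ ≤ (α₂ / α₁) * (2 * α₁ * X + 1) / n := by gcongr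
      _ = (2 * α₂ * X + α₂ * (1 / α₁)) / n := by field_simp
      _ ≤ (2 * V ^ 2 * X + V * V * X) / n := by
          refine div_le_div_of_nonneg_right (add_le_add ?_ ?_) hn0.le
          · have := hVα.trans hV2
            gcongr
          · calc α₂ * (1 / α₁) ≤ V * V := by gcongr
              _ = V * V * 1 := (mul_one _).symm
              _ ≤ _ := by gcongr
      _ = 3 * V ^ 2 * ((n : ℝ) ^ (1 / 2 : ℝ) / n) := by rw [← hXr]; ring
      _ ≤ _ := by
          gcongr
          · norm_num
          · exact hnn _ (by norm_num)
  have p3 : C2 * q * (Real.sqrt (α₂ * X) / (α₁ * X)) * (β * X * (γ * X / q)) / n ≤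
      C2 * V ^ 2 * (n : ℝ) ^ (-(1 / 64) : ℝ) := by
    have hs : Real.sqrt (α₂ * X) ≤ V * (n : ℝ) ^ (1 / 4 : ℝ) := by
      rw [Real.sqrt_mul hα2.le]
      have h1 : Real.sqrt α₂ ≤ V := Real.sqrt_le_iff.2 ⟨by linarith, by nlinarith⟩
      have h2 : Real.sqrt X = (n : ℝ) ^ (1 / 4 : ℝ) := by
        rw [Real.sqrt_eq_rpow, hXr, ← Real.rpow_mul hn0.le]; norm_num
      rw [h2]; gcongr
    have hβγ : β * γ ≤ α₁ * V := by
      calc β * γ ≤ α₁ * α₁ := by gcongr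
        _ ≤ _ := by gcongr; exact hα12.trans hVα
    calc _ = C2 * (Real.sqrt (α₂ * X) * X) * (β * γ) / α₁ / n := by
          field_simp
      _ ≤ C2 * (V * (n : ℝ) ^ (1 / 4 : ℝ) * X) * (α₁ * V) / α₁ / n := by gcongr
      _ = C2 * V ^ 2 * ((n : ℝ) ^ ((1 / 4 : ℝ) + 1 / 2) / n) := by
          rw [Real.rpow_add hn0, ← hXr]; field_simp
      _ ≤ _ := by
          gcongr
          exact hnn _ (by norm_num)
  set Nn : ℝ := ((∑ a ∈ S, (hypPoints a (-(n : ZMod a) * (q : ZMod a)⁻¹) ⌊β₁ * X⌋ ⌊β₂ * X⌋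
          ⌊γ₁ * X / q⌋ ⌊γ₂ * X / q⌋).card : ℕ) : ℝ) with hNn
  have efinal : Nn / n - totientDensity q / q * (β * γ * Real.log (α₂ / α₁)) =
      (Nn - U * I * J) / n + U * (I * J - β * X * (γ * X / q)) / n +
      (U - totientDensity q * Real.log (α₂ / α₁)) * (β * X * (γ * X / q)) / n := by
    have : β * X * (γ * X / q) = β * γ * n / q := by rw [← hXX]; ring
    rw [this]; field_simp; ring
  rw [efinal]
  refine (abs_add_three _ _ _).trans ?_
  have hbg : 0 ≤ β * X * (γ * X / q) := by positivity
  have f1 : |(Nn - U * I * J) / n| ≤ C1 * C3 * V ^ 2 * (n : ℝ) ^ (-(1 / 64) : ℝ) := by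
    rw [abs_div, abs_of_pos hn0]
    exact le_trans (by gcongr) p1
  have f2 : |U * (I * J - β * X * (γ * X / q)) / n| ≤ 4 * V ^ 2 * (n : ℝ) ^ (-(1 / 64) : ℝ) := by
    rw [abs_div, abs_of_pos hn0, abs_mul, abs_of_nonneg hU0]
    exact le_trans (by gcongr) p2
  have f3 : |(U - totientDensity q * Real.log (α₂ / α₁)) * (β * X * (γ * X / q)) / n| ≤
      C2 * V ^ 2 * (n : ℝ) ^ (-(1 / 64) : ℝ) := by
    rw [abs_div, abs_of_pos hn0, abs_mul, abs_of_nonneg hbg]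
    exact le_trans (by gcongr) p3
  linarith

end

section
open Finset MeasureTheory

/-- The condition on `(a, b, c)` for `[[a, b], [q c, *]]` to be completable to an integer matrix of
determinant `n` with coprime first column. -/
def IsLatticePoint (n q : ℕ) (p : ℤ × ℤ × ℤ) : Prop :=
  IsCoprime p.1 (q * p.2.2) ∧ p.1 ∣ n + p.2.1 * (q * p.2.2)

/-- The normalised entries `(a, b, q c) / √n`. -/
noncomputable def latticeScale (n q : ℕ) (p : ℤ × ℤ × ℤ) : ℝ × ℝ × ℝ :=
  ((p.1 : ℝ) / Real.sqrt n, (p.2.1 : ℝ) / Real.sqrt n, (q * p.2.2 : ℝ) / Real.sqrt n)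

/-- Boxes of triples with positive first coordinate between `1 / T` and `T`. -/
def chartBox (T : ℝ) : Set (ℝ × ℝ × ℝ) :=
  Set.Icc (1 / T) T ×ˢ Set.Icc (-T) T ×ˢ Set.Icc (-T) T

/-- The half-open cube of side `δ` with upper corner `x`. -/
def lowerCube (δ : ℝ) (x : ℝ × ℝ × ℝ) : Set (ℝ × ℝ × ℝ) :=
  Set.Ico (x.1 - δ) x.1 ×ˢ Set.Ico (x.2.1 - δ) x.2.1 ×ˢ Set.Ico (x.2.2 - δ) x.2.2

lemma measurableSet_lowerCube (δ : ℝ) (x : ℝ × ℝ × ℝ) : MeasurableSet (lowerCube δ x) :=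
  measurableSet_Ico.prod (measurableSet_Ico.prod measurableSet_Ico)

lemma volume_lowerCube {δ : ℝ} (hδ : 0 ≤ δ) (x : ℝ × ℝ × ℝ) :
    volume.real (lowerCube δ x) = δ ^ 3 := by
  rw [Measure.real, lowerCube, Measure.volume_eq_prod, Measure.prod_prod, Measure.volume_eq_prod,
    Measure.prod_prod]
  simp only [Real.volume_Ico, ENNReal.toReal_mul, sub_sub_cancel, ENNReal.toReal_ofReal hδ]
  ring

lemma volume_lowerCube_ne_top (δ : ℝ) (x : ℝ × ℝ × ℝ) : volume (lowerCube δ x) ≠ ⊤ := by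
  rw [lowerCube, Measure.volume_eq_prod, Measure.prod_prod, Measure.volume_eq_prod,
    Measure.prod_prod]
  simp only [Real.volume_Ico]
  finiteness

lemma volume_chartBox_le {T : ℝ} (hT : 1 ≤ T) : volume.real (chartBox T) ≤ 4 * T ^ 3 := by
  have h0 : 0 < T := by linarith
  have h1 : 1 / T ≤ 1 := (div_le_one h0).2 hT
  rw [Measure.real, chartBox, Measure.volume_eq_prod, Measure.prod_prod, Measure.volume_eq_prod,
    Measure.prod_prod]
  simp only [Real.volume_Icc, ENNReal.toReal_mul]
  rw [ENNReal.toReal_ofReal (by linarith), ENNReal.toReal_ofReal (by linarith)]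
  have : T - 1 / T ≤ T := by have : 0 < 1 / T := by positivity
                             linarith
  calc _ ≤ T * ((T - -T) * (T - -T)) := by
        gcongr
        apply mul_nonneg <;> linarith
    _ = _ := by ring

lemma volume_chartBox_ne_top (T : ℝ) : volume (chartBox T) ≠ ⊤ := by
  rw [chartBox, Measure.volume_eq_prod, Measure.prod_prod, Measure.volume_eq_prod,
    Measure.prod_prod]
  simp only [Real.volume_Icc]
  finiteness

lemma measurableSet_chartBox (T : ℝ) : MeasurableSet (chartBox T) :=
  measurableSet_Icc.prod (measurableSet_Icc.prod measurableSet_Icc)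

lemma mem_latticeBox_iff {n q : ℕ} (hn : 0 < n) {δ : ℝ} {x : ℝ × ℝ × ℝ} {p : ℤ × ℤ × ℤ} :
    p ∈ latticeBox n q x.1 (x.1 + δ) x.2.1 (x.2.1 + δ) x.2.2 (x.2.2 + δ) ↔
      IsLatticePoint n q p ∧ x ∈ lowerCube δ (latticeScale n q p) := by
  have hX : 0 < Real.sqrt n := Real.sqrt_pos.2 (by exact_mod_cast hn)
  have key : ∀ u v : ℝ, (u * Real.sqrt n < v ∧ v ≤ (u + δ) * Real.sqrt n) ↔
      u ∈ Set.Ico (v / Real.sqrt n - δ) (v / Real.sqrt n) := by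
    intro u v
    rw [Set.mem_Ico, lt_div_iff₀ hX, sub_le_iff_le_add, div_le_iff₀ hX, and_comm]
  simp only [latticeBox, Set.mem_ofPred_eq, lowerCube, Set.mem_prod, latticeScale, IsLatticePoint, key]
  tauto

lemma finite_latticePoints (n q : ℕ) (hn : 0 < n) (hq : 0 < q) (T : ℝ) :
    {p : ℤ × ℤ × ℤ | IsLatticePoint n q p ∧ latticeScale n q p ∈ chartBox T}.Finite := by
  have hX : 0 < Real.sqrt n := Real.sqrt_pos.2 (by exact_mod_cast hn)
  have hqR : (1 : ℝ) ≤ q := by exact_mod_cast hq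
  set B : ℤ := ⌈|T| * Real.sqrt n⌉ with hB
  have key : ∀ v : ℤ, |(v : ℝ)| ≤ |T| * Real.sqrt n → v ∈ Set.Icc (-B) B := by
    intro v hv
    have h2 := abs_le.1 (hv.trans (Int.le_ceil _))
    constructor
    · exact_mod_cast h2.1
    · exact_mod_cast h2.2
  refine ((Set.finite_Icc (-B) B).prod ((Set.finite_Icc (-B) B).prod (Set.finite_Icc (-B) B))).subset ?_
  rintro ⟨a, b, c⟩ ⟨-, h⟩
  simp only [latticeScale, chartBox, Set.mem_prod, Set.mem_Icc, div_le_iff₀ hX, le_div_iff₀ hX] at h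
  obtain ⟨⟨h1, h2⟩, ⟨h3, h4⟩, h5, h6⟩ := h
  have hT : T * Real.sqrt n ≤ |T| * Real.sqrt n := by gcongr; exact le_abs_self _
  refine ⟨key _ ?_, key _ ?_, key _ ?_⟩
  · have hT0 : 0 ≤ 1 / T * Real.sqrt n := by
      by_contra hneg
      push Not at hneg
      have : 1 / T < 0 := by
        by_contra h; push Not at h; have := mul_nonneg h hX.le; linarith
      have hT' : T < 0 := by simpa using this
      nlinarith
    rw [abs_le]; constructor <;> linarith
  · rw [abs_le]; constructor <;> linarith
  · have : |(q : ℝ) * c| ≤ |T| * Real.sqrt n := by rw [abs_le]; constructor <;> linarith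
    rw [abs_mul, abs_of_pos (by linarith : (0:ℝ) < q)] at this
    nlinarith [abs_nonneg (c : ℝ)]

lemma lowerCube_count_approx : ∃ C : ℝ, 1 ≤ C ∧ ∀ (n q : ℕ), 0 < n → 0 < q → ∀ (T δ : ℝ), 1 ≤ T →
    0 < δ → δ ≤ 1 / T → ∀ x ∈ chartBox T,
    |(({p | IsLatticePoint n q p ∧ x ∈ lowerCube δ (latticeScale n q p)}.ncard : ℕ) : ℝ) / n -
      totientDensity q / q * (δ ^ 3 / x.1)| ≤
      C * T ^ 2 * ((n : ℝ) ^ (-(1 / 64) : ℝ) + δ ^ 4) ∧ |totientDensity q / q| ≤ C := by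
  obtain ⟨C1, hC1, H1⟩ := ncard_latticeBox_approx
  obtain ⟨C2, hC2, H2⟩ := totientDensity_le
  refine ⟨16 * C1 + C2, by linarith, ?_⟩
  intro n q hn hq T δ hT hδ hδT x hx
  have hT0 : 0 < T := by linarith
  have hqR : (0 : ℝ) < q := by exact_mod_cast hq
  have hκ : |totientDensity q / q| ≤ C2 := by
    rw [abs_div, abs_of_pos hqR, div_le_iff₀ hqR]; exact H2 q hq
  refine ⟨?_, hκ.trans (by linarith)⟩
  obtain ⟨⟨hx1, hx2⟩, -⟩ := hx
  have hx0 : 0 < x.1 := lt_of_lt_of_le (by positivity) hx1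
  have h := H1 n q hn hq x.1 (x.1 + δ) x.2.1 (x.2.1 + δ) x.2.2 (x.2.2 + δ) hx0 (by linarith)
    (by linarith) (by linarith) (by linarith) (by linarith)
  have hset : latticeBox n q x.1 (x.1 + δ) x.2.1 (x.2.1 + δ) x.2.2 (x.2.2 + δ) =
      {p | IsLatticePoint n q p ∧ x ∈ lowerCube δ (latticeScale n q p)} :=
    Set.ext fun p => mem_latticeBox_iff hn
  rw [hset] at h
  set Nn := (({p | IsLatticePoint n q p ∧ x ∈ lowerCube δ (latticeScale n q p)}.ncard : ℕ) : ℝ)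
  set κ := totientDensity q / q
  have hinv : 1 / x.1 ≤ T := by
    rw [div_le_iff₀ hx0]; rw [div_le_iff₀ hT0] at hx1; linarith
  have hlog : |Real.log ((x.1 + δ) / x.1) - δ / x.1| ≤ (δ / x.1) ^ 2 := by
    have ht : 0 < δ / x.1 := by positivity
    have e : (x.1 + δ) / x.1 = 1 + δ / x.1 := by field_simp
    rw [e]
    set t := δ / x.1
    have l1 := Real.log_le_sub_one_of_pos (show 0 < 1 + t by linarith)
    have l2 := Real.one_sub_inv_le_log_of_pos (show 0 < 1 + t by linarith)
    have l3 : t - t ^ 2 ≤ 1 - (1 + t)⁻¹ := by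
      rw [← sub_nonneg]
      have : 1 - (1 + t)⁻¹ - (t - t ^ 2) = t ^ 3 / (1 + t) := by field_simp; ring
      rw [this]; positivity
    rw [abs_le]; constructor <;> nlinarith
  have e1 : Nn / n - κ * (δ ^ 3 / x.1) =
      (Nn / n - κ * ((x.2.1 + δ - x.2.1) * (x.2.2 + δ - x.2.2) * Real.log ((x.1 + δ) / x.1))) +
      κ * (δ ^ 2 * (Real.log ((x.1 + δ) / x.1) - δ / x.1)) := by ring
  rw [e1]
  refine (abs_add_le _ _).trans ?_
  have hδ1 : 1 / T ≤ T := by rw [div_le_iff₀ hT0]; nlinarith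
  have b1 : C1 * (1 + (x.1 + δ) + 1 / x.1) ^ 2 * (n : ℝ) ^ (-(1 / 64) : ℝ) ≤
      C1 * (16 * T ^ 2) * (n : ℝ) ^ (-(1 / 64) : ℝ) := by
    gcongr
    calc (1 + (x.1 + δ) + 1 / x.1) ^ 2 ≤ (4 * T) ^ 2 := by
          gcongr; linarith
      _ = _ := by ring
  have b2 : |κ * (δ ^ 2 * (Real.log ((x.1 + δ) / x.1) - δ / x.1))| ≤ C2 * (T ^ 2 * δ ^ 4) := by
    rw [abs_mul, abs_mul, abs_of_nonneg (sq_nonneg δ)]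
    calc _ ≤ C2 * (δ ^ 2 * (δ / x.1) ^ 2) := by gcongr
      _ = C2 * ((1 / x.1) ^ 2 * δ ^ 4) := by ring
      _ ≤ _ := by gcongr
  have hp : 0 ≤ (n : ℝ) ^ (-(1 / 64) : ℝ) := by positivity
  have hC20 : 0 < C2 := by linarith
  have hC10 : 0 < C1 := by linarith
  have k1 : 0 ≤ 16 * C1 * T ^ 2 * δ ^ 4 := by positivity
  have k2 : 0 ≤ C2 * T ^ 2 * (n : ℝ) ^ (-(1 / 64) : ℝ) := by positivity
  nlinarith

noncomputable instance decidableMemLowerCube (δ : ℝ) (x y : ℝ × ℝ × ℝ) : Decidable (x ∈ lowerCube δ y) :=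
  Classical.dec _

lemma sum_setIntegral_lowerCube (S : Finset (ℤ × ℤ × ℤ)) (n q : ℕ) (δ : ℝ) {Ω : ℝ × ℝ × ℝ → ℂ}
    (hΩ : Continuous Ω) {B : ℝ} (hB : ∀ x, ‖Ω x‖ ≤ B) :
    Integrable (fun x => (((S.filter fun p => x ∈ lowerCube δ (latticeScale n q p)).card : ℕ) : ℂ) *
      Ω x) ∧
    ∑ p ∈ S, ∫ x in lowerCube δ (latticeScale n q p), Ω x =
      ∫ x, (((S.filter fun p => x ∈ lowerCube δ (latticeScale n q p)).card : ℕ) : ℂ) * Ω x := by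
  have h_int : ∀ p ∈ S, Integrable ((lowerCube δ (latticeScale n q p)).indicator Ω) := by
    intro p _
    rw [integrable_indicator_iff (measurableSet_lowerCube _ _)]
    exact Measure.integrableOn_of_bounded (volume_lowerCube_ne_top _ _) hΩ.aestronglyMeasurable
      (Filter.Eventually.of_forall hB)
  have he : (fun x => (((S.filter fun p => x ∈ lowerCube δ (latticeScale n q p)).card : ℕ) : ℂ) *
      Ω x) = fun x => ∑ p ∈ S, (lowerCube δ (latticeScale n q p)).indicator Ω x := by
    ext x
    rw [← nsmul_eq_mul, ← sum_const, sum_filter]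
    refine sum_congr rfl fun p _ => ?_
    simp only [Set.indicator]
  rw [he]
  refine ⟨integrable_finsetSum _ h_int, ?_⟩
  rw [integral_finsetSum _ h_int]
  exact sum_congr rfl fun p _ => (integral_indicator (measurableSet_lowerCube _ _)).symm

/-- The lattice points whose normalisation lies in a chart box. -/
noncomputable def latticeFinset (n q : ℕ) (hn : 0 < n) (hq : 0 < q) (T : ℝ) : Finset (ℤ × ℤ × ℤ) :=
  (finite_latticePoints n q hn hq T).toFinset

lemma mem_latticeFinset {n q : ℕ} {hn : 0 < n} {hq : 0 < q} {T : ℝ} {p : ℤ × ℤ × ℤ} :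
    p ∈ latticeFinset n q hn hq T ↔ IsLatticePoint n q p ∧ latticeScale n q p ∈ chartBox T := by
  simp [latticeFinset]

lemma lowerCube_near {δ T : ℝ} (hT : 1 ≤ T) (hδ : δ ≤ 1 / (2 * T)) {x y : ℝ × ℝ × ℝ}
    (h : x ∈ lowerCube δ y) : (x ∈ chartBox T → y ∈ chartBox (2 * T)) ∧
      (y ∈ chartBox T → x ∈ chartBox (2 * T)) ∧ dist x y ≤ δ := by
  have hT0 : 0 < T := by linarith
  have hh : 1 / (2 * T) + 1 / (2 * T) = 1 / T := by field_simp; norm_num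
  have hh2 : 1 / (2 * T) ≤ T := by rw [div_le_iff₀ (by linarith)]; nlinarith
  simp only [lowerCube, Set.mem_prod, Set.mem_Ico] at h
  obtain ⟨⟨h1, h2⟩, ⟨h3, h4⟩, h5, h6⟩ := h
  simp only [chartBox, Set.mem_prod, Set.mem_Icc]
  refine ⟨?_, ?_, ?_⟩
  · rintro ⟨⟨_, _⟩, ⟨_, _⟩, _, _⟩
    refine ⟨⟨?_, ?_⟩, ⟨?_, ?_⟩, ?_, ?_⟩ <;> linarith
  · rintro ⟨⟨_, _⟩, ⟨_, _⟩, _, _⟩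
    refine ⟨⟨?_, ?_⟩, ⟨?_, ?_⟩, ?_, ?_⟩ <;> linarith
  · rw [Prod.dist_eq, Prod.dist_eq, Real.dist_eq, Real.dist_eq, Real.dist_eq]
    refine max_le ?_ (max_le ?_ ?_) <;> rw [abs_le] <;> constructor <;> linarith

lemma card_latticeFinset_filter {n q : ℕ} (hn : 0 < n) (hq : 0 < q) {T δ : ℝ} (hT : 1 ≤ T)
    (hδ : δ ≤ 1 / (2 * T)) {x : ℝ × ℝ × ℝ} (hx : x ∈ chartBox T) :
    ((latticeFinset n q hn hq (2 * T)).filter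
      fun p => x ∈ lowerCube δ (latticeScale n q p)).card =
      {p | IsLatticePoint n q p ∧ x ∈ lowerCube δ (latticeScale n q p)}.ncard := by
  rw [← Set.ncard_coe_finset]
  congr 1
  ext p
  simp only [coe_filter, mem_latticeFinset, Set.mem_ofPred_eq]
  constructor
  · rintro ⟨⟨h1, _⟩, h2⟩; exact ⟨h1, h2⟩
  · rintro ⟨h1, h2⟩; exact ⟨⟨h1, (lowerCube_near hT hδ h2).1 hx⟩, h2⟩

lemma card_latticeFinset_filter_le {n q : ℕ} (hn : 0 < n) (hq : 0 < q) {T δ : ℝ} (hT : 1 ≤ T)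
    (hδ : δ ≤ 1 / (2 * T)) {x : ℝ × ℝ × ℝ} (hx : x ∈ chartBox T) (T' : ℝ) :
    ((latticeFinset n q hn hq T').filter
      fun p => x ∈ lowerCube δ (latticeScale n q p)).card ≤
      {p | IsLatticePoint n q p ∧ x ∈ lowerCube δ (latticeScale n q p)}.ncard := by
  rw [← card_latticeFinset_filter hn hq hT hδ hx]
  refine card_le_card fun p hp => ?_
  rw [mem_filter, mem_latticeFinset] at hp ⊢
  exact ⟨⟨hp.1.1, (lowerCube_near hT hδ hp.2).1 hx⟩, hp.2⟩

set_option maxHeartbeats 1000000 in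
lemma card_latticeFinset_le : ∃ C : ℝ, 1 ≤ C ∧ ∀ (n q : ℕ) (hn : 0 < n) (hq : 0 < q) (T : ℝ),
    1 ≤ T → ((latticeFinset n q hn hq T).card : ℝ) ≤ C * T ^ 8 * n := by
  obtain ⟨C1, hC1, H1⟩ := lowerCube_count_approx
  refine ⟨32 * (C1 * 2 + 4 * C1 * 65), by linarith, ?_⟩
  intro n q hn hq T hT
  have hT0 : 0 < T := by linarith
  have hnR : (1 : ℝ) ≤ n := by exact_mod_cast hn
  set δ : ℝ := (n : ℝ) ^ (-(1 / 320) : ℝ) / (4 * T) with hδ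
  have hν1 : (n : ℝ) ^ (-(1 / 320) : ℝ) ≤ 1 := Real.rpow_le_one_of_one_le_of_nonpos hnR (by norm_num)
  have hν0 : 0 < (n : ℝ) ^ (-(1 / 320) : ℝ) := by positivity
  have hδ0 : 0 < δ := by positivity
  have hδ1 : δ ≤ 1 / (2 * T) := by rw [hδ]; gcongr; norm_num
  have hδ2 : δ ≤ 1 / (2 * (2 * T)) := by rw [hδ, show 2 * (2 * T) = 4 * T by ring]; gcongr
  have hδ11 : δ ≤ 1 := hδ1.trans (by rw [div_le_one (by linarith)]; linarith)
  set S := latticeFinset n q hn hq T with hS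
  obtain ⟨I0, I1⟩ := sum_setIntegral_lowerCube S n q δ (Ω := fun _ => 1) continuous_const
    (B := 1) (by simp)
  have L1 : ∑ p ∈ S, ∫ x in lowerCube δ (latticeScale n q p), (1 : ℂ) = (S.card * δ ^ 3 : ℝ) := by
    have : ∀ p ∈ S, ∫ x in lowerCube δ (latticeScale n q p), (1 : ℂ) = ((δ ^ 3 : ℝ) : ℂ) := by
      intro p _
      rw [setIntegral_const, volume_lowerCube hδ0.le]; simp
    rw [sum_congr rfl this, sum_const, nsmul_eq_mul]; push_cast; ring
  rw [L1] at I1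
  set E : ℝ := n * (C1 * (2 * T * δ ^ 3) + C1 * (2 * T) ^ 2 * ((n : ℝ) ^ (-(1 / 64) : ℝ) + δ ^ 4)) with hE
  have hE0 : 0 ≤ E := by positivity
  have hpt : ∀ x, ‖(((S.filter fun p => x ∈ lowerCube δ (latticeScale n q p)).card : ℕ) : ℂ) * 1‖ ≤
      (chartBox (2 * T)).indicator (fun _ => E) x := by
    intro x
    rw [mul_one, Complex.norm_natCast]
    by_cases hx : x ∈ chartBox (2 * T)
    · rw [Set.indicator_of_mem hx]
      have hx1 : 1 / x.1 ≤ 2 * T := by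
        obtain ⟨⟨h1, _⟩, _⟩ := hx
        have hx0 : 0 < x.1 := lt_of_lt_of_le (by positivity) h1
        rw [div_le_iff₀ hx0]; rw [div_le_iff₀ (by linarith)] at h1; linarith
      have hx0 : 0 ≤ 1 / x.1 := by
        obtain ⟨⟨h1, _⟩, _⟩ := hx
        have hx0 : 0 < x.1 := lt_of_lt_of_le (by positivity) h1
        positivity
      obtain ⟨a1, a2⟩ := H1 n q hn hq (2 * T) δ (by linarith) hδ0 hδ1 x hx
      have a3 := (abs_le.1 a1).2
      have a4 : totientDensity q / q * (δ ^ 3 / x.1) ≤ C1 * (2 * T * δ ^ 3) := by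
        calc _ ≤ |totientDensity q / q| * (1 / x.1 * δ ^ 3) := by
              rw [show δ ^ 3 / x.1 = 1 / x.1 * δ ^ 3 by ring]
              gcongr; exact le_abs_self _
          _ ≤ _ := by gcongr
      have a5 : ((S.filter fun p => x ∈ lowerCube δ (latticeScale n q p)).card : ℝ) ≤
          ({p | IsLatticePoint n q p ∧ x ∈ lowerCube δ (latticeScale n q p)}.ncard : ℝ) := by
        exact_mod_cast card_latticeFinset_filter_le hn hq (by linarith) hδ2 hx T
      have hn0 : (0 : ℝ) < n := by linarith
      refine a5.trans ?_
      rw [hE, ← div_le_iff₀' hn0]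
      linarith
    · rw [Set.indicator_of_notMem hx]
      have : S.filter (fun p => x ∈ lowerCube δ (latticeScale n q p)) = ∅ := by
        refine filter_eq_empty_iff.2 fun p hp hxp => hx ?_
        rw [hS, mem_latticeFinset] at hp
        exact (lowerCube_near hT hδ1 hxp).2.1 hp.2
      rw [this]; simp
  have hI2 : (S.card * δ ^ 3 : ℝ) ≤ E * (4 * (2 * T) ^ 3) := by
    have h1 := norm_integral_le_of_norm_le (μ := volume) (g := (chartBox (2 * T)).indicator (fun _ => E))
      ((integrable_indicator_iff (measurableSet_chartBox _)).2
        (integrableOn_const (volume_chartBox_ne_top _))) (Filter.Eventually.of_forall hpt)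
    rw [← I1, integral_indicator (measurableSet_chartBox _), setIntegral_const, Complex.norm_real,
      Real.norm_eq_abs, abs_of_nonneg (by positivity), smul_eq_mul] at h1
    refine h1.trans ?_
    rw [mul_comm]
    gcongr
    exact volume_chartBox_le (by linarith)
  have hδ3 : 0 < δ ^ 3 := by positivity
  have hnδ : (n : ℝ) ^ (-(1 / 64) : ℝ) ≤ 64 * T ^ 3 * δ ^ 3 := by
    have e : 64 * T ^ 3 * δ ^ 3 = ((n : ℝ) ^ (-(1 / 320) : ℝ)) ^ 3 := by
      rw [hδ]; field_simp; ring
    rw [e, ← Real.rpow_natCast, ← Real.rpow_mul (by linarith)]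
    exact Real.rpow_le_rpow_of_exponent_le hnR (by norm_num)
  have hδ4 : δ ^ 4 ≤ T ^ 3 * δ ^ 3 := by
    calc δ ^ 4 = δ * δ ^ 3 := by ring
      _ ≤ 1 * δ ^ 3 := by gcongr
      _ ≤ _ := by gcongr; exact one_le_pow₀ hT
  have hEle : E ≤ (n * (C1 * 2 + 4 * C1 * 65) * T ^ 5) * δ ^ 3 := by
    calc E ≤ n * (C1 * (2 * T * δ ^ 3) + C1 * (2 * T) ^ 2 * (64 * T ^ 3 * δ ^ 3 + T ^ 3 * δ ^ 3)) := by
          rw [hE]; gcongr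
      _ = n * (C1 * 2 * T + 4 * C1 * 65 * T ^ 5) * δ ^ 3 := by ring
      _ ≤ n * (C1 * 2 * T ^ 5 + 4 * C1 * 65 * T ^ 5) * δ ^ 3 := by
          gcongr; exact le_self_pow₀ hT (by norm_num)
      _ = _ := by ring
  have : (S.card : ℝ) * δ ^ 3 ≤ (32 * (C1 * 2 + 4 * C1 * 65) * T ^ 8 * n) * δ ^ 3 := by
    calc _ ≤ E * (4 * (2 * T) ^ 3) := hI2
      _ ≤ ((n * (C1 * 2 + 4 * C1 * 65) * T ^ 5) * δ ^ 3) * (4 * (2 * T) ^ 3) := by gcongr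
      _ = _ := by ring
  exact le_of_mul_le_mul_right this hδ3

set_option maxHeartbeats 1000000 in
/-- Sums over lattice points of a Lipschitz function supported in a chart box. -/
lemma sum_latticePoints_approx : ∃ C : ℝ, 1 ≤ C ∧ ∀ (n q : ℕ) (hn : 0 < n) (hq : 0 < q)
    (T B L : ℝ), 1 ≤ T → 0 ≤ B → 0 ≤ L → ∀ Ω : ℝ × ℝ × ℝ → ℂ, Continuous Ω → (∀ x, ‖Ω x‖ ≤ B) →
    (∀ x, x ∉ chartBox T → Ω x = 0) →
    (∀ x y, dist x y ≤ 1 / (2 * T) → ‖Ω x - Ω y‖ ≤ L * dist x y) →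
    ‖(n : ℂ)⁻¹ * ∑ p ∈ latticeFinset n q hn hq (2 * T), Ω (latticeScale n q p) -
      ((totientDensity q / q : ℝ) : ℂ) * ∫ x, Ω x * ((1 / x.1 : ℝ) : ℂ)‖ ≤
      C * T ^ 8 * (B + L) * (n : ℝ) ^ (-(1 / 320) : ℝ) := by
  obtain ⟨C1, hC1, H1⟩ := lowerCube_count_approx
  obtain ⟨C2, hC2, H2⟩ := card_latticeFinset_le
  refine ⟨128 * C2 + 36 * C1, by linarith, ?_⟩
  intro n q hn hq T B L hT hB hL Ω hΩ hΩB hΩT hΩL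
  have hT0 : 0 < T := by linarith
  have hnR : (1 : ℝ) ≤ n := by exact_mod_cast hn
  have hn0 : (0 : ℝ) < n := by linarith
  set ρ : ℝ := (n : ℝ) ^ (-(1 / 320) : ℝ) with hρ
  set δ : ℝ := ρ / (2 * T) with hδ
  have hν1 : ρ ≤ 1 := Real.rpow_le_one_of_one_le_of_nonpos hnR (by norm_num)
  have hν0 : 0 < ρ := by positivity
  have hδ0 : 0 < δ := by positivity
  have hδ1 : δ ≤ 1 / (2 * T) := by rw [hδ]; gcongr
  have hδT : δ ≤ 1 / T := hδ1.trans (by gcongr; linarith)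
  have hδρ : δ ≤ ρ / 2 := by
    rw [hδ]; apply div_le_div_of_nonneg_left hν0.le (by norm_num) (by linarith)
  set S := latticeFinset n q hn hq (2 * T) with hS
  set κ := totientDensity q / q with hκ
  set cnt : ℝ × ℝ × ℝ → ℕ := fun x => (S.filter fun p => x ∈ lowerCube δ (latticeScale n q p)).card
    with hcnt
  obtain ⟨I0, I1⟩ := sum_setIntegral_lowerCube S n q δ hΩ hΩB
  have hδ3 : 0 < δ ^ 3 := by positivity
  have step1 : ‖∑ p ∈ S, ((δ ^ 3 : ℝ) : ℂ) * Ω (latticeScale n q p) -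
      ∑ p ∈ S, ∫ x in lowerCube δ (latticeScale n q p), Ω x‖ ≤ S.card * (δ ^ 3 * (L * δ)) := by
    rw [← sum_sub_distrib, ← nsmul_eq_mul, ← sum_const]
    refine (norm_sum_le _ _).trans (sum_le_sum fun p _ => ?_)
    have e1 : ((δ ^ 3 : ℝ) : ℂ) * Ω (latticeScale n q p) =
        ∫ x in lowerCube δ (latticeScale n q p), Ω (latticeScale n q p) := by
      rw [setIntegral_const, volume_lowerCube hδ0.le]; simp
    rw [e1, ← integral_sub]
    · have := norm_setIntegral_le_of_norm_le_const (μ := volume)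
        (f := fun x => Ω (latticeScale n q p) - Ω x)
        (volume_lowerCube_ne_top δ (latticeScale n q p)).lt_top (C := L * δ) (fun x hx => by
          have h1 := (lowerCube_near hT hδ1 hx).2.2
          rw [dist_comm] at h1
          exact (hΩL _ _ (h1.trans hδ1)).trans (by gcongr))
      rwa [volume_lowerCube hδ0.le, mul_comm] at this
    · exact integrableOn_const (volume_lowerCube_ne_top _ _)
    · exact Measure.integrableOn_of_bounded (volume_lowerCube_ne_top _ _) hΩ.aestronglyMeasurable
        (Filter.Eventually.of_forall hΩB)
  have hinv : ∀ x ∈ chartBox T, 0 ≤ 1 / x.1 ∧ 1 / x.1 ≤ T := by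
    intro x hx
    obtain ⟨⟨h1, _⟩, _⟩ := hx
    have hx0 : 0 < x.1 := lt_of_lt_of_le (by positivity) h1
    refine ⟨by positivity, ?_⟩
    rw [div_le_iff₀ hx0]; rw [div_le_iff₀ hT0] at h1; linarith
  have I2 : Integrable fun x : ℝ × ℝ × ℝ => Ω x * ((1 / x.1 : ℝ) : ℂ) := by
    refine Integrable.mono' (g := (chartBox T).indicator fun _ => B * T)
      ((integrable_indicator_iff (measurableSet_chartBox _)).2
        (integrableOn_const (volume_chartBox_ne_top _))) ?_ ?_
    · apply hΩ.aestronglyMeasurable.mul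
      exact (Complex.measurable_ofReal.comp (measurable_const.div measurable_fst)).aestronglyMeasurable
    · refine Filter.Eventually.of_forall fun x => ?_
      by_cases hx : x ∈ chartBox T
      · rw [Set.indicator_of_mem hx, norm_mul, Complex.norm_real, Real.norm_eq_abs,
          abs_of_nonneg (hinv x hx).1]
        have := (hinv x hx).1
        have := (hinv x hx).2
        gcongr
        exact hΩB x
      · rw [Set.indicator_of_notMem hx, hΩT x hx]; simp
  set E : ℝ := C1 * T ^ 2 * ((n : ℝ) ^ (-(1 / 64) : ℝ) + δ ^ 4) with hE
  have hE0 : 0 ≤ E := by positivity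
  have step2 : ‖(n : ℂ)⁻¹ * (∫ x, ((cnt x : ℕ) : ℂ) * Ω x) -
      ((κ * δ ^ 3 : ℝ) : ℂ) * ∫ x, Ω x * ((1 / x.1 : ℝ) : ℂ)‖ ≤ (4 * T ^ 3) * (B * E) := by
    rw [← integral_const_mul, ← integral_const_mul, ← integral_sub (I0.const_mul _) (I2.const_mul _)]
    have h1 := norm_integral_le_of_norm_le (μ := volume) (g := (chartBox T).indicator (fun _ => B * E))
      (f := fun x => (n : ℂ)⁻¹ * (((cnt x : ℕ) : ℂ) * Ω x) -
        ((κ * δ ^ 3 : ℝ) : ℂ) * (Ω x * ((1 / x.1 : ℝ) : ℂ)))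
      ((integrable_indicator_iff (measurableSet_chartBox _)).2
        (integrableOn_const (volume_chartBox_ne_top _))) (Filter.Eventually.of_forall fun x => ?_)
    · refine h1.trans ?_
      rw [integral_indicator (measurableSet_chartBox _), setIntegral_const, smul_eq_mul]
      gcongr
      exact volume_chartBox_le hT
    · by_cases hx : x ∈ chartBox T
      · rw [Set.indicator_of_mem hx]
        have e : (n : ℂ)⁻¹ * (((cnt x : ℕ) : ℂ) * Ω x) -
          ((κ * δ ^ 3 : ℝ) : ℂ) * (Ω x * ((1 / x.1 : ℝ) : ℂ)) =
          Ω x * (((cnt x : ℝ) / n - κ * (δ ^ 3 / x.1) : ℝ) : ℂ) := by push_cast; ring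
        rw [e, norm_mul, Complex.norm_real, Real.norm_eq_abs,
          show cnt x = _ from card_latticeFinset_filter hn hq hT hδ1 hx]
        gcongr
        · exact hΩB x
        · exact (H1 n q hn hq T δ hT hδ0 hδT x hx).1
      · rw [Set.indicator_of_notMem hx, hΩT x hx]; simp
  have hδC : ((δ ^ 3 : ℝ) : ℂ) ≠ 0 := by exact_mod_cast hδ3.ne'
  have hnC : (n : ℂ) ≠ 0 := by exact_mod_cast hn.ne'
  set Z := ∑ p ∈ S, Ω (latticeScale n q p) with hZ
  set W := ∫ x, Ω x * ((1 / x.1 : ℝ) : ℂ) with hW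
  set Y := ∫ x, ((cnt x : ℕ) : ℂ) * Ω x with hY
  have step3 : δ ^ 3 * ‖(n : ℂ)⁻¹ * Z - (κ : ℂ) * W‖ ≤
      (n : ℝ)⁻¹ * (S.card * (δ ^ 3 * (L * δ))) + (4 * T ^ 3) * (B * E) := by
    rw [I1, ← mul_sum] at step1
    have e : ((δ ^ 3 : ℝ) : ℂ) * ((n : ℂ)⁻¹ * Z - (κ : ℂ) * W) =
        (n : ℂ)⁻¹ * (((δ ^ 3 : ℝ) : ℂ) * Z - Y) + ((n : ℂ)⁻¹ * Y - ((κ * δ ^ 3 : ℝ) : ℂ) * W) := by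
      push_cast; ring
    calc _ = ‖((δ ^ 3 : ℝ) : ℂ) * ((n : ℂ)⁻¹ * Z - (κ : ℂ) * W)‖ := by
          rw [norm_mul, Complex.norm_real, Real.norm_eq_abs, abs_of_pos hδ3]
      _ ≤ _ := by
          rw [e]
          refine (norm_add_le _ _).trans (add_le_add ?_ step2)
          rw [norm_mul, norm_inv, Complex.norm_natCast]
          gcongr
  have hcard : (n : ℝ)⁻¹ * S.card ≤ C2 * (2 * T) ^ 8 := by
    rw [inv_mul_le_iff₀ hn0]
    have := H2 n q hn hq (2 * T) (by linarith)
    linarith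
  have hnδ : (n : ℝ) ^ (-(1 / 64) : ℝ) ≤ 8 * T ^ 3 * δ ^ 3 * ρ := by
    have e : 8 * T ^ 3 * δ ^ 3 * ρ = ρ ^ 4 := by
      rw [hδ]; field_simp; ring
    rw [e, hρ, ← Real.rpow_natCast, ← Real.rpow_mul (by linarith)]
    exact Real.rpow_le_rpow_of_exponent_le hnR (by norm_num)
  have hEle : E ≤ δ ^ 3 * (C1 * 9 * T ^ 5 * ρ) := by
    have hδ4 : δ ^ 4 ≤ T ^ 3 * δ ^ 3 * ρ := by
      calc δ ^ 4 = 1 * δ ^ 3 * δ := by ring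
        _ ≤ T ^ 3 * δ ^ 3 * ρ := by
          gcongr
          · exact one_le_pow₀ hT
          · linarith
    calc E ≤ C1 * T ^ 2 * (8 * T ^ 3 * δ ^ 3 * ρ + T ^ 3 * δ ^ 3 * ρ) := by rw [hE]; gcongr
      _ = _ := by ring
  have : δ ^ 3 * ‖(n : ℂ)⁻¹ * Z - (κ : ℂ) * W‖ ≤
      δ ^ 3 * ((128 * C2 + 36 * C1) * T ^ 8 * (B + L) * ρ) := by
    refine step3.trans ?_
    calc _ = ((n : ℝ)⁻¹ * S.card) * (δ ^ 3 * (L * δ)) + (4 * T ^ 3) * (B * E) := by ring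
      _ ≤ (C2 * (2 * T) ^ 8) * (δ ^ 3 * (L * (ρ / 2))) +
          (4 * T ^ 3) * (B * (δ ^ 3 * (C1 * 9 * T ^ 5 * ρ))) := by gcongr
      _ = δ ^ 3 * ((128 * C2 * T ^ 8 * L + 36 * C1 * T ^ 8 * B) * ρ) := by ring
      _ ≤ δ ^ 3 * (((128 * C2 + 36 * C1) * T ^ 8 * (B + L)) * ρ) := by
          gcongr
          have h1 : 0 ≤ C2 * T ^ 8 * B := by positivity
          have h2 : 0 ≤ C1 * T ^ 8 * L := by positivity
          nlinarith
  exact le_of_mul_le_mul_left this hδ3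

/-- The entrywise embedding of `SL₂(ℤ)` in `SL₂(ℝ)`. -/
def emb : Matrix.SpecialLinearGroup (Fin 2) ℤ →* SL2R :=
  Matrix.SpecialLinearGroup.map (Int.castRingHom ℝ)

lemma emb_apply (γ : Matrix.SpecialLinearGroup (Fin 2) ℤ) (i j : Fin 2) :
    (emb γ) i j = (γ i j : ℝ) := rfl

/-- The sum of the absolute values of the entries. -/
def entryNorm (A : Matrix (Fin 2) (Fin 2) ℝ) : ℝ := |A 0 0| + |A 0 1| + |A 1 0| + |A 1 1|

lemma entryNorm_nonneg (A : Matrix (Fin 2) (Fin 2) ℝ) : 0 ≤ entryNorm A := by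
  unfold entryNorm; positivity

lemma abs_apply_le_entryNorm (A : Matrix (Fin 2) (Fin 2) ℝ) (i j : Fin 2) :
    |A i j| ≤ entryNorm A := by
  unfold entryNorm
  have := abs_nonneg (A 0 0)
  have := abs_nonneg (A 0 1)
  have := abs_nonneg (A 1 0)
  have := abs_nonneg (A 1 1)
  fin_cases i <;> fin_cases j <;> simp <;> linarith

lemma entryNorm_mul_le (A B : Matrix (Fin 2) (Fin 2) ℝ) :
    entryNorm (A * B) ≤ entryNorm A * entryNorm B := by
  have key : ∀ a b c d : ℝ, |a * b + c * d| ≤ |a| * |b| + |c| * |d| := fun a b c d => by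
    refine (abs_add_le _ _).trans_eq ?_
    rw [abs_mul, abs_mul]
  simp only [entryNorm, Matrix.mul_apply, Fin.sum_univ_two]
  have h1 := key (A 0 0) (B 0 0) (A 0 1) (B 1 0)
  have h2 := key (A 0 0) (B 0 1) (A 0 1) (B 1 1)
  have h3 := key (A 1 0) (B 0 0) (A 1 1) (B 1 0)
  have h4 := key (A 1 0) (B 0 1) (A 1 1) (B 1 1)
  have p : ∀ i j k l, 0 ≤ |A i j| * |B k l| := fun _ _ _ _ => by positivity
  have := p 0 0 1 0
  have := p 0 0 1 1
  have := p 0 1 0 0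
  have := p 0 1 0 1
  have := p 1 0 1 0
  have := p 1 0 1 1
  have := p 1 1 0 0
  have := p 1 1 0 1
  nlinarith

lemma entryNorm_add_le (A B : Matrix (Fin 2) (Fin 2) ℝ) :
    entryNorm (A + B) ≤ entryNorm A + entryNorm B := by
  simp only [entryNorm, Matrix.add_apply]
  have := abs_add_le (A 0 0) (B 0 0)
  have := abs_add_le (A 0 1) (B 0 1)
  have := abs_add_le (A 1 0) (B 1 0)
  have := abs_add_le (A 1 1) (B 1 1)
  linarith

lemma entryNorm_neg (A : Matrix (Fin 2) (Fin 2) ℝ) : entryNorm (-A) = entryNorm A := by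
  simp [entryNorm]

lemma entryNorm_sub_comm (A B : Matrix (Fin 2) (Fin 2) ℝ) :
    entryNorm (A - B) = entryNorm (B - A) := by
  rw [← entryNorm_neg, neg_sub]

lemma abs_entryNorm_sub_le (A B : Matrix (Fin 2) (Fin 2) ℝ) :
    |entryNorm A - entryNorm B| ≤ entryNorm (A - B) := by
  rw [abs_le]
  have h1 := entryNorm_add_le (A - B) B
  have h2 := entryNorm_add_le (B - A) A
  rw [sub_add_cancel] at h1 h2
  rw [entryNorm_sub_comm] at h2
  constructor <;> linarith

lemma det_eq_one (g : SL2R) : g 0 0 * g 1 1 - g 0 1 * g 1 0 = 1 := by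
  have := g.det_coe
  rwa [Matrix.det_fin_two] at this

lemma coe_inv_apply (g : SL2R) :
    ((g⁻¹ : SL2R) : Matrix (Fin 2) (Fin 2) ℝ) = !![g 1 1, -g 0 1; -g 1 0, g 0 0] := by
  rw [Matrix.SpecialLinearGroup.coe_inv, Matrix.adjugate_fin_two]

lemma entryNorm_inv (g : SL2R) : entryNorm ((g⁻¹ : SL2R) : Matrix (Fin 2) (Fin 2) ℝ) =
    entryNorm (g : Matrix (Fin 2) (Fin 2) ℝ) := by
  rw [coe_inv_apply]
  simp [entryNorm]
  ring

lemma one_le_entryNorm (g : SL2R) : 1 ≤ entryNorm (g : Matrix (Fin 2) (Fin 2) ℝ) := by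
  have h := det_eq_one g
  have h1 : 1 ≤ |g 0 0| * |g 1 1| + |g 0 1| * |g 1 0| := by
    rw [← abs_mul, ← abs_mul]
    have := le_abs_self (g 0 0 * g 1 1)
    have := neg_abs_le (g 0 1 * g 1 0)
    linarith
  unfold entryNorm
  have := abs_nonneg (g 0 0)
  have := abs_nonneg (g 0 1)
  have := abs_nonneg (g 1 0)
  have := abs_nonneg (g 1 1)
  nlinarith [mul_nonneg (abs_nonneg (g 0 0)) (abs_nonneg (g 0 1)),
    mul_nonneg (abs_nonneg (g 0 0)) (abs_nonneg (g 1 0)),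
    mul_nonneg (abs_nonneg (g 1 1)) (abs_nonneg (g 0 1)),
    mul_nonneg (abs_nonneg (g 1 1)) (abs_nonneg (g 1 0))]

/-- The point `u_{t / n} a_{√n}⁻¹`. -/
def horoPt (n : ℕ) (t : ℝ) : SL2R := uElt (t / n) * (aElt (Real.sqrt n))⁻¹

lemma coe_horoPt {n : ℕ} (hn : 0 < n) (t : ℝ) :
    ((horoPt n t : SL2R) : Matrix (Fin 2) (Fin 2) ℝ) =
      !![1 / Real.sqrt n, t / Real.sqrt n; 0, Real.sqrt n] := by
  have h0 : Real.sqrt n ≠ 0 := by positivity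
  have h1 : Real.sqrt n * Real.sqrt n = n := Real.mul_self_sqrt (by positivity)
  rw [horoPt, Matrix.SpecialLinearGroup.coe_mul, coe_inv_apply]
  have h2 : ((aElt (Real.sqrt n) : SL2R) : Matrix (Fin 2) (Fin 2) ℝ) =
    !![Real.sqrt n, 0; 0, (Real.sqrt n)⁻¹] :=
    congrArg Subtype.val (dif_neg h0)
  rw [uElt]
  ext i j
  fin_cases i <;> fin_cases j <;> simp [Matrix.mul_apply, Fin.sum_univ_two, h2]
  field_simp
  rw [sq, h1]

/-- Invariance under left translation by a group of integer matrices. -/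
def LeftInv (Δ : Subgroup (Matrix.SpecialLinearGroup (Fin 2) ℤ)) {β : Type*} (F : SL2R → β) :
    Prop := ∀ γ ∈ Δ, ∀ g, F (emb γ * g) = F g

/-- `F` is bounded by `M` and `M`-Lipschitz for right translations. -/
def Reg (M : ℝ) (F : SL2R → ℂ) : Prop :=
  (∀ g, ‖F g‖ ≤ M) ∧
    ∀ g η : SL2R, ‖F (g * η) - F g‖ ≤ M * entryNorm ((η : Matrix (Fin 2) (Fin 2) ℝ) - 1)

lemma Reg.nonneg {M : ℝ} {F : SL2R → ℂ} (h : Reg M F) : 0 ≤ M :=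
  (norm_nonneg _).trans (h.1 1)

lemma Reg.norm_sub_le {M : ℝ} {F : SL2R → ℂ} (h : Reg M F) (g g' : SL2R) :
    ‖F g' - F g‖ ≤ M * (entryNorm (g : Matrix (Fin 2) (Fin 2) ℝ) *
      entryNorm ((g' : Matrix (Fin 2) (Fin 2) ℝ) - g)) := by
  have h1 := h.2 g (g⁻¹ * g')
  rw [mul_inv_cancel_left] at h1
  refine h1.trans (mul_le_mul_of_nonneg_left ?_ h.nonneg)
  have e : ((g⁻¹ * g' : SL2R) : Matrix (Fin 2) (Fin 2) ℝ) - 1 =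
      ((g⁻¹ : SL2R) : Matrix (Fin 2) (Fin 2) ℝ) * ((g' : Matrix (Fin 2) (Fin 2) ℝ) - g) := by
    rw [mul_sub, Matrix.SpecialLinearGroup.coe_mul, ← Matrix.SpecialLinearGroup.coe_mul g⁻¹ g,
      inv_mul_cancel, Matrix.SpecialLinearGroup.coe_one]
  rw [e, ← entryNorm_inv g]
  exact entryNorm_mul_le _ _

/-- The average of `F` over the points `u_{j / n} a_{√n}⁻¹`. -/
def horoAvg (n : ℕ) (F : SL2R → ℂ) : ℂ := (n : ℂ)⁻¹ * ∑ j ∈ range n, F (horoPt n j)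

/-- The element of `SL₂(ℝ)` with given first row and lower left entry. -/
def chart (x : ℝ × ℝ × ℝ) : SL2R :=
  if h : x.1 = 0 then 1 else
    ⟨!![x.1, x.2.1; x.2.2, (1 + x.2.1 * x.2.2) / x.1], by
      rw [Matrix.det_fin_two_of]; field_simp; ring⟩

lemma coe_chart {x : ℝ × ℝ × ℝ} (h : x.1 ≠ 0) : ((chart x : SL2R) : Matrix (Fin 2) (Fin 2) ℝ) =
    !![x.1, x.2.1; x.2.2, (1 + x.2.1 * x.2.2) / x.1] :=
  congrArg Subtype.val (dif_neg h)

lemma chart_entries {g : SL2R} (h : g 0 0 ≠ 0) : chart (g 0 0, g 0 1, g 1 0) = g := by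
  apply Subtype.ext
  rw [coe_chart h]
  have h1 := det_eq_one g
  ext i j
  fin_cases i <;> fin_cases j <;> simp
  rw [div_eq_iff h]
  linarith

end

section
open Finset MeasureTheory

lemma abs_clamp_sub_le (a b : ℝ) : |min 1 (max 0 a) - min 1 (max 0 b)| ≤ |a - b| := by
  refine (abs_min_sub_min_le_max _ _ _ _).trans ?_
  simp only [sub_self, abs_zero]
  refine max_le (abs_nonneg _) ((abs_max_sub_max_le_max _ _ _ _).trans ?_)
  simp

/-- A Lipschitz cutoff to matrices of norm at most `3 R` with upper left entry at least
`1 / (8 R)`. -/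
def bump (R : ℝ) (A : Matrix (Fin 2) (Fin 2) ℝ) : ℝ :=
  min 1 (max 0 (8 * R * A 0 0 - 1)) * min 1 (max 0 (3 - entryNorm A / R))

lemma bump_nonneg (R : ℝ) (A : Matrix (Fin 2) (Fin 2) ℝ) : 0 ≤ bump R A := by
  unfold bump; positivity

lemma bump_le_one (R : ℝ) (A : Matrix (Fin 2) (Fin 2) ℝ) : bump R A ≤ 1 :=
  mul_le_one₀ (min_le_left _ _) (by positivity) (min_le_left _ _)

lemma bump_eq_one {R : ℝ} (hR : 0 < R) {A : Matrix (Fin 2) (Fin 2) ℝ} (h1 : 1 / (4 * R) ≤ A 0 0)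
    (h2 : entryNorm A ≤ 2 * R) : bump R A = 1 := by
  have h3 : entryNorm A / R ≤ 2 := by rwa [div_le_iff₀ hR]
  have h4 : 1 ≤ A 0 0 * (4 * R) := by rwa [div_le_iff₀ (by positivity)] at h1
  rw [bump, max_eq_right (by linarith), max_eq_right (by linarith), min_eq_left (by linarith),
    min_eq_left (by linarith), one_mul]

lemma of_bump_ne_zero {R : ℝ} (hR : 0 < R) {A : Matrix (Fin 2) (Fin 2) ℝ} (h : bump R A ≠ 0) :
    1 / (8 * R) < A 0 0 ∧ entryNorm A < 3 * R := by
  constructor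
  · by_contra! h1
    rw [le_div_iff₀ (by positivity)] at h1
    apply h
    rw [bump, max_eq_left (by linarith)]
    simp
  · by_contra! h1
    rw [← le_div_iff₀ hR] at h1
    apply h
    rw [bump, max_eq_left (a := (0 : ℝ)) (b := 3 - entryNorm A / R) (by linarith)]
    simp

lemma abs_bump_sub_le {R : ℝ} (hR : 1 ≤ R) (A B : Matrix (Fin 2) (Fin 2) ℝ) :
    |bump R A - bump R B| ≤ 9 * R * entryNorm (A - B) := by
  have hR0 : 0 < R := by linarith
  set a := min 1 (max 0 (8 * R * A 0 0 - 1))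
  set b := min 1 (max 0 (8 * R * B 0 0 - 1))
  set c := min 1 (max 0 (3 - entryNorm A / R))
  set d := min 1 (max 0 (3 - entryNorm B / R))
  have h1 : |a - b| ≤ 8 * R * entryNorm (A - B) := by
    refine (abs_clamp_sub_le _ _).trans ?_
    have := abs_apply_le_entryNorm (A - B) 0 0
    rw [Matrix.sub_apply] at this
    rw [show 8 * R * A 0 0 - 1 - (8 * R * B 0 0 - 1) = 8 * R * (A 0 0 - B 0 0) by ring, abs_mul,
      abs_of_pos (by positivity : 0 < 8 * R)]
    gcongr
  have h2 : |c - d| ≤ R * entryNorm (A - B) := by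
    refine (abs_clamp_sub_le _ _).trans ?_
    rw [show 3 - entryNorm A / R - (3 - entryNorm B / R) = (entryNorm B - entryNorm A) / R by ring,
      abs_div, abs_of_pos hR0, div_le_iff₀ hR0, entryNorm_sub_comm]
    refine (abs_entryNorm_sub_le _ _).trans ?_
    have := entryNorm_nonneg (B - A)
    have : 1 ≤ R * R := by nlinarith
    nlinarith
  have hc : |c| ≤ 1 := by rw [abs_of_nonneg (by positivity)]; exact min_le_left _ _
  have hb : |b| ≤ 1 := by rw [abs_of_nonneg (by positivity)]; exact min_le_left _ _
  show |a * c - b * d| ≤ _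
  rw [show a * c - b * d = (a - b) * c + b * (c - d) by ring]
  refine (abs_add_le _ _).trans ?_
  rw [abs_mul, abs_mul]
  have := mul_le_mul h1 hc (abs_nonneg _) (by have := entryNorm_nonneg (A - B); positivity)
  have := mul_le_mul hb h2 (abs_nonneg _) zero_le_one
  linarith

variable {Δ : Subgroup (Matrix.SpecialLinearGroup (Fin 2) ℤ)}

lemma finite_entryNorm_le (Δ : Subgroup (Matrix.SpecialLinearGroup (Fin 2) ℤ)) (K : ℝ) :
    {γ : Δ | entryNorm (emb γ : Matrix (Fin 2) (Fin 2) ℝ) ≤ K}.Finite ∧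
    (0 ≤ K → ({γ : Δ | entryNorm (emb γ : Matrix (Fin 2) (Fin 2) ℝ) ≤ K}.ncard : ℝ) ≤
      (2 * K + 1) ^ 4) := by
  set I := Finset.Icc (-⌊K⌋) ⌊K⌋ with hI
  set P := I ×ˢ I ×ˢ I ×ˢ I with hP
  let φ : Δ → ℤ × ℤ × ℤ × ℤ := fun γ => (γ.1 0 0, γ.1 0 1, γ.1 1 0, γ.1 1 1)
  have hφ : Function.Injective φ := by
    intro γ γ' h
    simp only [φ, Prod.mk.injEq] at h
    apply Subtype.ext
    apply Subtype.ext
    ext i j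
    fin_cases i <;> fin_cases j <;> simp_all
  have hmaps : ∀ γ ∈ {γ : Δ | entryNorm (emb γ : Matrix (Fin 2) (Fin 2) ℝ) ≤ K},
      φ γ ∈ (P : Set (ℤ × ℤ × ℤ × ℤ)) := by
    intro γ hγ
    have key : ∀ i j, γ.1 i j ∈ I := by
      intro i j
      have h := (abs_apply_le_entryNorm (emb γ : Matrix (Fin 2) (Fin 2) ℝ) i j).trans hγ
      rw [emb_apply] at h
      rw [hI, Finset.mem_Icc, ← abs_le, Int.le_floor]
      exact_mod_cast h
    simp only [hP, φ, Finset.coe_product, Set.mem_prod, Finset.mem_coe]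
    exact ⟨key _ _, key _ _, key _ _, key _ _⟩
  have hfin := Set.Finite.of_injOn (s := {γ : Δ | entryNorm (emb γ : Matrix (Fin 2) (Fin 2) ℝ) ≤ K})
    hmaps hφ.injOn P.finite_toSet
  refine ⟨hfin, fun hK => ?_⟩
  have h1 := Set.ncard_le_ncard_of_injOn φ hmaps hφ.injOn P.finite_toSet
  rw [Set.ncard_coe_finset] at h1
  have h2 : (I.card : ℝ) ≤ 2 * K + 1 := by
    rw [hI, Int.card_Icc]
    have h3 : 0 ≤ ⌊K⌋ := Int.floor_nonneg.2 hK
    have h4 : ((⌊K⌋ + 1 - -⌊K⌋).toNat : ℤ) = 2 * ⌊K⌋ + 1 := by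
      rw [Int.toNat_of_nonneg (by linarith)]; ring
    have h5 : (((⌊K⌋ + 1 - -⌊K⌋).toNat : ℕ) : ℝ) = 2 * ⌊K⌋ + 1 := by exact_mod_cast h4
    rw [h5]
    have := Int.floor_le K
    linarith
  calc _ ≤ (P.card : ℝ) := by exact_mod_cast h1
    _ = (I.card : ℝ) ^ 4 := by
      rw [hP]; simp only [Finset.card_product]; push_cast; ring
    _ ≤ _ := by gcongr

/-- The elements of `Δ` of norm at most `K`. -/
def normBall (Δ : Subgroup (Matrix.SpecialLinearGroup (Fin 2) ℤ)) (K : ℝ) : Finset Δ :=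
  (finite_entryNorm_le Δ K).1.toFinset

lemma mem_normBall {K : ℝ} {γ : Δ} :
    γ ∈ normBall Δ K ↔ entryNorm (emb γ : Matrix (Fin 2) (Fin 2) ℝ) ≤ K := by
  simp [normBall]

lemma card_normBall_le {K : ℝ} (hK : 0 ≤ K) : ((normBall Δ K).card : ℝ) ≤ (2 * K + 1) ^ 4 := by
  rw [normBall, ← Set.ncard_eq_toFinset_card _ (finite_entryNorm_le Δ K).1]
  exact (finite_entryNorm_le Δ K).2 hK

/-- If `γ g` and `g` are bounded then so is `γ`. -/
lemma entryNorm_emb_le (γ : Matrix.SpecialLinearGroup (Fin 2) ℤ) (g : SL2R) :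
    entryNorm (emb γ : Matrix (Fin 2) (Fin 2) ℝ) ≤
      entryNorm ((emb γ * g : SL2R) : Matrix (Fin 2) (Fin 2) ℝ) *
        entryNorm (g : Matrix (Fin 2) (Fin 2) ℝ) := by
  conv_lhs => rw [← mul_inv_cancel_right (emb γ) g]
  rw [Matrix.SpecialLinearGroup.coe_mul (emb γ * g), ← entryNorm_inv g]
  exact entryNorm_mul_le _ _

lemma mem_normBall_of_ne_zero {R L : ℝ} (hR : 0 < R) {g : SL2R} (hg : entryNorm g.1 ≤ L) {γ : Δ}
    (h : bump R (emb γ * g).1 ≠ 0) : γ ∈ normBall Δ (3 * R * L) := by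
  rw [mem_normBall]
  refine (entryNorm_emb_le γ g).trans ?_
  exact mul_le_mul (of_bump_ne_zero hR h).2.le hg (entryNorm_nonneg _) (by positivity)

/-- The sum of the cutoff over an orbit. -/
def foldSum (Δ : Subgroup (Matrix.SpecialLinearGroup (Fin 2) ℤ)) (R : ℝ) (g : SL2R) : ℝ :=
  ∑' γ : Δ, bump R (emb γ * g).1

lemma foldSum_eq_sum {R L : ℝ} (hR : 0 < R) {g : SL2R} (hg : entryNorm g.1 ≤ L) :
    foldSum Δ R g = ∑ γ ∈ normBall Δ (3 * R * L), bump R (emb γ * g).1 :=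
  tsum_eq_sum fun _ hγ => by
    by_contra h
    exact hγ (mem_normBall_of_ne_zero hR hg h)

lemma leftInv_foldSum (R : ℝ) : LeftInv Δ (foldSum Δ R) := by
  intro γ hγ g
  rw [foldSum, foldSum, ← (Equiv.mulRight (⟨γ, hγ⟩ : Δ)).tsum_eq fun τ : Δ => bump R (emb τ * g).1]
  refine tsum_congr fun τ => ?_
  simp only [Equiv.coe_mulRight, Subgroup.coe_mul, map_mul, mul_assoc]

lemma abs_foldSum_sub_le {R L : ℝ} (hR : 1 ≤ R) {g g' : SL2R} (hg : entryNorm g.1 ≤ L)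
    (hg' : entryNorm g'.1 ≤ L) :
    |foldSum Δ R g - foldSum Δ R g'| ≤ 9 ^ 4 * 27 * R ^ 6 * L ^ 5 * entryNorm (g.1 - g'.1) := by
  have hR0 : 0 < R := by linarith
  have hL : 1 ≤ L := (one_le_entryNorm g).trans hg
  rw [foldSum_eq_sum hR0 hg, foldSum_eq_sum hR0 hg', ← sum_sub_distrib]
  have hN := entryNorm_nonneg (g.1 - g'.1)
  have hRL : 1 ≤ R * L := by nlinarith
  calc _ ≤ ∑ γ ∈ normBall Δ (3 * R * L), |bump R (emb γ * g).1 - bump R (emb γ * g').1| :=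
        abs_sum_le_sum_abs _ _
    _ ≤ ∑ γ ∈ normBall Δ (3 * R * L), 9 * R * (3 * R * L * entryNorm (g.1 - g'.1)) := by
        refine sum_le_sum fun γ hγ => ?_
        rw [mem_normBall] at hγ
        refine (abs_bump_sub_le hR _ _).trans ?_
        gcongr
        rw [show ((emb γ * g : SL2R)).1 = (emb γ).1 * g.1 from rfl,
          show ((emb γ * g' : SL2R)).1 = (emb γ).1 * g'.1 from rfl, ← mul_sub]
        refine (entryNorm_mul_le _ _).trans ?_
        gcongr
    _ ≤ (2 * (3 * R * L) + 1) ^ 4 * (9 * R * (3 * R * L * entryNorm (g.1 - g'.1))) := by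
        rw [sum_const, nsmul_eq_mul]
        gcongr
        exact card_normBall_le (by positivity)
    _ ≤ (9 * (R * L)) ^ 4 * (9 * R * (3 * R * L * entryNorm (g.1 - g'.1))) := by
        gcongr
        linarith
    _ = _ := by ring

/-- A partition of unity for the action of `Δ` on a large part of `SL₂(ℝ)`. -/
def weight (Δ : Subgroup (Matrix.SpecialLinearGroup (Fin 2) ℤ)) (R : ℝ) (g : SL2R) : ℝ :=
  bump R g.1 / max 1 (foldSum Δ R g)

lemma weight_nonneg (R : ℝ) (g : SL2R) : 0 ≤ weight Δ R g :=
  div_nonneg (bump_nonneg _ _) (by positivity)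

lemma weight_le_one (R : ℝ) (g : SL2R) : weight Δ R g ≤ 1 :=
  (div_le_one (by positivity)).2 ((bump_le_one _ _).trans (le_max_left _ _))

lemma of_weight_ne_zero {R : ℝ} (hR : 0 < R) {g : SL2R} (h : weight Δ R g ≠ 0) :
    1 / (8 * R) < g 0 0 ∧ entryNorm g.1 < 3 * R :=
  of_bump_ne_zero hR fun h' => h (by rw [weight, h', zero_div])

lemma abs_weight_sub_le {R L : ℝ} (hR : 1 ≤ R) {g g' : SL2R} (hg : entryNorm g.1 ≤ L)
    (hg' : entryNorm g'.1 ≤ L) :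
    |weight Δ R g - weight Δ R g'| ≤ 10 ^ 6 * R ^ 6 * L ^ 5 * entryNorm (g.1 - g'.1) := by
  have hL : 1 ≤ L := (one_le_entryNorm g).trans hg
  have hN := entryNorm_nonneg (g.1 - g'.1)
  set A := max 1 (foldSum Δ R g)
  set B := max 1 (foldSum Δ R g')
  have hA : 1 ≤ A := le_max_left _ _
  have hB : 1 ≤ B := le_max_left _ _
  have hAB : |A - B| ≤ |foldSum Δ R g - foldSum Δ R g'| := by
    refine (abs_max_sub_max_le_max _ _ _ _).trans ?_
    simp
  have h1 := bump_nonneg R g'.1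
  have h2 := bump_le_one R g'.1
  show |bump R g.1 / A - bump R g'.1 / B| ≤ _
  have e : bump R g.1 / A - bump R g'.1 / B =
      (bump R g.1 - bump R g'.1) / A + bump R g'.1 * (B - A) / (A * B) := by
    field_simp; ring
  have hAB1 : 1 ≤ A * B := by nlinarith
  calc _ ≤ |bump R g.1 - bump R g'.1| + |A - B| := by
        rw [e]
        refine (abs_add_le _ _).trans (add_le_add ?_ ?_)
        · rw [abs_div, abs_of_pos (by linarith : 0 < A)]
          exact div_le_self (abs_nonneg _) hA
        · rw [abs_div, abs_of_pos (by linarith : 0 < A * B), abs_mul, abs_of_nonneg h1,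
            abs_sub_comm B A]
          refine (div_le_self (by positivity) hAB1).trans ?_
          exact mul_le_of_le_one_left (abs_nonneg _) h2
    _ ≤ 9 * R * entryNorm (g.1 - g'.1) +
        9 ^ 4 * 27 * R ^ 6 * L ^ 5 * entryNorm (g.1 - g'.1) :=
        add_le_add (abs_bump_sub_le hR _ _) (hAB.trans (abs_foldSum_sub_le hR hg hg'))
    _ ≤ 9 * (R ^ 6 * L ^ 5) * entryNorm (g.1 - g'.1) +
        9 ^ 4 * 27 * R ^ 6 * L ^ 5 * entryNorm (g.1 - g'.1) := by
        gcongr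
        calc R = R ^ 1 * 1 := by ring
          _ ≤ R ^ 6 * L ^ 5 := by
            gcongr ?_ * ?_
            · exact pow_le_pow_right₀ hR (by norm_num)
            · exact one_le_pow₀ hL
    _ ≤ _ := by
        have : 0 ≤ R ^ 6 * L ^ 5 * entryNorm (g.1 - g'.1) := by positivity
        nlinarith

lemma tsum_weight (R : ℝ) (g : SL2R) :
    ∑' γ : Δ, weight Δ R (emb γ * g) = foldSum Δ R g / max 1 (foldSum Δ R g) := by
  have h : ∀ γ : Δ, weight Δ R (emb γ * g) =
      bump R (emb γ * g).1 / max 1 (foldSum Δ R g) := fun γ => by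
    rw [weight, leftInv_foldSum R γ γ.2 g]
  simp_rw [h]
  rw [tsum_div_const, foldSum]

lemma tsum_weight_nonneg (R : ℝ) (g : SL2R) : 0 ≤ ∑' γ : Δ, weight Δ R (emb γ * g) :=
  tsum_nonneg fun _ => weight_nonneg _ _

lemma tsum_weight_le_one (R : ℝ) (g : SL2R) : ∑' γ : Δ, weight Δ R (emb γ * g) ≤ 1 := by
  rw [tsum_weight]
  exact (div_le_one (by positivity)).2 (le_max_right _ _)

/-- The translates under `Δ` of the matrices of norm at most `R`. -/
def orbitBall (Δ : Subgroup (Matrix.SpecialLinearGroup (Fin 2) ℤ)) (R : ℝ) : Set SL2R :=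
  {g | ∃ γ ∈ Δ, entryNorm (emb γ * g).1 ≤ R}

lemma coe_emb (γ : Matrix.SpecialLinearGroup (Fin 2) ℤ) :
    (emb γ).1 = !![(γ 0 0 : ℝ), γ 0 1; γ 1 0, γ 1 1] := by
  ext i j
  fin_cases i <;> fin_cases j <;> rfl

lemma tsum_weight_eq_one (hΔ : ∀ γ : Matrix.SpecialLinearGroup (Fin 2) ℤ, γ 1 0 = 0 → γ ∈ Δ)
    {R : ℝ} (hR : 0 < R) {g : SL2R} (hg : g ∈ orbitBall Δ R) :
    ∑' γ : Δ, weight Δ R (emb γ * g) = 1 := by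
  obtain ⟨γ, hγ, hN⟩ := hg
  rw [tsum_weight]
  suffices h : 1 ≤ foldSum Δ R g by
    rw [max_eq_right h, div_self (by linarith)]
  rw [← leftInv_foldSum R γ hγ]
  set x := emb γ * g
  have key : ∃ τ ∈ Δ, 1 / (4 * R) ≤ (emb τ * x).1 0 0 ∧ entryNorm (emb τ * x).1 ≤ 2 * R := by
    have hdet := det_eq_one x
    have hN' : |x 0 0| + |x 0 1| + |x 1 0| + |x 1 1| ≤ R := hN
    have key : ∀ e f : ℤ, (e = 1 ∨ e = -1) → (f = 0 ∨ f = 1 ∨ f = -1) →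
        1 / (4 * R) ≤ e * x 0 0 + f * x 1 0 →
        ∃ τ ∈ Δ, 1 / (4 * R) ≤ (emb τ * x).1 0 0 ∧ entryNorm (emb τ * x).1 ≤ 2 * R := by
      intro e f he hf h
      let τ : Matrix.SpecialLinearGroup (Fin 2) ℤ := ⟨!![e, f; 0, e], by
        rw [Matrix.det_fin_two_of]; rcases he with rfl | rfl <;> norm_num⟩
      have e1 : (emb τ * x).1 = (emb τ).1 * x.1 := rfl
      have ee : |(e : ℝ)| = 1 := by rcases he with rfl | rfl <;> norm_num
      have ef : |(f : ℝ)| ≤ 1 := by rcases hf with rfl | rfl | rfl <;> norm_num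
      refine ⟨τ, hΔ τ (by simp [τ]), ?_, ?_⟩
      · rw [e1, coe_emb, Matrix.mul_apply, Fin.sum_univ_two]
        simpa [τ] using h
      · rw [e1, coe_emb]
        have e2 : !![(τ 0 0 : ℝ), τ 0 1; τ 1 0, τ 1 1] * x.1 =
            !![e * x 0 0 + f * x 1 0, e * x 0 1 + f * x 1 1; e * x 1 0, e * x 1 1] := by
          ext i j
          fin_cases i <;> fin_cases j <;> simp [τ, Matrix.mul_apply, Fin.sum_univ_two]
        rw [e2]
        simp only [entryNorm, Matrix.of_apply, Matrix.cons_val', Matrix.cons_val_zero,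
          Matrix.cons_val_one, Matrix.cons_val_fin_one]
        have b1 : ∀ u v : ℝ, |e * u + f * v| ≤ |u| + |v| := fun u v => by
          refine (abs_add_le _ _).trans ?_
          rw [abs_mul, abs_mul, ee, one_mul]
          have := mul_le_of_le_one_left (abs_nonneg v) ef
          linarith
        have b2 : ∀ u : ℝ, |e * u| = |u| := fun u => by rw [abs_mul, ee, one_mul]
        rw [b2, b2]
        have := b1 (x 0 0) (x 1 0)
        have := b1 (x 0 1) (x 1 1)
        have := abs_nonneg (x 0 0)
        have := abs_nonneg (x 0 1)
        linarith
    by_cases h0 : 1 / (4 * R) ≤ |x 0 0|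
    · rcases le_total 0 (x 0 0) with h | h
      · rw [abs_of_nonneg h] at h0
        exact key 1 0 (by simp) (by simp) (by push_cast; linarith)
      · rw [abs_of_nonpos h] at h0
        exact key (-1) 0 (by simp) (by simp) (by push_cast; linarith)
    · push Not at h0
      have h1 : 3 / (4 * R) ≤ |x 1 0| := by
        have a1 : 1 ≤ |x 0 0| * |x 1 1| + |x 0 1| * |x 1 0| := by
          rw [← abs_mul, ← abs_mul]
          have := le_abs_self (x 0 0 * x 1 1)
          have := neg_abs_le (x 0 1 * x 1 0)
          linarith
        have a2 : |x 1 1| ≤ R := (abs_apply_le_entryNorm x.1 1 1).trans hN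
        have a3 : |x 0 1| ≤ R := (abs_apply_le_entryNorm x.1 0 1).trans hN
        have a4 : |x 0 0| * |x 1 1| ≤ 1 / (4 * R) * R := by gcongr
        have a5 : 1 / (4 * R) * R = 1 / 4 := by field_simp
        have a6 : |x 0 1| * |x 1 0| ≤ R * |x 1 0| := by gcongr
        rw [div_le_iff₀ (by positivity)]
        linarith
      have h3 : 3 / (4 * R) = 3 * (1 / (4 * R)) := by ring
      have h4 : 0 < 1 / (4 * R) := by positivity
      rw [abs_lt] at h0
      rcases le_total 0 (x 1 0) with h | h
      · rw [abs_of_nonneg h] at h1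
        exact key 1 1 (by simp) (by simp) (by push_cast; linarith)
      · rw [abs_of_nonpos h] at h1
        exact key 1 (-1) (by simp) (by simp) (by push_cast; linarith)
  obtain ⟨τ, hτ, h1, h2⟩ := key
  have hs : Summable fun γ : Δ => bump R (emb γ * x).1 :=
    summable_of_ne_finset_zero (s := normBall Δ (3 * R * entryNorm x.1)) fun γ hγ => by
      by_contra h
      exact hγ (mem_normBall_of_ne_zero hR le_rfl h)
  have := hs.le_tsum ⟨τ, hτ⟩ fun _ _ => bump_nonneg _ _
  rwa [bump_eq_one hR h1 h2] at this

end

section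
open Finset MeasureTheory

lemma tsum_emb_eq_sum {β : Type*} [AddCommMonoid β] [TopologicalSpace β]
    {Δ : Subgroup (Matrix.SpecialLinearGroup (Fin 2) ℤ)} {Φ : SL2R → β}
    {K L : ℝ} (hΦ : ∀ g, Φ g ≠ 0 → entryNorm g.1 ≤ K) {g : SL2R} (hg : entryNorm g.1 ≤ L) :
    ∑' γ : Δ, Φ (emb γ * g) = ∑ γ ∈ normBall Δ (K * L), Φ (emb γ * g) := by
  refine tsum_eq_sum fun γ hγ => ?_
  by_contra h
  have h1 := hΦ _ h
  refine hγ (mem_normBall.2 ((entryNorm_emb_le γ g).trans ?_))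
  exact mul_le_mul h1 hg (entryNorm_nonneg _) ((entryNorm_nonneg _).trans h1)

lemma det_int (γ : Matrix.SpecialLinearGroup (Fin 2) ℤ) :
    γ 0 0 * γ 1 1 - γ 0 1 * γ 1 0 = 1 := by
  have := γ.det_coe
  rwa [Matrix.det_fin_two] at this

lemma emb_mul_horoPt {n : ℕ} (hn : 0 < n) (γ : Matrix.SpecialLinearGroup (Fin 2) ℤ) (t : ℝ) :
    (emb γ * horoPt n t).1 0 0 = γ 0 0 / Real.sqrt n ∧
    (emb γ * horoPt n t).1 0 1 = (γ 0 0 * t + γ 0 1 * n) / Real.sqrt n ∧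
    (emb γ * horoPt n t).1 1 0 = γ 1 0 / Real.sqrt n ∧
    (emb γ * horoPt n t).1 1 1 = (γ 1 0 * t + γ 1 1 * n) / Real.sqrt n := by
  have e : (emb γ * horoPt n t).1 = (emb γ).1 * (horoPt n t).1 := rfl
  have h0 : Real.sqrt n ≠ 0 := by positivity
  have h1 : Real.sqrt n * Real.sqrt n = n := Real.mul_self_sqrt (by positivity)
  have h2 : Real.sqrt n = n / Real.sqrt n := by rw [eq_div_iff h0, h1]
  rw [e, coe_horoPt hn, coe_emb]
  simp only [Matrix.mul_apply, Fin.sum_univ_two]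
  refine ⟨?_, ?_, ?_, ?_⟩
  · simp; ring
  · simp; conv_lhs => rw [h2]
    field_simp
    rw [Real.sq_sqrt (by positivity)]; ring
  · simp; ring
  · simp; conv_lhs => rw [h2]
    field_simp
    rw [Real.sq_sqrt (by positivity)]; ring

lemma latticeScale_eq_entries {n q : ℕ} (hn : 0 < n)
    {γ : Matrix.SpecialLinearGroup (Fin 2) ℤ} (hγ : (q : ℤ) ∣ γ 1 0) (j : ℤ) :
    latticeScale n q (γ 0 0, γ 0 0 * j + γ 0 1 * n, γ 1 0 / q) =
      ((emb γ * horoPt n j).1 0 0, (emb γ * horoPt n j).1 0 1, (emb γ * horoPt n j).1 1 0) := by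
  obtain ⟨h1, h2, h3, -⟩ := emb_mul_horoPt hn γ j
  rw [h1, h2, h3, latticeScale]
  have : ((q : ℝ) * ((γ 1 0 / q : ℤ) : ℝ)) = γ 1 0 := by
    have := Int.mul_ediv_cancel' hγ
    exact_mod_cast this
  simp only [this]
  push_cast
  rfl

lemma isLatticePoint_of_gamma {n q : ℕ} {γ : Matrix.SpecialLinearGroup (Fin 2) ℤ}
    (hγ : (q : ℤ) ∣ γ 1 0) (j : ℤ) :
    IsLatticePoint n q (γ 0 0, γ 0 0 * j + γ 0 1 * n, γ 1 0 / q) := by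
  have hd := det_int γ
  have := Int.mul_ediv_cancel' hγ
  rw [IsLatticePoint]
  simp only [this]
  refine ⟨⟨γ 1 1, -γ 0 1, by linarith⟩, ⟨γ 1 1 * n + j * γ 1 0, ?_⟩⟩
  linear_combination (-n : ℤ) * hd

/-- Two integer matrices giving the same lattice point agree, and so do the residues. -/
lemma gamma_inj {n q : ℕ} {γ γ' : Matrix.SpecialLinearGroup (Fin 2) ℤ}
    (hγ : (q : ℤ) ∣ γ 1 0) (hγ' : (q : ℤ) ∣ γ' 1 0) {j j' : ℕ} (hj : j < n) (hj' : j' < n)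
    (h00 : 0 < γ 0 0)
    (h : (γ 0 0, γ 0 0 * (j : ℤ) + γ 0 1 * n, γ 1 0 / (q : ℤ)) =
      (γ' 0 0, γ' 0 0 * (j' : ℤ) + γ' 0 1 * n, γ' 1 0 / (q : ℤ))) : j = j' ∧ γ = γ' := by
  simp only [Prod.mk.injEq] at h
  obtain ⟨h1, h2, h3⟩ := h
  have hd := det_int γ
  have hd' := det_int γ'
  have h10 : γ 1 0 = γ' 1 0 := by
    rw [← Int.mul_ediv_cancel' hγ, h3, Int.mul_ediv_cancel' hγ']
  have h11 : γ 1 0 * j + γ 1 1 * n = γ' 1 0 * j' + γ' 1 1 * n := by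
    refine mul_left_cancel₀ h00.ne' ?_
    rw [← h1] at hd' h2
    rw [← h10] at hd'
    rw [← h10]
    linear_combination (n : ℤ) * hd - (n : ℤ) * hd' + γ 1 0 * h2
  have hdvd : (n : ℤ) ∣ j - j' := by
    have a1 : (n : ℤ) ∣ γ 0 0 * (j - j') := ⟨γ' 0 1 - γ 0 1, by rw [← h1] at h2; linarith⟩
    have a2 : (n : ℤ) ∣ γ 1 0 * (j - j') := ⟨γ' 1 1 - γ 1 1, by rw [← h10] at h11; linarith⟩
    have := (a1.mul_left (γ 1 1)).sub (a2.mul_left (γ 0 1))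
    have e : γ 1 1 * (γ 0 0 * ((j : ℤ) - j')) - γ 0 1 * (γ 1 0 * (j - j')) = j - j' := by
      linear_combination ((j : ℤ) - j') * hd
    rwa [e] at this
  have hjj : j = j' := by
    have h5 : ((j : ℤ) - j') = 0 := by
      refine Int.eq_zero_of_abs_lt_dvd hdvd ?_
      rw [abs_lt]; constructor <;> omega
    omega
  have hn : (n : ℤ) ≠ 0 := by omega
  refine ⟨hjj, ?_⟩
  subst hjj
  have h01 : γ 0 1 = γ' 0 1 := by
    refine mul_right_cancel₀ hn ?_
    rw [← h1] at h2; linarith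
  have h11' : γ 1 1 = γ' 1 1 := by
    refine mul_right_cancel₀ hn ?_
    rw [← h10] at h11; linarith
  apply Subtype.ext
  ext i k
  fin_cases i <;> fin_cases k <;> simpa

lemma gamma_surj {n q : ℕ} (hn : 0 < n) (hq : 0 < q) {p : ℤ × ℤ × ℤ} (hp : IsLatticePoint n q p)
    (h0 : p.1 ≠ 0) : ∃ γ : Matrix.SpecialLinearGroup (Fin 2) ℤ, (q : ℤ) ∣ γ 1 0 ∧
      ∃ j < n, (γ 0 0, γ 0 0 * (j : ℤ) + γ 0 1 * n, γ 1 0 / (q : ℤ)) = p := by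
  obtain ⟨a, b, c⟩ := p
  obtain ⟨⟨x, y, hxy⟩, d, hd⟩ := hp
  simp only at hxy hd h0
  have hnz : (n : ℤ) ≠ 0 := by omega
  set j0 : ℤ := x * b + y * d with hj0
  have hm := Int.emod_add_mul_ediv j0 n
  have hm0 := Int.emod_nonneg j0 hnz
  have hm1 := Int.emod_lt_of_pos j0 (by omega : (0 : ℤ) < n)
  set k := j0 / n
  set j := j0 % n
  let γ : Matrix.SpecialLinearGroup (Fin 2) ℤ := ⟨!![a, -y + a * k; q * c, x + q * c * k], by
    rw [Matrix.det_fin_two_of]; linear_combination hxy⟩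
  refine ⟨γ, ⟨c, rfl⟩, j.toNat, by omega, ?_⟩
  have hjj : ((j.toNat : ℕ) : ℤ) = j := Int.toNat_of_nonneg hm0
  have e1 : γ 0 0 = a := rfl
  have e2 : γ 0 1 = -y + a * k := rfl
  have e3 : γ 1 0 = q * c := rfl
  rw [e1, e2, e3, hjj, Int.mul_ediv_cancel_left _ (by omega : (q : ℤ) ≠ 0)]
  congr 2
  have : j = j0 - n * k := by linarith
  rw [this, hj0]
  linear_combination b * hxy - y * hd

lemma sum_tsum_horoPt {n q : ℕ} (hn : 0 < n) (hq : 0 < q) {T K : ℝ} (hT : 0 < T) {Φ : SL2R → ℂ}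
    (hΦ : ∀ g, Φ g ≠ 0 → entryNorm g.1 ≤ K ∧ (g 0 0, g 0 1, g 1 0) ∈ chartBox T) :
    ∑ j ∈ range n, ∑' γ : CongruenceSubgroup.Gamma0 q, Φ (emb γ * horoPt n j) =
      ∑ p ∈ latticeFinset n q hn hq T, Φ (chart (latticeScale n q p)) := by
  set L := ∑ j ∈ range n, entryNorm (horoPt n j).1 with hL
  have h1 : ∀ j ∈ range n, ∑' γ : CongruenceSubgroup.Gamma0 q, Φ (emb γ * horoPt n j) =
      ∑ γ ∈ normBall (CongruenceSubgroup.Gamma0 q) (K * L), Φ (emb γ * horoPt n j) := fun j hj =>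
    tsum_emb_eq_sum (fun g hg => (hΦ g hg).1)
      (single_le_sum (f := fun j : ℕ => entryNorm (horoPt n j).1)
        (fun _ _ => entryNorm_nonneg _) hj)
  have hdvd : ∀ γ : CongruenceSubgroup.Gamma0 q, (q : ℤ) ∣ γ.1 1 0 := fun γ =>
    (ZMod.intCast_zmod_eq_zero_iff_dvd _ q).1 (CongruenceSubgroup.Gamma0_mem.1 γ.2)
  have hsq : 0 < Real.sqrt n := by positivity
  have hcast : ∀ j : ℕ, horoPt n j = horoPt n ((j : ℤ) : ℝ) := fun j => by simp
  have hbox : ∀ (γ : CongruenceSubgroup.Gamma0 q) (j : ℕ), Φ (emb γ * horoPt n j) ≠ 0 →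
      latticeScale n q (γ.1 0 0, γ.1 0 0 * (j : ℤ) + γ.1 0 1 * n, γ.1 1 0 / q) ∈ chartBox T := by
    intro γ j h
    rw [latticeScale_eq_entries hn (hdvd γ), ← hcast]
    exact (hΦ _ h).2
  have hpos : ∀ p : ℤ × ℤ × ℤ, latticeScale n q p ∈ chartBox T → 0 < p.1 := by
    intro p hp
    have h2 : 1 / T ≤ (p.1 : ℝ) / Real.sqrt n := hp.1.1
    have h3 : 0 < (p.1 : ℝ) / Real.sqrt n := lt_of_lt_of_le (by positivity) h2
    have h4 : (0 : ℝ) < p.1 := by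
      rw [div_pos_iff_of_pos_right hsq] at h3; exact h3
    exact_mod_cast h4
  have hval : ∀ (γ : CongruenceSubgroup.Gamma0 q) (j : ℕ), γ.1 0 0 ≠ 0 →
      chart (latticeScale n q (γ.1 0 0, γ.1 0 0 * (j : ℤ) + γ.1 0 1 * n, γ.1 1 0 / q)) =
        emb γ * horoPt n j := by
    intro γ j h
    rw [latticeScale_eq_entries hn (hdvd γ), ← hcast]
    refine chart_entries ?_
    have := (emb_mul_horoPt hn γ.1 j).1
    change (emb γ * horoPt n j).1 0 0 ≠ 0
    rw [this]
    exact div_ne_zero (by exact_mod_cast h) hsq.ne'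
  rw [sum_congr rfl h1, ← sum_product']
  refine sum_bij_ne_zero (fun x _ _ => (x.2.1 0 0, x.2.1 0 0 * (x.1 : ℤ) + x.2.1 0 1 * n,
    x.2.1 1 0 / q)) ?_ ?_ ?_ ?_
  · rintro ⟨j, γ⟩ - h
    exact mem_latticeFinset.2 ⟨isLatticePoint_of_gamma (hdvd γ) j, hbox γ j h⟩
  · rintro ⟨j, γ⟩ hj h ⟨j', γ'⟩ hj' h' heq
    obtain ⟨e1, e2⟩ := gamma_inj (hdvd γ) (hdvd γ') (mem_range.1 (mem_product.1 hj).1)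
      (mem_range.1 (mem_product.1 hj').1) (hpos _ (hbox γ j h)) heq
    exact Prod.ext e1 (Subtype.ext e2)
  · intro p hp h
    rw [mem_latticeFinset] at hp
    have h0 := hpos p hp.2
    obtain ⟨γ, hγ, j, hj, rfl⟩ := gamma_surj hn hq hp.1 h0.ne'
    set γ' : CongruenceSubgroup.Gamma0 q :=
      ⟨γ, CongruenceSubgroup.Gamma0_mem.2 ((ZMod.intCast_zmod_eq_zero_iff_dvd _ q).2 hγ)⟩
    rw [hval γ' j h0.ne'] at h
    refine ⟨(j, γ'), mem_product.2 ⟨mem_range.2 hj, ?_⟩, h, rfl⟩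
    refine mem_normBall.2 ((entryNorm_emb_le γ (horoPt n j)).trans ?_)
    refine mul_le_mul (hΦ _ h).1 ?_ (entryNorm_nonneg _) ((entryNorm_nonneg _).trans (hΦ _ h).1)
    exact single_le_sum (f := fun j : ℕ => entryNorm (horoPt n j).1)
        (fun _ _ => entryNorm_nonneg _) (mem_range.2 hj)
  · rintro ⟨j, γ⟩ - h
    exact (congrArg Φ (hval γ j (hpos _ (hbox γ j h)).ne')).symm

end

section
open Finset MeasureTheory

variable {Δ : Subgroup (Matrix.SpecialLinearGroup (Fin 2) ℤ)}

/-- The weighted function `weight * F` in chart coordinates. -/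
def weightChart (Δ : Subgroup (Matrix.SpecialLinearGroup (Fin 2) ℤ)) (R : ℝ) (F : SL2R → ℂ)
    (x : ℝ × ℝ × ℝ) : ℂ :=
  if 1 / (8 * R) < x.1 then (weight Δ R (chart x) : ℂ) * F (chart x) else 0

lemma weightChart_of_pos {R : ℝ} (hR : 0 < R) (F : SL2R → ℂ) {x : ℝ × ℝ × ℝ} (hx : 0 < x.1) :
    weightChart Δ R F x = (weight Δ R (chart x) : ℂ) * F (chart x) := by
  unfold weightChart
  split_ifs with h
  · rfl
  · suffices weight Δ R (chart x) = 0 by rw [this]; simp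
    by_contra hw
    have := (of_weight_ne_zero hR hw).1
    change _ < (chart x).1 0 0 at this
    rw [coe_chart hx.ne'] at this
    exact h this

lemma of_weightChart_ne_zero {R : ℝ} (hR : 0 < R) {F : SL2R → ℂ} {x : ℝ × ℝ × ℝ}
    (h : weightChart Δ R F x ≠ 0) : 1 / (8 * R) < x.1 ∧ entryNorm (chart x).1 < 3 * R := by
  unfold weightChart at h
  split_ifs at h with h0
  · refine ⟨h0, (of_weight_ne_zero (Δ := Δ) hR fun hw => h ?_).2⟩
    rw [hw]; simp
  · exact absurd rfl h

lemma norm_weightChart_le {R M : ℝ} {F : SL2R → ℂ} (hM : 0 ≤ M) (hF : ∀ g, ‖F g‖ ≤ M)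
    (x : ℝ × ℝ × ℝ) : ‖weightChart Δ R F x‖ ≤ M := by
  unfold weightChart
  split_ifs
  · rw [norm_mul, Complex.norm_real, Real.norm_eq_abs, abs_of_nonneg (weight_nonneg _ _)]
    calc _ ≤ 1 * M := by
          gcongr
          · exact weight_le_one _ _
          · exact hF _
      _ = M := one_mul M
  · simpa using hM

lemma coords_le_of_entryNorm_chart {x : ℝ × ℝ × ℝ} (hx : x.1 ≠ 0) {K : ℝ}
    (h : entryNorm (chart x).1 ≤ K) :
    |x.1| ≤ K ∧ |x.2.1| ≤ K ∧ |x.2.2| ≤ K ∧ |(1 + x.2.1 * x.2.2) / x.1| ≤ K := by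
  rw [coe_chart hx] at h
  have h00 := abs_apply_le_entryNorm !![x.1, x.2.1; x.2.2, (1 + x.2.1 * x.2.2) / x.1] 0 0
  have h01 := abs_apply_le_entryNorm !![x.1, x.2.1; x.2.2, (1 + x.2.1 * x.2.2) / x.1] 0 1
  have h10 := abs_apply_le_entryNorm !![x.1, x.2.1; x.2.2, (1 + x.2.1 * x.2.2) / x.1] 1 0
  have h11 := abs_apply_le_entryNorm !![x.1, x.2.1; x.2.2, (1 + x.2.1 * x.2.2) / x.1] 1 1
  exact ⟨h00.trans h, h01.trans h, h10.trans h, h11.trans h⟩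

lemma weightChart_eq_zero_of_notMem {R : ℝ} (hR : 0 < R) {F : SL2R → ℂ} {x : ℝ × ℝ × ℝ}
    (hx : x ∉ chartBox (8 * R)) : weightChart Δ R F x = 0 := by
  by_contra h
  obtain ⟨h1, h2⟩ := of_weightChart_ne_zero hR h
  have h0 : 0 < 1 / (8 * R) := by positivity
  obtain ⟨a, b, c, -⟩ := coords_le_of_entryNorm_chart (h0.trans h1).ne' h2.le
  rw [abs_le] at a b c
  refine hx ⟨⟨h1.le, ?_⟩, ⟨?_, ?_⟩, ?_, ?_⟩ <;> linarith

/-- The chart is Lipschitz on bounded sets away from the singular hyperplane. -/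
lemma entryNorm_chart_sub_le {R : ℝ} (hR : 1 ≤ R) {x y : ℝ × ℝ × ℝ} (hx : 1 / (8 * R) < x.1)
    (hN : entryNorm (chart x).1 ≤ 3 * R) (hxy : dist x y ≤ 1 / (16 * R)) :
    1 / (16 * R) < y.1 ∧ entryNorm ((chart y).1 - (chart x).1) ≤ 163 * R ^ 2 * dist x y ∧
      entryNorm (chart y).1 ≤ 14 * R := by
  have hR0 : 0 < R := by linarith
  have h16 : 1 / (16 * R) ≤ 1 := by rw [div_le_one (by positivity)]; linarith
  have h16' : 0 < 1 / (16 * R) := by positivity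
  have h8 : 1 / (8 * R) = 1 / (16 * R) + 1 / (16 * R) := by field_simp; norm_num
  have hx0 : 0 < x.1 := lt_trans (by positivity) hx
  obtain ⟨a, b, c, e⟩ := coords_le_of_entryNorm_chart hx0.ne' hN
  set D := dist x y with hD
  have hd1 : |x.1 - y.1| ≤ D := by
    rw [← Real.dist_eq, hD, Prod.dist_eq]; exact le_max_left _ _
  have hd2 : |x.2.1 - y.2.1| ≤ D := by
    rw [← Real.dist_eq, hD, Prod.dist_eq, Prod.dist_eq]
    exact (le_max_left _ _).trans (le_max_right _ _)
  have hd3 : |x.2.2 - y.2.2| ≤ D := by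
    rw [← Real.dist_eq, hD, Prod.dist_eq, Prod.dist_eq]
    exact (le_max_right _ _).trans (le_max_right _ _)
  have hD0 : 0 ≤ D := dist_nonneg
  have hy : 1 / (16 * R) < y.1 := by
    have := (abs_le.1 hd1).2
    linarith
  have hy0 : 0 < y.1 := h16'.trans hy
  have hy2 : |y.2.1| ≤ 4 * R := by
    have : |y.2.1| ≤ |x.2.1| + |x.2.1 - y.2.1| := by
      rw [show y.2.1 = x.2.1 - (x.2.1 - y.2.1) by ring]
      simpa using abs_sub x.2.1 (x.2.1 - y.2.1)
    linarith
  set δ := (1 + x.2.1 * x.2.2) / x.1 with hδ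
  have hδ1 : δ * x.1 = 1 + x.2.1 * x.2.2 := by rw [hδ]; field_simp
  have h11 : |(1 + y.2.1 * y.2.2) / y.1 - δ| ≤ 160 * R ^ 2 * D := by
    have e1 : (1 + y.2.1 * y.2.2) / y.1 - δ =
        (-(y.2.1 * (x.2.2 - y.2.2)) - x.2.2 * (x.2.1 - y.2.1) + δ * (x.1 - y.1)) / y.1 := by
      rw [div_sub' hy0.ne']
      congr 1
      linear_combination -hδ1
    rw [e1, abs_div, abs_of_pos hy0, div_le_iff₀ hy0]
    have t1 : |y.2.1 * (x.2.2 - y.2.2)| ≤ 4 * R * D := by rw [abs_mul]; gcongr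
    have t2 : |x.2.2 * (x.2.1 - y.2.1)| ≤ 3 * R * D := by rw [abs_mul]; gcongr
    have t3 : |δ * (x.1 - y.1)| ≤ 3 * R * D := by rw [abs_mul]; gcongr
    have t4 := abs_add_le (-(y.2.1 * (x.2.2 - y.2.2)) - x.2.2 * (x.2.1 - y.2.1)) (δ * (x.1 - y.1))
    have t5 := abs_sub (-(y.2.1 * (x.2.2 - y.2.2))) (x.2.2 * (x.2.1 - y.2.1))
    rw [abs_neg] at t5
    have t6 : 10 * R * D = 160 * R ^ 2 * D * (1 / (16 * R)) := by field_simp; ring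
    calc _ ≤ 10 * R * D := by linarith
      _ = 160 * R ^ 2 * D * (1 / (16 * R)) := t6
      _ ≤ _ := by gcongr
  have hsub : entryNorm ((chart y).1 - (chart x).1) ≤ 163 * R ^ 2 * D := by
    rw [coe_chart hx0.ne', coe_chart hy0.ne']
    rw [abs_sub_comm] at hd1 hd2 hd3
    have hR2 : 1 ≤ R ^ 2 := one_le_pow₀ hR
    have : D ≤ R ^ 2 * D := by nlinarith
    change |y.1 - x.1| + |y.2.1 - x.2.1| + |y.2.2 - x.2.2| + |(1 + y.2.1 * y.2.2) / y.1 - δ| ≤ _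
    linarith
  refine ⟨hy, hsub, ?_⟩
  have h1 := entryNorm_add_le ((chart y).1 - (chart x).1) (chart x).1
  rw [sub_add_cancel] at h1
  have h2 : 163 * R ^ 2 * D ≤ 163 * R ^ 2 * (1 / (16 * R)) := by gcongr
  have h3 : 163 * R ^ 2 * (1 / (16 * R)) = 163 / 16 * R := by field_simp
  linarith

lemma norm_weightChart_sub_le {R M : ℝ} (hR : 1 ≤ R) {F : SL2R → ℂ} (hF : Reg M F)
    {x y : ℝ × ℝ × ℝ} (hxy : dist x y ≤ 1 / (2 * (8 * R))) :
    ‖weightChart Δ R F x - weightChart Δ R F y‖ ≤ 10 ^ 14 * M * R ^ 13 * dist x y := by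
  have hR0 : 0 < R := by linarith
  have hM := hF.nonneg
  have key : ∀ x y : ℝ × ℝ × ℝ, dist x y ≤ 1 / (16 * R) → weightChart Δ R F x ≠ 0 →
      ‖weightChart Δ R F x - weightChart Δ R F y‖ ≤ 10 ^ 14 * M * R ^ 13 * dist x y := by
    intro x y hxy hx
    obtain ⟨h1, h2⟩ := of_weightChart_ne_zero hR0 hx
    obtain ⟨hy, hsub, hNy⟩ := entryNorm_chart_sub_le hR h1 h2.le hxy
    rw [weightChart_of_pos hR0 F (lt_trans (by positivity) h1),
      weightChart_of_pos hR0 F (lt_trans (by positivity) hy)]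
    have hw := abs_weight_sub_le (Δ := Δ) hR (g := chart x) (g' := chart y) (L := 14 * R)
      (by linarith) hNy
    rw [entryNorm_sub_comm] at hw
    have hFs := hF.norm_sub_le (chart x) (chart y)
    have e : (weight Δ R (chart x) : ℂ) * F (chart x) - (weight Δ R (chart y) : ℂ) * F (chart y) =
        ((weight Δ R (chart x) - weight Δ R (chart y) : ℝ) : ℂ) * F (chart x) -
          (weight Δ R (chart y) : ℂ) * (F (chart y) - F (chart x)) := by push_cast; ring
    rw [e]
    refine (norm_sub_le _ _).trans ?_
    rw [norm_mul, norm_mul, Complex.norm_real, Complex.norm_real, Real.norm_eq_abs,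
      Real.norm_eq_abs, abs_of_nonneg (weight_nonneg R (chart y))]
    set N := entryNorm ((chart y).1 - (chart x).1)
    have hN0 : 0 ≤ N := entryNorm_nonneg _
    have hd : 0 ≤ dist x y := dist_nonneg
    have b1 : R ^ 1 ≤ R ^ 11 := pow_le_pow_right₀ hR (by norm_num)
    calc _ ≤ 10 ^ 6 * R ^ 6 * (14 * R) ^ 5 * N * M + 1 * (M * (3 * R * N)) := by
          gcongr
          · exact hF.1 _
          · exact weight_le_one _ _
          · exact hFs.trans (by gcongr)
      _ = (10 ^ 6 * 14 ^ 5 * R ^ 11 + 3 * R ^ 1) * (M * N) := by ring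
      _ ≤ (10 ^ 6 * 14 ^ 5 * R ^ 11 + 3 * R ^ 11) * (M * N) := by gcongr
      _ ≤ (10 ^ 6 * 14 ^ 5 * R ^ 11 + 3 * R ^ 11) * (M * (163 * R ^ 2 * dist x y)) := by gcongr
      _ = ((10 ^ 6 * 14 ^ 5 + 3) * 163) * (M * R ^ 13 * dist x y) := by ring
      _ ≤ 10 ^ 14 * (M * R ^ 13 * dist x y) := by gcongr; norm_num
      _ = _ := by ring
  have hxy' : dist x y ≤ 1 / (16 * R) := hxy.trans_eq (by ring)
  by_cases hx : weightChart Δ R F x = 0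
  · by_cases hy : weightChart Δ R F y = 0
    · rw [hx, hy]; simp; positivity
    · rw [norm_sub_rev, dist_comm]
      exact key y x (by rwa [dist_comm]) hy
  · exact key x y hxy' hx

lemma continuous_weightChart {R M : ℝ} (hR : 1 ≤ R) {F : SL2R → ℂ} (hF : Reg M F) :
    Continuous (weightChart Δ R F) := by
  have hM := hF.nonneg
  rw [Metric.continuous_iff]
  intro x ε hε
  set L := 10 ^ 14 * M * R ^ 13
  have hL : 0 ≤ L := by positivity
  refine ⟨min (1 / (2 * (8 * R))) (ε / (L + 1)), by positivity, fun y hy => ?_⟩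
  rw [dist_eq_norm]
  refine (norm_weightChart_sub_le hR hF (hy.le.trans (min_le_left _ _))).trans_lt ?_
  have h1 := hy.trans_le (min_le_right _ _)
  rw [lt_div_iff₀ (by linarith)] at h1
  have : 0 ≤ dist y x := dist_nonneg
  change L * dist y x < ε
  linarith

/-- The limit of the averages, up to the mass near the cusps. -/
def chartMean (q : ℕ) (R : ℝ) (F : SL2R → ℂ) : ℂ :=
  ((totientDensity q / q : ℝ) : ℂ) *
    ∫ x, weightChart (CongruenceSubgroup.Gamma0 q) R F x * ((1 / x.1 : ℝ) : ℂ)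

/-- The proportion of the points lying high in the cusps. -/
def escape (q n : ℕ) (R : ℝ) : ℝ :=
  ({j : ℕ | j < n ∧ horoPt n j ∉ orbitBall (CongruenceSubgroup.Gamma0 q) R}.ncard : ℝ) / n

lemma horoAvg_approx : ∃ C : ℝ, 1 ≤ C ∧ ∀ (n q : ℕ), 0 < n → 0 < q → ∀ R M : ℝ, 1 ≤ R →
    ∀ F : SL2R → ℂ, LeftInv (CongruenceSubgroup.Gamma0 q) F → Reg M F →
    ‖horoAvg n F - chartMean q R F‖ ≤
      C * M * R ^ 21 * (n : ℝ) ^ (-(1 / 320) : ℝ) + M * escape q n R := by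
  obtain ⟨C, hC, H⟩ := sum_latticePoints_approx
  refine ⟨C * 8 ^ 8 * (1 + 10 ^ 14), by nlinarith, ?_⟩
  intro n q hn hq R M hR F hinv hF
  have hM := hF.nonneg
  have hR0 : 0 < R := by linarith
  set Δ := CongruenceSubgroup.Gamma0 q
  have hn0 : (0 : ℝ) < n := by exact_mod_cast hn
  have h1 := H n q hn hq (8 * R) M (10 ^ 14 * M * R ^ 13) (by linarith) hM (by positivity)
    (weightChart Δ R F) (continuous_weightChart hR hF) (norm_weightChart_le hM hF.1)
    (fun x hx => weightChart_eq_zero_of_notMem hR0 hx)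
    (fun x y hxy => norm_weightChart_sub_le hR hF hxy)
  set Φ : SL2R → ℂ := fun g => (weight Δ R g : ℂ) * F g with hΦ
  have hΦs : ∀ g, Φ g ≠ 0 → entryNorm g.1 ≤ 3 * R ∧
      (g 0 0, g 0 1, g 1 0) ∈ chartBox (2 * (8 * R)) := by
    intro g hg
    have hw : weight Δ R g ≠ 0 := fun h => hg (by simp only [hΦ, h]; simp)
    obtain ⟨a, b⟩ := of_weight_ne_zero hR0 hw
    refine ⟨b.le, ?_⟩
    have c0 := abs_le.1 ((abs_apply_le_entryNorm g.1 0 0).trans b.le)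
    have c1 := abs_le.1 ((abs_apply_le_entryNorm g.1 0 1).trans b.le)
    have c2 := abs_le.1 ((abs_apply_le_entryNorm g.1 1 0).trans b.le)
    have : 1 / (2 * (8 * R)) ≤ 1 / (8 * R) :=
      one_div_le_one_div_of_le (by linarith) (by linarith)
    refine ⟨⟨this.trans a.le, ?_⟩, ⟨?_, ?_⟩, ?_, ?_⟩ <;> simp only <;> linarith
  have h2 := sum_tsum_horoPt hn hq (T := 2 * (8 * R)) (by linarith) hΦs
  have h3 : ∑ p ∈ latticeFinset n q hn hq (2 * (8 * R)), Φ (chart (latticeScale n q p)) =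
      ∑ p ∈ latticeFinset n q hn hq (2 * (8 * R)), weightChart Δ R F (latticeScale n q p) := by
    refine sum_congr rfl fun p hp => (weightChart_of_pos hR0 F ?_).symm
    exact lt_of_lt_of_le (by positivity) (mem_latticeFinset.1 hp).2.1.1
  have h4 : ∀ g, ∑' γ : Δ, Φ (emb γ * g) = ((∑' γ : Δ, weight Δ R (emb γ * g) : ℝ) : ℂ) * F g := by
    intro g
    rw [Complex.ofReal_tsum, ← tsum_mul_right]
    refine tsum_congr fun γ => ?_
    simp only [hΦ]
    rw [hinv γ γ.2]
  have h4' : ∑ j ∈ range n, ∑' γ : Δ, Φ (emb γ * horoPt n j) = ∑ j ∈ range n,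
      ((∑' γ : Δ, weight Δ R (emb γ * horoPt n j) : ℝ) : ℂ) * F (horoPt n j) :=
    sum_congr rfl fun j _ => h4 _
  rw [← h4'.symm.trans (h2.trans h3)] at h1
  have h5 : ‖horoAvg n F - (n : ℂ)⁻¹ * ∑ j ∈ range n,
      ((∑' γ : Δ, weight Δ R (emb γ * horoPt n j) : ℝ) : ℂ) * F (horoPt n j)‖ ≤
      M * escape q n R := by
    rw [horoAvg, ← mul_sub, ← sum_sub_distrib, norm_mul, norm_inv, Complex.norm_natCast, escape]
    classical
    have e : {j : ℕ | j < n ∧ horoPt n j ∉ orbitBall Δ R} =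
        ((range n).filter fun j => horoPt n j ∉ orbitBall Δ R : Finset ℕ) := by
      ext j; simp
    rw [e, Set.ncard_coe_finset]
    calc _ ≤ (n : ℝ)⁻¹ * ∑ j ∈ range n, (if horoPt n j ∉ orbitBall Δ R then M else 0) := by
          gcongr
          refine (norm_sum_le _ _).trans (sum_le_sum fun j _ => ?_)
          rw [← one_sub_mul, norm_mul]
          split_ifs with h
          · rw [tsum_weight_eq_one (Δ := Δ) (fun γ hγ => CongruenceSubgroup.Gamma0_mem.2 (by
              rw [hγ]; simp)) hR0 h]
            simp
          · have t0 := tsum_weight_nonneg (Δ := Δ) R (horoPt n j)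
            have t1 := tsum_weight_le_one (Δ := Δ) R (horoPt n j)
            rw [← Complex.ofReal_one, ← Complex.ofReal_sub, Complex.norm_real, Real.norm_eq_abs,
              abs_of_nonneg (by linarith)]
            calc _ ≤ 1 * M := by
                  gcongr
                  · linarith
                  · exact hF.1 _
              _ = M := one_mul _
      _ = _ := by
          rw [← sum_filter, sum_const, nsmul_eq_mul]; ring
  have hρ : 0 ≤ (n : ℝ) ^ (-(1 / 320) : ℝ) := by positivity
  set Y := (n : ℂ)⁻¹ * ∑ j ∈ range n,
      ((∑' γ : Δ, weight Δ R (emb γ * horoPt n j) : ℝ) : ℂ) * F (horoPt n j)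
  have h6 : ‖horoAvg n F - chartMean q R F‖ ≤ ‖horoAvg n F - Y‖ + ‖Y - chartMean q R F‖ := by
    have := norm_add_le (horoAvg n F - Y) (Y - chartMean q R F)
    rwa [sub_add_sub_cancel] at this
  have h7 : C * (8 * R) ^ 8 * (M + 10 ^ 14 * M * R ^ 13) ≤
      C * 8 ^ 8 * (1 + 10 ^ 14) * M * R ^ 21 := by
    have : M * R ^ 8 ≤ M * R ^ 21 := by
      gcongr ?_ * ?_
      exact pow_le_pow_right₀ hR (by norm_num)
    calc _ = C * 8 ^ 8 * (M * R ^ 8 + 10 ^ 14 * M * R ^ 21) := by ring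
      _ ≤ C * 8 ^ 8 * (M * R ^ 21 + 10 ^ 14 * M * R ^ 21) := by gcongr
      _ = _ := by ring
  have h8 : ‖Y - chartMean q R F‖ ≤ C * 8 ^ 8 * (1 + 10 ^ 14) * M * R ^ 21 *
      (n : ℝ) ^ (-(1 / 320) : ℝ) := h1.trans (by gcongr)
  linarith

end

section
open Finset MeasureTheory

lemma bottom_row_lt_of_reduced {R a b c d : ℝ} (hR : 4 ≤ R) (hd : a * d - b * c = 1)
    (h1 : c ^ 2 + d ^ 2 ≤ a ^ 2 + b ^ 2) (h2 : |b * d + a * c| ≤ 1 / 2 * (c ^ 2 + d ^ 2))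
    (hN : R < |a| + |b| + |c| + |d|) : c ^ 2 + d ^ 2 < 8 / R ^ 2 := by
  have hB : (b * d + a * c) ^ 2 ≤ (1 / 2 * (c ^ 2 + d ^ 2)) ^ 2 := by
    rw [← sq_abs]; gcongr
  have hPQ : (a ^ 2 + b ^ 2) * (c ^ 2 + d ^ 2) = 1 + (b * d + a * c) ^ 2 := by
    linear_combination (a * d - b * c + 1) * hd
  have hN2 : R ^ 2 < 4 * ((a ^ 2 + b ^ 2) + (c ^ 2 + d ^ 2)) := by
    have h3 : R ^ 2 < (|a| + |b| + |c| + |d|) ^ 2 := by gcongr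
    rw [← sq_abs a, ← sq_abs b, ← sq_abs c, ← sq_abs d]
    linarith [sq_nonneg (|a| - |b|), sq_nonneg (|a| - |c|), sq_nonneg (|a| - |d|),
      sq_nonneg (|b| - |c|), sq_nonneg (|b| - |d|), sq_nonneg (|c| - |d|)]
  have hQ0 : 0 ≤ c ^ 2 + d ^ 2 := by positivity
  generalize a ^ 2 + b ^ 2 = P at *
  generalize c ^ 2 + d ^ 2 = Q at *
  have hQ2 : Q * Q ≤ 4 / 3 := by nlinarith
  have hR2 : (16 : ℝ) ≤ R ^ 2 := by nlinarith
  rw [lt_div_iff₀ (by positivity)]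
  have : Q * R ^ 2 ≤ 4 * (P * Q + Q * Q) := by nlinarith
  nlinarith

lemma exists_bottom_row_lt {g : SL2R} {R : ℝ} (hR : 4 ≤ R)
    (hg : g ∉ orbitBall (CongruenceSubgroup.Gamma0 1) R) :
    ∃ γ : Matrix.SpecialLinearGroup (Fin 2) ℤ,
      (emb γ * g).1 1 0 ^ 2 + (emb γ * g).1 1 1 ^ 2 < 8 / R ^ 2 := by
  obtain ⟨γ, hγ⟩ := ModularGroup.exists_smul_mem_fd (g • UpperHalfPlane.I)
  refine ⟨γ, ?_⟩
  have e : γ • (g • UpperHalfPlane.I) = (emb γ * g) • UpperHalfPlane.I := by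
    rw [mul_smul]; rfl
  rw [e] at hγ
  have hN : R < entryNorm (emb γ * g).1 := by
    by_contra! h
    refine hg ⟨γ, ?_, h⟩
    rw [CongruenceSubgroup.Gamma0_mem]
    exact Subsingleton.elim _ _
  set x := emb γ * g with hx
  obtain ⟨h1, h2⟩ := hγ
  have hd := det_eq_one x
  set a := x.1 0 0 with ha
  set b := x.1 0 1 with hb
  set c := x.1 1 0 with hc
  set d := x.1 1 1 with hdd
  have hd : a * d - b * c = 1 := hd
  have hz : ((x • UpperHalfPlane.I : UpperHalfPlane) : ℂ) =
      ((a : ℂ) * Complex.I + b) / ((c : ℂ) * Complex.I + d) := by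
    rw [UpperHalfPlane.coe_specialLinearGroup_apply]
    simp
    rfl
  have hQ : 0 < c ^ 2 + d ^ 2 := by
    by_contra! h
    have hc0 : c = 0 := by nlinarith [sq_nonneg c, sq_nonneg d]
    have hd0 : d = 0 := by nlinarith [sq_nonneg c, sq_nonneg d]
    rw [hc0, hd0] at hd
    norm_num at hd
  have hnc : Complex.normSq ((c : ℂ) * Complex.I + d) = c ^ 2 + d ^ 2 := by
    simp [Complex.normSq_apply]; ring
  have hna : Complex.normSq ((a : ℂ) * Complex.I + b) = a ^ 2 + b ^ 2 := by
    simp [Complex.normSq_apply]; ring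
  rw [hz, Complex.normSq_div, hnc, hna, one_le_div hQ] at h1
  have h2' : |(((a : ℂ) * Complex.I + b) / ((c : ℂ) * Complex.I + d)).re| ≤ 1 / 2 := by
    rw [← hz]; exact h2
  rw [Complex.div_re, hnc] at h2'
  simp only [Complex.add_re, Complex.mul_re, Complex.ofReal_re, Complex.I_re, mul_zero,
    Complex.ofReal_im, Complex.I_im, mul_one, sub_self, zero_add, Complex.add_im, Complex.mul_im,
    add_zero] at h2'
  rw [← add_div, abs_div, abs_of_pos hQ, div_le_iff₀ hQ] at h2'
  exact bottom_row_lt_of_reduced hR hd h1 h2' hN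

lemma card_filter_abs_le (n : ℕ) {s : ℕ} (hs : 0 < s) (u : ℝ) {S : ℝ} (hS : (s : ℝ) ≤ S) :
    (((range n).filter fun j : ℕ => |(s : ℝ) * j - u| ≤ S).card : ℝ) ≤ 3 * S / s := by
  have hs0 : (0 : ℝ) < s := by exact_mod_cast hs
  have h : ((range n).filter fun j : ℕ => |(s : ℝ) * j - u| ≤ S).card ≤
      (Icc ⌈(u - S) / s⌉ ⌊(u + S) / s⌋).card := by
    refine card_le_card_of_injOn (fun j : ℕ => (j : ℤ)) (fun j hj => ?_)
      (fun a _ b _ h => Int.ofNat_inj.mp h)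
    have hj' := (mem_filter.mp hj).2
    rw [abs_le] at hj'
    simp only [coe_Icc, Set.mem_Icc, Int.ceil_le, Int.le_floor, Int.cast_natCast]
    rw [div_le_iff₀ hs0, le_div_iff₀ hs0]
    constructor <;> nlinarith
  rw [Int.card_Icc] at h
  have h1 : (((⌊(u + S) / s⌋ + 1 - ⌈(u - S) / s⌉).toNat : ℤ) : ℝ) ≤ 3 * S / s := by
    rw [Int.toNat_eq_max]
    push_cast
    apply max_le
    · have h2 := Int.floor_le ((u + S) / s)
      have h3 := Int.le_ceil ((u - S) / s)
      have h4 : 1 ≤ S / s := by rwa [one_le_div hs0]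
      have h5 : (u + S) / s - (u - S) / s = 2 * (S / s) := by ring
      have h6 : 3 * S / s = 3 * (S / s) := by ring
      linarith
    · have : 0 ≤ S := hs0.le.trans hS
      positivity
  refine le_trans ?_ h1
  exact_mod_cast h

lemma escape_le_one {n : ℕ} (hn : 0 < n) (q : ℕ) (R : ℝ) : escape q n R ≤ 1 := by
  rw [escape, div_le_one (by positivity)]
  have : {j : ℕ | j < n ∧ horoPt n j ∉ orbitBall (CongruenceSubgroup.Gamma0 q) R} ⊆
      ((range n : Finset ℕ) : Set ℕ) := fun j hj => by simpa using hj.1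
  have h := Set.ncard_le_ncard this (range n).finite_toSet
  rw [Set.ncard_coe_finset, card_range] at h
  exact_mod_cast h

lemma escape_one_le {n : ℕ} (hn : 0 < n) {R : ℝ} (hR : 4 ≤ R) : escape 1 n R ≤ 48 / R ^ 2 := by
  classical
  have hn0 : (0 : ℝ) < n := by exact_mod_cast hn
  have hn1 : (1 : ℝ) ≤ n := by exact_mod_cast hn
  set S := Real.sqrt (8 * n / R ^ 2) with hS
  have hS0 : 0 ≤ S := Real.sqrt_nonneg _
  have hS2 : S ^ 2 = 8 * n / R ^ 2 := Real.sq_sqrt (by positivity)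
  have hSn : S < n := by
    have : S ^ 2 < (n : ℝ) ^ 2 := by
      rw [hS2, div_lt_iff₀ (by positivity)]
      have : (16 : ℝ) ≤ R ^ 2 := by nlinarith
      nlinarith
    exact lt_of_pow_lt_pow_left₀ 2 hn0.le this
  have hsub : {j : ℕ | j < n ∧ horoPt n j ∉ orbitBall (CongruenceSubgroup.Gamma0 1) R} ⊆
      (((Icc 1 ⌊S⌋₊).biUnion fun s => (range (s + 1)).biUnion fun t =>
        (range n).filter fun j : ℕ => |(s : ℝ) * j - (t : ℝ) * n| ≤ S : Finset ℕ) : Set ℕ) := by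
    rintro j ⟨hj, hjR⟩
    obtain ⟨γ, hγ⟩ := exists_bottom_row_lt hR hjR
    have h10 : (emb γ * horoPt n j).1 1 0 = γ 1 0 / Real.sqrt n := (emb_mul_horoPt hn γ j).2.2.1
    have h11 : (emb γ * horoPt n j).1 1 1 = (γ 1 0 * j + γ 1 1 * n) / Real.sqrt n :=
      (emb_mul_horoPt hn γ j).2.2.2
    rw [h10, h11, div_pow, div_pow, Real.sq_sqrt hn0.le, ← add_div, div_lt_iff₀ hn0] at hγ
    have hγ : (γ 1 0 : ℝ) ^ 2 + ((γ 1 0 : ℝ) * j + γ 1 1 * n) ^ 2 < S ^ 2 := by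
      rw [hS2]; calc _ < _ := hγ
        _ = _ := by ring
    have hs0 : γ 1 0 ≠ 0 := by
      intro h0
      have hdet := det_int γ
      rw [h0] at hdet
      rw [h0] at hγ
      have hne : γ 1 1 ≠ 0 := by rintro h; rw [h] at hdet; simp at hdet
      have h1 : (1 : ℝ) ≤ (γ 1 1 : ℝ) ^ 2 := by
        have : (1 : ℤ) ≤ γ 1 1 ^ 2 := by
          have := sq_pos_of_ne_zero hne; omega
        exact_mod_cast this
      push_cast at hγ
      have : S ^ 2 < (n : ℝ) ^ 2 := by gcongr
      nlinarith
    have main : ∀ s t : ℤ, 0 < s → (s : ℝ) ^ 2 + ((s : ℝ) * j + t * n) ^ 2 < S ^ 2 →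
        ∃ s' t' : ℕ, 1 ≤ s' ∧ (s' : ℝ) ≤ S ∧ t' ≤ s' ∧ |(s' : ℝ) * j - (t' : ℝ) * n| ≤ S := by
      intro s t hs h
      have hs1 : (1 : ℝ) ≤ s := by exact_mod_cast hs
      have ha : |(s : ℝ) * j + t * n| ≤ S := abs_le_of_sq_le_sq (by nlinarith) hS0
      have hb : (s : ℝ) ≤ S := by
        apply le_of_sq_le_sq _ hS0
        nlinarith [sq_nonneg ((s : ℝ) * j + t * n)]
      have ha' := abs_le.mp ha
      have hj0 : (0 : ℝ) ≤ j := by positivity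
      have hjn : (j : ℝ) < n := by exact_mod_cast hj
      have ht0 : t < 1 := by
        have : (t : ℝ) * n < 1 * n := by nlinarith
        exact_mod_cast lt_of_mul_lt_mul_right this hn0.le
      have hts : -t < s + 1 := by
        have : (-t : ℝ) * n < (s + 1) * n := by nlinarith
        exact_mod_cast lt_of_mul_lt_mul_right this hn0.le
      have e1 : ((s.toNat : ℕ) : ℝ) = s := by
        have : ((s.toNat : ℕ) : ℤ) = s := Int.toNat_of_nonneg hs.le
        exact_mod_cast this
      have e2 : (((-t).toNat : ℕ) : ℝ) = -t := by
        have : (((-t).toNat : ℕ) : ℤ) = -t := Int.toNat_of_nonneg (by omega)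
        exact_mod_cast this
      refine ⟨s.toNat, (-t).toNat, by omega, by rwa [e1], by omega, ?_⟩
      rw [e1, e2]
      convert ha using 2
      ring
    have : ∃ s' t' : ℕ, 1 ≤ s' ∧ (s' : ℝ) ≤ S ∧ t' ≤ s' ∧
        |(s' : ℝ) * j - (t' : ℝ) * n| ≤ S := by
      rcases lt_or_gt_of_ne hs0 with h | h
      · refine main (-γ 1 0) (-γ 1 1) (by omega) ?_
        push_cast
        nlinarith
      · exact main _ _ h hγ
    obtain ⟨s, t, hs, hsS, hts, hst⟩ := this
    simp only [coe_biUnion, Set.mem_iUnion, mem_coe, mem_Icc, mem_range, mem_filter]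
    exact ⟨s, ⟨hs, Nat.le_floor hsS⟩, t, by omega, hj, hst⟩
  have hcard := Set.ncard_le_ncard hsub (Finset.finite_toSet _)
  rw [Set.ncard_coe_finset] at hcard
  have hcard2 : ({j : ℕ | j < n ∧ horoPt n j ∉
      orbitBall (CongruenceSubgroup.Gamma0 1) R}.ncard : ℝ) ≤ 6 * S ^ 2 := by
    calc _ ≤ ((∑ s ∈ Icc 1 ⌊S⌋₊, ∑ t ∈ range (s + 1),
          ((range n).filter fun j : ℕ => |(s : ℝ) * j - (t : ℝ) * n| ≤ S).card : ℕ) : ℝ) := by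
          exact_mod_cast hcard.trans (card_biUnion_le.trans
            (sum_le_sum fun s _ => card_biUnion_le))
      _ = ∑ s ∈ Icc 1 ⌊S⌋₊, ∑ t ∈ range (s + 1),
          (((range n).filter fun j : ℕ => |(s : ℝ) * j - (t : ℝ) * n| ≤ S).card : ℝ) := by
          push_cast; rfl
      _ ≤ ∑ s ∈ Icc 1 ⌊S⌋₊, 6 * S := by
          refine sum_le_sum fun s hs => ?_
          rw [mem_Icc] at hs
          have hs1 : (1 : ℝ) ≤ s := by exact_mod_cast hs.1
          have hsS : (s : ℝ) ≤ S := (Nat.le_floor_iff hS0).mp hs.2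
          calc _ ≤ ∑ t ∈ range (s + 1), 3 * S / s :=
                sum_le_sum fun t _ => card_filter_abs_le n hs.1 _ hsS
            _ = (s + 1) * (3 * S / s) := by rw [sum_const, card_range, nsmul_eq_mul]; push_cast; rfl
            _ ≤ (2 * s) * (3 * S / s) := by gcongr; linarith
            _ = 6 * S := by field_simp; ring
      _ = ⌊S⌋₊ * (6 * S) := by simp
      _ ≤ S * (6 * S) := by gcongr; exact Nat.floor_le hS0
      _ = 6 * S ^ 2 := by ring
  rw [escape, div_le_iff₀ hn0]
  refine hcard2.trans_eq ?_
  rw [hS2]; ring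

lemma exists_row_mem_Gamma0 {q : ℕ} (hq : 0 < q) (γ : Matrix.SpecialLinearGroup (Fin 2) ℤ) :
    ∃ τ : Matrix.SpecialLinearGroup (Fin 2) ℤ, entryNorm (emb τ).1 ≤ 5 * q ∧
      τ * γ ∈ CongruenceSubgroup.Gamma0 q := by
  have hdet := det_int γ
  set a := γ 0 0 with ha
  set c := γ 1 0 with hc
  have hq' : (0 : ℤ) < q := by exact_mod_cast hq
  obtain ⟨x, y, hx0, hxq, hy0, hyq, hxy, hcop⟩ : ∃ x y : ℤ, 0 < x ∧ x ≤ q ∧ 0 ≤ y ∧ y ≤ q ∧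
      (q : ℤ) ∣ x * a + y * c ∧ IsCoprime x y := by
    have m1 := Int.emod_nonneg c hq'.ne'
    have m2 := Int.emod_lt_of_pos c hq'
    have m3 := Int.emod_nonneg a hq'.ne'
    have m4 := Int.emod_lt_of_pos a hq'
    set x₀ := (q : ℤ) - c % q with hx₀
    set y₀ := a % q with hy₀
    have hxc : (q : ℤ) ∣ x₀ + c := ⟨1 + c / q, by have := Int.mul_ediv_add_emod c q; rw [hx₀]; linarith⟩
    have hya : (q : ℤ) ∣ y₀ - a := ⟨-(a / q), by have := Int.mul_ediv_add_emod a q; rw [hy₀]; linarith⟩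
    have hh : (0 : ℤ) < Int.gcd x₀ y₀ := by
      have : 0 < Int.gcd x₀ y₀ := Int.gcd_pos_of_ne_zero_left _ (by omega)
      exact_mod_cast this
    set h := (Int.gcd x₀ y₀ : ℤ) with hh'
    obtain ⟨x, hx⟩ : h ∣ x₀ := Int.gcd_dvd_left _ _
    obtain ⟨y, hy⟩ : h ∣ y₀ := Int.gcd_dvd_right _ _
    have hx0 : 0 < x := by
      by_contra! hneg
      nlinarith
    have hy0 : 0 ≤ y := by
      by_contra! hneg
      nlinarith
    refine ⟨x, y, hx0, by nlinarith, hy0, by nlinarith, ?_, ?_⟩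
    · have hqh : IsCoprime (q : ℤ) h := by
        rw [Int.isCoprime_iff_gcd_eq_one]
        have hd1 : (Int.gcd (q : ℤ) h : ℤ) ∣ q := Int.gcd_dvd_left _ _
        have hd2 : (Int.gcd (q : ℤ) h : ℤ) ∣ h := Int.gcd_dvd_right _ _
        have hd3 : (Int.gcd (q : ℤ) h : ℤ) ∣ c := by
          have := dvd_sub (hd1.trans hxc) (hd2.trans ⟨x, hx⟩)
          simpa using this
        have hd4 : (Int.gcd (q : ℤ) h : ℤ) ∣ a := by
          have := dvd_sub (hd2.trans ⟨y, hy⟩) (hd1.trans hya)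
          simpa using this
        have hd5 : (Int.gcd (q : ℤ) h : ℤ) ∣ 1 := by
          rw [← hdet]
          exact dvd_sub (hd4.mul_right _) (hd3.mul_left _)
        have := Int.eq_one_of_dvd_one (by positivity) hd5
        exact_mod_cast this
      have : (q : ℤ) ∣ h * (x * a + y * c) := by
        have e : h * (x * a + y * c) = (x₀ + c) * a + (y₀ - a) * c := by rw [hx, hy]; ring
        rw [e]
        exact dvd_add (hxc.mul_right _) (hya.mul_right _)
      exact hqh.dvd_of_dvd_mul_left this
    · have hb := Int.gcd_eq_gcd_ab x₀ y₀
      refine ⟨Int.gcdA x₀ y₀, Int.gcdB x₀ y₀, ?_⟩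
      apply mul_left_cancel₀ hh.ne'
      calc h * (Int.gcdA x₀ y₀ * x + Int.gcdB x₀ y₀ * y)
          = (h * x) * Int.gcdA x₀ y₀ + (h * y) * Int.gcdB x₀ y₀ := by ring
        _ = x₀ * Int.gcdA x₀ y₀ + y₀ * Int.gcdB x₀ y₀ := by rw [← hx, ← hy]
        _ = h * 1 := by rw [← hb, hh']; ring
  obtain ⟨e, f, hef⟩ := hcop
  set u := f % x with hu
  have hu0 : 0 ≤ u := Int.emod_nonneg f hx0.ne'
  have hux : u < x := Int.emod_lt_of_pos f hx0
  set v := -e - (f / x) * y with hv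
  have huv : u * y - v * x = 1 := by
    have := Int.mul_ediv_add_emod f x
    have hu' : u = f - x * (f / x) := by rw [hu]; linarith
    rw [hu', hv]; linear_combination hef
  have hv1 : -1 ≤ v := by
    by_contra! hneg
    nlinarith
  have hv2 : v ≤ q := by
    by_contra! hneg
    nlinarith
  refine ⟨⟨!![u, v; x, y], by rw [Matrix.det_fin_two_of]; exact huv⟩, ?_, ?_⟩
  · have : entryNorm (emb ⟨!![u, v; x, y], by rw [Matrix.det_fin_two_of]; exact huv⟩).1 =
        |(u : ℝ)| + |(v : ℝ)| + |(x : ℝ)| + |(y : ℝ)| := rfl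
    rw [this]
    have h1 : |(u : ℝ)| ≤ q := by
      rw [abs_le]; constructor
      · have : -(q : ℤ) ≤ u := by omega
        exact_mod_cast this
      · have : u ≤ (q : ℤ) := by omega
        exact_mod_cast this
    have h2 : |(v : ℝ)| ≤ q := by
      rw [abs_le]; constructor
      · have : -(q : ℤ) ≤ v := by omega
        exact_mod_cast this
      · exact_mod_cast hv2
    have h3 : |(x : ℝ)| ≤ q := by
      rw [abs_le]; constructor
      · have : -(q : ℤ) ≤ x := by omega
        exact_mod_cast this
      · exact_mod_cast hxq
    have h4 : |(y : ℝ)| ≤ q := by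
      rw [abs_le]; constructor
      · have : -(q : ℤ) ≤ y := by omega
        exact_mod_cast this
      · exact_mod_cast hyq
    have : (0 : ℝ) ≤ q := by positivity
    linarith
  · rw [CongruenceSubgroup.Gamma0_mem, ZMod.intCast_zmod_eq_zero_iff_dvd _ q]
    show (q : ℤ) ∣ (!![u, v; x, y] * γ.1) 1 0
    have e1 : (!![u, v; x, y] * γ.1) 1 0 = x * a + y * c := by
      rw [Matrix.mul_apply, Fin.sum_univ_two]; rfl
    exact e1.symm ▸ hxy

lemma orbitBall_subset {q : ℕ} (hq : 0 < q) (R : ℝ) :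
    orbitBall (CongruenceSubgroup.Gamma0 1) (R / (5 * q)) ⊆
      orbitBall (CongruenceSubgroup.Gamma0 q) R := by
  rintro g ⟨γ, -, hγ⟩
  obtain ⟨τ, hτ, hm⟩ := exists_row_mem_Gamma0 hq γ
  refine ⟨τ * γ, hm, ?_⟩
  have hq0 : (0 : ℝ) < q := by exact_mod_cast hq
  have e : (emb (τ * γ) * g).1 = (emb τ).1 * (emb γ * g).1 := by
    rw [map_mul, mul_assoc]; rfl
  rw [e]
  rw [le_div_iff₀ (by positivity)] at hγ
  refine (entryNorm_mul_le _ _).trans (le_trans ?_ hγ)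
  rw [mul_comm]
  exact mul_le_mul_of_nonneg_left hτ (entryNorm_nonneg _)

/-- Few of the points `u_{j / n} a_{√n}⁻¹` lie high in the cusps. -/
lemma escape_le {n q : ℕ} (hn : 0 < n) (hq : 0 < q) {R : ℝ} (hR : 0 < R) :
    escape q n R ≤ 1200 * q ^ 2 / R ^ 2 := by
  have hn0 : (0 : ℝ) < n := by exact_mod_cast hn
  have hq0 : (0 : ℝ) < q := by exact_mod_cast hq
  by_cases h : 4 ≤ R / (5 * q)
  · calc escape q n R ≤ escape 1 n (R / (5 * q)) := by
          unfold escape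
          gcongr ?_ / _
          have hfin : {j : ℕ | j < n ∧ horoPt n j ∉
              orbitBall (CongruenceSubgroup.Gamma0 1) (R / (5 * q))}.Finite :=
            (range n).finite_toSet.subset fun j hj => by simpa using hj.1
          have := Set.ncard_le_ncard (s := {j : ℕ | j < n ∧ horoPt n j ∉
              orbitBall (CongruenceSubgroup.Gamma0 q) R})
              (Set.ofPred_subset_ofPred.mpr fun j hj =>
                ⟨hj.1, fun hc => hj.2 (orbitBall_subset hq R hc)⟩) hfin
          exact_mod_cast this
      _ ≤ 48 / (R / (5 * q)) ^ 2 := escape_one_le hn h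
      _ = 1200 * q ^ 2 / R ^ 2 := by field_simp; ring
  · refine (escape_le_one hn q R).trans ?_
    rw [one_le_div (by positivity)]
    push Not at h
    rw [div_lt_iff₀ (by positivity)] at h
    nlinarith

end

section
open Finset MeasureTheory
open scoped ENNReal

instance : BorelSpace (Matrix (Fin 2) (Fin 2) ℝ) := inferInstanceAs (BorelSpace (Fin 2 → Fin 2 → ℝ))

instance : BorelSpace SL2R :=
  inferInstanceAs (BorelSpace {A : Matrix (Fin 2) (Fin 2) ℝ // A.det = 1})

instance : IsTopologicalGroup SL2R := Matrix.SpecialLinearGroup.topologicalGroup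

instance : SecondCountableTopology (Matrix (Fin 2) (Fin 2) ℝ) :=
  inferInstanceAs (SecondCountableTopology (Fin 2 → Fin 2 → ℝ))

instance : SecondCountableTopology SL2R :=
  TopologicalSpace.Subtype.secondCountableTopology {A : Matrix (Fin 2) (Fin 2) ℝ | A.det = 1}

instance : LocallyCompactSpace (Matrix (Fin 2) (Fin 2) ℝ) :=
  inferInstanceAs (LocallyCompactSpace (Fin 2 → Fin 2 → ℝ))

lemma isClosed_det_eq_one : IsClosed {A : Matrix (Fin 2) (Fin 2) ℝ | A.det = 1} :=
  isClosed_eq (Continuous.matrix_det continuous_id) continuous_const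

lemma isClosedEmbedding_coe :
    Topology.IsClosedEmbedding (fun g : SL2R => (g.1 : Matrix (Fin 2) (Fin 2) ℝ)) :=
  isClosed_det_eq_one.isClosedEmbedding_subtypeVal

instance : LocallyCompactSpace SL2R := isClosedEmbedding_coe.locallyCompactSpace

instance : T2Space SL2R := inferInstanceAs (T2Space {A : Matrix (Fin 2) (Fin 2) ℝ // A.det = 1})

lemma continuous_entry (i j : Fin 2) : Continuous fun g : SL2R => g.1 i j :=
  (continuous_apply_apply i j).comp isClosedEmbedding_coe.continuous

lemma continuous_entryNorm_sub (A : Matrix (Fin 2) (Fin 2) ℝ) :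
    Continuous fun g : SL2R => entryNorm (g.1 - A) := by
  have h := continuous_entry
  unfold entryNorm
  exact ((((h 0 0).sub continuous_const).abs.add ((h 0 1).sub continuous_const).abs).add
    ((h 1 0).sub continuous_const).abs).add ((h 1 1).sub continuous_const).abs

lemma continuous_entryNorm : Continuous fun g : SL2R => entryNorm g.1 := by
  simpa using continuous_entryNorm_sub 0

lemma isCompact_entryNorm_sub_le (A : Matrix (Fin 2) (Fin 2) ℝ) (r : ℝ) :
    IsCompact {g : SL2R | entryNorm (g.1 - A) ≤ r} := by
  have hc : IsCompact (Set.univ.pi fun i => Set.univ.pi fun j =>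
      Set.Icc (A i j - r) (A i j + r) : Set (Fin 2 → Fin 2 → ℝ)) :=
    isCompact_univ_pi fun i => isCompact_univ_pi fun j => isCompact_Icc
  have h2 := isClosedEmbedding_coe.isCompact_preimage (K := (Set.univ.pi fun i => Set.univ.pi fun j =>
      Set.Icc (A i j - r) (A i j + r) : Set (Fin 2 → Fin 2 → ℝ))) hc
  refine h2.of_isClosed_subset (isClosed_le (continuous_entryNorm_sub A) continuous_const) ?_
  intro g hg
  refine Set.mem_preimage.mpr (Set.mem_univ_pi.mpr fun i => Set.mem_univ_pi.mpr fun j => ?_)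
  rw [Set.mem_Icc]
  have := (abs_apply_le_entryNorm (g.1 - A) i j).trans hg
  rw [Matrix.sub_apply, abs_le] at this
  constructor <;> linarith [this.1, this.2]

lemma isCompact_entryNorm_le (r : ℝ) : IsCompact {g : SL2R | entryNorm g.1 ≤ r} := by
  simpa using isCompact_entryNorm_sub_le 0 r

lemma measurable_chart : Measurable chart := by
  have : Measurable fun x : ℝ × ℝ × ℝ => (chart x).1 := by
    have e : (fun x : ℝ × ℝ × ℝ => (chart x).1) = fun x => if x.1 = 0 then 1 else
        !![x.1, x.2.1; x.2.2, (1 + x.2.1 * x.2.2) / x.1] := by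
      funext x
      split_ifs with h
      · exact congrArg Subtype.val (dif_pos h)
      · exact coe_chart h
    rw [e]
    refine Measurable.ite (measurable_fst (measurableSet_singleton 0)) measurable_const ?_
    refine measurable_pi_lambda _ fun i => measurable_pi_lambda _ fun j => ?_
    fin_cases i <;> fin_cases j <;> simp <;> fun_prop
  exact this.subtype_mk

/-- A Haar measure on `SL₂(ℝ)` in chart coordinates. -/
def chartMeasure : Measure SL2R :=
  Measure.map chart (volume.withDensity fun x : ℝ × ℝ × ℝ => ENNReal.ofReal (|x.1|⁻¹))

lemma lintegral_chartMeasure {φ : SL2R → ℝ≥0∞} (hφ : Measurable φ) :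
    ∫⁻ g, φ g ∂chartMeasure = ∫⁻ x : ℝ × ℝ × ℝ, ENNReal.ofReal (|x.1|⁻¹) * φ (chart x) := by
  rw [chartMeasure, lintegral_map hφ measurable_chart,
    lintegral_withDensity_eq_lintegral_mul _ (by fun_prop) (g := fun x => φ (chart x))
      (hφ.comp measurable_chart)]
  rfl

lemma lintegral_chartMeasure_iter {φ : SL2R → ℝ≥0∞} (hφ : Measurable φ) :
    ∫⁻ g, φ g ∂chartMeasure =
      ∫⁻ a : ℝ, ∫⁻ b : ℝ, ∫⁻ c : ℝ, ENNReal.ofReal (|a|⁻¹) * φ (chart (a, b, c)) := by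
  have hm : Measurable fun x : ℝ × ℝ × ℝ => ENNReal.ofReal (|x.1|⁻¹) * φ (chart x) :=
    Measurable.mul (by fun_prop) (hφ.comp measurable_chart)
  rw [lintegral_chartMeasure hφ, Measure.volume_eq_prod, lintegral_prod _ hm.aemeasurable]
  refine lintegral_congr fun a => ?_
  rw [Measure.volume_eq_prod, lintegral_prod (fun y : ℝ × ℝ => ENNReal.ofReal (|a|⁻¹) *
    φ (chart (a, y))) (hm.comp measurable_prodMk_left).aemeasurable]

lemma lintegral_comp_affine {φ : ℝ → ℝ≥0∞} (hφ : Measurable φ) {k : ℝ} (hk : k ≠ 0) (l : ℝ) :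
    ∫⁻ c : ℝ, φ (k * c + l) = ENNReal.ofReal (|k|⁻¹) * ∫⁻ c : ℝ, φ c := by
  have h1 : ∫⁻ c : ℝ, φ (k * c + l) = ∫⁻ c, φ (c + l) ∂(Measure.map (k * ·) volume) := by
    rw [lintegral_map (by fun_prop) (by fun_prop)]
  rw [h1, Real.map_volume_mul_left hk, lintegral_smul_measure, lintegral_add_right_eq_self φ l,
    abs_inv]
  rfl

lemma chart_mul_uElt {a : ℝ} (ha : a ≠ 0) (b c t : ℝ) :
    chart (a, b, c) * uElt t = chart (a, b + t * a, c) := by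
  apply Subtype.ext
  change (chart (a, b, c)).1 * (uElt t).1 = _
  rw [coe_chart ha, coe_chart ha]
  ext i j
  fin_cases i <;> fin_cases j <;> simp [uElt, Matrix.mul_apply, Fin.sum_univ_two]
  · ring
  · field_simp; ring

lemma chart_mul_vElt {a b t : ℝ} (ha : a ≠ 0) (ha' : a + t * b ≠ 0) (c : ℝ) :
    chart (a, b, c) * vElt t = chart (a + t * b, b, (a + t * b) / a * c + t / a) := by
  apply Subtype.ext
  change (chart (a, b, c)).1 * (vElt t).1 = _
  rw [coe_chart ha, coe_chart ha']
  ext i j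
  fin_cases i <;> fin_cases j <;> simp [vElt, Matrix.mul_apply, Fin.sum_univ_two]
  · ring
  · field_simp; ring
  · have e : 1 + b * ((a + t * b) / a * c + t / a) = (a + t * b) * (1 + b * c) / a := by
      field_simp; ring
    rw [e, mul_div_assoc, mul_div_cancel_left₀ _ ha']

lemma ae_ne (r : ℝ) : ∀ᵐ a : ℝ, a ≠ r := by
  simp [ae_iff]

lemma measurable_chart_integrand {φ : SL2R → ℝ≥0∞} (hφ : Measurable φ) :
    Measurable fun x : ℝ × ℝ × ℝ => ENNReal.ofReal (|x.1|⁻¹) * φ (chart x) :=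
  Measurable.mul (by fun_prop) (hφ.comp measurable_chart)

lemma lintegral_chartMeasure_mul_uElt {φ : SL2R → ℝ≥0∞} (hφ : Measurable φ) (t : ℝ) :
    ∫⁻ g, φ (g * uElt t) ∂chartMeasure = ∫⁻ g, φ g ∂chartMeasure := by
  rw [lintegral_chartMeasure_iter hφ, lintegral_chartMeasure_iter (φ := fun g => φ (g * uElt t))
    (hφ.comp (measurable_mul_const _))]
  refine lintegral_congr_ae ?_
  filter_upwards [ae_ne 0] with a ha
  simp only [chart_mul_uElt ha]
  exact lintegral_add_right_eq_self (fun b => ∫⁻ c : ℝ, ENNReal.ofReal (|a|⁻¹) *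
    φ (chart (a, b, c))) (t * a)

lemma lintegral_chartMeasure_swap {φ : SL2R → ℝ≥0∞} (hφ : Measurable φ) :
    ∫⁻ g, φ g ∂chartMeasure =
      ∫⁻ b : ℝ, ∫⁻ a : ℝ, ∫⁻ c : ℝ, ENNReal.ofReal (|a|⁻¹) * φ (chart (a, b, c)) := by
  rw [lintegral_chartMeasure_iter hφ]
  apply lintegral_lintegral_swap
  have h := (measurable_chart_integrand hφ).comp
    (MeasurableEquiv.prodAssoc (α := ℝ) (β := ℝ) (γ := ℝ)).measurable
  exact (Measurable.lintegral_prod_right' (f := _) h).aemeasurable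

lemma lintegral_chartMeasure_mul_vElt {φ : SL2R → ℝ≥0∞} (hφ : Measurable φ) (t : ℝ) :
    ∫⁻ g, φ (g * vElt t) ∂chartMeasure = ∫⁻ g, φ g ∂chartMeasure := by
  rw [lintegral_chartMeasure_swap hφ, lintegral_chartMeasure_swap (φ := fun g => φ (g * vElt t))
    (hφ.comp (measurable_mul_const _))]
  refine lintegral_congr fun b => ?_
  rw [← lintegral_add_right_eq_self (fun a => ∫⁻ c : ℝ, ENNReal.ofReal (|a|⁻¹) *
    φ (chart (a, b, c))) (t * b)]
  refine lintegral_congr_ae ?_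
  filter_upwards [ae_ne 0, ae_ne (-(t * b))] with a ha ha'
  have ha' : a + t * b ≠ 0 := fun h => ha' (by linarith)
  simp only [chart_mul_vElt ha ha']
  have hm : Measurable fun c : ℝ => φ (chart (a + t * b, b, c)) :=
    hφ.comp (measurable_chart.comp (by fun_prop))
  have hm2 : Measurable fun c : ℝ => φ (chart (a + t * b, b, (a + t * b) / a * c + t / a)) :=
    hφ.comp (measurable_chart.comp (by fun_prop))
  rw [lintegral_const_mul _ hm, lintegral_const_mul _ hm2,
    lintegral_comp_affine hm (div_ne_zero ha' ha), ← mul_assoc,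
    ← ENNReal.ofReal_mul (by positivity)]
  congr 2
  rw [abs_div]
  have : |a| ≠ 0 := by positivity
  have : |a + t * b| ≠ 0 := by positivity
  field_simp

lemma eq_mul_of_ne {g : SL2R} (h : g 1 0 ≠ 0) :
    g = uElt ((g 0 0 - 1) / g 1 0) * vElt (g 1 0) * uElt ((g 1 1 - 1) / g 1 0) := by
  apply Subtype.ext
  change _ = (uElt _).1 * (vElt _).1 * (uElt _).1
  have hd := det_eq_one g
  ext i j
  fin_cases i <;> fin_cases j <;>
    simp [uElt, vElt, Matrix.mul_apply, Fin.sum_univ_two] <;> field_simp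
  · ring
  · linear_combination -hd
  · ring

lemma exists_eq_mul (g : SL2R) : ∃ a b c d, g = uElt a * vElt b * uElt c * vElt d := by
  by_cases h : g 1 0 = 0
  · have hd := det_eq_one g
    rw [h, mul_zero, sub_zero] at hd
    have h1 : (g * vElt 1) 1 0 ≠ 0 := by
      have : (g * vElt 1).1 1 0 = g 1 1 := by
        change (g.1 * (vElt 1).1) 1 0 = g.1 1 1
        have h : g.1 1 0 = 0 := h
        simp [vElt, Matrix.mul_apply, Fin.sum_univ_two, h]
      change (g * vElt 1).1 1 0 ≠ 0
      rw [this]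
      exact right_ne_zero_of_mul_eq_one hd
    refine ⟨((g * vElt 1) 0 0 - 1) / (g * vElt 1) 1 0, (g * vElt 1) 1 0,
      ((g * vElt 1) 1 1 - 1) / (g * vElt 1) 1 0, -1, ?_⟩
    rw [← eq_mul_of_ne h1, mul_assoc]
    have : vElt 1 * vElt (-1) = 1 := by
      apply Subtype.ext
      change (vElt 1).1 * (vElt (-1)).1 = 1
      ext i j
      fin_cases i <;> fin_cases j <;> simp [vElt, Matrix.mul_apply, Fin.sum_univ_two]
    rw [this, mul_one]
  · refine ⟨(g 0 0 - 1) / g 1 0, g 1 0, (g 1 1 - 1) / g 1 0, 0, ?_⟩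
    have : vElt 0 = 1 := by
      apply Subtype.ext
      change (vElt 0).1 = 1
      ext i j
      fin_cases i <;> fin_cases j <;> simp [vElt]
    rw [← eq_mul_of_ne h, this, mul_one]

lemma lintegral_chartMeasure_mul_right {φ : SL2R → ℝ≥0∞} (hφ : Measurable φ) (h : SL2R) :
    ∫⁻ g, φ (g * h) ∂chartMeasure = ∫⁻ g, φ g ∂chartMeasure := by
  obtain ⟨a, b, c, d, rfl⟩ := exists_eq_mul h
  simp only [← mul_assoc]
  rw [lintegral_chartMeasure_mul_uElt
      (φ := fun g => φ (g * vElt b * uElt c * vElt d)) (by fun_prop),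
    lintegral_chartMeasure_mul_vElt (φ := fun g => φ (g * uElt c * vElt d)) (by fun_prop),
    lintegral_chartMeasure_mul_uElt (φ := fun g => φ (g * vElt d)) (by fun_prop),
    lintegral_chartMeasure_mul_vElt hφ]

/-- Transposition on `SL₂(ℝ)`. -/
def transp (g : SL2R) : SL2R := ⟨g.1.transpose, by rw [Matrix.det_transpose]; exact g.2⟩

lemma measurable_transp : Measurable transp := by
  have : Measurable fun g : SL2R => (transp g).1 := by
    refine measurable_pi_lambda _ fun i => measurable_pi_lambda _ fun j => ?_
    exact (continuous_entry j i).measurable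
  exact this.subtype_mk

lemma transp_mul (g h : SL2R) : transp (g * h) = transp h * transp g :=
  Subtype.ext (Matrix.transpose_mul g.1 h.1)

lemma transp_transp (g : SL2R) : transp (transp g) = g :=
  Subtype.ext (Matrix.transpose_transpose g.1)

lemma transp_chart {a : ℝ} (ha : a ≠ 0) (b c : ℝ) :
    transp (chart (a, b, c)) = chart (a, c, b) := by
  apply Subtype.ext
  change (chart (a, b, c)).1.transpose = _
  rw [coe_chart ha, coe_chart ha]
  ext i j
  fin_cases i <;> fin_cases j <;> simp [mul_comm]

lemma lintegral_chartMeasure_transp {φ : SL2R → ℝ≥0∞} (hφ : Measurable φ) :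
    ∫⁻ g, φ (transp g) ∂chartMeasure = ∫⁻ g, φ g ∂chartMeasure := by
  rw [lintegral_chartMeasure_iter hφ, lintegral_chartMeasure_iter (φ := fun g => φ (transp g))
    (hφ.comp measurable_transp)]
  refine lintegral_congr_ae ?_
  filter_upwards [ae_ne 0] with a ha
  simp only [transp_chart ha]
  refine lintegral_lintegral_swap ?_
  exact ((measurable_chart_integrand hφ).comp (g := _) (f := fun p : ℝ × ℝ => (a, p.2, p.1))
    (by fun_prop)).aemeasurable

lemma lintegral_chartMeasure_mul_left {φ : SL2R → ℝ≥0∞} (hφ : Measurable φ) (h : SL2R) :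
    ∫⁻ g, φ (h * g) ∂chartMeasure = ∫⁻ g, φ g ∂chartMeasure := by
  rw [← lintegral_chartMeasure_transp (φ := fun g => φ (h * g)) (by fun_prop),
    ← lintegral_chartMeasure_transp hφ,
    ← lintegral_chartMeasure_mul_right (φ := fun g => φ (transp g)) (hφ.comp measurable_transp)
      (transp h)]
  simp only [transp_mul, transp_transp]

instance : chartMeasure.IsMulRightInvariant := by
  refine ⟨fun h => ?_⟩
  ext s hs
  rw [Measure.map_apply (measurable_mul_const h) hs]
  have := lintegral_chartMeasure_mul_right (φ := s.indicator 1) (measurable_one.indicator hs) h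
  rw [lintegral_indicator_one hs] at this
  rw [← this, ← lintegral_indicator_one (measurable_mul_const h hs)]
  rfl

instance : chartMeasure.IsMulLeftInvariant := by
  refine ⟨fun h => ?_⟩
  ext s hs
  rw [Measure.map_apply (measurable_const_mul h) hs]
  have := lintegral_chartMeasure_mul_left (φ := s.indicator 1) (measurable_one.indicator hs) h
  rw [lintegral_indicator_one hs] at this
  rw [← this, ← lintegral_indicator_one (measurable_const_mul h hs)]
  rfl

/-- A compact symmetric neighbourhood of the identity. -/
def idNhd : Set SL2R := {g | entryNorm (g.1 - 1) ≤ 1 / 2}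

lemma isCompact_idNhd : IsCompact idNhd := isCompact_entryNorm_sub_le 1 (1 / 2)

lemma inv_idNhd : idNhd⁻¹ = idNhd := by
  ext g
  have : entryNorm ((g⁻¹ : SL2R).1 - 1) = entryNorm (g.1 - 1) := by
    rw [show (g⁻¹ : SL2R).1 = _ from coe_inv_apply g]
    simp [entryNorm]
    ring
  simp only [idNhd, Set.mem_inv, Set.mem_ofPred_eq]
  rw [this]

lemma interior_idNhd_nonempty : (interior idNhd).Nonempty := by
  refine ⟨1, mem_interior.2 ⟨{g | entryNorm (g.1 - 1) < 1 / 2}, ?_,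
    isOpen_lt (continuous_entryNorm_sub 1) continuous_const, ?_⟩⟩
  · intro g hg
    exact le_of_lt (α := ℝ) hg
  · have h : entryNorm ((1 : SL2R).1 - 1) = 0 := by
      rw [show (1 : SL2R).1 = 1 from rfl, sub_self]; simp [entryNorm]
    rw [Set.mem_ofPred_eq, h]; norm_num

lemma chartMeasure_idNhd_ne_zero : chartMeasure idNhd ≠ 0 := by
  rw [← lintegral_indicator_one isCompact_idNhd.measurableSet,
    lintegral_chartMeasure (measurable_one.indicator isCompact_idNhd.measurableSet)]
  have hB : volume (Set.Icc (9 / 10 : ℝ) (11 / 10) ×ˢ (Set.Icc (-(1 / 20) : ℝ) (1 / 20) ×ˢ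
      Set.Icc (-(1 / 20) : ℝ) (1 / 20))) ≠ 0 := by
    rw [Measure.volume_eq_prod, Measure.prod_prod, Measure.volume_eq_prod, Measure.prod_prod,
      Real.volume_Icc, Real.volume_Icc]
    norm_num
  have hm : Measurable fun x : ℝ × ℝ × ℝ =>
      ENNReal.ofReal (|x.1|⁻¹) * idNhd.indicator (1 : SL2R → ℝ≥0∞) (chart x) :=
    Measurable.mul (by fun_prop)
      ((measurable_one.indicator isCompact_idNhd.measurableSet).comp measurable_chart)
  intro h0
  rw [lintegral_eq_zero_iff hm] at h0
  refine hB (measure_mono_null ?_ (ae_iff.1 h0))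
  rintro ⟨a, b, c⟩ ⟨ha, hb, hc⟩
  simp only [Set.mem_Icc] at ha hb hc
  have ha0 : 0 < a := by linarith [ha.1]
  have hmem : chart (a, b, c) ∈ idNhd := by
    rw [idNhd, Set.mem_ofPred_eq, show (chart (a, b, c)).1 = _ from coe_chart (x := (a, b, c)) ha0.ne']
    have hd : |(1 + b * c) / a - 1| ≤ 3 / 20 := by
      rw [div_sub_one ha0.ne', abs_div, abs_of_pos ha0, div_le_iff₀ ha0, abs_le]
      constructor <;> nlinarith [ha.1, ha.2, hb.1, hb.2, hc.1, hc.2]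
    have h1 : |a - 1| ≤ 1 / 10 := by rw [abs_le]; constructor <;> linarith [ha.1, ha.2]
    have h2 : |b| ≤ 1 / 20 := abs_le.2 hb
    have h3 : |c| ≤ 1 / 20 := abs_le.2 hc
    simp only [entryNorm, Matrix.sub_apply, Matrix.of_apply, Matrix.cons_val', Matrix.cons_val_zero,
      Matrix.cons_val_one, Matrix.one_apply_eq, ne_eq, zero_ne_one, one_ne_zero, not_false_eq_true,
      Matrix.one_apply_ne, sub_zero]
    simp
    linarith
  simp [hmem, ha0.ne']

lemma chartMeasure_idNhd_ne_top : chartMeasure idNhd ≠ ⊤ := by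
  rw [← lintegral_indicator_one isCompact_idNhd.measurableSet,
    lintegral_chartMeasure (measurable_one.indicator isCompact_idNhd.measurableSet)]
  set B : Set (ℝ × ℝ × ℝ) := Set.Icc (1 / 2 : ℝ) (3 / 2) ×ˢ (Set.Icc (-(1 / 2) : ℝ) (1 / 2) ×ˢ
      Set.Icc (-(1 / 2) : ℝ) (1 / 2)) with hB
  have hBm : MeasurableSet B :=
    measurableSet_Icc.prod (measurableSet_Icc.prod measurableSet_Icc)
  have hBf : volume B ≠ ⊤ := by
    rw [hB, Measure.volume_eq_prod, Measure.prod_prod, Measure.volume_eq_prod, Measure.prod_prod,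
      Real.volume_Icc, Real.volume_Icc]
    exact ENNReal.mul_ne_top ENNReal.ofReal_ne_top
      (ENNReal.mul_ne_top ENNReal.ofReal_ne_top ENNReal.ofReal_ne_top)
  have hle : ∀ x : ℝ × ℝ × ℝ, ENNReal.ofReal (|x.1|⁻¹) * idNhd.indicator 1 (chart x) ≤
      B.indicator (fun _ => ENNReal.ofReal 2) x := by
    rintro ⟨a, b, c⟩
    by_cases ha : a = 0
    · simp [ha]
    by_cases hm : chart (a, b, c) ∈ idNhd
    · have hm' := hm
      rw [idNhd, Set.mem_ofPred_eq] at hm'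
      have e := fun i j => (abs_apply_le_entryNorm _ i j).trans hm'
      rw [show (chart (a, b, c)).1 = _ from coe_chart (x := (a, b, c)) ha] at e
      have h1 := e 0 0
      have h2 := e 0 1
      have h3 := e 1 0
      simp [Matrix.sub_apply] at h1 h2 h3
      rw [abs_le] at h1 h2 h3
      have hBx : (a, b, c) ∈ B := by
        refine ⟨⟨?_, ?_⟩, ⟨?_, ?_⟩, ⟨?_, ?_⟩⟩ <;> simp only <;>
          linarith [h1.1, h1.2, h2.1, h2.2, h3.1, h3.2]
      rw [Set.indicator_of_mem hm, Set.indicator_of_mem hBx]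
      simp only [Pi.one_apply, mul_one]
      apply ENNReal.ofReal_le_ofReal
      rw [abs_of_pos (by linarith [h1.1]), inv_le_comm₀ (by linarith [h1.1]) (by norm_num)]
      linarith [h1.1]
    · simp [hm]
  refine ne_top_of_le_ne_top ?_ (lintegral_mono hle)
  rw [lintegral_indicator hBm, setLIntegral_const]
  exact ENNReal.mul_ne_top ENNReal.ofReal_ne_top hBf

instance : chartMeasure.IsHaarMeasure :=
  Measure.isHaarMeasure_of_isCompact_nonempty_interior chartMeasure idNhd isCompact_idNhd
    interior_idNhd_nonempty chartMeasure_idNhd_ne_zero chartMeasure_idNhd_ne_top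

lemma inv_chartMeasure : chartMeasure.inv = chartMeasure := by
  have hfin : IsFiniteMeasureOnCompacts chartMeasure.inv := by
    refine ⟨fun K hK => ?_⟩
    rw [Measure.inv_apply]
    exact hK.inv.measure_lt_top
  have h := Measure.isMulLeftInvariant_eq_smul chartMeasure.inv chartMeasure
  have h2 : chartMeasure.inv idNhd = chartMeasure idNhd := by
    rw [Measure.inv_apply, inv_idNhd]
  rw [h] at h2 ⊢
  rw [Measure.smul_apply, ENNReal.smul_def, smul_eq_mul] at h2
  have h3 : ((Measure.haarScalarFactor chartMeasure.inv chartMeasure : NNReal) : ℝ≥0∞) = 1 := by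
    exact (ENNReal.mul_eq_right chartMeasure_idNhd_ne_zero chartMeasure_idNhd_ne_top).1 h2
  have h4 : Measure.haarScalarFactor chartMeasure.inv chartMeasure = 1 := by exact_mod_cast h3
  rw [h4, one_smul]

lemma eq_smul_chartMeasure (ν : Measure SL2R) [IsFiniteMeasureOnCompacts ν]
    [ν.IsMulRightInvariant] : ∃ c : NNReal, ν = c • chartMeasure := by
  have hfin : IsFiniteMeasureOnCompacts ν.inv := by
    refine ⟨fun K hK => ?_⟩
    rw [Measure.inv_apply]
    exact hK.inv.measure_lt_top
  refine ⟨Measure.haarScalarFactor ν.inv chartMeasure, ?_⟩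
  have h := Measure.isMulLeftInvariant_eq_smul ν.inv chartMeasure
  set c := Measure.haarScalarFactor ν.inv chartMeasure
  calc ν = ν.inv.inv := (Measure.inv_inv ν).symm
    _ = (c • chartMeasure).inv := by rw [h]
    _ = c • chartMeasure.inv := by
      unfold Measure.inv; rw [Measure.map_smul]
    _ = _ := by rw [inv_chartMeasure]

instance : Countable (Matrix.SpecialLinearGroup (Fin 2) ℤ) :=
  have : Countable (Matrix (Fin 2) (Fin 2) ℤ) := inferInstanceAs (Countable (Fin 2 → Fin 2 → ℤ))
  inferInstanceAs (Countable {A : Matrix (Fin 2) (Fin 2) ℤ // A.det = 1})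

lemma mem_Gamma0_one (γ : Matrix.SpecialLinearGroup (Fin 2) ℤ) :
    γ ∈ CongruenceSubgroup.Gamma0 1 := by
  rw [CongruenceSubgroup.Gamma0_mem]; exact Subsingleton.elim _ _

lemma XProj_eq_iff {g h : SL2R} : XProj Γℤ g = XProj Γℤ h ↔ ∃ γ, h = emb γ * g := by
  unfold XProj
  rw [Quotient.eq, QuotientGroup.rightRel_apply, Γℤ, MonoidHom.mem_range]
  constructor
  · rintro ⟨γ, hγ⟩
    exact ⟨γ, by rw [emb, hγ]; group⟩
  · rintro ⟨γ, hγ⟩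
    exact ⟨γ, by rw [hγ]; simp [emb]⟩

lemma XProj_out (x : XQuot Γℤ) : XProj Γℤ x.out = x := Quotient.out_eq x

lemma LeftInv.apply_out {β : Type*} {Ψ : SL2R → β} (h : LeftInv (CongruenceSubgroup.Gamma0 1) Ψ)
    (g : SL2R) : Ψ (XProj Γℤ g).out = Ψ g := by
  obtain ⟨γ, hγ⟩ := XProj_eq_iff.1 (XProj_out (XProj Γℤ g)).symm
  rw [hγ, h γ (mem_Gamma0_one γ)]

lemma LeftInv.measurable_out {β : Type*} [MeasurableSpace β] {Ψ : SL2R → β}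
    (h : LeftInv (CongruenceSubgroup.Gamma0 1) Ψ) (hm : Measurable Ψ) :
    Measurable fun x : XQuot Γℤ => Ψ x.out := by
  rw [measurable_from_quotient]
  have : (fun x : XQuot Γℤ => Ψ x.out) ∘ Quotient.mk'' = Ψ := by
    funext g
    exact h.apply_out g
  rwa [this]

lemma measurable_XProj : Measurable (XProj Γℤ) := measurable_quotient_mk''

lemma measurable_rightT (g : SL2R) : Measurable (rightT Γℤ g) := by
  rw [measurable_from_quotient]
  exact measurable_XProj.comp (measurable_mul_const g)

lemma leftInv_liftX (f : XQuot Γℤ → ℂ) : LeftInv (CongruenceSubgroup.Gamma0 1) (liftX Γℤ f) := by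
  intro γ _ g
  exact congrArg f (XProj_eq_iff.2 ⟨γ, rfl⟩).symm

lemma leftInv_tsum {β : Type*} [AddCommMonoid β] [TopologicalSpace β] (φ : SL2R → β) :
    LeftInv (CongruenceSubgroup.Gamma0 1)
      fun g => ∑' γ : CongruenceSubgroup.Gamma0 1, φ (emb γ * g) := by
  intro γ hγ g
  simp only
  rw [← (Equiv.mulRight (⟨γ, hγ⟩ : CongruenceSubgroup.Gamma0 1)).tsum_eq
    fun η : CongruenceSubgroup.Gamma0 1 => φ (emb η * g)]
  refine tsum_congr fun η => ?_
  simp [mul_assoc]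

/-- The counting measure on the orbit over a point of `X`. -/
def orbitMeasure (x : XQuot Γℤ) : Measure SL2R :=
  Measure.sum fun γ : CongruenceSubgroup.Gamma0 1 => Measure.dirac (emb γ * x.out)

lemma lintegral_orbitMeasure {φ : SL2R → ℝ≥0∞} (hφ : Measurable φ) (x : XQuot Γℤ) :
    ∫⁻ g, φ g ∂orbitMeasure x = ∑' γ : CongruenceSubgroup.Gamma0 1, φ (emb γ * x.out) := by
  rw [orbitMeasure, lintegral_sum_measure]
  exact tsum_congr fun γ => lintegral_dirac' _ hφ

lemma measurable_tsum_emb {φ : SL2R → ℝ≥0∞} (hφ : Measurable φ) :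
    Measurable fun g => ∑' γ : CongruenceSubgroup.Gamma0 1, φ (emb γ * g) :=
  Measurable.tsum fun _ => hφ.comp (measurable_const_mul _)

lemma measurable_orbitMeasure : Measurable orbitMeasure := by
  refine Measure.measurable_of_measurable_coe _ fun s hs => ?_
  have : (fun x => orbitMeasure x s) = fun x : XQuot Γℤ =>
      ∑' γ : CongruenceSubgroup.Gamma0 1, s.indicator (1 : SL2R → ℝ≥0∞) (emb γ * x.out) := by
    funext x
    rw [← lintegral_indicator_one hs, lintegral_orbitMeasure (measurable_one.indicator hs)]
  rw [this]
  exact (leftInv_tsum _).measurable_out (measurable_tsum_emb (measurable_one.indicator hs))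

/-- The lift to `SL₂(ℝ)` of a measure on `X`. -/
def liftMeasure (μ : Measure (XQuot Γℤ)) : Measure SL2R := μ.bind orbitMeasure

lemma lintegral_liftMeasure (μ : Measure (XQuot Γℤ)) {φ : SL2R → ℝ≥0∞} (hφ : Measurable φ) :
    ∫⁻ g, φ g ∂liftMeasure μ =
      ∫⁻ x, ∑' γ : CongruenceSubgroup.Gamma0 1, φ (emb γ * x.out) ∂μ := by
  rw [liftMeasure, Measure.lintegral_bind measurable_orbitMeasure.aemeasurable hφ.aemeasurable]
  exact lintegral_congr fun x => lintegral_orbitMeasure hφ x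

lemma lintegral_liftMeasure_mul_right {μ : Measure (XQuot Γℤ)}
    (hμ : ∀ g : SL2R, Measure.map (rightT Γℤ g) μ = μ) {φ : SL2R → ℝ≥0∞} (hφ : Measurable φ)
    (h : SL2R) : ∫⁻ g, φ (g * h) ∂liftMeasure μ = ∫⁻ g, φ g ∂liftMeasure μ := by
  rw [lintegral_liftMeasure μ hφ,
    lintegral_liftMeasure μ (φ := fun g => φ (g * h)) (hφ.comp (measurable_mul_const h))]
  conv_rhs => rw [← hμ h]
  rw [lintegral_map ((leftInv_tsum φ).measurable_out (measurable_tsum_emb hφ)) (measurable_rightT h)]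
  refine lintegral_congr fun x => ?_
  have e : rightT Γℤ h x = XProj Γℤ (x.out * h) := by
    conv_lhs => rw [← XProj_out x]
    rfl
  rw [e, (leftInv_tsum φ).apply_out]
  simp only [mul_assoc]

lemma isMulRightInvariant_liftMeasure {μ : Measure (XQuot Γℤ)}
    (hμ : ∀ g : SL2R, Measure.map (rightT Γℤ g) μ = μ) :
    (liftMeasure μ).IsMulRightInvariant := by
  refine ⟨fun h => ?_⟩
  ext s hs
  rw [Measure.map_apply (measurable_mul_const h) hs]
  have := lintegral_liftMeasure_mul_right hμ (φ := s.indicator 1) (measurable_one.indicator hs) h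
  rw [lintegral_indicator_one hs] at this
  rw [← this, ← lintegral_indicator_one (measurable_mul_const h hs)]
  rfl

/-- At most boundedly many points of an orbit lie in a ball. -/
lemma tsum_indicator_le {r : ℝ} (hr : 0 ≤ r) (g : SL2R) :
    ∑' γ : CongruenceSubgroup.Gamma0 1,
      Set.indicator {g : SL2R | entryNorm g.1 ≤ r} (1 : SL2R → ℝ≥0∞) (emb γ * g) ≤
      ENNReal.ofReal ((2 * (r * r) + 1) ^ 4) := by
  classical
  by_cases h : ∃ γ₀ : CongruenceSubgroup.Gamma0 1, entryNorm (emb γ₀ * g).1 ≤ r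
  · obtain ⟨γ₀, h0⟩ := h
    have e := leftInv_tsum (Set.indicator {g : SL2R | entryNorm g.1 ≤ r} (1 : SL2R → ℝ≥0∞)) γ₀ γ₀.2 g
    simp only at e
    rw [← e, tsum_emb_eq_sum (K := r) (L := r) (fun g' hg' => by
      have hm : g' ∈ {g : SL2R | entryNorm g.1 ≤ r} := Set.mem_of_indicator_ne_zero hg'
      exact hm) h0]
    calc _ ≤ ∑ γ ∈ normBall (CongruenceSubgroup.Gamma0 1) (r * r), (1 : ℝ≥0∞) :=
          Finset.sum_le_sum fun γ _ => by
            rw [Set.indicator_apply]; split_ifs <;> simp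
      _ = ((normBall (CongruenceSubgroup.Gamma0 1) (r * r)).card : ℝ≥0∞) := by simp
      _ = ENNReal.ofReal ((normBall (CongruenceSubgroup.Gamma0 1) (r * r)).card : ℝ) := by simp
      _ ≤ _ := ENNReal.ofReal_le_ofReal (card_normBall_le (mul_nonneg hr hr))
  · push Not at h
    rw [ENNReal.tsum_eq_zero.2 fun γ => Set.indicator_of_notMem
      (by rw [Set.mem_ofPred_eq, not_le]; exact h γ) _]
    exact zero_le

lemma isFiniteMeasureOnCompacts_liftMeasure (μ : Measure (XQuot Γℤ)) [IsProbabilityMeasure μ] :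
    IsFiniteMeasureOnCompacts (liftMeasure μ) := by
  refine ⟨fun K hK => ?_⟩
  obtain ⟨r, hr⟩ := (hK.image continuous_entryNorm).bddAbove
  have hsub : K ⊆ {g : SL2R | entryNorm g.1 ≤ max r 0} := fun g hg =>
    (hr ⟨g, hg, rfl⟩).trans (le_max_left _ _)
  refine lt_of_le_of_lt (measure_mono hsub) ?_
  rw [← lintegral_indicator_one (isCompact_entryNorm_le _).measurableSet,
    lintegral_liftMeasure μ (measurable_one.indicator (isCompact_entryNorm_le _).measurableSet)]
  refine lt_of_le_of_lt (lintegral_mono fun x => tsum_indicator_le (le_max_right r 0) x.out) ?_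
  simp

lemma exists_liftMeasure_eq (μ : Measure (XQuot Γℤ)) [IsProbabilityMeasure μ]
    (hμ : ∀ g : SL2R, Measure.map (rightT Γℤ g) μ = μ) :
    ∃ c : NNReal, liftMeasure μ = c • chartMeasure := by
  have := isFiniteMeasureOnCompacts_liftMeasure μ
  have := isMulRightInvariant_liftMeasure hμ
  exact eq_smul_chartMeasure _

end

section
open Finset MeasureTheory Filter Topology
open scoped ENNReal

lemma tendsto_entryNorm_sub (g : SL2R) :
    Tendsto (fun g' : SL2R => entryNorm (g'.1 - g.1)) (𝓝 g) (𝓝 0) := by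
  simpa [entryNorm] using (continuous_entryNorm_sub g.1).tendsto g

lemma Reg.continuous {M : ℝ} {F : SL2R → ℂ} (h : Reg M F) : Continuous F := by
  rw [continuous_iff_continuousAt]
  intro g
  have h2 : Tendsto (fun g' : SL2R => M * (entryNorm g.1 * entryNorm (g'.1 - g.1))) (𝓝 g) (𝓝 0) := by
    simpa only [mul_zero] using ((tendsto_entryNorm_sub g).const_mul (entryNorm g.1)).const_mul M
  rw [ContinuousAt, tendsto_iff_norm_sub_tendsto_zero]
  exact squeeze_zero (fun _ => norm_nonneg _) (fun g' => h.norm_sub_le g g') h2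

lemma continuous_weight {Δ : Subgroup (Matrix.SpecialLinearGroup (Fin 2) ℤ)} {R : ℝ} (hR : 1 ≤ R) :
    Continuous (weight Δ R) := by
  rw [continuous_iff_continuousAt]
  intro g
  have h1 : ∀ᶠ g' : SL2R in 𝓝 g, entryNorm g'.1 ≤ entryNorm g.1 + 1 := by
    filter_upwards [(continuous_entryNorm.tendsto g).eventually (gt_mem_nhds (by linarith :
      entryNorm g.1 < entryNorm g.1 + 1))] with g' h using h.le
  have h2 : Tendsto (fun g' : SL2R => 10 ^ 6 * R ^ 6 * (entryNorm g.1 + 1) ^ 5 *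
      entryNorm (g'.1 - g.1)) (𝓝 g) (𝓝 0) := by
    simpa only [mul_zero] using (tendsto_entryNorm_sub g).const_mul
      (10 ^ 6 * R ^ 6 * (entryNorm g.1 + 1) ^ 5)
  rw [ContinuousAt, tendsto_iff_norm_sub_tendsto_zero]
  refine squeeze_zero' (Eventually.of_forall fun _ => norm_nonneg _) ?_ h2
  filter_upwards [h1] with g' hg'
  exact abs_weight_sub_le hR hg' (by linarith)

/-- The integral over the lifted measure unfolds. -/
lemma integral_liftMeasure (μ : Measure (XQuot Γℤ)) [IsProbabilityMeasure μ] {Φ : SL2R → ℂ}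
    {K : ℝ} (hΦ : ∀ g, Φ g ≠ 0 → entryNorm g.1 ≤ K) (hi : Integrable Φ (liftMeasure μ)) :
    ∫ g, Φ g ∂liftMeasure μ =
      ∫ x, ∑' γ : CongruenceSubgroup.Gamma0 1, Φ (emb γ * x.out) ∂μ := by
  set η : ProbabilityTheory.Kernel (XQuot Γℤ) SL2R := ⟨orbitMeasure, measurable_orbitMeasure⟩
  have e : liftMeasure μ = (η.comp (ProbabilityTheory.Kernel.const Unit μ)) () := by
    rw [ProbabilityTheory.Kernel.comp_apply, ProbabilityTheory.Kernel.const_apply]; rfl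
  rw [e] at hi ⊢
  rw [ProbabilityTheory.Kernel.integral_comp hi, ProbabilityTheory.Kernel.const_apply]
  refine integral_congr_ae (Eventually.of_forall fun x => ?_)
  change ∫ y, Φ y ∂orbitMeasure x = ∑' γ : CongruenceSubgroup.Gamma0 1, Φ (emb γ * x.out)
  rw [orbitMeasure, integral_sum_measure]
  · simp only [integral_dirac]
  · refine integrable_sum_measure (fun γ => integrable_dirac (by simp)) ?_
    simp only [integral_dirac]
    refine summable_of_ne_finset_zero
      (s := normBall (CongruenceSubgroup.Gamma0 1) (K * entryNorm (x.out).1)) fun γ hγ => ?_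
    rw [norm_eq_zero]
    by_contra h
    refine hγ (mem_normBall.2 ((entryNorm_emb_le _ x.out).trans ?_))
    exact mul_le_mul_of_nonneg_right (hΦ _ h) (entryNorm_nonneg _)

lemma integral_chartMeasure {Φ : SL2R → ℂ} (hΦ : Continuous Φ) :
    ∫ g, Φ g ∂chartMeasure = ∫ x : ℝ × ℝ × ℝ, ((|x.1|⁻¹ : ℝ) : ℂ) * Φ (chart x) := by
  rw [chartMeasure, integral_map measurable_chart.aemeasurable
    hΦ.stronglyMeasurable.aestronglyMeasurable,
    integral_withDensity_eq_integral_toReal_smul (by fun_prop)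
      (Eventually.of_forall fun x => ENNReal.ofReal_lt_top)]
  refine integral_congr_ae (Eventually.of_forall fun x => ?_)
  simp only
  rw [ENNReal.toReal_ofReal (by positivity), Complex.real_smul]

lemma weightChart_mul_eq {R : ℝ} (hR : 0 < R) (F : SL2R → ℂ) (x : ℝ × ℝ × ℝ) :
    ((|x.1|⁻¹ : ℝ) : ℂ) * ((weight (CongruenceSubgroup.Gamma0 1) R (chart x) : ℂ) * F (chart x)) =
      weightChart (CongruenceSubgroup.Gamma0 1) R F x * ((1 / x.1 : ℝ) : ℂ) := by
  rcases lt_trichotomy x.1 0 with h | h | h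
  · have h1 : weight (CongruenceSubgroup.Gamma0 1) R (chart x) = 0 := by
      by_contra hw
      have := (of_weight_ne_zero hR hw).1
      change _ < (chart x).1 0 0 at this
      rw [coe_chart h.ne] at this
      have h3 : 0 < 1 / (8 * R) := by positivity
      exact absurd (h3.trans this) (not_lt.2 h.le)
    have h2 : weightChart (CongruenceSubgroup.Gamma0 1) R F x = 0 := by
      unfold weightChart; rw [h1]; simp
    rw [h1, h2]; simp
  · rw [h]; simp
  · rw [weightChart_of_pos hR F h, abs_of_pos h, one_div, mul_comm]

lemma integral_weight_mul (μ : Measure (XQuot Γℤ)) [IsProbabilityMeasure μ] {c : NNReal}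
    (hc : liftMeasure μ = c • chartMeasure) {R M : ℝ} (hR : 1 ≤ R) {F : SL2R → ℂ}
    (hinv : LeftInv (CongruenceSubgroup.Gamma0 1) F) (hF : Reg M F) :
    ((totientDensity 1 : ℝ) : ℂ) * ∫ x : XQuot Γℤ,
        ((∑' γ : CongruenceSubgroup.Gamma0 1,
          weight (CongruenceSubgroup.Gamma0 1) R (emb γ * x.out) : ℝ) : ℂ) * F x.out ∂μ =
      ((c : ℝ) : ℂ) * chartMean 1 R F := by
  set Δ := CongruenceSubgroup.Gamma0 1
  have hR0 : 0 < R := by linarith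
  have hcont : Continuous fun g => (weight Δ R g : ℂ) * F g :=
    (Complex.continuous_ofReal.comp (continuous_weight hR)).mul hF.continuous
  have hsupp : ∀ g, (weight Δ R g : ℂ) * F g ≠ 0 → entryNorm g.1 ≤ 3 * R := by
    intro g hg
    refine (of_weight_ne_zero (Δ := Δ) hR0 fun h => hg ?_).2.le
    rw [h]; simp
  have hcs : HasCompactSupport fun g => (weight Δ R g : ℂ) * F g := by
    refine HasCompactSupport.of_support_subset_isCompact (isCompact_entryNorm_le (3 * R)) ?_
    intro g hg
    exact hsupp g hg
  have hfin := isFiniteMeasureOnCompacts_liftMeasure μ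
  have h1 := integral_liftMeasure μ hsupp (hcont.integrable_of_hasCompactSupport hcs)
  have h2 : ∀ g : SL2R, ∑' γ : Δ, (weight Δ R (emb γ * g) : ℂ) * F (emb γ * g) =
      ((∑' γ : Δ, weight Δ R (emb γ * g) : ℝ) : ℂ) * F g := by
    intro g
    rw [Complex.ofReal_tsum, ← tsum_mul_right]
    exact tsum_congr fun γ => by rw [hinv γ γ.2 g]
  simp only [Δ] at h2
  rw [hc, integral_smul_nnreal_measure, integral_chartMeasure hcont] at h1
  simp only [Δ, weightChart_mul_eq hR0] at h1
  replace h1 := h1.trans (integral_congr_ae (Eventually.of_forall fun x => h2 x.out))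
  refine (congrArg (fun z => ((totientDensity 1 : ℝ) : ℂ) * z) h1.symm).trans ?_
  rw [chartMean, NNReal.smul_def, Complex.real_smul]
  push_cast
  ring

/-- The mass of `X` that is captured by the weight function. -/
def cuspMass (R : ℝ) (x : XQuot Γℤ) : ℝ :=
  ∑' γ : CongruenceSubgroup.Gamma0 1, weight (CongruenceSubgroup.Gamma0 1) R (emb γ * x.out)

lemma reg_one : Reg 1 (fun _ => (1 : ℂ)) :=
  ⟨fun _ => by simp, fun _ _ => by simpa using entryNorm_nonneg _⟩

lemma measurable_cuspMass {R : ℝ} (hR : 1 ≤ R) : Measurable (cuspMass R) := by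
  have h : Measurable fun g : SL2R => (∑' γ : CongruenceSubgroup.Gamma0 1,
      weight (CongruenceSubgroup.Gamma0 1) R (emb γ * g)) :=
    Measurable.tsum fun γ => (continuous_weight hR).measurable.comp (measurable_const_mul _)
  exact (leftInv_tsum _).measurable_out h

lemma norm_one_sub_chartMean_le {R : ℝ} (hR : 1 ≤ R) :
    ‖1 - chartMean 1 R (fun _ => 1)‖ ≤ 1200 / R ^ 2 := by
  obtain ⟨C, hC, H⟩ := horoAvg_approx
  have hlim : Tendsto (fun n : ℕ => C * 1 * R ^ 21 * (n : ℝ) ^ (-(1 / 320) : ℝ) + 1200 / R ^ 2)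
      atTop (𝓝 (C * 1 * R ^ 21 * 0 + 1200 / R ^ 2)) :=
    (((tendsto_rpow_neg_atTop (by norm_num : (0 : ℝ) < 1 / 320)).comp
      tendsto_natCast_atTop_atTop).const_mul _).add_const _
  rw [mul_zero, zero_add] at hlim
  refine ge_of_tendsto hlim ?_
  filter_upwards [eventually_gt_atTop 0] with n hn
  have h1 := H n 1 hn one_pos R 1 hR (fun _ => 1) (fun _ _ _ => rfl) reg_one
  have h2 : horoAvg n (fun _ => (1 : ℂ)) = 1 := by
    have : (n : ℂ) ≠ 0 := by exact_mod_cast hn.ne'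
    simp [horoAvg, this]
  rw [h2] at h1
  have h3 := escape_le hn one_pos (show 0 < R by linarith)
  norm_num at h3 ⊢
  norm_num at h1
  linarith

lemma cuspMass_nonneg (R : ℝ) (x : XQuot Γℤ) : 0 ≤ cuspMass R x := tsum_weight_nonneg R _

lemma cuspMass_le_one (R : ℝ) (x : XQuot Γℤ) : cuspMass R x ≤ 1 := tsum_weight_le_one R _

lemma integrable_cuspMass (μ : Measure (XQuot Γℤ)) [IsProbabilityMeasure μ] {R : ℝ} (hR : 1 ≤ R) :
    Integrable (cuspMass R) μ :=
  Integrable.of_bound (measurable_cuspMass hR).aestronglyMeasurable 1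
    (Eventually.of_forall fun x => by
      rw [Real.norm_of_nonneg (cuspMass_nonneg R x)]; exact cuspMass_le_one R x)

lemma tendsto_integral_cuspMass (μ : Measure (XQuot Γℤ)) [IsProbabilityMeasure μ] :
    Tendsto (fun k : ℕ => ∫ x, cuspMass (k + 1) x ∂μ) atTop (𝓝 1) := by
  have h := tendsto_integral_of_dominated_convergence (μ := μ)
    (F := fun k : ℕ => cuspMass (k + 1)) (f := fun _ => (1 : ℝ)) (fun _ => (1 : ℝ))
    (fun k => (measurable_cuspMass (by linarith [k.cast_nonneg (α := ℝ)])).aestronglyMeasurable)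
    (integrable_const _)
    (fun k => Eventually.of_forall fun x => by
      rw [Real.norm_of_nonneg (cuspMass_nonneg _ x)]; exact cuspMass_le_one _ x)
    (Eventually.of_forall fun x => by
      refine tendsto_const_nhds.congr' ?_
      filter_upwards [eventually_ge_atTop ⌈entryNorm (x.out).1⌉₊] with k hk
      refine (tsum_weight_eq_one (fun γ _ => mem_Gamma0_one γ) (by positivity) ⟨1, one_mem _, ?_⟩).symm
      rw [map_one, one_mul]
      have := Nat.le_ceil (entryNorm (x.out).1)
      have h2 : ((⌈entryNorm (x.out).1⌉₊ : ℕ) : ℝ) ≤ k := by exact_mod_cast hk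
      linarith)
  simpa using h

lemma exists_liftMeasure_eq_totientDensity (μ : Measure (XQuot Γℤ)) [IsProbabilityMeasure μ]
    (hμ : ∀ g : SL2R, Measure.map (rightT Γℤ g) μ = μ) :
    ∃ c : NNReal, liftMeasure μ = c • chartMeasure ∧ (c : ℝ) = totientDensity 1 ∧ c ≠ 0 := by
  obtain ⟨c, hc⟩ := exists_liftMeasure_eq μ hμ
  have key : ∀ {R M : ℝ} (_ : 1 ≤ R) {F : SL2R → ℂ}
      (_ : LeftInv (CongruenceSubgroup.Gamma0 1) F) (_ : Reg M F),
      ((totientDensity 1 : ℝ) : ℂ) * ∫ x : XQuot Γℤ, (cuspMass R x : ℂ) * F x.out ∂μ =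
        ((c : ℝ) : ℂ) * chartMean 1 R F := fun hR _ hinv hF => integral_weight_mul μ hc hR hinv hF
  have hone : ∀ R : ℝ, 1 ≤ R → ((totientDensity 1 : ℝ) : ℂ) * ((∫ x, cuspMass R x ∂μ : ℝ) : ℂ) =
      ((c : ℝ) : ℂ) * chartMean 1 R (fun _ => 1) := by
    intro R hR
    rw [← key hR (fun _ _ _ => rfl) reg_one]
    simp only [mul_one]
    rw [integral_complex_ofReal]
  have hlim1 : Tendsto (fun k : ℕ => chartMean 1 ((k : ℝ) + 1) (fun _ => 1)) atTop (𝓝 1) := by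
    rw [tendsto_iff_norm_sub_tendsto_zero]
    have h0 : Tendsto (fun k : ℕ => 1200 / ((k : ℝ) + 1) ^ 2) atTop (𝓝 0) := by
      refine Tendsto.div_atTop tendsto_const_nhds ?_
      refine (tendsto_pow_atTop (by norm_num)).comp ?_
      exact tendsto_atTop_add_const_right _ _ tendsto_natCast_atTop_atTop
    refine squeeze_zero (fun _ => norm_nonneg _) (fun k => ?_) h0
    rw [norm_sub_rev]
    exact norm_one_sub_chartMean_le (by linarith [k.cast_nonneg (α := ℝ)])
  have hlim2 : Tendsto (fun k : ℕ => ((∫ x, cuspMass (k + 1) x ∂μ : ℝ) : ℂ)) atTop (𝓝 1) := by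
    have := (Complex.continuous_ofReal.tendsto 1).comp (tendsto_integral_cuspMass μ)
    simpa [Function.comp_def] using this
  have hceq : ((totientDensity 1 : ℝ) : ℂ) = ((c : ℝ) : ℂ) := by
    have a := hlim2.const_mul ((totientDensity 1 : ℝ) : ℂ)
    have b := hlim1.const_mul ((c : ℝ) : ℂ)
    rw [mul_one] at a b
    refine tendsto_nhds_unique a (b.congr fun k => ?_)
    exact (hone _ (by linarith [k.cast_nonneg (α := ℝ)])).symm
  have hne : ((totientDensity 1 : ℝ) : ℂ) ≠ 0 := by
    intro h0
    have : ∀ R : ℝ, chartMean 1 R (fun _ => 1) = 0 := by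
      intro R
      rw [chartMean]
      push_cast
      rw [h0]; simp
    have h2 : Tendsto (fun k : ℕ => chartMean 1 ((k : ℝ) + 1) (fun _ => 1)) atTop (𝓝 0) := by
      simp only [this]; exact tendsto_const_nhds
    exact zero_ne_one (tendsto_nhds_unique h2 hlim1)
  have hcr : totientDensity 1 = c := Complex.ofReal_injective hceq
  refine ⟨c, hc, hcr.symm, fun h0 => hne ?_⟩
  rw [hcr, h0]
  simp

lemma integral_cuspMass_mul (μ : Measure (XQuot Γℤ)) [IsProbabilityMeasure μ]
    (hμ : ∀ g : SL2R, Measure.map (rightT Γℤ g) μ = μ) {R M : ℝ} (hR : 1 ≤ R) {F : SL2R → ℂ}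
    (hinv : LeftInv (CongruenceSubgroup.Gamma0 1) F) (hF : Reg M F) :
    ∫ x : XQuot Γℤ, (cuspMass R x : ℂ) * F x.out ∂μ = chartMean 1 R F := by
  obtain ⟨c, hc, hceq, hne⟩ := exists_liftMeasure_eq_totientDensity μ hμ
  have h := integral_weight_mul μ hc hR hinv hF
  rw [← hceq] at h
  refine mul_left_cancel₀ ?_ h
  simpa using hne

lemma norm_integral_sub_chartMean_le (μ : Measure (XQuot Γℤ)) [IsProbabilityMeasure μ]
    (hμ : ∀ g : SL2R, Measure.map (rightT Γℤ g) μ = μ) {R M : ℝ} (hR : 1 ≤ R) {F : SL2R → ℂ}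
    (hinv : LeftInv (CongruenceSubgroup.Gamma0 1) F) (hF : Reg M F) :
    ‖(∫ x : XQuot Γℤ, F x.out ∂μ) - chartMean 1 R F‖ ≤ M * (1200 / R ^ 2) := by
  have hm : Measurable fun x : XQuot Γℤ => F x.out := hinv.measurable_out hF.continuous.measurable
  have hi : Integrable (fun x : XQuot Γℤ => F x.out) μ :=
    Integrable.of_bound hm.aestronglyMeasurable M (Eventually.of_forall fun x => hF.1 _)
  have hi2 : Integrable (fun x : XQuot Γℤ => (cuspMass R x : ℂ) * F x.out) μ := by
    refine Integrable.of_bound ((Complex.measurable_ofReal.comp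
      (measurable_cuspMass hR)).mul hm).aestronglyMeasurable M (Eventually.of_forall fun x => ?_)
    rw [norm_mul, Complex.norm_real, Real.norm_of_nonneg (cuspMass_nonneg R x)]
    exact (mul_le_of_le_one_left (norm_nonneg _) (cuspMass_le_one R x)).trans (hF.1 _)
  rw [← integral_cuspMass_mul μ hμ hR hinv hF, ← integral_sub hi hi2]
  have h1 : 1 - ∫ x, cuspMass R x ∂μ ≤ 1200 / R ^ 2 := by
    have h := norm_one_sub_chartMean_le hR
    rw [← integral_cuspMass_mul μ hμ hR (fun _ _ _ => rfl) reg_one] at h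
    simp only [mul_one] at h
    rw [integral_complex_ofReal, ← Complex.ofReal_one, ← Complex.ofReal_sub, Complex.norm_real] at h
    exact (le_abs_self _).trans h
  have hic := integrable_cuspMass μ hR
  calc _ ≤ ∫ x : XQuot Γℤ, M * (1 - cuspMass R x) ∂μ := by
        refine norm_integral_le_of_norm_le (((integrable_const 1).sub hic).const_mul M)
          (Eventually.of_forall fun x => ?_)
        have e : F x.out - (cuspMass R x : ℂ) * F x.out = ((1 - cuspMass R x : ℝ) : ℂ) * F x.out := by
          push_cast; ring
        rw [e, norm_mul, Complex.norm_real,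
          Real.norm_of_nonneg (by linarith [cuspMass_le_one R x]), mul_comm M]
        exact mul_le_mul_of_nonneg_left (hF.1 _) (by linarith [cuspMass_le_one R x])
    _ = M * (1 - ∫ x, cuspMass R x ∂μ) := by
        rw [integral_const_mul, integral_sub (integrable_const 1) hic]; simp
    _ ≤ _ := mul_le_mul_of_nonneg_left h1 hF.nonneg

/-- The balance of the error terms. -/
lemma error_balance {n : ℕ} (hn : 0 < n) :
    ((n : ℝ) ^ (1 / 7360 : ℝ)) ^ 21 * (n : ℝ) ^ (-(1 / 320) : ℝ) = (n : ℝ) ^ (-(1 / 3680) : ℝ) ∧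
    1 / ((n : ℝ) ^ (1 / 7360 : ℝ)) ^ 2 = (n : ℝ) ^ (-(1 / 3680) : ℝ) := by
  have hn0 : (0 : ℝ) < n := by exact_mod_cast hn
  constructor
  · rw [← Real.rpow_natCast, ← Real.rpow_mul hn0.le, ← Real.rpow_add hn0]
    norm_num
  · rw [← Real.rpow_natCast, ← Real.rpow_mul hn0.le, one_div, ← Real.rpow_neg hn0.le]
    norm_num

/-- Effective equidistribution of the points `u_{j/n} a_{√n}⁻¹`. -/
lemma horoAvg_sub_integral_le : ∃ C : ℝ, 1 ≤ C ∧ ∀ (μ : Measure (XQuot Γℤ)),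
    IsProbabilityMeasure μ → (∀ g : SL2R, Measure.map (rightT Γℤ g) μ = μ) →
    ∀ n : ℕ, 0 < n → ∀ M : ℝ, ∀ F : SL2R → ℂ, LeftInv (CongruenceSubgroup.Gamma0 1) F → Reg M F →
    ‖horoAvg n F - ∫ x : XQuot Γℤ, F x.out ∂μ‖ ≤ C * M * (n : ℝ) ^ (-(1 / 3680) : ℝ) := by
  obtain ⟨C, hC, H⟩ := horoAvg_approx
  refine ⟨C + 2400, by linarith, fun μ _ hμ n hn M F hinv hF => ?_⟩
  have hM := hF.nonneg
  obtain ⟨e1, e2⟩ := error_balance hn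
  set R := (n : ℝ) ^ (1 / 7360 : ℝ) with hRdef
  have hR : 1 ≤ R := Real.one_le_rpow (by exact_mod_cast hn) (by norm_num)
  have h1 := H n 1 hn one_pos R M hR F hinv hF
  have h2 := norm_integral_sub_chartMean_le μ hμ hR hinv hF
  have h3 := mul_le_mul_of_nonneg_left (escape_le hn one_pos (show 0 < R by linarith)) hM
  have e3 : (1200 : ℝ) / R ^ 2 = 1200 * (n : ℝ) ^ (-(1 / 3680) : ℝ) := by rw [← e2]; ring
  have e4 : (1200 : ℝ) * ((1 : ℕ) : ℝ) ^ 2 / R ^ 2 = 1200 * (n : ℝ) ^ (-(1 / 3680) : ℝ) := by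
    rw [← e2]; push_cast; ring
  rw [e3] at h2
  rw [e4] at h3
  have e5 : C * M * R ^ 21 * (n : ℝ) ^ (-(1 / 320) : ℝ) = C * M * (n : ℝ) ^ (-(1 / 3680) : ℝ) := by
    rw [← e1]; ring
  rw [e5] at h1
  rw [norm_sub_rev] at h2
  have := norm_sub_le_norm_sub_add_norm_sub (horoAvg n F) (chartMean 1 R F)
    (∫ x : XQuot Γℤ, F x.out ∂μ)
  nlinarith

/-- The averages of a function of level `q` at different scales are close. -/
lemma horoAvg_sub_horoAvg_le : ∃ C : ℝ, 1 ≤ C ∧ ∀ n n' q : ℕ, 0 < n → n ≤ n' → 0 < q →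
    ∀ M : ℝ, ∀ F : SL2R → ℂ, LeftInv (CongruenceSubgroup.Gamma0 q) F → Reg M F →
    ‖horoAvg n F - horoAvg n' F‖ ≤ C * M * q ^ 2 * (n : ℝ) ^ (-(1 / 3680) : ℝ) := by
  obtain ⟨C, hC, H⟩ := horoAvg_approx
  refine ⟨2 * C + 2400, by linarith, fun n n' q hn hnn hq M F hinv hF => ?_⟩
  have hM := hF.nonneg
  have hn0 : (0 : ℝ) < n := by exact_mod_cast hn
  obtain ⟨e1, e2⟩ := error_balance hn
  set R := (n : ℝ) ^ (1 / 7360 : ℝ) with hRdef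
  have hR : 1 ≤ R := Real.one_le_rpow (by exact_mod_cast hn) (by norm_num)
  have h1 := H n q hn hq R M hR F hinv hF
  have h2 := H n' q (hn.trans_le hnn) hq R M hR F hinv hF
  have h3 := mul_le_mul_of_nonneg_left (escape_le hn hq (show 0 < R by linarith)) hM
  have h4 := mul_le_mul_of_nonneg_left
    (escape_le (hn.trans_le hnn) hq (show 0 < R by linarith)) hM
  have e4 : (1200 : ℝ) * (q : ℝ) ^ 2 / R ^ 2 = 1200 * q ^ 2 * (n : ℝ) ^ (-(1 / 3680) : ℝ) := by
    rw [← e2]; ring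
  rw [e4] at h3 h4
  have e5 : C * M * R ^ 21 * (n : ℝ) ^ (-(1 / 320) : ℝ) = C * M * (n : ℝ) ^ (-(1 / 3680) : ℝ) := by
    rw [← e1]; ring
  have h5 : C * M * R ^ 21 * (n' : ℝ) ^ (-(1 / 320) : ℝ) ≤
      C * M * R ^ 21 * (n : ℝ) ^ (-(1 / 320) : ℝ) := by
    refine mul_le_mul_of_nonneg_left ?_ (by positivity)
    exact Real.rpow_le_rpow_of_nonpos hn0 (by exact_mod_cast hnn) (by norm_num)
  rw [e5] at h1 h5
  have h6 : C * M * (n : ℝ) ^ (-(1 / 3680) : ℝ) ≤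
      C * M * q ^ 2 * (n : ℝ) ^ (-(1 / 3680) : ℝ) := by
    refine mul_le_mul_of_nonneg_right ?_ (by positivity)
    exact le_mul_of_one_le_right (by positivity) (one_le_pow₀ (by exact_mod_cast hq))
  rw [norm_sub_rev] at h2
  have := norm_sub_le_norm_sub_add_norm_sub (horoAvg n F) (chartMean q R F) (horoAvg n' F)
  nlinarith

lemma abs_apply_le_matSup (A : Matrix (Fin 2) (Fin 2) ℝ) (i j : Fin 2) : |A i j| ≤ matSup A := by
  unfold matSup
  fin_cases i <;> fin_cases j <;> simp

lemma matSup_nonneg (A : Matrix (Fin 2) (Fin 2) ℝ) : 0 ≤ matSup A :=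
  (abs_nonneg _).trans (abs_apply_le_matSup A 0 0)

lemma matSup_lt {A : Matrix (Fin 2) (Fin 2) ℝ} {r : ℝ} (h : ∀ i j, |A i j| < r) : matSup A < r :=
  max_lt (max_lt (h 0 0) (h 0 1)) (max_lt (h 1 0) (h 1 1))

lemma entryNorm_le_matSup (A : Matrix (Fin 2) (Fin 2) ℝ) : entryNorm A ≤ 4 * matSup A := by
  unfold entryNorm
  linarith [abs_apply_le_matSup A 0 0, abs_apply_le_matSup A 0 1, abs_apply_le_matSup A 1 0,
    abs_apply_le_matSup A 1 1]

/-- The conjugate of an integer matrix. -/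
def conjInt (g : SL2R) (w : Matrix (Fin 2) (Fin 2) ℤ) : Matrix (Fin 2) (Fin 2) ℝ :=
  ((g⁻¹ : SL2R) : Matrix (Fin 2) (Fin 2) ℝ) * w.map (Int.cast : ℤ → ℝ) *
    (g : Matrix (Fin 2) (Fin 2) ℝ)

/-- The height as a function on the group. -/
def htFun (g : SL2R) : ℝ :=
  sSup {r : ℝ | ∃ w : Matrix (Fin 2) (Fin 2) ℤ, w ≠ 0 ∧ w.trace = 0 ∧
    r = (matSup (conjInt g w))⁻¹}

lemma one_le_entryNorm_int {w : Matrix (Fin 2) (Fin 2) ℤ} (hw : w ≠ 0) :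
    1 ≤ entryNorm (w.map (Int.cast : ℤ → ℝ)) := by
  obtain ⟨i, j, hij⟩ : ∃ i j, w i j ≠ 0 := by
    by_contra! h
    exact hw (Matrix.ext h)
  refine le_trans ?_ (abs_apply_le_entryNorm _ i j)
  rw [Matrix.map_apply]
  exact_mod_cast Int.one_le_abs hij

lemma coe_mul_coe_inv (g : SL2R) : (g.1 : Matrix (Fin 2) (Fin 2) ℝ) * (g⁻¹ : SL2R).1 = 1 := by
  change (g * g⁻¹ : SL2R).1 = 1
  rw [mul_inv_cancel]; rfl

lemma coe_inv_mul_coe (g : SL2R) : ((g⁻¹ : SL2R).1 : Matrix (Fin 2) (Fin 2) ℝ) * g.1 = 1 := by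
  change (g⁻¹ * g : SL2R).1 = 1
  rw [inv_mul_cancel]; rfl

lemma map_eq_conj (g : SL2R) (w : Matrix (Fin 2) (Fin 2) ℤ) :
    w.map (Int.cast : ℤ → ℝ) = g.1 * conjInt g w * (g⁻¹ : SL2R).1 := by
  unfold conjInt
  calc _ = 1 * w.map (Int.cast : ℤ → ℝ) * 1 := by rw [one_mul, mul_one]
    _ = (g.1 * (g⁻¹ : SL2R).1) * w.map (Int.cast : ℤ → ℝ) * (g.1 * (g⁻¹ : SL2R).1) := by
        rw [coe_mul_coe_inv]
    _ = _ := by simp only [Matrix.mul_assoc]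

lemma one_le_mul_matSup {g : SL2R} {w : Matrix (Fin 2) (Fin 2) ℤ} (hw : w ≠ 0) :
    1 ≤ 4 * entryNorm g.1 ^ 2 * matSup (conjInt g w) := by
  have h := one_le_entryNorm_int hw
  rw [map_eq_conj g w] at h
  have h1 := entryNorm_mul_le (g.1 * conjInt g w) (g⁻¹ : SL2R).1
  have h2 := entryNorm_mul_le g.1 (conjInt g w)
  have h3 : entryNorm (g⁻¹ : SL2R).1 = entryNorm g.1 := entryNorm_inv g
  rw [h3] at h1
  have h4 := entryNorm_le_matSup (conjInt g w)
  have h5 := entryNorm_nonneg g.1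
  calc 1 ≤ entryNorm g.1 * entryNorm (conjInt g w) * entryNorm g.1 :=
        h.trans (h1.trans (mul_le_mul_of_nonneg_right h2 h5))
    _ ≤ entryNorm g.1 * (4 * matSup (conjInt g w)) * entryNorm g.1 := by gcongr
    _ = _ := by ring

lemma matSup_conjInt_pos {g : SL2R} {w : Matrix (Fin 2) (Fin 2) ℤ} (hw : w ≠ 0) :
    0 < matSup (conjInt g w) := by
  rcases (matSup_nonneg (conjInt g w)).eq_or_lt with h | h
  · have := one_le_mul_matSup (g := g) hw
    rw [← h] at this
    linarith
  · exact h

lemma inv_matSup_le {g : SL2R} {w : Matrix (Fin 2) (Fin 2) ℤ} (hw : w ≠ 0) :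
    (matSup (conjInt g w))⁻¹ ≤ 4 * entryNorm g.1 ^ 2 := by
  have h := matSup_conjInt_pos (g := g) hw
  rw [inv_le_iff_one_le_mul₀ h]
  exact one_le_mul_matSup hw

lemma inv_matSup_le_htFun {g : SL2R} {w : Matrix (Fin 2) (Fin 2) ℤ} (hw : w ≠ 0)
    (ht : w.trace = 0) : (matSup (conjInt g w))⁻¹ ≤ htFun g := by
  refine le_csSup ⟨4 * entryNorm g.1 ^ 2, ?_⟩ ⟨w, hw, ht, rfl⟩
  rintro _ ⟨w, hw, -, rfl⟩
  exact inv_matSup_le hw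

lemma exists_traceless : ∃ w : Matrix (Fin 2) (Fin 2) ℤ, w ≠ 0 ∧ w.trace = 0 :=
  ⟨!![0, 1; 0, 0], fun h => by simpa using congrFun (congrFun h 0) 1, by simp [Matrix.trace_fin_two]⟩

lemma htFun_pos (g : SL2R) : 0 < htFun g := by
  obtain ⟨w, hw, ht⟩ := exists_traceless
  exact (inv_pos.2 (matSup_conjInt_pos hw)).trans_le (inv_matSup_le_htFun hw ht)

lemma htFun_le (g : SL2R) : htFun g ≤ 4 * entryNorm g.1 ^ 2 := by
  obtain ⟨w, hw, ht⟩ := exists_traceless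
  refine csSup_le ⟨_, w, hw, ht, rfl⟩ ?_
  rintro _ ⟨w, hw, -, rfl⟩
  exact inv_matSup_le hw

lemma conjInt_emb_mul (γ : Matrix.SpecialLinearGroup (Fin 2) ℤ) (g : SL2R)
    (w : Matrix (Fin 2) (Fin 2) ℤ) :
    conjInt (emb γ * g) w = conjInt g ((γ⁻¹).1 * w * γ.1) := by
  have e : ((γ⁻¹).1 * w * γ.1).map (Int.cast : ℤ → ℝ) =
      (emb γ⁻¹).1 * w.map (Int.cast : ℤ → ℝ) * (emb γ).1 := by
    rw [show (Int.cast : ℤ → ℝ) = ⇑(Int.castRingHom ℝ) from rfl, Matrix.map_mul, Matrix.map_mul]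
    rfl
  unfold conjInt
  rw [e, map_inv]
  change ((emb γ * g)⁻¹ : SL2R).1 * _ * ((emb γ).1 * g.1) = _
  rw [_root_.mul_inv_rev]
  change ((g⁻¹ : SL2R).1 * ((emb γ)⁻¹ : SL2R).1) * _ * ((emb γ).1 * g.1) = _
  simp only [Matrix.mul_assoc]

lemma htFun_emb_mul_le (γ : Matrix.SpecialLinearGroup (Fin 2) ℤ) (g : SL2R) :
    htFun (emb γ * g) ≤ htFun g := by
  obtain ⟨w, hw, ht⟩ := exists_traceless
  refine csSup_le ⟨_, w, hw, ht, rfl⟩ ?_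
  rintro _ ⟨w, hw, ht, rfl⟩
  rw [conjInt_emb_mul]
  have e1 : γ.1 * (γ⁻¹).1 = 1 := by
    change (γ * γ⁻¹).1 = 1
    rw [mul_inv_cancel]; rfl
  refine inv_matSup_le_htFun (fun h => hw ?_) ?_
  · calc w = (γ.1 * (γ⁻¹).1) * w * (γ.1 * (γ⁻¹).1) := by rw [e1, one_mul, mul_one]
      _ = γ.1 * ((γ⁻¹).1 * w * γ.1) * (γ⁻¹).1 := by simp only [Matrix.mul_assoc]
      _ = 0 := by rw [h, Matrix.mul_zero, Matrix.zero_mul]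
  · rw [Matrix.trace_mul_comm, ← Matrix.mul_assoc, e1, one_mul, ht]

lemma leftInv_htFun : LeftInv (CongruenceSubgroup.Gamma0 1) htFun := by
  intro γ _ g
  refine (htFun_emb_mul_le γ g).antisymm ?_
  have := htFun_emb_mul_le γ⁻¹ (emb γ * g)
  rwa [map_inv, inv_mul_cancel_left] at this

lemma continuous_matSup_conjInt (w : Matrix (Fin 2) (Fin 2) ℤ) :
    Continuous fun g : SL2R => matSup (conjInt g w) := by
  have h : ∀ i j, Continuous fun g : SL2R => conjInt g w i j := by
    intro i j
    have h0 : Continuous fun g : SL2R => conjInt g w := by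
      unfold conjInt
      exact ((isClosedEmbedding_coe.continuous.comp continuous_inv).matrix_mul
        continuous_const).matrix_mul isClosedEmbedding_coe.continuous
    exact (continuous_apply_apply i j).comp h0
  unfold matSup
  exact ((h 0 0).abs.max (h 0 1).abs).max ((h 1 0).abs.max (h 1 1).abs)

lemma measurable_htFun : Measurable htFun := by
  have : Countable (Matrix (Fin 2) (Fin 2) ℤ) := inferInstanceAs (Countable (Fin 2 → Fin 2 → ℤ))
  have e : htFun = fun g => ⨆ w : {w : Matrix (Fin 2) (Fin 2) ℤ // w ≠ 0 ∧ w.trace = 0},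
      (matSup (conjInt g w.1))⁻¹ := by
    funext g
    rw [iSup, htFun]
    congr 1
    ext r
    constructor
    · rintro ⟨w, hw, ht, rfl⟩
      exact ⟨⟨w, hw, ht⟩, rfl⟩
    · rintro ⟨⟨w, hw, ht⟩, rfl⟩
      exact ⟨w, hw, ht, rfl⟩
  rw [e]
  exact Measurable.iSup fun w => (continuous_matSup_conjInt w.1).measurable.inv

lemma conjInt_sub (g : SL2R) (a b : Matrix (Fin 2) (Fin 2) ℤ) :
    conjInt g (a - b) = conjInt g a - conjInt g b := by
  unfold conjInt
  rw [Matrix.map_sub _ (by simp), mul_sub, sub_mul]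

lemma trace_conjInt (g : SL2R) (a : Matrix (Fin 2) (Fin 2) ℤ) :
    (conjInt g a).trace = a.trace := by
  unfold conjInt
  rw [Matrix.trace_mul_comm, ← Matrix.mul_assoc, show (g : Matrix (Fin 2) (Fin 2) ℝ) *
    ((g⁻¹ : SL2R) : Matrix (Fin 2) (Fin 2) ℝ) = 1 from coe_mul_coe_inv g, one_mul]
  simp [Matrix.trace_fin_two]

/-- Twice the traceless part of an integer matrix. -/
def tracelessPart (a : Matrix (Fin 2) (Fin 2) ℤ) : Matrix (Fin 2) (Fin 2) ℤ :=
  !![a 0 0 - a 1 1, 2 * a 0 1; 2 * a 1 0, a 1 1 - a 0 0]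

lemma conjInt_tracelessPart (g : SL2R) (a : Matrix (Fin 2) (Fin 2) ℤ) :
    conjInt g (tracelessPart a) = (2 : ℝ) • conjInt g a - (a.trace : ℝ) • 1 := by
  have e : (tracelessPart a).map (Int.cast : ℤ → ℝ) =
      (2 : ℝ) • a.map (Int.cast : ℤ → ℝ) - (a.trace : ℝ) • 1 := by
    ext i j
    fin_cases i <;> fin_cases j <;> simp [tracelessPart, Matrix.trace_fin_two] <;> ring
  unfold conjInt
  rw [e, mul_sub, sub_mul, Matrix.mul_smul, Matrix.smul_mul, Matrix.mul_smul, Matrix.smul_mul,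
    mul_one, show ((g⁻¹ : SL2R) : Matrix (Fin 2) (Fin 2) ℝ) *
      (g : Matrix (Fin 2) (Fin 2) ℝ) = 1 from coe_inv_mul_coe g]

lemma trace_tracelessPart (a : Matrix (Fin 2) (Fin 2) ℤ) : (tracelessPart a).trace = 0 := by
  simp [tracelessPart, Matrix.trace_fin_two]

lemma abs_sub_mul_lt_of_floor_eq {H x y : ℝ} (hH : 0 < H) (h : ⌊H * x⌋ = ⌊H * y⌋) :
    |x - y| < H⁻¹ := by
  have h1 := Int.abs_sub_lt_one_of_floor_eq_floor h
  rw [← mul_sub, abs_mul, abs_of_pos hH] at h1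
  rwa [inv_eq_one_div, lt_div_iff₀' hH]

lemma matSup_sub_lt {A B : Matrix (Fin 2) (Fin 2) ℝ} {r : ℝ}
    (ht : A 0 0 - B 0 0 + (A 1 1 - B 1 1) = 0) (h00 : |A 0 0 - B 0 0| < r)
    (h01 : |A 0 1 - B 0 1| < r) (h10 : |A 1 0 - B 1 0| < r) : matSup (A - B) < r := by
  have h11 : |A 1 1 - B 1 1| < r := by
    rwa [eq_neg_of_add_eq_zero_right ht, abs_neg]
  refine matSup_lt fun i j => ?_
  fin_cases i <;> fin_cases j
  · exact h00
  · exact h01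
  · exact h10
  · exact h11

lemma eq_of_floor_eq (g : SL2R) {a b : Matrix (Fin 2) (Fin 2) ℤ} (ht : a.trace = b.trace)
    (h00 : ⌊htFun g * conjInt g (tracelessPart a) 0 0⌋ =
      ⌊htFun g * conjInt g (tracelessPart b) 0 0⌋)
    (h01 : ⌊htFun g * conjInt g (tracelessPart a) 0 1⌋ =
      ⌊htFun g * conjInt g (tracelessPart b) 0 1⌋)
    (h10 : ⌊htFun g * conjInt g (tracelessPart a) 1 0⌋ =
      ⌊htFun g * conjInt g (tracelessPart b) 1 0⌋) : a = b := by
  have hH := htFun_pos g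
  have hz : tracelessPart a - tracelessPart b = 0 := by
    by_contra hne
    have htr : (tracelessPart a - tracelessPart b).trace = 0 := by
      rw [Matrix.trace_sub, trace_tracelessPart, trace_tracelessPart, sub_zero]
    have h1 := inv_matSup_le_htFun (g := g) hne htr
    have hc := trace_conjInt g (tracelessPart a - tracelessPart b)
    rw [htr, Matrix.trace_fin_two] at hc
    have k00 := abs_sub_mul_lt_of_floor_eq hH h00
    have k01 := abs_sub_mul_lt_of_floor_eq hH h01
    have k10 := abs_sub_mul_lt_of_floor_eq hH h10
    have hm : matSup (conjInt g (tracelessPart a - tracelessPart b)) < (htFun g)⁻¹ := by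
      rw [conjInt_sub] at hc ⊢
      simp only [Matrix.sub_apply] at hc
      push_cast at hc
      exact matSup_sub_lt hc k00 k01 k10
    have h2 := matSup_conjInt_pos (g := g) hne
    have h3 := (lt_inv_comm₀ h2 hH).1 hm
    linarith
  have e : ∀ i j, tracelessPart a i j = tracelessPart b i j := fun i j => by
    rw [sub_eq_zero.1 hz]
  have e00 := e 0 0
  have e01 := e 0 1
  have e10 := e 1 0
  simp [tracelessPart] at e00 e01 e10
  rw [Matrix.trace_fin_two, Matrix.trace_fin_two] at ht
  ext i j
  fin_cases i <;> fin_cases j <;> simp <;> omega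

/-- The number of integral matrices of bounded size relative to `g` is controlled by the height. -/
lemma card_conj_le (g : SL2R) {K : ℝ} (hK : 1 ≤ K)
    (S : Finset (Matrix.SpecialLinearGroup (Fin 2) ℤ))
    (hS : ∀ γ ∈ S, entryNorm (conjInt g γ.1) ≤ K) :
    (S.card : ℝ) ≤ (9 * K * (1 + htFun g)) ^ 4 := by
  have hH := htFun_pos g
  set B := 3 * K * (1 + htFun g) with hB
  have hB1 : 3 ≤ B := by rw [hB]; nlinarith
  set I := Finset.Icc (-(⌊B⌋ + 1)) (⌊B⌋ + 1) with hI
  have hmem : ∀ x : ℝ, |x| ≤ B → ⌊x⌋ ∈ I := by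
    intro x hx
    rw [hI, Finset.mem_Icc]
    obtain ⟨h1, h2⟩ := abs_le.1 hx
    constructor
    · rw [Int.le_floor]
      push_cast
      linarith [Int.lt_floor_add_one B]
    · linarith [Int.floor_le_floor h2]
  let f : Matrix.SpecialLinearGroup (Fin 2) ℤ → ℤ × ℤ × ℤ × ℤ := fun γ =>
    (γ.1.trace, ⌊htFun g * conjInt g (tracelessPart γ.1) 0 0⌋,
      ⌊htFun g * conjInt g (tracelessPart γ.1) 0 1⌋, ⌊htFun g * conjInt g (tracelessPart γ.1) 1 0⌋)
  have hf : Function.Injective f := by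
    intro γ γ' h
    simp only [f, Prod.mk.injEq] at h
    exact Subtype.ext (eq_of_floor_eq g h.1 h.2.1 h.2.2.1 h.2.2.2)
  have hmaps : ∀ γ ∈ S, f γ ∈ I ×ˢ I ×ˢ I ×ˢ I := by
    intro γ hγ
    have hx : ∀ i j, |conjInt g γ.1 i j| ≤ K := fun i j =>
      (abs_apply_le_entryNorm _ i j).trans (hS γ hγ)
    have htr : |(γ.1.trace : ℝ)| ≤ K := by
      rw [← trace_conjInt g, Matrix.trace_fin_two]
      refine le_trans ?_ (hS γ hγ)
      unfold entryNorm
      linarith [abs_add_le (conjInt g γ.1 0 0) (conjInt g γ.1 1 1),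
        abs_nonneg (conjInt g γ.1 0 1), abs_nonneg (conjInt g γ.1 1 0)]
    have key : ∀ i j, |htFun g * conjInt g (tracelessPart γ.1) i j| ≤ B := by
      intro i j
      have h1 : |conjInt g (tracelessPart γ.1) i j| ≤ 3 * K := by
        rw [conjInt_tracelessPart]
        have h2 : |(1 : Matrix (Fin 2) (Fin 2) ℝ) i j| ≤ 1 := by
          rw [Matrix.one_apply]; split_ifs <;> simp
        simp only [Matrix.sub_apply, Matrix.smul_apply, smul_eq_mul]
        refine (abs_sub _ _).trans ?_
        rw [abs_mul, abs_mul, abs_of_pos (two_pos : (0 : ℝ) < 2)]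
        nlinarith [hx i j, abs_nonneg (γ.1.trace : ℝ), abs_nonneg ((1 : Matrix (Fin 2) (Fin 2) ℝ) i j)]
      rw [abs_mul, abs_of_pos hH, hB]
      nlinarith [mul_le_mul_of_nonneg_left h1 hH.le]
    simp only [f, Finset.mem_product]
    refine ⟨?_, hmem _ (key _ _), hmem _ (key _ _), hmem _ (key _ _)⟩
    have := hmem (γ.1.trace : ℝ) (htr.trans (by rw [hB]; nlinarith))
    rwa [Int.floor_intCast] at this
  have h1 := Finset.card_le_card_of_injOn f hmaps hf.injOn
  have h2 : (I.card : ℝ) ≤ 9 * K * (1 + htFun g) := by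
    rw [hI, Int.card_Icc]
    have h3 : 0 ≤ ⌊B⌋ := Int.floor_nonneg.2 (by linarith)
    have h4 : ((⌊B⌋ + 1 + 1 - -(⌊B⌋ + 1)).toNat : ℤ) = 2 * ⌊B⌋ + 3 := by
      rw [Int.toNat_of_nonneg (by linarith)]; ring
    have h5 : (((⌊B⌋ + 1 + 1 - -(⌊B⌋ + 1)).toNat : ℕ) : ℝ) = 2 * ⌊B⌋ + 3 := by exact_mod_cast h4
    rw [h5]
    have := Int.floor_le B
    linarith
  calc (S.card : ℝ) ≤ ((I ×ˢ I ×ˢ I ×ˢ I).card : ℝ) := by exact_mod_cast h1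
    _ = (I.card : ℝ) ^ 4 := by
      simp only [Finset.card_product]; push_cast; ring
    _ ≤ _ := by gcongr

lemma sq_integral_le {h : ℝ → ℝ} (hh : Continuous h) :
    (∫ s in (0 : ℝ)..1, h s) ^ 2 ≤ ∫ s in (0 : ℝ)..1, h s ^ 2 := by
  set c := ∫ s in (0 : ℝ)..1, h s with hc
  have h0 : 0 ≤ ∫ s in (0 : ℝ)..1, (h s - c) ^ 2 :=
    intervalIntegral.integral_nonneg zero_le_one fun s _ => sq_nonneg _
  have e : ∫ s in (0 : ℝ)..1, (h s - c) ^ 2 = (∫ s in (0 : ℝ)..1, h s ^ 2) - c ^ 2 := by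
    have e1 : (fun s => (h s - c) ^ 2) = fun s => (h s ^ 2 - 2 * c * h s) + c ^ 2 := by
      funext s; ring
    rw [e1, intervalIntegral.integral_add
      (Continuous.intervalIntegrable (by fun_prop) _ _) (by simp),
      intervalIntegral.integral_sub (Continuous.intervalIntegrable (by fun_prop) _ _)
      (Continuous.intervalIntegrable (by fun_prop) _ _), intervalIntegral.integral_const_mul, ← hc]
    simp
    ring
  rw [e] at h0
  linarith

lemma sq_norm_le_integral {ψ ψ' : ℝ → ℂ} (hψ : ∀ s, HasDerivAt ψ (ψ' s) s) (hc : Continuous ψ') :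
    ‖ψ 0‖ ^ 2 ≤ 2 * ∫ s in (0 : ℝ)..1, (‖ψ s‖ ^ 2 + ‖ψ' s‖ ^ 2) := by
  have hcψ : Continuous ψ := continuous_iff_continuousAt.2 fun s => (hψ s).continuousAt
  have hI : ∀ f : ℝ → ℝ, Continuous f → IntervalIntegrable f volume 0 1 := fun f hf =>
    hf.intervalIntegrable _ _
  have hpt : ∀ s ∈ Set.Icc (0 : ℝ) 1,
      ‖ψ 0‖ ^ 2 ≤ 2 * ‖ψ s‖ ^ 2 + 2 * ∫ s in (0 : ℝ)..1, ‖ψ' s‖ ^ 2 := by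
    intro s hs
    have h1 : ψ s - ψ 0 = ∫ t in (0 : ℝ)..s, ψ' t :=
      (intervalIntegral.integral_eq_sub_of_hasDerivAt (fun t _ => hψ t)
        (hc.intervalIntegrable _ _)).symm
    have h2 : ‖ψ s - ψ 0‖ ≤ ∫ t in (0 : ℝ)..1, ‖ψ' t‖ := by
      rw [h1]
      refine (intervalIntegral.norm_integral_le_integral_norm hs.1).trans ?_
      exact intervalIntegral.integral_mono_interval le_rfl hs.1 hs.2
        (Eventually.of_forall fun t => norm_nonneg _) (hI _ hc.norm)
    have h3 := sq_integral_le hc.norm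
    have h4 : ‖ψ 0‖ ≤ ‖ψ s‖ + ‖ψ s - ψ 0‖ := by
      have := norm_sub_le (ψ s) (ψ s - ψ 0)
      rwa [sub_sub_cancel] at this
    have h5 := norm_nonneg (ψ 0)
    have h6 := norm_nonneg (ψ s - ψ 0)
    have h7 : ‖ψ s - ψ 0‖ ^ 2 ≤ ∫ t in (0 : ℝ)..1, ‖ψ' t‖ ^ 2 :=
      (pow_le_pow_left₀ h6 h2 2).trans h3
    nlinarith [pow_le_pow_left₀ h5 h4 2, sq_nonneg (‖ψ s‖ - ‖ψ s - ψ 0‖)]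
  have hm := intervalIntegral.integral_mono_on zero_le_one (hI (fun _ => ‖ψ 0‖ ^ 2) (by fun_prop))
    (hI (fun s => 2 * ‖ψ s‖ ^ 2 + 2 * ∫ s in (0 : ℝ)..1, ‖ψ' s‖ ^ 2) (by fun_prop)) hpt
  rw [intervalIntegral.integral_add (hI _ (by fun_prop)) (by simp),
    intervalIntegral.integral_const_mul] at hm
  simp only [intervalIntegral.integral_const, sub_zero, one_smul] at hm
  rw [intervalIntegral.integral_add (hI _ (by fun_prop)) (hI _ (by fun_prop))]
  linarith

lemma oneParam_add (i : Fin 3) (s t : ℝ) : oneParam i (s + t) = oneParam i s * oneParam i t := by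
  apply Subtype.ext
  change _ = (oneParam i s).1 * (oneParam i t).1
  fin_cases i <;> ext a b <;> fin_cases a <;> fin_cases b <;>
    simp [oneParam, hElt, uElt, vElt, Real.exp_add, Matrix.mul_apply, Fin.sum_univ_two] <;> ring

lemma oneParam_zero (i : Fin 3) : oneParam i 0 = 1 := by
  apply Subtype.ext
  change _ = (1 : Matrix (Fin 2) (Fin 2) ℝ)
  fin_cases i <;> ext a b <;> fin_cases a <;> fin_cases b <;>
    simp [oneParam, hElt, uElt, vElt]

lemma continuous_oneParam (i : Fin 3) : Continuous (oneParam i) := by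
  rw [isClosedEmbedding_coe.isInducing.continuous_iff]
  refine continuous_pi fun a => continuous_pi fun b => ?_
  fin_cases i <;> fin_cases a <;> fin_cases b <;>
    simp [oneParam, hElt, uElt, vElt] <;> fun_prop

lemma hasDerivAt_wordDeriv {Φ : SL2R → ℂ} (h : IsSmoothSL Φ) (w : List (Fin 3)) (i : Fin 3)
    (g : SL2R) (s : ℝ) : HasDerivAt (fun s => wordDeriv w Φ (g * oneParam i s))
      (wordDeriv (i :: w) Φ (g * oneParam i s)) s := by
  have h1 := ((h w).2 i (g * oneParam i s)).hasDerivAt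
  have h2 : HasDerivAt (fun t => wordDeriv w Φ (g * oneParam i s * oneParam i (t - s)))
      (wordDeriv (i :: w) Φ (g * oneParam i s)) s := by
    have := HasDerivAt.comp_sub_const (f := fun t => wordDeriv w Φ (g * oneParam i s * oneParam i t))
      s s (by rw [sub_self]; exact h1)
    exact this
  refine h2.congr_of_eventuallyEq (Eventually.of_forall fun t => ?_)
  simp only [mul_assoc, ← oneParam_add, add_sub_cancel]

/-- The squared modulus of a derivative along a word. -/
def wordSq (Φ : SL2R → ℂ) (w : List (Fin 3)) (g : SL2R) : ℝ≥0∞ :=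
  ENNReal.ofReal (‖wordDeriv w Φ g‖ ^ 2)

lemma continuous_wordSq {Φ : SL2R → ℂ} (h : IsSmoothSL Φ) (w : List (Fin 3)) :
    Continuous (wordSq Φ w) :=
  ENNReal.continuous_ofReal.comp ((h w).1.norm.pow 2)

lemma wordSq_le {Φ : SL2R → ℂ} (h : IsSmoothSL Φ) (w : List (Fin 3)) (i : Fin 3) (g : SL2R) :
    wordSq Φ w g ≤ 2 * ∫⁻ s in Set.Icc (0 : ℝ) 1,
      (wordSq Φ w (g * oneParam i s) + wordSq Φ (i :: w) (g * oneParam i s)) := by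
  have hco : ∀ w, Continuous fun s => wordDeriv w Φ (g * oneParam i s) := fun w =>
    (h w).1.comp (continuous_const.mul (continuous_oneParam i))
  have h1 := sq_norm_le_integral (hasDerivAt_wordDeriv h w i g) (hco (i :: w))
  rw [oneParam_zero, mul_one] at h1
  unfold wordSq
  refine (ENNReal.ofReal_le_ofReal h1).trans ?_
  rw [ENNReal.ofReal_mul zero_le_two, ENNReal.ofReal_ofNat,
    intervalIntegral.integral_of_le zero_le_one, ← integral_Icc_eq_integral_Ioc,
    ofReal_integral_eq_lintegral_ofReal]
  · refine mul_le_mul_right (lintegral_mono fun s => ?_) _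
    exact (ENNReal.ofReal_add (sq_nonneg _) (sq_nonneg _)).le
  · exact Continuous.integrableOn_Icc (((hco w).norm.pow 2).add ((hco (i :: w)).norm.pow 2))
  · exact Eventually.of_forall fun s => by positivity

lemma hElt_mul_vElt_mul_uElt (s t r : ℝ) : hElt s * vElt t * uElt r =
    chart (Real.exp (-s), Real.exp (-s) * r, (Real.exp (-s))⁻¹ * t) := by
  apply Subtype.ext
  rw [coe_chart (Real.exp_pos _).ne']
  change (hElt s).1 * (vElt t).1 * (uElt r).1 = _
  ext a b
  fin_cases a <;> fin_cases b <;>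
    simp [hElt, vElt, uElt, Matrix.mul_apply, Fin.sum_univ_two, Real.exp_neg]
  field_simp
  ring

lemma lintegral_chart_smul_le {K : SL2R → ℝ≥0∞} (hK : Measurable K) {a : ℝ} (ha : 0 < a) :
    ∫⁻ t : ℝ, ∫⁻ r : ℝ, K (chart (a, a * r, a⁻¹ * t)) =
      ∫⁻ b : ℝ, ∫⁻ c : ℝ, K (chart (a, b, c)) := by
  have hm : Measurable fun x : ℝ × ℝ => K (chart (a, x.1, x.2)) :=
    hK.comp (measurable_chart.comp (by fun_prop))
  have h1 : ∀ c : ℝ, ∫⁻ r : ℝ, K (chart (a, a * r, c)) =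
      ENNReal.ofReal a⁻¹ * ∫⁻ b : ℝ, K (chart (a, b, c)) := by
    intro c
    have := lintegral_comp_affine (φ := fun b => K (chart (a, b, c)))
      (hm.comp (measurable_id.prodMk measurable_const)) ha.ne' 0
    simpa only [add_zero, abs_of_pos ha] using this
  have hmi : Measurable fun c : ℝ => ∫⁻ b : ℝ, K (chart (a, b, c)) :=
    (hm.comp measurable_swap).lintegral_prod_right'
  have h2 := lintegral_comp_affine hmi (inv_ne_zero ha.ne') 0
  simp only [add_zero, abs_of_pos (inv_pos.2 ha), inv_inv] at h2
  simp only [h1]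
  rw [lintegral_const_mul' _ _ ENNReal.ofReal_ne_top, h2, ← mul_assoc,
    ← ENNReal.ofReal_mul (inv_pos.2 ha).le, inv_mul_cancel₀ ha.ne', ENNReal.ofReal_one, one_mul]
  exact (lintegral_lintegral_swap hm.aemeasurable).symm

lemma lintegral_cube_le {K : SL2R → ℝ≥0∞} (hK : Measurable K) :
    ∫⁻ s in Set.Icc (0 : ℝ) 1, ∫⁻ t in Set.Icc (0 : ℝ) 1, ∫⁻ r in Set.Icc (0 : ℝ) 1,
      K (hElt s * vElt t * uElt r) ≤ ∫⁻ y, K y ∂chartMeasure := by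
  set k : ℝ → ℝ≥0∞ := fun a => ∫⁻ b : ℝ, ∫⁻ c : ℝ, ENNReal.ofReal (|a|⁻¹) * K (chart (a, b, c))
    with hk
  have h1 : ∀ s : ℝ, ∫⁻ t in Set.Icc (0 : ℝ) 1, ∫⁻ r in Set.Icc (0 : ℝ) 1,
      K (hElt s * vElt t * uElt r) ≤ ENNReal.ofReal |-Real.exp (-s)| * k (Real.exp (-s)) := by
    intro s
    have ha := Real.exp_pos (-s)
    have e : ENNReal.ofReal |-Real.exp (-s)| * k (Real.exp (-s)) =
        ∫⁻ b : ℝ, ∫⁻ c : ℝ, K (chart (Real.exp (-s), b, c)) := by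
      have hm : ∀ b : ℝ, Measurable fun c : ℝ => K (chart (Real.exp (-s), b, c)) := fun b =>
        hK.comp (measurable_chart.comp (by fun_prop))
      have hm2 : Measurable fun b : ℝ => ∫⁻ c : ℝ, K (chart (Real.exp (-s), b, c)) :=
        Measurable.lintegral_prod_right' (f := fun x : ℝ × ℝ => K (chart (Real.exp (-s), x.1, x.2)))
          (hK.comp (measurable_chart.comp (by fun_prop)))
      simp only [hk]
      simp_rw [lintegral_const_mul _ (hm _)]
      rw [lintegral_const_mul _ hm2, ← mul_assoc, ← ENNReal.ofReal_mul (abs_nonneg _), abs_neg,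
        mul_inv_cancel₀ (abs_ne_zero.2 ha.ne'), ENNReal.ofReal_one, one_mul]
    rw [e, ← lintegral_chart_smul_le hK ha]
    simp only [hElt_mul_vElt_mul_uElt]
    exact (setLIntegral_le_lintegral _ _).trans (lintegral_mono fun t => setLIntegral_le_lintegral _ _)
  calc _ ≤ ∫⁻ s in Set.Icc (0 : ℝ) 1, ENNReal.ofReal |-Real.exp (-s)| * k (Real.exp (-s)) :=
        lintegral_mono fun s => h1 s
    _ = ∫⁻ a in (fun s => Real.exp (-s)) '' Set.Icc (0 : ℝ) 1, k a := by
        rw [lintegral_image_eq_lintegral_abs_deriv_mul measurableSet_Icc (f' := fun s => -Real.exp (-s))]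
        · intro s _
          have := ((hasDerivAt_id s).neg).exp
          simp only [mul_neg, mul_one] at this
          exact this.hasDerivWithinAt
        · intro s _ t _ hst
          exact neg_injective (Real.exp_injective hst)
    _ ≤ ∫⁻ a, k a := setLIntegral_le_lintegral _ _
    _ = _ := (lintegral_chartMeasure_iter hK).symm

lemma measurable_oneParam (i : Fin 3) : Measurable (oneParam i) := (continuous_oneParam i).measurable

lemma wordSq_add_le_one {Φ : SL2R → ℂ} (h : IsSmoothSL Φ) (w : List (Fin 3)) (g : SL2R) :
    wordSq Φ w g ≤ 2 * ∫⁻ r in Set.Icc (0 : ℝ) 1,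
      (wordSq Φ w (g * uElt r) + wordSq Φ (1 :: w) (g * uElt r)) := wordSq_le h w 1 g

lemma measurable_wordSq_mul {Φ : SL2R → ℂ} (h : IsSmoothSL Φ) (w : List (Fin 3)) {α : Type*}
    [MeasurableSpace α] {f : α → SL2R} (hf : Measurable f) :
    Measurable fun a => wordSq Φ w (f a) := (continuous_wordSq h w).measurable.comp hf

lemma measurable_uElt : Measurable uElt := measurable_oneParam 1

lemma measurable_vElt : Measurable vElt := measurable_oneParam 2

lemma two_mul_lintegral_add {α : Type*} [MeasurableSpace α] {ν : Measure α} {p q : α → ℝ≥0∞}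
    (hp : Measurable p) (A : ℝ≥0∞) :
    A * ∫⁻ a, p a ∂ν + A * ∫⁻ a, q a ∂ν = A * ∫⁻ a, (p a + q a) ∂ν := by
  rw [lintegral_add_left hp, mul_add]

lemma wordSq_le_two {Φ : SL2R → ℂ} (h : IsSmoothSL Φ) (w : List (Fin 3)) (g : SL2R) :
    wordSq Φ w g ≤ 4 * ∫⁻ t in Set.Icc (0 : ℝ) 1, ∫⁻ r in Set.Icc (0 : ℝ) 1,
      ((wordSq Φ w (g * vElt t * uElt r) + wordSq Φ (1 :: w) (g * vElt t * uElt r)) +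
       (wordSq Φ (2 :: w) (g * vElt t * uElt r) + wordSq Φ (1 :: 2 :: w) (g * vElt t * uElt r))) := by
  have h1 : wordSq Φ w g ≤ 2 * ∫⁻ t in Set.Icc (0 : ℝ) 1,
      (wordSq Φ w (g * vElt t) + wordSq Φ (2 :: w) (g * vElt t)) := wordSq_le h w 2 g
  refine h1.trans ?_
  rw [show (4 : ℝ≥0∞) = 2 * 2 by norm_num, mul_assoc]
  refine mul_le_mul_right ?_ _
  rw [← lintegral_const_mul' _ _ ENNReal.ofNat_ne_top]
  refine lintegral_mono fun t => ?_
  refine (add_le_add (wordSq_add_le_one h w _) (wordSq_add_le_one h (2 :: w) _)).trans ?_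
  refine (two_mul_lintegral_add (Measurable.add ?_ ?_) 2).le <;>
    exact measurable_wordSq_mul h _ (measurable_const.mul measurable_uElt)

/-- The sum of the squared moduli over the derivatives needed to bound a pointwise value. -/
def wordSqSum (Φ : SL2R → ℂ) (w : List (Fin 3)) (g : SL2R) : ℝ≥0∞ :=
  ((wordSq Φ w g + wordSq Φ (1 :: w) g) + (wordSq Φ (2 :: w) g + wordSq Φ (1 :: 2 :: w) g)) +
  ((wordSq Φ (0 :: w) g + wordSq Φ (1 :: 0 :: w) g) +
    (wordSq Φ (2 :: 0 :: w) g + wordSq Φ (1 :: 2 :: 0 :: w) g))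

lemma entryNorm_hvu_le {s t r : ℝ} (hs : s ∈ Set.Icc (0 : ℝ) 1) (ht : t ∈ Set.Icc (0 : ℝ) 1)
    (hr : r ∈ Set.Icc (0 : ℝ) 1) : entryNorm (hElt s * vElt t * uElt r).1 ≤ 11 := by
  have h1 : Real.exp (-s) ≤ 1 := Real.exp_le_one_iff.2 (by linarith [hs.1])
  have h2 : Real.exp s ≤ 3 :=
    (Real.exp_le_exp.2 hs.2).trans (Real.exp_one_lt_d9.le.trans (by norm_num))
  have h3 := Real.exp_pos (-s)
  have h4 := Real.exp_pos s
  have e : (hElt s * vElt t * uElt r).1 = !![Real.exp (-s), Real.exp (-s) * r;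
      Real.exp s * t, Real.exp s * (1 + t * r)] := by
    change (hElt s).1 * (vElt t).1 * (uElt r).1 = _
    ext a b
    fin_cases a <;> fin_cases b <;>
      simp [hElt, vElt, uElt, Matrix.mul_apply, Fin.sum_univ_two]
    ring
  rw [e]
  have k1 := mul_le_mul h1 hr.2 hr.1 zero_le_one
  have k2 := mul_le_mul h2 ht.2 ht.1 (by norm_num)
  have k3 := mul_le_mul ht.2 hr.2 hr.1 zero_le_one
  have k4 := mul_nonneg ht.1 hr.1
  have k5 := mul_nonneg h3.le hr.1
  have k6 := mul_nonneg h4.le ht.1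
  have k7 := mul_le_mul h2 (by linarith : 1 + t * r ≤ 2) (by linarith) (by norm_num)
  simp only [entryNorm, Matrix.of_apply, Matrix.cons_val', Matrix.cons_val_zero,
    Matrix.cons_val_one, Matrix.cons_val_fin_one]
  rw [abs_of_pos h3, abs_of_nonneg k5, abs_of_nonneg k6, abs_of_nonneg (by positivity)]
  linarith

lemma measurable_wordSqSum {Φ : SL2R → ℂ} (h : IsSmoothSL Φ) (w : List (Fin 3)) :
    Measurable (wordSqSum Φ w) := by
  have hw := fun w => (continuous_wordSq h w).measurable
  exact (((hw _).add (hw _)).add ((hw _).add (hw _))).add (((hw _).add (hw _)).add ((hw _).add (hw _)))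

lemma wordSq_le_lintegral_cube {Φ : SL2R → ℂ} (h : IsSmoothSL Φ) (w : List (Fin 3)) (g : SL2R) :
    wordSq Φ w g ≤ 8 * ∫⁻ s in Set.Icc (0 : ℝ) 1, ∫⁻ t in Set.Icc (0 : ℝ) 1,
      ∫⁻ r in Set.Icc (0 : ℝ) 1, wordSqSum Φ w (g * (hElt s * vElt t * uElt r)) := by
  have h1 : wordSq Φ w g ≤ 2 * ∫⁻ s in Set.Icc (0 : ℝ) 1,
      (wordSq Φ w (g * hElt s) + wordSq Φ (0 :: w) (g * hElt s)) := wordSq_le h w 0 g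
  refine h1.trans ?_
  rw [show (8 : ℝ≥0∞) = 2 * 4 by norm_num, mul_assoc]
  refine mul_le_mul_right ?_ _
  rw [← lintegral_const_mul' _ _ ENNReal.ofNat_ne_top]
  refine lintegral_mono fun s => ?_
  refine (add_le_add (wordSq_le_two h w _) (wordSq_le_two h (0 :: w) _)).trans ?_
  have hm : ∀ w, Measurable fun x : ℝ × ℝ => wordSq Φ w (g * hElt s * vElt x.1 * uElt x.2) :=
    fun w => measurable_wordSq_mul h _ ((measurable_const.mul (measurable_vElt.comp measurable_fst)).mul
      (measurable_uElt.comp measurable_snd))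
  have hm' : ∀ w t, Measurable fun r : ℝ => wordSq Φ w (g * hElt s * vElt t * uElt r) :=
    fun w t => measurable_wordSq_mul h _ (measurable_const.mul measurable_uElt)
  rw [two_mul_lintegral_add (Measurable.lintegral_prod_right' (f := fun x : ℝ × ℝ =>
    ((wordSq Φ w (g * hElt s * vElt x.1 * uElt x.2) + wordSq Φ (1 :: w) (g * hElt s * vElt x.1 * uElt x.2)) +
       (wordSq Φ (2 :: w) (g * hElt s * vElt x.1 * uElt x.2) +
        wordSq Φ (1 :: 2 :: w) (g * hElt s * vElt x.1 * uElt x.2))))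
      (((hm _).add (hm _)).add ((hm _).add (hm _)))) 4]
  refine mul_le_mul_right (lintegral_mono fun t => ?_) _
  refine (lintegral_add_left (((hm' _ t).add (hm' _ t)).add ((hm' _ t).add (hm' _ t))) _).symm.le.trans
    (lintegral_mono fun r => ?_)
  simp only [wordSqSum, ← mul_assoc]
  exact le_rfl

/-- The ball on which pointwise values are averaged. -/
def sobBall : Set SL2R := {y | entryNorm y.1 ≤ 11}

lemma measurableSet_sobBall : MeasurableSet sobBall :=
  (isCompact_entryNorm_le 11).isClosed.measurableSet

lemma wordSq_le_lintegral_ball {Φ : SL2R → ℂ} (h : IsSmoothSL Φ) (w : List (Fin 3)) (g : SL2R) :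
    wordSq Φ w g ≤ 8 * ∫⁻ y, sobBall.indicator 1 (g⁻¹ * y) * wordSqSum Φ w y ∂chartMeasure := by
  have hi : Measurable (sobBall.indicator (1 : SL2R → ℝ≥0∞)) :=
    measurable_one.indicator measurableSet_sobBall
  have hK : Measurable fun y => sobBall.indicator (1 : SL2R → ℝ≥0∞) (g⁻¹ * y) * wordSqSum Φ w y :=
    (hi.comp (measurable_const_mul _)).mul (measurable_wordSqSum h w)
  rw [← lintegral_chartMeasure_mul_left hK g]
  refine (wordSq_le_lintegral_cube h w g).trans (mul_le_mul_right ?_ _)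
  refine le_trans ?_ (lintegral_cube_le (hK.comp (measurable_const_mul g)))
  refine setLIntegral_mono' measurableSet_Icc fun s hs => ?_
  refine setLIntegral_mono' measurableSet_Icc fun t ht => ?_
  refine setLIntegral_mono' measurableSet_Icc fun r hr => ?_
  have hmem : hElt s * vElt t * uElt r ∈ sobBall := entryNorm_hvu_le hs ht hr
  simp only [inv_mul_cancel_left]
  rw [Set.indicator_of_mem hmem, Pi.one_apply, one_mul]

lemma tsum_sobBall_le (g x : SL2R) :
    ∑' γ : CongruenceSubgroup.Gamma0 1, sobBall.indicator (1 : SL2R → ℝ≥0∞) (g⁻¹ * (emb γ * x)) ≤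
      ENNReal.ofReal ((1089 * (1 + htFun x)) ^ 4) := by
  classical
  have hH := htFun_pos x
  rw [ENNReal.tsum_eq_iSup_sum]
  refine iSup_le fun S => ?_
  set S' := S.filter fun γ : CongruenceSubgroup.Gamma0 1 => g⁻¹ * (emb γ * x) ∈ sobBall with hS'
  have e : ∑ γ ∈ S, sobBall.indicator (1 : SL2R → ℝ≥0∞) (g⁻¹ * (emb γ * x)) = (S'.card : ℝ≥0∞) := by
    rw [hS', Finset.card_filter]
    push_cast
    refine Finset.sum_congr rfl fun γ _ => ?_
    rw [Set.indicator_apply]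
    rfl
  rw [e]
  rcases S'.eq_empty_or_nonempty with h0 | ⟨γ₁, h1⟩
  · rw [h0]; simp
  · have hb : ∀ γ ∈ S', entryNorm (g⁻¹ * (emb γ * x) : SL2R).1 ≤ 11 := fun γ hγ =>
      (Finset.mem_filter.1 hγ).2
    set T : Finset (Matrix.SpecialLinearGroup (Fin 2) ℤ) :=
      S'.image fun γ => (γ₁.1)⁻¹ * γ.1 with hT
    have hcard : T.card = S'.card := Finset.card_image_of_injective _ fun a b hab =>
      Subtype.ext (mul_left_cancel hab)
    have hc := card_conj_le x (K := 121) (by norm_num) T (by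
      intro γ hγ
      obtain ⟨γ', hγ', rfl⟩ := Finset.mem_image.1 hγ
      have e2 : conjInt x ((γ₁.1)⁻¹ * γ'.1).1 =
          ((g⁻¹ * (emb γ₁ * x))⁻¹ : SL2R).1 * (g⁻¹ * (emb γ' * x) : SL2R).1 := by
        have e3 : (x⁻¹ * emb ((γ₁.1)⁻¹ * γ'.1) * x : SL2R) =
            (g⁻¹ * (emb γ₁ * x))⁻¹ * (g⁻¹ * (emb γ' * x)) := by
          rw [map_mul, map_inv]; group
        exact congrArg Subtype.val e3
      rw [e2]
      refine (entryNorm_mul_le _ _).trans ?_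
      rw [show entryNorm ((g⁻¹ * (emb γ₁ * x))⁻¹ : SL2R).1 = _ from entryNorm_inv _]
      have b1 := hb γ₁ h1
      have b2 := hb γ' hγ'
      calc _ ≤ (11 : ℝ) * 11 := mul_le_mul b1 b2 (entryNorm_nonneg _) (by norm_num)
        _ = 121 := by norm_num)
    rw [hcard] at hc
    rw [← ENNReal.ofReal_natCast]
    refine ENNReal.ofReal_le_ofReal (hc.trans (le_of_eq ?_))
    norm_num

lemma lintegral_ball_le {μ : Measure (XQuot Γℤ)} {c : NNReal}
    (hc : liftMeasure μ = c • chartMeasure) (g : SL2R) {F : SL2R → ℝ≥0∞} (hF : Measurable F)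
    (hinv : LeftInv (CongruenceSubgroup.Gamma0 1) F) :
    c * ∫⁻ y, sobBall.indicator 1 (g⁻¹ * y) * F y ∂chartMeasure ≤
      ∫⁻ x, ENNReal.ofReal ((1089 * (1 + htFun x.out)) ^ 4) * F x.out ∂μ := by
  have hi : Measurable (sobBall.indicator (1 : SL2R → ℝ≥0∞)) :=
    measurable_one.indicator measurableSet_sobBall
  have hK : Measurable fun y => sobBall.indicator (1 : SL2R → ℝ≥0∞) (g⁻¹ * y) * F y :=
    (hi.comp (measurable_const_mul _)).mul hF
  have h1 := lintegral_liftMeasure μ hK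
  rw [hc, show c • chartMeasure = (c : ℝ≥0∞) • chartMeasure from rfl, lintegral_smul_measure] at h1
  refine (show _ = _ from h1).le.trans (lintegral_mono fun x => ?_)
  have e : ∀ γ : CongruenceSubgroup.Gamma0 1, F (emb γ * x.out) = F x.out := fun γ =>
    hinv γ γ.2 x.out
  simp only [e]
  rw [ENNReal.tsum_mul_right]
  exact mul_le_mul_left (tsum_sobBall_le g x.out) _

lemma leftInv_wordDeriv {Φ : SL2R → ℂ} (h : LeftInv (CongruenceSubgroup.Gamma0 1) Φ)
    (w : List (Fin 3)) : LeftInv (CongruenceSubgroup.Gamma0 1) (wordDeriv w Φ) := by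
  induction w with
  | nil => exact h
  | cons i w ih =>
    intro γ hγ g
    change deriv (fun s => wordDeriv w Φ (emb γ * g * oneParam i s)) 0 =
      deriv (fun s => wordDeriv w Φ (g * oneParam i s)) 0
    simp only [mul_assoc, ih γ hγ]

lemma continuous_XProj : Continuous (XProj Γℤ) := continuous_quotient_mk'

lemma wordDeriv_eq_zero {f : XQuot Γℤ → ℂ} (w : List (Fin 3)) {g : SL2R}
    (hg : XProj Γℤ g ∉ tsupport f) : wordDeriv w (liftX Γℤ f) g = 0 := by
  induction w generalizing g with
  | nil => exact image_eq_zero_of_notMem_tsupport (f := f) hg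
  | cons i w ih =>
    change deriv (fun s => wordDeriv w (liftX Γℤ f) (g * oneParam i s)) 0 = 0
    have hopen : IsOpen {s : ℝ | XProj Γℤ (g * oneParam i s) ∉ tsupport f} := by
      have hcont : Continuous fun s => XProj Γℤ (g * oneParam i s) :=
        continuous_XProj.comp (continuous_const.mul (continuous_oneParam i))
      exact (isClosed_tsupport f).isOpen_compl.preimage hcont
    have hev : (fun s => wordDeriv w (liftX Γℤ f) (g * oneParam i s)) =ᶠ[𝓝 0] fun _ => 0 := by
      filter_upwards [hopen.mem_nhds (by
        rw [Set.mem_ofPred_eq, oneParam_zero, mul_one]; exact hg)] with s hs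
      exact ih hs
    rw [hev.deriv_eq, deriv_const]

lemma isOpenMap_XProj : IsOpenMap (XProj Γℤ) := by
  intro U hU
  have e : XProj Γℤ ⁻¹' (XProj Γℤ '' U) = ⋃ γ : Matrix.SpecialLinearGroup (Fin 2) ℤ,
      (fun g => emb γ * g) ⁻¹' U := by
    ext g
    simp only [Set.mem_preimage, Set.mem_image, Set.mem_iUnion]
    constructor
    · rintro ⟨h, hU, hh⟩
      obtain ⟨γ, rfl⟩ := XProj_eq_iff.1 hh.symm
      exact ⟨γ, hU⟩
    · rintro ⟨γ, hγ⟩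
      exact ⟨_, hγ, (XProj_eq_iff.2 ⟨γ, rfl⟩).symm⟩
  have h2 : IsOpen (XProj Γℤ ⁻¹' (XProj Γℤ '' U)) := by
    rw [e]
    exact isOpen_iUnion fun γ => hU.preimage (continuous_const_mul _)
  exact h2

lemma exists_entryNorm_le {s : Set (XQuot Γℤ)} (hs : IsCompact s) :
    ∃ R : ℝ, ∀ x ∈ s, ∃ g, XProj Γℤ g = x ∧ entryNorm g.1 ≤ R := by
  obtain ⟨k, hk⟩ := hs.elim_directed_cover
    (fun k : ℕ => XProj Γℤ '' {g | entryNorm g.1 < k})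
    (fun k => isOpenMap_XProj _ (isOpen_lt continuous_entryNorm continuous_const))
    (fun x _ => by
      obtain ⟨k, hk⟩ := exists_nat_gt (entryNorm x.out.1)
      exact Set.mem_iUnion.2 ⟨k, x.out, hk, XProj_out x⟩)
    (directed_of_isDirected_le fun a b hab => Set.image_mono fun g hg =>
      lt_of_lt_of_le (show entryNorm g.1 < a from hg) (by exact_mod_cast hab))
  exact ⟨k, fun x hx => by
    obtain ⟨g, hg, rfl⟩ := hk hx
    exact ⟨g, rfl, le_of_lt hg⟩⟩

/-- The integrand of the Sobolev norm. -/
def sobFun (D : ℕ) (Φ : SL2R → ℂ) (w : List (Fin 3)) (g : SL2R) : ℝ :=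
  (1 + htFun g) ^ (2 * D) * ‖wordDeriv w Φ g‖ ^ 2

lemma sobFun_nonneg (D : ℕ) (Φ : SL2R → ℂ) (w : List (Fin 3)) (g : SL2R) :
    0 ≤ sobFun D Φ w g := by
  have := htFun_pos g
  unfold sobFun
  positivity

lemma leftInv_sobFun (D : ℕ) {Φ : SL2R → ℂ} (h : LeftInv (CongruenceSubgroup.Gamma0 1) Φ)
    (w : List (Fin 3)) : LeftInv (CongruenceSubgroup.Gamma0 1) (sobFun D Φ w) := by
  intro γ hγ g
  unfold sobFun
  rw [leftInv_htFun γ hγ, leftInv_wordDeriv h w γ hγ]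

lemma exists_sobFun_le (D : ℕ) {f : XQuot Γℤ → ℂ} (hf : IsSmoothSL (liftX Γℤ f))
    (hs : HasCompactSupport f) (w : List (Fin 3)) : ∃ B, ∀ g, sobFun D (liftX Γℤ f) w g ≤ B := by
  obtain ⟨R, hR⟩ := exists_entryNorm_le hs
  obtain ⟨M, hM⟩ := (isCompact_entryNorm_le R).exists_bound_of_continuousOn
    (hf w).1.continuousOn
  refine ⟨(1 + 4 * R ^ 2) ^ (2 * D) * M ^ 2, fun g => ?_⟩
  by_cases hg : XProj Γℤ g ∈ tsupport f
  · obtain ⟨g', hg', hR'⟩ := hR _ hg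
    obtain ⟨γ, rfl⟩ := XProj_eq_iff.1 hg'
    rw [leftInv_sobFun D (leftInv_liftX f) w γ (mem_Gamma0_one γ)]
    have h1 := htFun_le g'
    have h2 := htFun_pos g'
    have h3 := entryNorm_nonneg g'.1
    have h4 : htFun g' ≤ 4 * R ^ 2 := h1.trans (by gcongr)
    have h5 := hM g' hR'
    unfold sobFun
    gcongr
  · have h0 : sobFun D (liftX Γℤ f) w g = 0 := by
      unfold sobFun
      rw [wordDeriv_eq_zero w hg]; simp
    rw [h0]
    rw [pow_mul]
    positivity

lemma measurable_sobFun (D : ℕ) {Φ : SL2R → ℂ} (h : IsSmoothSL Φ) (w : List (Fin 3)) :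
    Measurable (sobFun D Φ w) :=
  ((measurable_const.add measurable_htFun).pow_const _).mul ((h w).1.measurable.norm.pow_const _)

lemma integrable_sobFun (D : ℕ) {f : XQuot Γℤ → ℂ} (hf : IsSmoothSL (liftX Γℤ f))
    (hs : HasCompactSupport f) (w : List (Fin 3)) (μ : Measure (XQuot Γℤ)) [IsProbabilityMeasure μ] :
    Integrable (fun x => sobFun D (liftX Γℤ f) w x.out) μ := by
  obtain ⟨B, hB⟩ := exists_sobFun_le D hf hs w
  refine Integrable.of_bound (C := B) ?_ (Eventually.of_forall fun x => ?_)
  · exact ((leftInv_sobFun D (leftInv_liftX f) w).measurable_out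
      (measurable_sobFun D hf w)).aestronglyMeasurable
  · rw [Real.norm_of_nonneg (sobFun_nonneg _ _ _ _)]
    exact hB _

lemma integral_sobFun_le (D : ℕ) (f : XQuot Γℤ → ℂ) (μ : Measure (XQuot Γℤ)) (w : List (Fin 3))
    (hw : w.length ≤ D) :
    ∫ x, sobFun D (liftX Γℤ f) w x.out ∂μ ≤ sobX Γℤ μ D f ^ 2 := by
  have hnn : ∀ w : List (Fin 3), 0 ≤ ∫ x, sobFun D (liftX Γℤ f) w x.out ∂μ := fun w =>
    integral_nonneg fun x => sobFun_nonneg _ _ _ _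
  have h0 : 0 ≤ ∑ l ∈ Finset.range (D + 1), ∑ v : Fin l → Fin 3,
      ∫ x, sobFun D (liftX Γℤ f) (List.ofFn v) x.out ∂μ :=
    Finset.sum_nonneg fun l _ => Finset.sum_nonneg fun v _ => hnn _
  have e : sobX Γℤ μ D f ^ 2 = ∑ l ∈ Finset.range (D + 1), ∑ v : Fin l → Fin 3,
      ∫ x, sobFun D (liftX Γℤ f) (List.ofFn v) x.out ∂μ := Real.sq_sqrt h0
  rw [e]
  refine le_trans ?_ (Finset.single_le_sum (f := fun l => ∑ v : Fin l → Fin 3,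
      ∫ x, sobFun D (liftX Γℤ f) (List.ofFn v) x.out ∂μ)
    (fun l _ => Finset.sum_nonneg fun v _ => hnn _) (Finset.mem_range.2 (Nat.lt_succ_of_le hw)))
  refine le_trans ?_ (Finset.single_le_sum (f := fun v : Fin w.length → Fin 3 =>
      ∫ x, sobFun D (liftX Γℤ f) (List.ofFn v) x.out ∂μ)
    (fun v _ => hnn _) (Finset.mem_univ w.get))
  simp only [List.ofFn_get]
  exact le_rfl

lemma sobX_nonneg (μ : Measure (XQuot Γℤ)) (D : ℕ) (f : XQuot Γℤ → ℂ) : 0 ≤ sobX Γℤ μ D f :=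
  Real.sqrt_nonneg _

lemma lintegral_wordSq_le {f : XQuot Γℤ → ℂ} (hf : IsSmoothSL (liftX Γℤ f))
    (hs : HasCompactSupport f) (μ : Measure (XQuot Γℤ)) [IsProbabilityMeasure μ] (w : List (Fin 3))
    (hw : w.length ≤ 4) :
    ∫⁻ x, ENNReal.ofReal ((1089 * (1 + htFun x.out)) ^ 4) * wordSq (liftX Γℤ f) w x.out ∂μ ≤
      ENNReal.ofReal (1089 ^ 4 * sobX Γℤ μ 4 f ^ 2) := by
  have h1 := integrable_sobFun 4 hf hs w μ
  have h2 : ∫⁻ x, ENNReal.ofReal ((1089 * (1 + htFun x.out)) ^ 4) * wordSq (liftX Γℤ f) w x.out ∂μ ≤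
      ∫⁻ x, ENNReal.ofReal (1089 ^ 4 * sobFun 4 (liftX Γℤ f) w x.out) ∂μ := by
    refine lintegral_mono fun x => ?_
    have hH := htFun_pos x.out
    rw [wordSq, ← ENNReal.ofReal_mul (by positivity)]
    refine ENNReal.ofReal_le_ofReal ?_
    rw [mul_pow, mul_assoc, sobFun]
    have : (1 + htFun x.out) ^ 4 ≤ (1 + htFun x.out) ^ (2 * 4) :=
      pow_le_pow_right₀ (by linarith) (by norm_num)
    gcongr
  refine h2.trans ?_
  rw [← ofReal_integral_eq_lintegral_ofReal (h1.const_mul _) (Eventually.of_forall fun x =>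
    mul_nonneg (by norm_num) (sobFun_nonneg _ _ _ _)), integral_const_mul]
  refine ENNReal.ofReal_le_ofReal ?_
  gcongr
  exact integral_sobFun_le 4 f μ w hw

lemma lintegral_mul_wordSqSum_le {μ : Measure (XQuot Γℤ)} {Φ : SL2R → ℂ} {k : XQuot Γℤ → ℝ≥0∞}
    (hk : Measurable k) (hΦ : ∀ w, Measurable fun x : XQuot Γℤ => wordSq Φ w x.out) {A : ℝ≥0∞}
    (hb : ∀ v : List (Fin 3), v.length ≤ 4 → ∫⁻ x, k x * wordSq Φ v x.out ∂μ ≤ A)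
    {w : List (Fin 3)} (hw : w.length ≤ 1) : ∫⁻ x, k x * wordSqSum Φ w x.out ∂μ ≤ 8 * A := by
  have hm : ∀ w, Measurable fun x : XQuot Γℤ => k x * wordSq Φ w x.out := fun w => hk.mul (hΦ w)
  have hadd : ∀ {p q : XQuot Γℤ → ℝ≥0∞} {a b : ℝ≥0∞}, Measurable p → ∫⁻ x, p x ∂μ ≤ a →
      ∫⁻ x, q x ∂μ ≤ b → ∫⁻ x, (p x + q x) ∂μ ≤ a + b := fun hp ha hb =>
    (lintegral_add_left hp _).le.trans (add_le_add ha hb)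
  simp only [wordSqSum, mul_add]
  rw [show (8 : ℝ≥0∞) * A = ((A + A) + (A + A)) + ((A + A) + (A + A)) by ring]
  refine hadd (((hm _).add (hm _)).add ((hm _).add (hm _)))
    (hadd ((hm _).add (hm _)) (hadd (hm _) (hb _ ?_) (hb _ ?_)) (hadd (hm _) (hb _ ?_) (hb _ ?_)))
    (hadd ((hm _).add (hm _)) (hadd (hm _) (hb _ ?_) (hb _ ?_)) (hadd (hm _) (hb _ ?_) (hb _ ?_)))
  all_goals (try simp only [List.length_cons]); omega

/-- A pointwise bound for derivatives of order at most one. -/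
lemma norm_sq_wordDeriv_le {f : XQuot Γℤ → ℂ} (hf : IsSmoothSL (liftX Γℤ f))
    (hs : HasCompactSupport f) (μ : Measure (XQuot Γℤ)) [IsProbabilityMeasure μ]
    (hμ : ∀ g : SL2R, Measure.map (rightT Γℤ g) μ = μ) (w : List (Fin 3))
    (hw : w.length ≤ 1) (g : SL2R) :
    totientDensity 1 * ‖wordDeriv w (liftX Γℤ f) g‖ ^ 2 ≤ 64 * (1089 ^ 4 * sobX Γℤ μ 4 f ^ 2) := by
  obtain ⟨c, hc, hct, -⟩ := exists_liftMeasure_eq_totientDensity μ hμ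
  set Φ := liftX Γℤ f with hΦ
  set A := ENNReal.ofReal (1089 ^ 4 * sobX Γℤ μ 4 f ^ 2) with hA
  have hinv : ∀ w, LeftInv (CongruenceSubgroup.Gamma0 1) (wordSq Φ w) := fun w γ hγ g => by
    unfold wordSq
    rw [leftInv_wordDeriv (leftInv_liftX f) w γ hγ]
  have hinvS : LeftInv (CongruenceSubgroup.Gamma0 1) (wordSqSum Φ w) := fun γ hγ g => by
    unfold wordSqSum
    rw [hinv _ γ hγ, hinv _ γ hγ, hinv _ γ hγ, hinv _ γ hγ, hinv _ γ hγ, hinv _ γ hγ, hinv _ γ hγ,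
      hinv _ γ hγ]
  have h1 := lintegral_ball_le hc g (measurable_wordSqSum hf w) hinvS
  have h2 : ∫⁻ x, ENNReal.ofReal ((1089 * (1 + htFun x.out)) ^ 4) * wordSqSum Φ w x.out ∂μ ≤
      8 * A := by
    have a1 : Measurable fun x : XQuot Γℤ => htFun x.out :=
      leftInv_htFun.measurable_out measurable_htFun
    exact lintegral_mul_wordSqSum_le (k := fun x => ENNReal.ofReal ((1089 * (1 + htFun x.out)) ^ 4))
      (by fun_prop) (fun v => (hinv v).measurable_out (continuous_wordSq hf v).measurable)
      (lintegral_wordSq_le hf hs μ) hw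
  have h3 : (c : ℝ≥0∞) * wordSq Φ w g ≤ 64 * A := by
    calc _ ≤ (c : ℝ≥0∞) * (8 * ∫⁻ y, sobBall.indicator 1 (g⁻¹ * y) * wordSqSum Φ w y ∂chartMeasure) :=
          mul_le_mul_right (wordSq_le_lintegral_ball hf w g) _
      _ = 8 * (c * ∫⁻ y, sobBall.indicator 1 (g⁻¹ * y) * wordSqSum Φ w y ∂chartMeasure) := by ring
      _ ≤ 8 * (8 * A) := mul_le_mul_right (h1.trans h2) _
      _ = 64 * A := by ring
  rw [← hct]
  rw [wordSq, hA, ← ENNReal.ofReal_coe_nnreal, ← ENNReal.ofReal_mul c.coe_nonneg,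
    show (64 : ℝ≥0∞) = ENNReal.ofReal 64 by simp, ← ENNReal.ofReal_mul (by norm_num)] at h3
  exact (ENNReal.ofReal_le_ofReal_iff (by positivity)).1 h3

lemma norm_oneParam_sub_le {Φ : SL2R → ℂ} (h : IsSmoothSL Φ) {B : ℝ} (i : Fin 3)
    (hB : ∀ g, ‖wordDeriv [i] Φ g‖ ≤ B) (g : SL2R) (s : ℝ) :
    ‖Φ (g * oneParam i s) - Φ g‖ ≤ B * |s| := by
  have h1 := Convex.norm_image_sub_le_of_norm_hasDerivWithin_le (𝕜 := ℝ) (s := Set.univ)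
    (f := fun s => Φ (g * oneParam i s)) (f' := fun s => wordDeriv [i] Φ (g * oneParam i s))
    (C := B) (x := 0) (y := s)
    (fun x _ => (hasDerivAt_wordDeriv h [] i g x).hasDerivWithinAt) (fun x _ => hB _) convex_univ
    (Set.mem_univ _) (Set.mem_univ _)
  simpa [oneParam_zero] using h1

lemma exists_eq_hvu {η : SL2R} (h : entryNorm (η.1 - 1) ≤ 1 / 4) :
    ∃ s t r, η = hElt s * vElt t * uElt r ∧ |s| ≤ 2 * entryNorm (η.1 - 1) ∧
      |t| ≤ 2 * entryNorm (η.1 - 1) ∧ |r| ≤ 2 * entryNorm (η.1 - 1) := by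
  set ε := entryNorm (η.1 - 1) with hε
  have h00 : |η.1 0 0 - 1| ≤ ε := by simpa using abs_apply_le_entryNorm (η.1 - 1) 0 0
  have h01 : |η.1 0 1| ≤ ε := by simpa using abs_apply_le_entryNorm (η.1 - 1) 0 1
  have h10 : |η.1 1 0| ≤ ε := by simpa using abs_apply_le_entryNorm (η.1 - 1) 1 0
  have hdet := det_eq_one η
  have hε0 : 0 ≤ ε := entryNorm_nonneg _
  obtain ⟨k1, k2⟩ := abs_le.1 h00
  generalize ha : η.1 0 0 = a at *
  generalize hb : η.1 0 1 = b at *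
  generalize hc : η.1 1 0 = c at *
  generalize hd : η.1 1 1 = d at *
  have hapos : 0 < a := by linarith
  refine ⟨-Real.log a, a * c, a⁻¹ * b, ?_, ?_, ?_, ?_⟩
  · rw [hElt_mul_vElt_mul_uElt, neg_neg, Real.exp_log hapos, mul_inv_cancel_left₀ hapos.ne',
      inv_mul_cancel_left₀ hapos.ne']
    apply Subtype.ext
    rw [coe_chart hapos.ne']
    ext i j
    fin_cases i <;> fin_cases j
    · simpa using ha
    · simpa using hb
    · simpa using hc
    · simp only [Fin.mk_one, Fin.isValue, Matrix.of_apply, Matrix.cons_val', Matrix.cons_val_one,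
        Matrix.cons_val_fin_one]
      refine hd.trans ?_
      field_simp
      linarith
  · rw [abs_neg, abs_le]
    constructor
    · have := Real.one_sub_inv_le_log_of_pos hapos
      have h2 : a⁻¹ ≤ 1 + 2 * ε := by
        rw [inv_le_iff_one_le_mul₀ hapos]
        nlinarith
      linarith
    · linarith [Real.log_le_sub_one_of_pos hapos]
  · rw [abs_mul, abs_of_pos hapos]
    nlinarith [abs_nonneg c]
  · rw [abs_mul, abs_of_pos (inv_pos.2 hapos), inv_mul_le_iff₀ hapos]
    nlinarith [abs_nonneg b]

lemma reg_of_wordDeriv_le {Φ : SL2R → ℂ} (h : IsSmoothSL Φ) {B : ℝ}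
    (hB : ∀ w : List (Fin 3), w.length ≤ 1 → ∀ g, ‖wordDeriv w Φ g‖ ≤ B) : Reg (8 * B) Φ := by
  have h0 : ∀ g, ‖Φ g‖ ≤ B := hB [] (by simp)
  have hB0 : 0 ≤ B := (norm_nonneg _).trans (h0 1)
  refine ⟨fun g => (h0 g).trans (by linarith), fun g η => ?_⟩
  rcases le_or_gt (entryNorm (η.1 - 1)) (1 / 4) with hη | hη
  · obtain ⟨s, t, r, e, hs, ht, hr⟩ := exists_eq_hvu hη
    have k := fun i => norm_oneParam_sub_le h i (hB [i] (by simp))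
    have e1 : g * η = g * hElt s * vElt t * uElt r := by rw [e]; group
    have k1 : ‖Φ (g * hElt s) - Φ g‖ ≤ B * |s| := k 0 g s
    have k2 : ‖Φ (g * hElt s * vElt t) - Φ (g * hElt s)‖ ≤ B * |t| := k 2 _ t
    have k3 : ‖Φ (g * hElt s * vElt t * uElt r) - Φ (g * hElt s * vElt t)‖ ≤ B * |r| := k 1 _ r
    rw [e1]
    have k4 := (norm_sub_le_norm_sub_add_norm_sub (Φ (g * hElt s * vElt t * uElt r))
      (Φ (g * hElt s * vElt t)) (Φ g))
    have k5 := (norm_sub_le_norm_sub_add_norm_sub (Φ (g * hElt s * vElt t)) (Φ (g * hElt s)) (Φ g))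
    have hε := entryNorm_nonneg (η.1 - 1)
    change _ ≤ 8 * B * entryNorm (η.1 - 1)
    nlinarith [mul_le_mul_of_nonneg_left hs hB0, mul_le_mul_of_nonneg_left ht hB0,
      mul_le_mul_of_nonneg_left hr hB0, mul_nonneg hB0 hε]
  · refine (norm_sub_le _ _).trans ?_
    have := h0 (g * η)
    have := h0 g
    change _ ≤ 8 * B * entryNorm (η.1 - 1)
    nlinarith

/-- The Sobolev norm controls the uniform and Lipschitz norms. -/
lemma exists_reg_liftX : ∃ C : ℝ, 0 ≤ C ∧ ∀ (μ : Measure (XQuot Γℤ)), IsProbabilityMeasure μ →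
    (∀ g : SL2R, Measure.map (rightT Γℤ g) μ = μ) → ∀ f : XQuot Γℤ → ℂ,
      IsSmoothSL (liftX Γℤ f) → HasCompactSupport f → Reg (C * sobX Γℤ μ 4 f) (liftX Γℤ f) := by
  refine ⟨8 * √(64 * 1089 ^ 4 / totientDensity 1), by positivity, fun μ _ hμ f hf hs => ?_⟩
  obtain ⟨c, -, hct, hc0⟩ := exists_liftMeasure_eq_totientDensity μ hμ
  have hT : 0 < totientDensity 1 := by rw [← hct]; exact_mod_cast pos_iff_ne_zero.2 hc0
  have hS := sobX_nonneg μ 4 f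
  rw [mul_assoc]
  refine reg_of_wordDeriv_le hf fun w hw g => ?_
  have h1 := norm_sq_wordDeriv_le hf hs μ hμ w hw g
  refine le_of_sq_le_sq ?_ (by positivity)
  rw [mul_pow, Real.sq_sqrt (by positivity), div_mul_eq_mul_div, le_div_iff₀ hT]
  linarith

end

section
open Finset MeasureTheory Filter Topology

lemma card_pow_eq_one_le_index {G : Type*} [CommGroup G] [Finite G] (H : Subgroup G) [IsCyclic H]
    {d : ℕ} (hd : 0 < d) : Nat.card {x : G // x ^ d = 1} ≤ H.index * d := by
  classical
  have := Fintype.ofFinite G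
  have h1 : Nat.card {x : G // x ^ d = 1} = #{x : G | x ^ d = 1} := by
    rw [Nat.card_eq_fintype_card, Fintype.card_subtype]
  rw [h1, mul_comm, Subgroup.index, Nat.card_eq_fintype_card]
  refine card_le_mul_card_image_of_maps_to (f := fun x : G => (x : G ⧸ H))
    (t := Finset.univ) (fun _ _ => mem_univ _) d fun c _ => ?_
  by_cases hc : ∃ x0 ∈ ({x : G | x ^ d = 1} : Finset G), (x0 : G ⧸ H) = c
  · obtain ⟨x0, hx0, rfl⟩ := hc
    refine le_trans ?_ (IsCyclic.card_pow_eq_one_le (α := H) hd)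
    rw [mem_filter] at hx0
    refine card_le_card_of_surjOn (fun h : H => x0 * h) fun x hx => ?_
    rw [mem_coe, mem_filter, mem_filter] at hx
    have hm : x0⁻¹ * x ∈ H := QuotientGroup.eq.1 hx.2.symm
    refine ⟨⟨x0⁻¹ * x, hm⟩, ?_, by simp⟩
    rw [mem_coe, mem_filter]
    refine ⟨mem_univ _, Subtype.ext ?_⟩
    change (x0⁻¹ * x) ^ d = 1
    rw [mul_pow, inv_pow, hx0.2, hx.1.2]; simp
  · rw [card_eq_zero.2]
    · exact Nat.zero_le _
    · exact filter_eq_empty_iff.2 fun x hx h => hc ⟨x, hx, h⟩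

/-- The number of `d`-th roots of unity modulo `n`. -/
def rootCount (d n : ℕ) : ℕ := Nat.card {x : (ZMod n)ˣ // x ^ d = 1}

lemma rootCount_of_isCyclic {d n : ℕ} [NeZero n] (hd : 0 < d) [IsCyclic (ZMod n)ˣ] :
    rootCount d n ≤ 2 * d := by
  have : IsCyclic (⊤ : Subgroup (ZMod n)ˣ) := inferInstance
  have := card_pow_eq_one_le_index (⊤ : Subgroup (ZMod n)ˣ) hd
  rw [Subgroup.index_top] at this
  unfold rootCount
  omega

lemma rootCount_two_pow {d : ℕ} (hd : 0 < d) (k : ℕ) : rootCount d (2 ^ (k + 2)) ≤ 2 * d := by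
  have hu : IsUnit (5 : ZMod (2 ^ (k + 2))) := by
    have := (ZMod.isUnit_iff_coprime 5 (2 ^ (k + 2))).2 (Nat.Coprime.pow_right _ (by norm_num))
    simpa using this
  obtain ⟨u, hu⟩ := hu
  have ho : Nat.card (Subgroup.zpowers u) = 2 ^ k := by
    rw [Nat.card_zpowers, ← orderOf_units, hu, ZMod.orderOf_five]
  have hi := (Subgroup.zpowers u).card_mul_index
  rw [ho, Nat.card_eq_fintype_card, ZMod.card_units_eq_totient, Nat.totient_prime_pow Nat.prime_two
    (by omega)] at hi
  have hi2 : (Subgroup.zpowers u).index = 2 := by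
    have h2 : 2 ^ k * (Subgroup.zpowers u).index = 2 ^ k * 2 := by
      rw [hi]; simp [pow_succ]
    exact Nat.eq_of_mul_eq_mul_left (by positivity) h2
  have := card_pow_eq_one_le_index (Subgroup.zpowers u) hd
  rwa [hi2] at this

lemma rootCount_prime_pow {d p : ℕ} (hd : 0 < d) (hp : p.Prime) (k : ℕ) :
    rootCount d (p ^ k) ≤ 2 * d := by
  have : NeZero (p ^ k) := ⟨pow_ne_zero _ hp.ne_zero⟩
  by_cases h2 : p = 2
  · subst h2
    match k with
    | 0 =>
      have : IsCyclic (ZMod (2 ^ 0))ˣ := ZMod.isCyclic_units_one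
      exact rootCount_of_isCyclic hd
    | 1 =>
      have : IsCyclic (ZMod (2 ^ 1))ˣ := ZMod.isCyclic_units_two
      exact rootCount_of_isCyclic hd
    | k + 2 => exact rootCount_two_pow hd k
  · have := ZMod.isCyclic_units_of_prime_pow p hp h2 k
    exact rootCount_of_isCyclic hd

lemma rootCount_mul_le {d a b : ℕ} [NeZero a] [NeZero b] (h : a.Coprime b) :
    rootCount d (a * b) ≤ rootCount d a * rootCount d b := by
  have : NeZero (a * b) := inferInstance
  unfold rootCount
  rw [← Nat.card_prod]
  let e : (ZMod (a * b))ˣ ≃* (ZMod a)ˣ × (ZMod b)ˣ :=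
    (Units.mapEquiv (ZMod.chineseRemainder h).toMulEquiv).trans MulEquiv.prodUnits
  have he : ∀ x : (ZMod (a * b))ˣ, x ^ d = 1 → (e x).1 ^ d = 1 ∧ (e x).2 ^ d = 1 := fun x hx => by
    have : e x ^ d = 1 := by rw [← map_pow, hx, map_one]
    exact Prod.ext_iff.1 this
  refine Nat.card_le_card_of_injective
    (fun x : {x : (ZMod (a * b))ˣ // x ^ d = 1} =>
      ((⟨(e x.1).1, (he x.1 x.2).1⟩, ⟨(e x.1).2, (he x.1 x.2).2⟩) :
        {x : (ZMod a)ˣ // x ^ d = 1} × {x : (ZMod b)ˣ // x ^ d = 1})) fun x y hxy => ?_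
  simp only [Prod.mk.injEq, Subtype.mk.injEq] at hxy
  exact Subtype.ext (e.injective (Prod.ext hxy.1 hxy.2))

lemma rootCount_le {d : ℕ} (hd : 0 < d) : ∀ {n : ℕ}, 0 < n →
    rootCount d n ≤ n.divisors.card ^ (2 * d) := by
  intro n
  induction n using Nat.recOnPosPrimePosCoprime with
  | zero => simp
  | one =>
    intro _
    have : Subsingleton (ZMod 1)ˣ := inferInstance
    have : Subsingleton {x : (ZMod 1)ˣ // x ^ d = 1} := inferInstance
    have h := Finite.card_le_one_iff_subsingleton.2 this
    rw [Nat.divisors_one, card_singleton, one_pow]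
    exact h
  | prime_pow p k hp hk =>
    intro _
    refine (rootCount_prime_pow hd hp k).trans ?_
    rw [Nat.divisors_prime_pow hp, card_map, card_range]
    calc 2 * d ≤ 2 ^ (2 * d) := Nat.lt_two_pow_self.le
      _ ≤ _ := Nat.pow_le_pow_left (by omega) _
  | coprime a b ha hb hab iha ihb =>
    intro _
    have : NeZero a := ⟨by omega⟩
    have : NeZero b := ⟨by omega⟩
    rw [hab.card_divisors_mul, mul_pow]
    exact (rootCount_mul_le hab).trans (Nat.mul_le_mul (iha (by omega)) (ihb (by omega)))

/-- The proportion of a fibre of `k ↦ b k ^ d` is negligible on the scale of powers of `n`. -/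
lemma rootCount_mul_le_rpow {d : ℕ} (hd : 0 < d) {ε : ℝ} (hε : 0 < ε) :
    ∃ C : ℝ, 1 ≤ C ∧ ∀ n : ℕ, 0 < n →
      (rootCount d n : ℝ) * (n / n.totient) ≤ C * (n : ℝ) ^ ε := by
  obtain ⟨C, hC, H⟩ := card_divisors_le_rpow (ε := ε / (2 * d + 1)) (by positivity)
  refine ⟨C ^ (2 * d + 1), one_le_pow₀ hC, fun n hn => ?_⟩
  have h1 : (rootCount d n : ℝ) ≤ (n.divisors.card : ℝ) ^ (2 * d) := by
    exact_mod_cast rootCount_le hd hn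
  have ht : (0 : ℝ) < n.totient := by exact_mod_cast Nat.totient_pos.2 hn
  have h2 : (n : ℝ) / n.totient ≤ n.divisors.card := by
    rw [div_le_iff₀ ht]; exact_mod_cast le_card_divisors_mul_totient n
  calc (rootCount d n : ℝ) * (n / n.totient)
      ≤ (n.divisors.card : ℝ) ^ (2 * d) * n.divisors.card := by gcongr
    _ = (n.divisors.card : ℝ) ^ (2 * d + 1) := (pow_succ _ _).symm
    _ ≤ (C * (n : ℝ) ^ (ε / (2 * d + 1))) ^ (2 * d + 1) := by gcongr; exact H n
    _ = C ^ (2 * d + 1) * (n : ℝ) ^ ε := by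
      rw [mul_pow, ← Real.rpow_natCast ((n : ℝ) ^ _), ← Real.rpow_mul (by positivity)]
      push_cast
      rw [div_mul_cancel₀ _ (by positivity)]

/-- There are many primes coprime to `n` between two small powers of `n`. -/
lemma exists_primes {δ : ℝ} (hδ : 0 < δ) : ∃ K : ℝ, 1 ≤ K ∧ ∀ n : ℕ, 0 < n → K ≤ (n : ℝ) ^ δ →
    ∃ P : Finset ℕ, (∀ p ∈ P, p.Prime ∧ p.Coprime n ∧ (n : ℝ) ^ (2 * δ) ≤ p ∧
      (p : ℝ) ≤ (n : ℝ) ^ (8 * δ)) ∧ (n : ℝ) ^ (2 * δ) ≤ #P := by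
  obtain ⟨C, hC, H⟩ := card_divisors_le_rpow hδ
  refine ⟨C + 10, by linarith, fun n hn hK => ?_⟩
  have hn0 : (0 : ℝ) < n := by exact_mod_cast hn
  set z := (n : ℝ) ^ δ with hz
  have e2 : (n : ℝ) ^ (2 * δ) = z ^ 2 := by
    rw [hz, ← Real.rpow_natCast, ← Real.rpow_mul hn0.le]; congr 1; push_cast; ring
  have e8 : (n : ℝ) ^ (8 * δ) = (z ^ 2) ^ 4 := by
    rw [hz, ← Real.rpow_natCast, ← Real.rpow_natCast, ← Real.rpow_mul hn0.le, ← Real.rpow_mul hn0.le]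
    congr 1; push_cast; ring
  rw [e2, e8]
  have hz10 : 10 ≤ z := by linarith
  set y := z ^ 2 with hy
  have hy10 : 10 ≤ y := by nlinarith
  have hx : 1 < y ^ 4 := one_lt_pow₀ (by linarith) (by norm_num)
  have hlog : Real.log (y ^ 4) ≤ 4 * y := by
    rw [Real.log_pow]
    have := Real.log_le_sub_one_of_pos (show 0 < y by linarith)
    push_cast
    linarith
  have hlog2 : Real.log (y ^ 4 + 2) ≤ 8 * y := by
    calc Real.log (y ^ 4 + 2) ≤ Real.log ((y ^ 4) ^ 2) := by
          apply Real.log_le_log (by positivity)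
          have : 10 ≤ y ^ 4 := hy10.trans (le_self_pow₀ (by linarith) (by norm_num))
          nlinarith
      _ = 2 * Real.log (y ^ 4) := by rw [Real.log_pow]; norm_num
      _ ≤ _ := by linarith
  have hpi : 3 * y ≤ (Nat.primeCounting ⌊y ^ 4⌋₊ : ℝ) := by
    refine le_trans ?_ (Chebyshev.pi_ge' hx)
    rw [le_div_iff₀ (Real.log_pos hx)]
    have := Real.log_two_gt_d9
    have h4 : 100 * y ^ 2 ≤ y ^ 4 := by
      have : y ^ 4 = y ^ 2 * y ^ 2 := by ring
      rw [this]
      exact mul_le_mul_of_nonneg_right (by nlinarith) (by positivity)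
    nlinarith
  classical
  refine ⟨((Finset.range (⌊y ^ 4⌋₊ + 1)).filter Nat.Prime \ Finset.Icc 1 ⌊y⌋₊) \ n.primeFactors,
    fun p hp => ?_, ?_⟩
  · simp only [Finset.mem_sdiff, mem_filter, Finset.mem_range, mem_Icc, Nat.mem_primeFactors] at hp
    obtain ⟨⟨⟨h1, h2⟩, h3⟩, h4⟩ := hp
    refine ⟨h2, (Nat.Prime.coprime_iff_not_dvd h2).2 fun h => h4 ⟨h2, h, hn.ne'⟩, ?_, ?_⟩
    · have : ⌊y⌋₊ < p := by
        by_contra h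
        exact h3 ⟨h2.one_le, by omega⟩
      exact ((Nat.floor_lt (by linarith)).1 this).le
    · exact (Nat.le_floor_iff (by positivity)).1 (by omega)
  · have h1 : Nat.primeCounting ⌊y ^ 4⌋₊ = #((Finset.range (⌊y ^ 4⌋₊ + 1)).filter Nat.Prime) := by
      rw [Nat.primeCounting, Nat.primeCounting', Nat.count_eq_card_filter_range]
    have h2 := le_card_sdiff (Finset.Icc 1 ⌊y⌋₊) ((Finset.range (⌊y ^ 4⌋₊ + 1)).filter Nat.Prime)
    have h3 := le_card_sdiff n.primeFactors
      ((Finset.range (⌊y ^ 4⌋₊ + 1)).filter Nat.Prime \ Finset.Icc 1 ⌊y⌋₊)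
    rw [Nat.card_Icc] at h2
    have h4 : #n.primeFactors ≤ #n.divisors := card_le_card fun p hp =>
      Nat.mem_divisors.2 ⟨Nat.dvd_of_mem_primeFactors hp, hn.ne'⟩
    have h5 : (#n.primeFactors : ℝ) ≤ y := by
      have : (#n.primeFactors : ℝ) ≤ #n.divisors := by exact_mod_cast h4
      have := H n
      nlinarith
    have h6 : (⌊y⌋₊ : ℝ) ≤ y := Nat.floor_le (by linarith)
    have h7 : (Nat.primeCounting ⌊y ^ 4⌋₊ : ℝ) ≤ #(((Finset.range (⌊y ^ 4⌋₊ + 1)).filter Nat.Prime \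
        Finset.Icc 1 ⌊y⌋₊) \ n.primeFactors) + ⌊y⌋₊ + #n.primeFactors := by
      rw [h1]
      norm_cast
      omega
    linarith

/-- Conjugation by the diagonal matrix with ratio `r`. -/
def dilate (r : ℕ) (g : SL2R) : SL2R := aElt (Real.sqrt r) * g * (aElt (Real.sqrt r))⁻¹

lemma coe_dilate {r : ℕ} (hr : 0 < r) (g : SL2R) :
    (dilate r g).1 = !![g.1 0 0, r * g.1 0 1; g.1 1 0 / r, g.1 1 1] := by
  have h0 : Real.sqrt r ≠ 0 := by positivity
  have h1 : Real.sqrt r * Real.sqrt r = r := Real.mul_self_sqrt (by positivity)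
  have h2 : (aElt (Real.sqrt r)).1 = !![Real.sqrt r, 0; 0, (Real.sqrt r)⁻¹] :=
    congrArg Subtype.val (dif_neg h0)
  have e : (dilate r g).1 = (aElt (Real.sqrt r)).1 * g.1 * ((aElt (Real.sqrt r))⁻¹ : SL2R).1 := rfl
  have h3 : ((aElt (Real.sqrt r))⁻¹ : SL2R).1 = !![(Real.sqrt r)⁻¹, 0; 0, Real.sqrt r] := by
    rw [coe_inv_apply, h2]; ext i j; fin_cases i <;> fin_cases j <;> simp
  rw [e, h3, h2]
  generalize g.1 = A
  clear h3 h2 e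
  generalize Real.sqrt r = w at *
  rw [← h1, Matrix.eta_fin_two A, Matrix.mul_fin_two, Matrix.mul_fin_two]
  ext i j
  fin_cases i <;> fin_cases j <;> simp <;> field_simp

lemma dilate_mul (r : ℕ) (g h : SL2R) : dilate r (g * h) = dilate r g * dilate r h := by
  unfold dilate; group

lemma dilate_horoPt {r n : ℕ} (hr : 0 < r) (hn : 0 < n) (t : ℝ) :
    dilate r (horoPt n t) = horoPt n (r * t) := by
  apply Subtype.ext
  rw [coe_dilate hr, coe_horoPt hn, coe_horoPt hn]
  ext i j
  fin_cases i <;> fin_cases j <;> simp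
  ring

lemma dilate_emb {r q : ℕ} (hr : 0 < r) (hrq : r ∣ q) {γ : Matrix.SpecialLinearGroup (Fin 2) ℤ}
    (hγ : γ ∈ CongruenceSubgroup.Gamma0 q) : ∃ γ', dilate r (emb γ) = emb γ' := by
  have h1 : (r : ℤ) ∣ γ 1 0 := by
    rw [CongruenceSubgroup.Gamma0_mem] at hγ
    exact (Int.natCast_dvd_natCast.2 hrq).trans ((ZMod.intCast_zmod_eq_zero_iff_dvd _ q).1 hγ)
  obtain ⟨c, hc⟩ := h1
  have hd := det_int γ
  refine ⟨⟨!![γ 0 0, r * γ 0 1; c, γ 1 1], ?_⟩, Subtype.ext ?_⟩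
  · rw [hc] at hd
    rw [Matrix.det_fin_two_of]
    linarith
  · have hr0 : (r : ℝ) ≠ 0 := by positivity
    refine ((coe_dilate hr _).trans ?_).trans (coe_emb _).symm
    rw [coe_emb]
    ext i j
    fin_cases i <;> fin_cases j <;> simp [hc]
    field_simp

lemma entryNorm_dilate_sub_le {r : ℕ} (hr : 0 < r) (g : SL2R) :
    entryNorm ((dilate r g).1 - 1) ≤ r * entryNorm (g.1 - 1) := by
  have h1 : (1 : ℝ) ≤ r := by exact_mod_cast hr
  rw [coe_dilate hr]
  generalize g.1 = A
  simp only [entryNorm, Matrix.sub_apply, Matrix.one_apply]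
  simp
  have e2 : |A 1 0 / (r : ℝ)| ≤ r * |A 1 0| := by
    rw [abs_div, abs_of_nonneg (show (0 : ℝ) ≤ r by positivity), div_le_iff₀ (by positivity)]
    nlinarith [abs_nonneg (A 1 0), mul_nonneg (abs_nonneg (A 1 0)) (sub_nonneg.2 h1)]
  nlinarith [abs_nonneg (A 0 0 - 1), abs_nonneg (A 1 1 - 1)]

/-- The correlation of two dilates of a function. -/
def pairFun (F : SL2R → ℂ) (r s : ℕ) (g : SL2R) : ℂ :=
  F (dilate r g) * (starRingEnd ℂ) (F (dilate s g))

lemma leftInv_pairFun {F : SL2R → ℂ} (h : LeftInv (CongruenceSubgroup.Gamma0 1) F) {r s : ℕ}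
    (hr : 0 < r) (hs : 0 < s) : LeftInv (CongruenceSubgroup.Gamma0 (r * s)) (pairFun F r s) := by
  intro γ hγ g
  obtain ⟨γ1, h1⟩ := dilate_emb hr (dvd_mul_right r s) hγ
  obtain ⟨γ2, h2⟩ := dilate_emb hs (dvd_mul_left s r) hγ
  rw [pairFun, dilate_mul, dilate_mul, h1, h2, h _ (mem_Gamma0_one _), h _ (mem_Gamma0_one _),
    pairFun]

lemma reg_pairFun {F : SL2R → ℂ} {M : ℝ} (h : Reg M F) {r s : ℕ} (hr : 0 < r) (hs : 0 < s) :
    Reg (M ^ 2 * (r + s)) (pairFun F r s) := by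
  have hM := h.nonneg
  have hr1 : (1 : ℝ) ≤ r := by exact_mod_cast hr
  have hs1 : (1 : ℝ) ≤ s := by exact_mod_cast hs
  constructor
  · intro g
    rw [pairFun, norm_mul, RCLike.norm_conj]
    have := mul_le_mul (h.1 (dilate r g)) (h.1 (dilate s g)) (norm_nonneg _) hM
    nlinarith [sq_nonneg M]
  · intro g η
    have h1 := (h.2 (dilate r g) (dilate r η)).trans
      (mul_le_mul_of_nonneg_left (entryNorm_dilate_sub_le hr η) hM)
    have h2 := (h.2 (dilate s g) (dilate s η)).trans
      (mul_le_mul_of_nonneg_left (entryNorm_dilate_sub_le hs η) hM)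
    rw [← dilate_mul] at h1 h2
    have e : pairFun F r s (g * η) - pairFun F r s g =
        (F (dilate r (g * η)) - F (dilate r g)) * (starRingEnd ℂ) (F (dilate s (g * η))) +
        F (dilate r g) * (starRingEnd ℂ) (F (dilate s (g * η)) - F (dilate s g)) := by
      rw [pairFun, pairFun, map_sub]; ring
    rw [e]
    refine (norm_add_le _ _).trans ?_
    rw [norm_mul, norm_mul, RCLike.norm_conj, RCLike.norm_conj]
    have h3 := mul_le_mul h1 (h.1 (dilate s (g * η))) (norm_nonneg _) ((norm_nonneg _).trans h1)
    have h4 := mul_le_mul (h.1 (dilate r g)) h2 (norm_nonneg _) hM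
    refine (add_le_add h3 h4).trans_eq ?_
    ring

lemma LeftInv.horoPt_add {F : SL2R → ℂ} (h : LeftInv (CongruenceSubgroup.Gamma0 1) F) {n : ℕ}
    (hn : 0 < n) (t : ℝ) (m : ℤ) : F (horoPt n (t + m * n)) = F (horoPt n t) := by
  rw [← h (⟨!![1, m; 0, 1], by simp⟩) (mem_Gamma0_one _) (horoPt n t)]
  congr 1
  apply Subtype.ext
  obtain ⟨h1, h2, h3, h4⟩ := emb_mul_horoPt hn ⟨!![1, m; 0, 1], by simp⟩ t
  rw [coe_horoPt hn]
  ext i j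
  fin_cases i <;> fin_cases j
  · simpa using h1.symm
  · simpa using h2.symm
  · simpa using h3.symm
  · have h0 : Real.sqrt n ≠ 0 := by positivity
    have h5 : Real.sqrt n * Real.sqrt n = n := Real.mul_self_sqrt (by positivity)
    refine Eq.trans ?_ h4.symm
    simp

lemma horoPt_mul_horoPt {r N : ℕ} (hr : 0 < r) (hN : 0 < N) (i t : ℝ) :
    horoPt r i * horoPt N t = horoPt (r * N) (t + i * N) := by
  apply Subtype.ext
  have e : (horoPt r i * horoPt N t).1 = (horoPt r i).1 * (horoPt N t).1 := rfl
  have h0 : Real.sqrt N ≠ 0 := by positivity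
  have h1 : Real.sqrt r ≠ 0 := by positivity
  have h2 : Real.sqrt N * Real.sqrt N = N := Real.mul_self_sqrt (by positivity)
  rw [e, coe_horoPt hr, coe_horoPt hN, coe_horoPt (by positivity)]
  push_cast
  rw [Real.sqrt_mul (by positivity)]
  ext a b
  fin_cases a <;> fin_cases b <;> simp [Matrix.mul_apply, Fin.sum_univ_two]
  · ring
  · nth_rw 3 [← h2]; field_simp

lemma sum_range_mul_coprime {β : Type*} [AddCommMonoid β] {h : ℕ → β} {r s : ℕ}
    (hp : ∀ i, h (i % r) = h i) (hr : 0 < r) (hs : s.Coprime r) :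
    ∑ i ∈ range r, h (s * i) = ∑ i ∈ range r, h i := by
  have hinj : Set.InjOn (fun i => s * i % r) (range r : Finset ℕ) := fun i hi j hj hij => by
    have h1 : s * i ≡ s * j [MOD r] := hij
    have h2 := Nat.ModEq.cancel_left_of_coprime (by rwa [Nat.coprime_comm] at hs) h1
    rw [mem_coe, mem_range] at hi hj
    exact Nat.ModEq.eq_of_lt_of_lt h2 hi hj
  have hmaps : Set.MapsTo (fun i => s * i % r) (range r : Finset ℕ) (range r : Finset ℕ) :=
    fun i _ => by simpa using Nat.mod_lt _ hr
  refine sum_nbij (fun i => s * i % r) (fun i hi => hmaps hi) hinj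
    (surjOn_of_injOn_of_card_le _ hmaps hinj le_rfl) fun i _ => (hp _).symm

lemma sum_range_mul_eq {β : Type*} [AddCommMonoid β] (h : ℕ → β) {N : ℕ} (r : ℕ) (hN : 0 < N) :
    ∑ j ∈ range (r * N), h j = ∑ k ∈ range N, ∑ i ∈ range r, h (k + N * i) := by
  rw [← sum_product']
  refine sum_nbij' (fun j => (j % N, j / N)) (fun x => x.1 + N * x.2) ?_ ?_ ?_ ?_ ?_
  · intro j hj
    rw [mem_range] at hj
    rw [mem_product, mem_range, mem_range]
    exact ⟨Nat.mod_lt _ hN, (Nat.div_lt_iff_lt_mul hN).2 hj⟩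
  · rintro ⟨k, i⟩ hx
    rw [mem_product, mem_range, mem_range] at hx
    rw [mem_range]
    have := Nat.mul_le_mul_left N (Nat.succ_le_of_lt hx.2)
    nlinarith [hx.1]
  · intro j _
    exact Nat.mod_add_div j N
  · rintro ⟨k, i⟩ hx
    rw [mem_product, mem_range, mem_range] at hx
    simp only
    rw [Nat.add_mul_mod_self_left, Nat.mod_eq_of_lt hx.1, Nat.add_mul_div_left _ _ hN,
      Nat.div_eq_of_lt hx.1, zero_add]
  · intro j _
    exact congrArg h (Nat.mod_add_div j N).symm

/-- The average of `F` over the translates of `x` by the points `u_{i / r} a_{√r}⁻¹`. -/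
def heckeMean (F : SL2R → ℂ) (r : ℕ) (x : SL2R) : ℂ := horoAvg r fun g => F (g * x)

lemma norm_heckeMean_le {F : SL2R → ℂ} {M : ℝ} (h : ∀ g, ‖F g‖ ≤ M) {r : ℕ} (hr : 0 < r)
    (x : SL2R) : ‖heckeMean F r x‖ ≤ M := by
  have hr0 : (0 : ℝ) < r := by exact_mod_cast hr
  rw [heckeMean, horoAvg, norm_mul, norm_inv, Complex.norm_natCast, inv_mul_le_iff₀ hr0]
  refine (norm_sum_le _ _).trans ((sum_le_card_nsmul _ _ M fun i _ => h _).trans_eq ?_)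
  rw [card_range, nsmul_eq_mul]

lemma exists_emb_mul_horoPt {r : ℕ} (hr : 0 < r) (γ : Matrix.SpecialLinearGroup (Fin 2) ℤ)
    (i i' : ℤ) (h : (r : ℤ) ∣ γ 0 1 + i * γ 1 1 - (γ 0 0 + i * γ 1 0) * i') :
    ∃ γ', horoPt r i * emb γ = emb γ' * horoPt r i' := by
  obtain ⟨e, he⟩ := h
  have hd := det_int γ
  have h0 : Real.sqrt r ≠ 0 := by positivity
  have h1 : Real.sqrt r * Real.sqrt r = r := Real.mul_self_sqrt (by positivity)
  have he' : (γ 0 1 : ℝ) + i * γ 1 1 - (γ 0 0 + i * γ 1 0) * i' = r * e := by exact_mod_cast he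
  refine ⟨⟨!![γ 0 0 + i * γ 1 0, e; r * γ 1 0, γ 1 1 - γ 1 0 * i'], ?_⟩, Subtype.ext ?_⟩
  · rw [Matrix.det_fin_two_of]
    linear_combination hd + γ 1 0 * he
  · change (horoPt r i).1 * (emb γ).1 = (emb _).1 * (horoPt r i').1
    refine Eq.trans ?_ (congrArg (fun A => A * (horoPt r i').1) (coe_emb _).symm)
    rw [coe_horoPt hr, coe_horoPt hr, coe_emb]
    generalize Real.sqrt r = w at *
    rw [Matrix.mul_fin_two, Matrix.mul_fin_two]
    ext a b
    fin_cases a <;> fin_cases b <;> simp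
    · ring
    · field_simp
      rw [sq, h1]
      linear_combination he'
    · rw [← h1]; field_simp
    · rw [← h1]; field_simp; ring

lemma dvd_sub_of_same_image {r a b c d i j i' : ℤ} (hd : a * d - b * c = 1)
    (hi : r ∣ b + i * d - (a + i * c) * i') (hj : r ∣ b + j * d - (a + j * c) * i') :
    r ∣ i - j := by
  obtain ⟨x, hx⟩ := hi
  obtain ⟨y, hy⟩ := hj
  refine ⟨(x - y) * (a + i * c) - (i - j) * c * x, ?_⟩
  linear_combination (-(i - j)) * hd + (a + i * c) * hx - (a + i * c) * hy - (i - j) * c * hx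

/-- The Hecke-type means are almost invariant under the modular group. -/
lemma norm_heckeMean_emb_mul_sub_le {F : SL2R → ℂ} {M : ℝ}
    (hinv : LeftInv (CongruenceSubgroup.Gamma0 1) F) (h : ∀ g, ‖F g‖ ≤ M) {p d : ℕ}
    (hp : p.Prime) (hd : 0 < d) (γ : Matrix.SpecialLinearGroup (Fin 2) ℤ) (x : SL2R) :
    ‖heckeMean F (p ^ d) (emb γ * x) - heckeMean F (p ^ d) x‖ ≤ 2 * M / p := by
  classical
  have hr : 0 < p ^ d := pow_pos hp.pos d
  have hdet := det_int γ
  have hpZ : Prime (p : ℤ) := Nat.prime_iff_prime_int.1 hp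
  set G : Finset ℕ := (range (p ^ d)).filter fun i : ℕ => ¬ (p : ℤ) ∣ γ 0 0 + i * γ 1 0 with hG
  have hbad : #((range (p ^ d)).filter fun i : ℕ => (p : ℤ) ∣ γ 0 0 + i * γ 1 0) ≤ p ^ (d - 1) := by
    rw [← card_range (p ^ (d - 1))]
    refine card_le_card_of_injOn (fun i => i / p) (fun i hi => ?_) fun i hi j hj hij => ?_
    · rw [mem_coe, mem_filter, mem_range] at hi
      rw [mem_coe, mem_range]
      refine (Nat.div_lt_iff_lt_mul hp.pos).2 ?_
      rw [← pow_succ, Nat.sub_add_cancel hd]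
      exact hi.1
    · rw [mem_coe, mem_filter] at hi hj
      have h1 : (p : ℤ) ∣ ((i : ℤ) - j) * γ 1 0 := by
        have := dvd_sub hi.2 hj.2
        rwa [show γ 0 0 + (i : ℤ) * γ 1 0 - (γ 0 0 + j * γ 1 0) = (i - j) * γ 1 0 by ring] at this
      have h2 : ¬ (p : ℤ) ∣ γ 1 0 := fun hc => by
        have h3 : (p : ℤ) ∣ γ 0 0 := (dvd_add_left (hc.mul_left _)).1 hi.2
        exact hpZ.not_dvd_one (hdet ▸ dvd_sub (h3.mul_right _) (hc.mul_left _))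
      have h3 := (hpZ.dvd_or_dvd h1).resolve_right h2
      have h4 : j % p = i % p := (Nat.modEq_iff_dvd.2 h3)
      have h5 : i / p = j / p := hij
      rw [← Nat.div_add_mod i p, ← Nat.div_add_mod j p, h5, h4]
  have hcard : #G + #((range (p ^ d)).filter fun i : ℕ => (p : ℤ) ∣ γ 0 0 + i * γ 1 0) = p ^ d := by
    have := card_filter_add_card_filter_not (s := range (p ^ d))
      (fun i : ℕ => (p : ℤ) ∣ γ 0 0 + i * γ 1 0)
    rw [card_range] at this
    rw [hG, add_comm]
    convert this
  have hex : ∀ i ∈ G, ∃ i' : ℕ, i' < p ^ d ∧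
      ((p ^ d : ℕ) : ℤ) ∣ γ 0 1 + i * γ 1 1 - (γ 0 0 + i * γ 1 0) * i' := by
    intro i hi
    have h1 : IsCoprime (γ 0 0 + i * γ 1 0) ((p ^ d : ℕ) : ℤ) := by
      push_cast
      exact (((Prime.coprime_iff_not_dvd hpZ).2 (mem_filter.1 hi).2).symm).pow_right
    obtain ⟨u, v, huv⟩ := h1
    have hr0 : ((p ^ d : ℕ) : ℤ) ≠ 0 := by exact_mod_cast hr.ne'
    set i' := (u * (γ 0 1 + i * γ 1 1)) % ((p ^ d : ℕ) : ℤ) with hi'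
    have h2 : 0 ≤ i' := Int.emod_nonneg _ hr0
    have h3 : i' < ((p ^ d : ℕ) : ℤ) := Int.emod_lt_of_pos _ (by exact_mod_cast hr)
    have h4 := Int.emod_add_mul_ediv (u * (γ 0 1 + i * γ 1 1)) ((p ^ d : ℕ) : ℤ)
    rw [← hi'] at h4
    clear_value i'
    lift i' to ℕ using h2
    refine ⟨i', by exact_mod_cast h3, v * (γ 0 1 + i * γ 1 1) + (γ 0 0 + i * γ 1 0) *
      ((u * (γ 0 1 + i * γ 1 1)) / ((p ^ d : ℕ) : ℤ)), ?_⟩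
    linear_combination (-(γ 0 1 + i * γ 1 1)) * huv - (γ 0 0 + i * γ 1 0) * h4
  choose! σ hσ using hex
  have hσinj : Set.InjOn σ G := fun i hi j hj hij => by
    have h1 := (hσ i hi).2
    rw [hij] at h1
    have h2 := dvd_sub_of_same_image hdet h1 (hσ j hj).2
    have h3 : j ≡ i [MOD p ^ d] := Nat.modEq_iff_dvd.2 h2
    exact (Nat.ModEq.eq_of_lt_of_lt h3 (mem_range.1 (mem_filter.1 hj).1)
      (mem_range.1 (mem_filter.1 hi).1)).symm
  have hσF : ∀ i ∈ G, F (horoPt (p ^ d) i * (emb γ * x)) = F (horoPt (p ^ d) (σ i) * x) := by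
    intro i hi
    obtain ⟨γ', hγ'⟩ := exists_emb_mul_horoPt hr γ i (σ i) (hσ i hi).2
    rw [Int.cast_natCast, Int.cast_natCast] at hγ'
    rw [← mul_assoc, hγ', mul_assoc, hinv _ (mem_Gamma0_one _)]
  have hsub : G ⊆ range (p ^ d) := filter_subset _ _
  have hsub' : G.image σ ⊆ range (p ^ d) := fun i' hi' => by
    obtain ⟨i, hi, rfl⟩ := mem_image.1 hi'
    exact mem_range.2 (hσ i hi).1
  have hsum : ∑ i ∈ G, F (horoPt (p ^ d) i * (emb γ * x)) =
      ∑ i ∈ G.image σ, F (horoPt (p ^ d) i * x) := by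
    rw [sum_image hσinj]
    exact sum_congr rfl hσF
  have hM : 0 ≤ M := (norm_nonneg _).trans (h 1)
  have hb : ∀ S : Finset ℕ, #S ≤ p ^ (d - 1) → ∀ y, ‖∑ i ∈ S, F (horoPt (p ^ d) i * y)‖ ≤
      p ^ (d - 1) * M := fun S hS y => by
    refine (norm_sum_le _ _).trans ((sum_le_card_nsmul _ _ M fun i _ => h _).trans ?_)
    rw [nsmul_eq_mul]
    exact mul_le_mul_of_nonneg_right (by exact_mod_cast hS) hM
  have hc1 : #(range (p ^ d) \ G) ≤ p ^ (d - 1) := by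
    rw [card_sdiff_of_subset hsub, card_range]; omega
  have hc2 : #(range (p ^ d) \ G.image σ) ≤ p ^ (d - 1) := by
    rw [card_sdiff_of_subset hsub', card_range, card_image_of_injOn hσinj]; omega
  have hp0 : (0 : ℝ) < p := by exact_mod_cast hp.pos
  rw [heckeMean, heckeMean, horoAvg, horoAvg, ← mul_sub, norm_mul, norm_inv, Complex.norm_natCast,
    ← sum_sdiff hsub, ← sum_sdiff hsub', hsum, add_sub_add_right_eq_sub]
  have h1 := (norm_sub_le _ _).trans (add_le_add (hb _ hc1 (emb γ * x)) (hb _ hc2 x))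
  have e : ((p ^ d : ℕ) : ℝ) = p ^ (d - 1) * p := by
    rw [← pow_succ, Nat.sub_add_cancel hd]; push_cast; rfl
  rw [inv_mul_le_iff₀ (by positivity), e]
  refine h1.trans_eq ?_
  field_simp
  ring

lemma integral_out_mul (μ : Measure (XQuot Γℤ))
    (hμ : ∀ g : SL2R, Measure.map (rightT Γℤ g) μ = μ) {F : SL2R → ℂ}
    (hinv : LeftInv (CongruenceSubgroup.Gamma0 1) F) (hF : Measurable F) (g : SL2R) :
    ∫ x : XQuot Γℤ, F (x.out * g) ∂μ = ∫ x : XQuot Γℤ, F x.out ∂μ := by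
  conv_rhs => rw [← hμ g]
  rw [integral_map (measurable_rightT g).aemeasurable
    (hinv.measurable_out hF).aestronglyMeasurable]
  refine integral_congr_ae (.of_forall fun x => ?_)
  have e : rightT Γℤ g x = XProj Γℤ (x.out * g) := by
    conv_lhs => rw [← XProj_out x]
    rfl
  change _ = F (rightT Γℤ g x).out
  rw [e, hinv.apply_out]

lemma Reg.mul_right {M : ℝ} {F : SL2R → ℂ} (h : Reg M F) (x : SL2R) :
    Reg (M * entryNorm x.1 ^ 2) fun g => F (g * x) := by
  have hM := h.nonneg
  have hx := one_le_entryNorm x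
  refine ⟨fun g => (h.1 _).trans (le_mul_of_one_le_right hM (one_le_pow₀ hx)), fun g η => ?_⟩
  have h1 := h.2 (g * x) (x⁻¹ * η * x)
  have e1 : g * x * (x⁻¹ * η * x) = g * η * x := by group
  rw [e1] at h1
  refine h1.trans ?_
  rw [mul_assoc M]
  refine mul_le_mul_of_nonneg_left ?_ hM
  have e2 : (x⁻¹ * η * x).1 - 1 = (x⁻¹ : SL2R).1 * (η.1 - 1) * x.1 := by
    have e3 : (x⁻¹ * η * x).1 = (x⁻¹ : SL2R).1 * η.1 * x.1 := rfl
    have e4 : (x⁻¹ : SL2R).1 * x.1 = 1 := by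
      have : (x⁻¹ * x).1 = (x⁻¹ : SL2R).1 * x.1 := rfl
      rw [← this, inv_mul_cancel]; rfl
    rw [e3, mul_sub, sub_mul, mul_one, e4]
  have h2 := entryNorm_mul_le ((x⁻¹ : SL2R).1 * (η.1 - 1)) x.1
  have h3 := entryNorm_mul_le (x⁻¹ : SL2R).1 (η.1 - 1)
  rw [entryNorm_inv] at h3
  change entryNorm ((x⁻¹ * η * x).1 - 1) ≤ entryNorm x.1 ^ 2 * entryNorm (η.1 - 1)
  rw [e2]
  have := mul_le_mul_of_nonneg_right h3 (entryNorm_nonneg x.1)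
  nlinarith

lemma LeftInv.mul_right {Δ : Subgroup (Matrix.SpecialLinearGroup (Fin 2) ℤ)} {F : SL2R → ℂ}
    (h : LeftInv Δ F) (x : SL2R) : LeftInv Δ fun g => F (g * x) := fun γ hγ g => by
  change F (emb γ * g * x) = F (g * x)
  rw [mul_assoc, h γ hγ]

/-- The mean of the Hecke-type means of a function of mean zero over the points `u_{k/N} a_{√N}⁻¹`. -/
lemma sum_heckeMean_le {F : SL2R → ℂ} {M : ℝ}
    (hinv : LeftInv (CongruenceSubgroup.Gamma0 1) F) (h : ∀ g, ‖F g‖ ≤ M) {p d N : ℕ}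
    (hp : p.Prime) (hd : 0 < d) (hN : 0 < N) {R B : ℝ} (hR : 0 < R)
    (hB0 : 0 ≤ B)
    (hB : ∀ x : SL2R, entryNorm x.1 ≤ R → ‖heckeMean F (p ^ d) x‖ ≤ B) :
    (N : ℝ)⁻¹ * ∑ k ∈ range N, ‖heckeMean F (p ^ d) (horoPt N k)‖ ≤
      B + 2 * M / p + M * (1200 / R ^ 2) := by
  classical
  have hM : 0 ≤ M := (norm_nonneg _).trans (h 1)
  have hN0 : (0 : ℝ) < N := by exact_mod_cast hN
  have hp0 : (0 : ℝ) < p := by exact_mod_cast hp.pos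
  set S : Finset ℕ := (range N).filter fun k : ℕ =>
    horoPt N k ∉ orbitBall (CongruenceSubgroup.Gamma0 1) R with hS
  have h1 : ∀ k ∈ range N, ‖heckeMean F (p ^ d) (horoPt N k)‖ ≤
      (if k ∈ S then M else 0) + (if k ∈ S then 0 else (B + 2 * M / p)) := by
    intro k hk
    by_cases hkS : k ∈ S
    · rw [if_pos hkS, if_pos hkS, add_zero]
      exact norm_heckeMean_le h (pow_pos hp.pos d) _
    · rw [if_neg hkS, if_neg hkS, zero_add]
      have hmem : horoPt N k ∈ orbitBall (CongruenceSubgroup.Gamma0 1) R := by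
        by_contra hc
        exact hkS (mem_filter.2 ⟨hk, hc⟩)
      obtain ⟨γ, -, hγ⟩ := hmem
      have h2 := norm_heckeMean_emb_mul_sub_le hinv h hp hd γ (horoPt N k)
      rw [norm_sub_rev] at h2
      have h3 := norm_le_norm_add_norm_sub' (heckeMean F (p ^ d) (horoPt N k))
        (heckeMean F (p ^ d) (emb γ * horoPt N k))
      have h4 := hB _ hγ
      linarith
  have hesc : (#S : ℝ) / N ≤ 1200 / R ^ 2 := by
    have := escape_le (q := 1) hN one_pos hR
    rw [Nat.cast_one, one_pow, mul_one] at this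
    refine le_trans (le_of_eq ?_) this
    rw [escape, ← Set.ncard_coe_finset]
    congr 3
    ext k
    simp [hS]
  have h2 : ∑ k ∈ range N, ((if k ∈ S then M else 0) + (if k ∈ S then 0 else (B + 2 * M / p))) ≤
      M * #S + N * (B + 2 * M / p) := by
    rw [sum_add_distrib]
    refine add_le_add (le_of_eq ?_) ?_
    · rw [sum_ite_mem, inter_eq_right.2 (filter_subset _ _), sum_const, nsmul_eq_mul, mul_comm]
    · refine (sum_le_card_nsmul _ _ (B + 2 * M / p) fun k _ => ?_).trans_eq ?_
      · split_ifs
        · positivity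
        · exact le_rfl
      · rw [card_range, nsmul_eq_mul]
  rw [inv_mul_le_iff₀ hN0]
  refine ((sum_le_sum h1).trans h2).trans ?_
  rw [div_le_iff₀ hN0] at hesc
  have := mul_le_mul_of_nonneg_left hesc hM
  nlinarith

lemma sum_range_add_periodic {h : ℕ → ℂ} {r : ℕ} (hp : ∀ i, h (i % r) = h i) (m : ℕ) :
    ∑ i ∈ range r, h (i + m) = ∑ i ∈ range r, h i := by
  induction m with
  | zero => simp
  | succ m ih =>
    rw [← ih]
    have h1 := sum_range_succ' (fun i => h (i + m)) r
    rw [sum_range_succ] at h1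
    have h2 : h (r + m) = h (0 + m) := by
      rw [← hp (r + m), Nat.add_mod_left, hp, zero_add]
    rw [h2] at h1
    rw [sum_congr rfl fun i _ => show h (i + (m + 1)) = h (i + 1 + m) by congr 1; ring]
    exact (add_right_cancel h1).symm

/-- The correlation of two dilates is controlled by the Hecke-type means. -/
lemma norm_horoAvg_pairFun_le {F : SL2R → ℂ} {M : ℝ}
    (hinv : LeftInv (CongruenceSubgroup.Gamma0 1) F) (h : ∀ g, ‖F g‖ ≤ M) {r s N : ℕ}
    (hr : 0 < r) (hs : 0 < s) (hN : 0 < N) (hsr : s.Coprime r) (hsN : s.Coprime N) :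
    ‖horoAvg (r * N) (pairFun F r s)‖ ≤
      M * ((N : ℝ)⁻¹ * ∑ k ∈ range N, ‖heckeMean F r (horoPt N k)‖) := by
  have hM : 0 ≤ M := (norm_nonneg _).trans (h 1)
  have hrN : 0 < r * N := Nat.mul_pos hr hN
  have hr0 : (r : ℝ) ≠ 0 := by positivity
  have hr1 : (r : ℂ) ≠ 0 := by exact_mod_cast hr.ne'
  have hN0 : (0 : ℝ) < N := by exact_mod_cast hN
  have hper : ∀ (x : SL2R) (i : ℕ), F (horoPt r ((i % r : ℕ) : ℝ) * x) = F (horoPt r i * x) := by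
    intro x i
    rw [← (hinv.mul_right x).horoPt_add hr ((i % r : ℕ) : ℝ) ((i / r : ℕ) : ℤ)]
    have : (i : ℝ) = ((i % r : ℕ) : ℝ) + (((i / r : ℕ) : ℤ) : ℝ) * r := by
      rw [Int.cast_natCast]
      exact_mod_cast (Nat.mod_add_div' i r).symm
    rw [← this]
  have hT : ∀ m : ℕ, heckeMean F r (horoPt N ((m % N : ℕ) : ℝ)) = heckeMean F r (horoPt N m) := by
    intro m
    have hm : (m : ℝ) = ((m % N : ℕ) : ℝ) + ((m / N : ℕ) : ℝ) * N := by
      exact_mod_cast (Nat.mod_add_div' m N).symm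
    have hshift : ∀ i : ℕ, F (horoPt r i * horoPt N m) =
        F (horoPt r ((i + m / N : ℕ) : ℝ) * horoPt N ((m % N : ℕ) : ℝ)) := by
      intro i
      rw [horoPt_mul_horoPt hr hN, horoPt_mul_horoPt hr hN]
      congr 2
      rw [hm]; push_cast; ring
    rw [heckeMean, heckeMean, horoAvg, horoAvg]
    congr 1
    rw [sum_congr rfl fun i _ => hshift i]
    exact (sum_range_add_periodic (h := fun i => F (horoPt r i * horoPt N ((m % N : ℕ) : ℝ)))
      (fun i => hper _ i) _).symm
  have hterm : ∀ k i : ℕ, pairFun F r s (horoPt (r * N) ((k + N * i : ℕ) : ℝ)) =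
      F (horoPt (r * N) (r * k)) * (starRingEnd ℂ)
        (F (horoPt r ((s * i : ℕ) : ℝ) * horoPt N ((s * k : ℕ) : ℝ))) := by
    intro k i
    rw [pairFun, dilate_horoPt hr hrN, dilate_horoPt hs hrN, horoPt_mul_horoPt hr hN]
    congr 1
    · rw [← hinv.horoPt_add hrN (r * k) (i : ℤ)]
      congr 2; push_cast; ring
    · congr 3; push_cast; ring
  have hk : ∀ k : ℕ, ‖∑ i ∈ range r, pairFun F r s (horoPt (r * N) ((k + N * i : ℕ) : ℝ))‖ ≤
      M * (r * ‖heckeMean F r (horoPt N ((s * k : ℕ) : ℝ))‖) := by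
    intro k
    rw [sum_congr rfl fun i _ => hterm k i, ← mul_sum, ← map_sum, norm_mul, RCLike.norm_conj,
      sum_range_mul_coprime (h := fun i => F (horoPt r i * horoPt N ((s * k : ℕ) : ℝ)))
        (fun i => hper _ i) hr hsr, heckeMean, horoAvg, norm_mul, norm_inv, Complex.norm_natCast,
      mul_inv_cancel_left₀ hr0]
    exact mul_le_mul_of_nonneg_right (h _) (norm_nonneg _)
  rw [horoAvg, sum_range_mul_eq _ r hN, norm_mul, norm_inv, Complex.norm_natCast,
    inv_mul_le_iff₀ (by positivity)]
  refine (norm_sum_le _ _).trans ((sum_le_sum fun k _ => hk k).trans_eq ?_)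
  rw [← mul_sum, ← mul_sum, sum_range_mul_coprime
    (h := fun m => ‖heckeMean F r (horoPt N m)‖) (fun m => congrArg norm (hT m)) hN hsN]
  push_cast
  field_simp

/-- Decay of the correlations of the dilates by different prime powers. -/
lemma norm_horoAvg_pairFun_prime_le : ∃ C : ℝ, 1 ≤ C ∧ ∀ (μ : Measure (XQuot Γℤ)),
    IsProbabilityMeasure μ → (∀ g : SL2R, Measure.map (rightT Γℤ g) μ = μ) →
    ∀ (M : ℝ) (F : SL2R → ℂ), LeftInv (CongruenceSubgroup.Gamma0 1) F → Reg M F →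
    ∫ x : XQuot Γℤ, F x.out ∂μ = 0 → ∀ n d p p' : ℕ, 0 < n → 0 < d → p.Prime → p'.Prime → p ≠ p' →
    ‖horoAvg n (pairFun F (p ^ d) (p' ^ d))‖ ≤
      C * M ^ 2 * (((p : ℝ) ^ d + (p' : ℝ) ^ d) * ((p : ℝ) ^ d * (p' : ℝ) ^ d) ^ 2 *
        (n : ℝ) ^ (-(1 / 3680) : ℝ) + (p : ℝ) ^ (-(1 / 7360) : ℝ)) := by
  obtain ⟨C1, hC1, H1⟩ := horoAvg_sub_integral_le
  obtain ⟨C2, hC2, H2⟩ := horoAvg_sub_horoAvg_le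
  refine ⟨C1 + C2 + 1202, by linarith, fun μ hμ1 hμ M F hinv hF h0 n d p p' hn hd hp hp' hpp => ?_⟩
  have hM := hF.nonneg
  have hr : 0 < p ^ d := pow_pos hp.pos d
  have hs : 0 < p' ^ d := pow_pos hp'.pos d
  have hp1 : (1 : ℝ) ≤ p := by exact_mod_cast hp.one_le
  have hp0 : (0 : ℝ) < p := by linarith
  have hrp : (p : ℝ) ≤ ((p ^ d : ℕ) : ℝ) := by
    exact_mod_cast Nat.le_self_pow hd.ne' p
  have hr0 : (0 : ℝ) < ((p ^ d : ℕ) : ℝ) := by exact_mod_cast hr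
  set N := p' ^ d * n + 1 with hN
  have hsN : (p' ^ d).Coprime N := by
    rw [hN, Nat.coprime_mul_left_add_right]; exact Nat.coprime_one_right _
  have hsr : (p' ^ d).Coprime (p ^ d) := (((Nat.coprime_primes hp' hp).2 hpp.symm).pow _ _)
  have hnN : n ≤ p ^ d * N := by
    have h1 := Nat.le_mul_of_pos_left n hs
    have h2 := Nat.le_mul_of_pos_left N hr
    omega
  have h1 := H2 n (p ^ d * N) (p ^ d * p' ^ d) hn hnN (Nat.mul_pos hr hs) _ _
    (leftInv_pairFun hinv hr hs) (reg_pairFun hF hr hs)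
  have h2 := norm_horoAvg_pairFun_le hinv hF.1 hr hs (Nat.succ_pos _ : 0 < N) hsr hsN
  set κ := (p : ℝ) ^ (-(1 / 7360) : ℝ) with hκ
  have hκ0 : 0 ≤ κ := by positivity
  have hrκ : ((p ^ d : ℕ) : ℝ) ^ (-(1 / 7360) : ℝ) ≤ κ :=
    Real.rpow_le_rpow_of_nonpos hp0 hrp (by norm_num)
  set R := ((p ^ d : ℕ) : ℝ) ^ (1 / 14720 : ℝ) with hR
  have hR0 : 0 < R := by positivity
  have hR2 : R ^ 2 = ((p ^ d : ℕ) : ℝ) ^ (1 / 7360 : ℝ) := by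
    rw [hR, ← Real.rpow_natCast, ← Real.rpow_mul hr0.le]; norm_num
  have hmean : ∀ x : SL2R, entryNorm x.1 ≤ R → ‖heckeMean F (p ^ d) x‖ ≤ C1 * M * κ := by
    intro x hx
    have h3 := H1 μ hμ1 hμ (p ^ d) hr _ _ (hinv.mul_right x) (hF.mul_right x)
    rw [integral_out_mul μ hμ hinv hF.continuous.measurable, h0, sub_zero] at h3
    refine h3.trans ?_
    have h4 : entryNorm x.1 ^ 2 ≤ R ^ 2 := pow_le_pow_left₀ (entryNorm_nonneg _) hx 2
    have h5 : R ^ 2 * ((p ^ d : ℕ) : ℝ) ^ (-(1 / 3680) : ℝ) ≤ κ := by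
      refine le_trans (le_of_eq ?_) hrκ
      rw [hR2, ← Real.rpow_add hr0]; norm_num
    calc C1 * (M * entryNorm x.1 ^ 2) * ((p ^ d : ℕ) : ℝ) ^ (-(1 / 3680) : ℝ)
        ≤ C1 * (M * R ^ 2) * ((p ^ d : ℕ) : ℝ) ^ (-(1 / 3680) : ℝ) := by gcongr
      _ = C1 * M * (R ^ 2 * ((p ^ d : ℕ) : ℝ) ^ (-(1 / 3680) : ℝ)) := by ring
      _ ≤ C1 * M * κ := by gcongr
  have h6 := sum_heckeMean_le hinv hF.1 hp hd (Nat.succ_pos _ : 0 < N) hR0 (by positivity) hmean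
  have h7 : 1 / R ^ 2 ≤ κ := by
    refine le_trans (le_of_eq ?_) hrκ
    rw [hR2, one_div, ← Real.rpow_neg hr0.le]
  have h8 : 1 / (p : ℝ) ≤ κ := by
    rw [one_div, ← Real.rpow_neg_one]
    exact Real.rpow_le_rpow_of_exponent_le hp1 (by norm_num)
  have h9 : (N : ℝ)⁻¹ * ∑ k ∈ range N, ‖heckeMean F (p ^ d) (horoPt N k)‖ ≤
      (C1 + 1202) * M * κ := by
    refine h6.trans ?_
    have e1 : 2 * M / p = 2 * M * (1 / p) := by ring
    have e2 : M * (1200 / R ^ 2) = 1200 * M * (1 / R ^ 2) := by ring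
    rw [e1, e2]
    have := mul_le_mul_of_nonneg_left h7 (show 0 ≤ 1200 * M by positivity)
    have := mul_le_mul_of_nonneg_left h8 (show 0 ≤ 2 * M by positivity)
    linarith
  have h10 := h2.trans (mul_le_mul_of_nonneg_left h9 hM)
  have h11 := norm_le_norm_add_norm_sub' (horoAvg n (pairFun F (p ^ d) (p' ^ d)))
    (horoAvg (p ^ d * N) (pairFun F (p ^ d) (p' ^ d)))
  push_cast at h1
  set E := ((p : ℝ) ^ d + (p' : ℝ) ^ d) * ((p : ℝ) ^ d * (p' : ℝ) ^ d) ^ 2 *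
        (n : ℝ) ^ (-(1 / 3680) : ℝ) with hE
  have hE0 : 0 ≤ E := by positivity
  have e3 : C2 * (M ^ 2 * ((p : ℝ) ^ d + (p' : ℝ) ^ d)) * ((p : ℝ) ^ d * (p' : ℝ) ^ d) ^ 2 *
        (n : ℝ) ^ (-(1 / 3680) : ℝ) = C2 * (M ^ 2 * E) := by rw [hE]; ring
  rw [e3] at h1
  have h12 : 0 ≤ M ^ 2 * E := by positivity
  have h13 : 0 ≤ M ^ 2 * κ := by positivity
  nlinarith

lemma card_fiber_le {d n : ℕ} [NeZero n] (b : (ZMod n)ˣ) (y : ZMod n) :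
    #{k : (ZMod n)ˣ | ((b * k ^ d : (ZMod n)ˣ) : ZMod n) = y} ≤ rootCount d n := by
  classical
  have h1 : rootCount d n = #{x : (ZMod n)ˣ | x ^ d = 1} := by
    rw [rootCount, Nat.card_eq_fintype_card, Fintype.card_subtype]
  rw [h1]
  rcases ({k : (ZMod n)ˣ | ((b * k ^ d : (ZMod n)ˣ) : ZMod n) = y} : Finset _).eq_empty_or_nonempty
    with he | ⟨k0, hk0⟩
  · rw [he, card_empty]; exact Nat.zero_le _
  · refine card_le_card_of_injOn (fun k => k * k0⁻¹) (fun k hk => ?_)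
      (fun k _ k' _ h => mul_right_cancel h)
    rw [mem_coe, mem_filter] at hk
    rw [mem_filter] at hk0
    have h2 : b * k ^ d = b * k0 ^ d := Units.ext (hk.2.trans hk0.2.symm)
    rw [mem_coe, mem_filter]
    refine ⟨mem_univ _, ?_⟩
    rw [mul_pow, mul_left_cancel h2, inv_pow, mul_inv_cancel]

lemma sum_units_le {d n : ℕ} [NeZero n] (b : (ZMod n)ˣ) {h : ZMod n → ℝ} (hh : ∀ y, 0 ≤ h y) :
    ∑ k : (ZMod n)ˣ, h ((b * k ^ d : (ZMod n)ˣ) : ZMod n) ≤ rootCount d n * ∑ y, h y := by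
  classical
  rw [← sum_fiberwise (s := univ) (g := fun k : (ZMod n)ˣ => ((b * k ^ d : (ZMod n)ˣ) : ZMod n)),
    mul_sum]
  refine sum_le_sum fun y _ => ?_
  rw [sum_congr rfl fun k hk => show h ((b * k ^ d : (ZMod n)ˣ) : ZMod n) = h y by
    rw [(mem_filter.1 hk).2], sum_const, nsmul_eq_mul]
  exact mul_le_mul_of_nonneg_right (by exact_mod_cast card_fiber_le b y) (hh y)

/-- The amplification inequality. -/
lemma amplification {d n : ℕ} [NeZero n] (b : (ZMod n)ˣ) (G : ZMod n → ℂ) (P : Finset ℕ)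
    (hP : ∀ p ∈ P, p.Coprime n) :
    (#P : ℝ) ^ 2 * ‖∑ k : (ZMod n)ˣ, G ((b * k ^ d : (ZMod n)ˣ) : ZMod n)‖ ^ 2 ≤
      n.totient * (rootCount d n * ∑ p ∈ P, ∑ p' ∈ P,
        ‖∑ y, G (((p ^ d : ℕ) : ZMod n) * y) *
          (starRingEnd ℂ) (G (((p' ^ d : ℕ) : ZMod n) * y))‖) := by
  set H : ZMod n → ℂ := fun y => ∑ p ∈ P, G (((p ^ d : ℕ) : ZMod n) * y) with hH
  have h1 : ∀ p ∈ P, ∑ k : (ZMod n)ˣ, G ((b * k ^ d : (ZMod n)ˣ) : ZMod n) =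
      ∑ k : (ZMod n)ˣ, G (((p ^ d : ℕ) : ZMod n) * ((b * k ^ d : (ZMod n)ˣ) : ZMod n)) := by
    intro p hp
    rw [← Equiv.sum_comp (Equiv.mulRight (ZMod.unitOfCoprime p (hP p hp)))]
    refine sum_congr rfl fun k _ => ?_
    congr 1
    simp
    ring
  have h2 : (#P : ℂ) * ∑ k : (ZMod n)ˣ, G ((b * k ^ d : (ZMod n)ˣ) : ZMod n) =
      ∑ k : (ZMod n)ˣ, H ((b * k ^ d : (ZMod n)ˣ) : ZMod n) := by
    rw [hH, sum_comm, ← nsmul_eq_mul, ← sum_const]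
    exact sum_congr rfl h1
  have h3 : (#P : ℝ) ^ 2 * ‖∑ k : (ZMod n)ˣ, G ((b * k ^ d : (ZMod n)ˣ) : ZMod n)‖ ^ 2 =
      ‖∑ k : (ZMod n)ˣ, H ((b * k ^ d : (ZMod n)ˣ) : ZMod n)‖ ^ 2 := by
    rw [← h2, norm_mul, Complex.norm_natCast, mul_pow]
  rw [h3]
  have h4 : ‖∑ k : (ZMod n)ˣ, H ((b * k ^ d : (ZMod n)ˣ) : ZMod n)‖ ^ 2 ≤
      n.totient * ∑ k : (ZMod n)ˣ, ‖H ((b * k ^ d : (ZMod n)ˣ) : ZMod n)‖ ^ 2 := by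
    have := sq_sum_le_card_mul_sum_sq (s := (univ : Finset (ZMod n)ˣ))
      (f := fun k => ‖H ((b * k ^ d : (ZMod n)ˣ) : ZMod n)‖)
    rw [card_univ, ZMod.card_units_eq_totient] at this
    refine le_trans ?_ this
    exact pow_le_pow_left₀ (norm_nonneg _) (norm_sum_le _ _) 2
  refine h4.trans (mul_le_mul_of_nonneg_left ?_ (by positivity))
  refine (sum_units_le b (h := fun y => ‖H y‖ ^ 2) fun y => by positivity).trans
    (mul_le_mul_of_nonneg_left ?_ (by positivity))
  have h5 : ((∑ y, ‖H y‖ ^ 2 : ℝ) : ℂ) = ∑ p ∈ P, ∑ p' ∈ P,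
      ∑ y, G (((p ^ d : ℕ) : ZMod n) * y) *
          (starRingEnd ℂ) (G (((p' ^ d : ℕ) : ZMod n) * y)) := by
    push_cast
    rw [sum_congr rfl fun p _ => sum_comm, sum_comm]
    refine sum_congr rfl fun y _ => ?_
    rw [← Complex.mul_conj', hH, map_sum, sum_mul_sum]
    simp only [Nat.cast_pow]
  have h6 : 0 ≤ ∑ y, ‖H y‖ ^ 2 := sum_nonneg fun y _ => pow_nonneg (norm_nonneg _) 2
  rw [← Real.norm_of_nonneg h6, ← Complex.norm_real, h5]
  exact (norm_sum_le _ _).trans (sum_le_sum fun p _ => norm_sum_le _ _)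

/-- The function on `ℤ/nℤ` obtained by sampling `F` at the points `horoPt n j`. -/
def sample (n : ℕ) (F : SL2R → ℂ) (y : ZMod n) : ℂ := F (horoPt n y.val)

lemma sample_intCast {F : SL2R → ℂ} (h : LeftInv (CongruenceSubgroup.Gamma0 1) F) {n : ℕ}
    [NeZero n] (m : ℤ) : sample n F (m : ZMod n) = F (horoPt n m) := by
  have h1 := h.horoPt_add (NeZero.pos n) (((m : ZMod n).val : ℕ) : ℝ) (m / n)
  rw [sample, ← h1]
  congr 2
  have h2 := ZMod.val_intCast (n := n) m
  have h3 := Int.emod_add_mul_ediv m n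
  rw [← h2] at h3
  have h4 : (((((m : ZMod n).val : ℕ) : ℤ) + n * (m / n) : ℤ) : ℝ) = m := by rw [h3]
  push_cast at h4
  linarith

lemma sample_natCast {F : SL2R → ℂ} (h : LeftInv (CongruenceSubgroup.Gamma0 1) F) {n : ℕ}
    [NeZero n] (m : ℕ) : sample n F (m : ZMod n) = F (horoPt n m) := by
  have := sample_intCast h (n := n) (m : ℤ)
  simpa using this

lemma sum_zmod_eq {n : ℕ} [NeZero n] (g : ZMod n → ℂ) : ∑ y, g y = ∑ j ∈ range n, g (j : ZMod n) := by
  refine sum_nbij' (fun y => y.val) (fun j => (j : ZMod n)) ?_ ?_ ?_ ?_ ?_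
  · intro y _; exact mem_range.2 y.val_lt
  · intro j _; exact mem_univ _
  · intro y _; exact ZMod.natCast_zmod_val y
  · intro j hj; exact ZMod.val_cast_of_lt (mem_range.1 hj)
  · intro y _; rw [ZMod.natCast_zmod_val]

lemma sum_sample_mul_conj {F : SL2R → ℂ} (h : LeftInv (CongruenceSubgroup.Gamma0 1) F) {n r s : ℕ}
    [NeZero n] (hr : 0 < r) (hs : 0 < s) :
    ∑ y, sample n F ((r : ZMod n) * y) * (starRingEnd ℂ) (sample n F ((s : ZMod n) * y)) =
      n * horoAvg n (pairFun F r s) := by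
  have hn := NeZero.pos n
  rw [sum_zmod_eq, horoAvg, mul_inv_cancel_left₀ (by exact_mod_cast hn.ne')]
  refine sum_congr rfl fun j _ => ?_
  rw [← Nat.cast_mul, ← Nat.cast_mul, sample_natCast h, sample_natCast h, pairFun,
    dilate_horoPt hr hn, dilate_horoPt hs hn]
  push_cast
  rfl

lemma norm_sum_units_le {n : ℕ} [NeZero n] {M : ℝ} {g : (ZMod n)ˣ → ℂ} (hg : ∀ k, ‖g k‖ ≤ M) :
    ‖∑ k, g k‖ ≤ n.totient * M := by
  refine (norm_sum_le_of_le _ fun k _ => hg k).trans ?_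
  rw [sum_const, card_univ, ZMod.card_units_eq_totient, nsmul_eq_mul]

lemma prime_error_le {x δ p p' : ℝ} {d : ℕ} (hd : 0 < d) (hx : 1 ≤ x)
    (hδ : δ = 1 / (294400 * d)) (hp1 : x ^ (2 * δ) ≤ p) (hp : p ≤ x ^ (8 * δ)) (hp'0 : 0 ≤ p')
    (hp' : p' ≤ x ^ (8 * δ)) :
    (p ^ d + p' ^ d) * (p ^ d * p' ^ d) ^ 2 * x ^ (-(1 / 3680) : ℝ) + p ^ (-(1 / 7360) : ℝ) ≤
      3 * x ^ (-(δ / 3680)) := by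
  have hx0 : 0 < x := by linarith
  have hd0 : (0 : ℝ) < d := by exact_mod_cast hd
  have hd1 : (1 : ℝ) ≤ d := by exact_mod_cast hd
  have hp0 : 0 < p := lt_of_lt_of_le (by positivity) hp1
  have hδd : δ * d = 1 / 294400 := by rw [hδ]; field_simp
  have hδ1 : δ ≤ 1 / 294400 := by
    rw [hδ]; exact one_div_le_one_div_of_le (by norm_num) (by linarith)
  set y := x ^ (1 / 36800 : ℝ) with hy
  have hy0 : 0 < y := by positivity
  have e : (x ^ (8 * δ)) ^ d = y := by
    rw [← Real.rpow_natCast, ← Real.rpow_mul hx0.le, hy]; congr 1; linarith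
  have h1 : p ^ d ≤ y := by rw [← e]; exact pow_le_pow_left₀ hp0.le hp d
  have h2 : p' ^ d ≤ y := by rw [← e]; exact pow_le_pow_left₀ hp'0 hp' d
  have h3 : (p ^ d + p' ^ d) * (p ^ d * p' ^ d) ^ 2 * x ^ (-(1 / 3680) : ℝ) ≤
      (y + y) * (y * y) ^ 2 * x ^ (-(1 / 3680) : ℝ) := by gcongr
  have h4 : (y + y) * (y * y) ^ 2 * x ^ (-(1 / 3680) : ℝ) = 2 * x ^ (-(1 / 7360) : ℝ) := by
    have : y ^ 5 * x ^ (-(1 / 3680) : ℝ) = x ^ (-(1 / 7360) : ℝ) := by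
      rw [hy, ← Real.rpow_natCast, ← Real.rpow_mul hx0.le, ← Real.rpow_add hx0]; norm_num
    rw [← this]; ring
  have h5 : x ^ (-(1 / 7360) : ℝ) ≤ x ^ (-(δ / 3680)) :=
    Real.rpow_le_rpow_of_exponent_le hx (by linarith)
  have h6 : p ^ (-(1 / 7360) : ℝ) ≤ x ^ (-(δ / 3680)) := by
    refine (Real.rpow_le_rpow_of_nonpos (by positivity) hp1 (by norm_num)).trans (le_of_eq ?_)
    rw [← Real.rpow_mul hx0.le]; congr 1; ring
  linarith

/-- Equidistribution for mean-zero functions. -/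
lemma norm_sum_units_sample_le {d : ℕ} (hd : 0 < d) : ∃ C κ : ℝ, 1 ≤ C ∧ 0 < κ ∧
    ∀ (μ : Measure (XQuot Γℤ)),
    IsProbabilityMeasure μ → (∀ g : SL2R, Measure.map (rightT Γℤ g) μ = μ) →
    ∀ (M : ℝ) (F : SL2R → ℂ), LeftInv (CongruenceSubgroup.Gamma0 1) F → Reg M F →
    ∫ x : XQuot Γℤ, F x.out ∂μ = 0 → ∀ (n : ℕ) [NeZero n] (b : (ZMod n)ˣ),
    ‖∑ k : (ZMod n)ˣ, sample n F ((b * k ^ d : (ZMod n)ˣ) : ZMod n)‖ ≤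
      n.totient * (C * M * (n : ℝ) ^ (-κ)) := by
  obtain ⟨δ, hδ⟩ : ∃ δ : ℝ, δ = 1 / (294400 * d) := ⟨_, rfl⟩
  have hd0 : (0 : ℝ) < d := by exact_mod_cast hd
  have hδ0 : 0 < δ := by rw [hδ]; positivity
  obtain ⟨C1, hC1, H1⟩ := norm_horoAvg_pairFun_prime_le
  obtain ⟨K, hK, H2⟩ := exists_primes hδ0
  obtain ⟨C3, hC3, H3⟩ := rootCount_mul_le_rpow hd (show 0 < δ / 7360 by positivity)
  have hCC : 1 ≤ C1 * C3 := one_le_mul_of_one_le_of_one_le hC1 hC3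
  have hCK : 1 ≤ C1 * C3 * K := one_le_mul_of_one_le_of_one_le hCC hK
  refine ⟨4 * C1 * C3 * K, δ / 14720, by linarith, by positivity,
    fun μ hμ1 hμ M F hinv hF h0 n hn0 b => ?_⟩
  have hn := NeZero.pos n
  have hx : (1 : ℝ) ≤ n := by exact_mod_cast hn
  have hx0 : (0 : ℝ) < n := by linarith
  have hM := hF.nonneg
  rcases lt_or_ge ((n : ℝ) ^ δ) K with hKn | hKn
  · refine (norm_sum_units_le fun k => hF.1 _).trans ?_
    refine mul_le_mul_of_nonneg_left ?_ (by positivity)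
    have h1 : ((n : ℝ) ^ δ) ^ (-(1 / 14720) : ℝ) = (n : ℝ) ^ (-(δ / 14720)) := by
      rw [← Real.rpow_mul hx0.le]; congr 1; ring
    have h2 : K⁻¹ ≤ (n : ℝ) ^ (-(δ / 14720)) := by
      rw [← h1]
      refine le_trans ?_ (Real.rpow_le_rpow_of_nonpos (by positivity) hKn.le (by norm_num))
      rw [← Real.rpow_neg_one]
      exact Real.rpow_le_rpow_of_exponent_le hK (by norm_num)
    have h3 : 1 ≤ K * (n : ℝ) ^ (-(δ / 14720)) := by
      have := mul_le_mul_of_nonneg_left h2 (show 0 ≤ K by linarith)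
      rwa [mul_inv_cancel₀ (by linarith)] at this
    calc M = M * (1 * 1) := by ring
      _ ≤ M * ((4 * (C1 * C3)) * (K * (n : ℝ) ^ (-(δ / 14720)))) := by
          gcongr; linarith
      _ = _ := by ring
  · obtain ⟨P, hP, hPc⟩ := H2 n hn hKn
    have h1 := amplification (d := d) b (sample n F) P fun p hp => (hP p hp).2.1
    set S := ‖∑ k : (ZMod n)ˣ, sample n F ((b * k ^ d : (ZMod n)ˣ) : ZMod n)‖ with hS
    have hS0 : 0 ≤ S := norm_nonneg _
    clear_value S
    set z := (n : ℝ) ^ (-(δ / 3680)) with hz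
    have hz0 : 0 < z := by positivity
    have h2 : ∀ p ∈ P, ∀ p' ∈ P, ‖∑ y, sample n F (((p ^ d : ℕ) : ZMod n) * y) *
        (starRingEnd ℂ) (sample n F (((p' ^ d : ℕ) : ZMod n) * y))‖ ≤
        n * (C1 * M ^ 2 * (3 * z)) + if p = p' then n * M ^ 2 else 0 := by
      intro p hp p' hp'
      obtain ⟨a1, a2, a3, a4⟩ := hP p hp
      obtain ⟨b1, b2, b3, b4⟩ := hP p' hp'
      split_ifs with hpp
      · have : ‖∑ y, sample n F (((p ^ d : ℕ) : ZMod n) * y) *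
            (starRingEnd ℂ) (sample n F (((p' ^ d : ℕ) : ZMod n) * y))‖ ≤ n * M ^ 2 := by
          refine (norm_sum_le_of_le (n := fun _ => M ^ 2) _ fun y _ => ?_).trans ?_
          · rw [norm_mul, RCLike.norm_conj, sq]
            exact mul_le_mul (hF.1 _) (hF.1 _) (norm_nonneg _) hM
          · rw [sum_const, card_univ, ZMod.card, nsmul_eq_mul]
        have h' : 0 ≤ n * (C1 * M ^ 2 * (3 * z)) := by positivity
        linarith
      · rw [sum_sample_mul_conj hinv (pow_pos a1.pos d) (pow_pos b1.pos d), norm_mul,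
          Complex.norm_natCast, add_zero]
        refine mul_le_mul_of_nonneg_left ?_ hx0.le
        refine (H1 μ hμ1 hμ M F hinv hF h0 n d p p' hn hd a1 b1 hpp).trans ?_
        refine mul_le_mul_of_nonneg_left ?_ (by positivity)
        exact prime_error_le hd hx hδ a3 a4 (by positivity) b4
    have hPz : 1 ≤ #P * z := by
      have h3 : (n : ℝ) ^ (2 * δ) * z ≤ #P * z := by gcongr
      refine le_trans ?_ h3
      rw [hz, ← Real.rpow_add hx0]
      exact Real.one_le_rpow hx (by linarith)
    have hP0 : (0 : ℝ) < #P := lt_of_lt_of_le (by positivity) hPc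
    have h4 : ∑ p ∈ P, ∑ p' ∈ P, ‖∑ y, sample n F (((p ^ d : ℕ) : ZMod n) * y) *
        (starRingEnd ℂ) (sample n F (((p' ^ d : ℕ) : ZMod n) * y))‖ ≤
        (#P : ℝ) ^ 2 * (n * (4 * C1 * M ^ 2 * z)) := by
      refine (sum_le_sum fun p hp => sum_le_sum fun p' hp' => h2 p hp p' hp').trans ?_
      have h5 : ∑ p ∈ P, ∑ p' ∈ P, ((n : ℝ) * (C1 * M ^ 2 * (3 * z)) +
          if p = p' then (n : ℝ) * M ^ 2 else 0) =
          (#P : ℝ) ^ 2 * (n * (C1 * M ^ 2 * (3 * z))) + #P * (n * M ^ 2) := by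
        simp only [sum_add_distrib, sum_const, nsmul_eq_mul, sum_ite_eq]
        rw [sum_congr rfl fun p hp => if_pos hp, sum_const, nsmul_eq_mul]
        ring
      rw [h5]
      have h6 : (#P : ℝ) * (n * M ^ 2) * 1 ≤ #P * (n * M ^ 2) * (#P * z) := by gcongr
      have h7 : (#P : ℝ) ^ 2 * (n * (1 * M ^ 2 * z)) ≤ (#P : ℝ) ^ 2 * (n * (C1 * M ^ 2 * z)) := by
        gcongr
      linarith
    have h8 := H3 n hn
    have hφ : (0 : ℝ) < n.totient := by exact_mod_cast Nat.totient_pos.2 hn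
    set w := (n : ℝ) ^ (-(δ / 14720)) with hw
    have hw0 : 0 < w := by positivity
    have hwz : (n : ℝ) ^ (δ / 7360) * z = w ^ 2 := by
      rw [hz, hw, ← Real.rpow_natCast, ← Real.rpow_mul hx0.le, ← Real.rpow_add hx0]
      congr 1; push_cast; ring
    have h9 : (rootCount d n : ℝ) * n ≤ n.totient * (C3 * (n : ℝ) ^ (δ / 7360)) := by
      have := mul_le_mul_of_nonneg_left h8 hφ.le
      refine le_trans (le_of_eq ?_) this
      field_simp
    have h10 : (#P : ℝ) ^ 2 * S ^ 2 ≤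
        (#P : ℝ) ^ 2 * ((n.totient : ℝ) ^ 2 * ((4 * (C1 * C3)) * M ^ 2 * w ^ 2)) := by
      calc (#P : ℝ) ^ 2 * S ^ 2
          ≤ n.totient * (rootCount d n * ((#P : ℝ) ^ 2 * (n * (4 * C1 * M ^ 2 * z)))) := by
            refine h1.trans ?_
            gcongr
        _ = n.totient * (#P : ℝ) ^ 2 * (4 * C1 * M ^ 2 * z) * (rootCount d n * n) := by ring
        _ ≤ n.totient * (#P : ℝ) ^ 2 * (4 * C1 * M ^ 2 * z) *
              (n.totient * (C3 * (n : ℝ) ^ (δ / 7360))) := by gcongr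
        _ = (#P : ℝ) ^ 2 * ((n.totient : ℝ) ^ 2 * ((4 * (C1 * C3)) * M ^ 2 *
              ((n : ℝ) ^ (δ / 7360) * z))) := by ring
        _ = _ := by rw [hwz]
    have h11 := le_of_mul_le_mul_left h10 (by positivity)
    refine (pow_le_pow_iff_left₀ hS0 (by positivity) two_ne_zero).1 (h11.trans ?_)
    have h12 : 4 * (C1 * C3) ≤ (4 * C1 * C3 * K) ^ 2 := by
      have a1 : 4 * (C1 * C3) ≤ 4 * C1 * C3 * K := by
        nlinarith
      have a2 : 1 ≤ 4 * C1 * C3 * K := by linarith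
      nlinarith
    calc (n.totient : ℝ) ^ 2 * ((4 * (C1 * C3)) * M ^ 2 * w ^ 2)
        ≤ (n.totient : ℝ) ^ 2 * ((4 * C1 * C3 * K) ^ 2 * M ^ 2 * w ^ 2) := by gcongr
      _ = _ := by ring

lemma sum_filter_coprime_eq {n : ℕ} [NeZero n] (g : ZMod n → ℂ) :
    ∑ k ∈ (range n).filter (fun k => Nat.gcd k n = 1), g (k : ZMod n) =
      ∑ k : (ZMod n)ˣ, g (k : ZMod n) := by
  symm
  refine sum_nbij (fun u => (u : ZMod n).val) ?_ ?_ ?_ ?_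
  · intro u _
    exact mem_filter.2 ⟨mem_range.2 (ZMod.val_lt _), ZMod.val_coe_unit_coprime u⟩
  · intro u _ v _ h
    exact Units.ext (ZMod.val_injective n h)
  · intro k hk
    rw [mem_coe, mem_filter, mem_range] at hk
    refine ⟨ZMod.unitOfCoprime k hk.2, mem_coe.2 (mem_univ _), ?_⟩
    simp only [ZMod.coe_unitOfCoprime]
    exact ZMod.val_cast_of_lt hk.1
  · intro u _
    rw [ZMod.natCast_zmod_val]

lemma sum_filter_eq_sum_units {F : SL2R → ℂ} (hF : LeftInv (CongruenceSubgroup.Gamma0 1) F)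
    {n d : ℕ} [NeZero n] {b : ℤ} {u : (ZMod n)ˣ} (hu : (u : ZMod n) = b) :
    ∑ k ∈ (range n).filter (fun k => Nat.gcd k n = 1), F (horoPt n ((b : ℝ) * (k : ℝ) ^ d)) =
      ∑ k : (ZMod n)ˣ, sample n F ((u * k ^ d : (ZMod n)ˣ) : ZMod n) := by
  have h := sum_filter_coprime_eq (n := n) fun y => sample n F (b * y ^ d)
  refine Eq.trans (sum_congr rfl fun k _ => ?_) (h.trans (sum_congr rfl fun k _ => ?_))
  · have h1 := sample_intCast hF (n := n) (b * (k : ℤ) ^ d)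
    push_cast at h1
    exact h1.symm
  · rw [Units.val_mul, Units.val_pow_eq_pow_val, hu]

lemma integral_liftX_sub_const {μ : Measure (XQuot Γℤ)} [IsProbabilityMeasure μ]
    {f : XQuot Γℤ → ℂ} {M : ℝ} (hf : Reg M (liftX Γℤ f)) :
    ∫ x : XQuot Γℤ, (liftX Γℤ f x.out - ∫ y, f y ∂μ) ∂μ = 0 ∧ ‖∫ y, f y ∂μ‖ ≤ M := by
  have h1 : (fun x : XQuot Γℤ => liftX Γℤ f x.out) = f := by
    funext x; exact congrArg f (XProj_out x)
  have h2 : ∀ x, ‖f x‖ ≤ M := fun x => by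
    rw [← h1]; exact hf.1 _
  have h3 : Measurable f := by
    rw [← h1]; exact (leftInv_liftX f).measurable_out hf.continuous.measurable
  have h4 : Integrable f μ :=
    Integrable.of_bound h3.aestronglyMeasurable M (Eventually.of_forall h2)
  constructor
  · rw [integral_sub (by rw [h1]; exact h4) (integrable_const _), h1]
    simp
  · refine (norm_integral_le_of_norm_le_const (Eventually.of_forall h2)).trans ?_
    simp

lemma Reg.sub_const {M : ℝ} {F : SL2R → ℂ} (hF : Reg M F) {c : ℂ} (hc : ‖c‖ ≤ M) :
    Reg (2 * M) fun g => F g - c := by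
  refine ⟨fun g => (_root_.norm_sub_le _ _).trans (by linarith [hF.1 g]), fun g η => ?_⟩
  have h := hF.2 g η
  have h' := mul_nonneg hF.nonneg (entryNorm_nonneg ((η : Matrix (Fin 2) (Fin 2) ℝ) - 1))
  rw [sub_sub_sub_cancel_right]
  linarith

end

end HorocyclePoints

/-- Fix `d ∈ ℕ+`.  There exist `D ∈ ℕ` and constants `C₁, κ' > 0` such that
for every `n ∈ ℕ+`, every `b ∈ ℤ` coprime to `n` and every smooth compactly supported
`f : X → ℂ`,
`|φ(n)⁻¹ ∑_{k ∈ (ℤ/nℤ)ˣ} f(SL₂(ℤ) u_{b k^d/n} a_{√n}⁻¹) − ∫_X f dμ_X| ≤ C₁ n^{−κ'} S_D(f)`. -/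
theorem primitive_monomial_points_equidistribute_modular_surface (d : ℕ+) :
    ∃ (D : ℕ) (C₁ κ' : ℝ), 0 < C₁ ∧ 0 < κ' ∧
      ∀ (μX : Measure (XQuot Γℤ)), IsProbabilityMeasure μX →
        (∀ g : SL2R, Measure.map (rightT Γℤ g) μX = μX) →
        ∀ (n : ℕ+) (b : ℤ), Int.gcd (n : ℕ) b = 1 →
          ∀ f : XQuot Γℤ → ℂ, IsSmoothSL (liftX Γℤ f) → HasCompactSupport f →
            ‖(Nat.totient (n : ℕ) : ℂ)⁻¹ *
                (∑ k ∈ (Finset.range (n : ℕ)).filter fun k => Nat.gcd k (n : ℕ) = 1,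
                  f (XProj Γℤ
                    (uElt ((b : ℝ) * (k : ℝ) ^ (d : ℕ) / ((n : ℕ) : ℝ)) *
                      (aElt (Real.sqrt ((n : ℕ) : ℝ)))⁻¹))) -
              ∫ x, f x ∂μX‖ ≤
            C₁ * ((n : ℕ) : ℝ) ^ (-κ') * sobX Γℤ μX D f := by
  obtain ⟨C, κ, hC, hκ, H⟩ := HorocyclePoints.norm_sum_units_sample_le d.pos
  obtain ⟨A, hA, HA⟩ := HorocyclePoints.exists_reg_liftX
  refine ⟨4, C * (2 * A) + 1, κ, by positivity, hκ, fun μ hμ1 hμ n b hb f hf hfc => ?_⟩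
  have hn : 0 < (n : ℕ) := n.pos
  obtain ⟨N, hN⟩ : ∃ N : ℕ, N = (n : ℕ) := ⟨_, rfl⟩
  rw [← hN] at hb hn ⊢
  have : NeZero N := ⟨hn.ne'⟩
  have hreg := HA μ hμ1 hμ f hf hfc
  have hinv := HorocyclePoints.leftInv_liftX f
  obtain ⟨h0, hc⟩ := HorocyclePoints.integral_liftX_sub_const (μ := μ) hreg
  set c := ∫ x, f x ∂μ
  have hinv' : HorocyclePoints.LeftInv (CongruenceSubgroup.Gamma0 1)
      fun g => liftX Γℤ f g - c := fun γ hγ g => by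
    change liftX Γℤ f _ - c = _
    rw [hinv γ hγ g]
  obtain ⟨u, hu⟩ : IsUnit (b : ZMod N) := by
    rw [ZMod.coe_int_isUnit_iff_isCoprime]
    exact Int.isCoprime_iff_gcd_eq_one.2 hb
  have h1 := H μ hμ1 hμ _ _ hinv' (hreg.sub_const hc) h0 N u
  rw [← HorocyclePoints.sum_filter_eq_sum_units hinv' hu, Finset.sum_sub_distrib,
    Finset.sum_const] at h1
  have hcard : ((Finset.range N).filter fun k => Nat.gcd k N = 1).card = N.totient := by
    rw [Nat.totient_eq_card_coprime]
    congr 1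
    refine Finset.filter_congr fun k _ => ?_
    rw [Nat.coprime_comm]
  rw [hcard, nsmul_eq_mul] at h1
  have hφ : (0 : ℝ) < N.totient := by exact_mod_cast Nat.totient_pos.2 hn
  have hφ' : (N.totient : ℂ) ≠ 0 := by exact_mod_cast hφ.ne'
  have h2 : ∀ T : ℂ, ‖(N.totient : ℂ)⁻¹ * T - c‖ = (N.totient : ℝ)⁻¹ * ‖T - N.totient * c‖ := by
    intro T
    rw [show (N.totient : ℂ)⁻¹ * T - c = (N.totient : ℂ)⁻¹ * (T - N.totient * c) by
      field_simp, norm_mul, norm_inv, Complex.norm_natCast]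
  rw [h2]
  have hs := HorocyclePoints.sobX_nonneg μ 4 f
  have hnκ : 0 ≤ (N : ℝ) ^ (-κ) := by positivity
  calc _ ≤ (N.totient : ℝ)⁻¹ * (N.totient * (C * (2 * (A * sobX Γℤ μ 4 f)) * (N : ℝ) ^ (-κ))) :=
        mul_le_mul_of_nonneg_left h1 (by positivity)
    _ = C * (2 * A) * (N : ℝ) ^ (-κ) * sobX Γℤ μ 4 f := by
        rw [inv_mul_cancel_left₀ hφ.ne']; ring
    _ ≤ _ := by gcongr; linarith

end
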